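/- Suppose α ≤ max(d/2, 1), and additionally α < 1 when d = 1. Then ℙ-almost surely, as n → ∞, log g^ω(0, (n,0)) / log n → −(1−α)/(1+α) if d = 1, and log g^ω(0, (n,0)) / log n → −1 − min(1, α, 4α/d)·(d−2) if d ≥ 2; that is, g^ω(0, n e₁) = n^{−(1−α)/(1+α)+o(1)} for d = 1 with α < 1, and g^ω(0, n e₁) = n^{−1−min(1,α,4α/d)(d−2)+o(1)} for d ≥ 2. -/

import Mathlib

open MeasureTheory ProbabilityTheory Filter Set

noncomputable section

/-- `n`-step transition probabilities of the discrete-time simple random walk on `ℤ^m`. -/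
def srwKernel (m : ℕ) : ℕ → (Fin m → ℤ) → (Fin m → ℤ) → ℝ
  | 0, x, y => if x = y then 1 else 0
  | n + 1, x, y =>
      (∑ i : Fin m, (srwKernel m n (Function.update x i (x i + 1)) y
        + srwKernel m n (Function.update x i (x i - 1)) y)) / (2 * m)

/-- Transition kernel of the continuous-time simple random walk on `ℤ^m` which jumps to
each of its `2m` nearest neighbours at rate `1` (total jump rate `2m`). -/
def heatKernel (m : ℕ) (t : ℝ) (x y : Fin m → ℤ) : ℝ :=
  ∑' n : ℕ, Real.exp (-(2 * m) * t) * ((2 * m) * t) ^ n / n.factorial * srwKernel m n x y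

/-- `(P, S)` is (a realization of) the continuous-time simple random walk on `ℤ^m`:
under `P x` the process `S` starts at `x`, has right-continuous (piecewise constant)
paths, and its finite-dimensional distributions are given by the heat kernel. -/
structure IsCTSRW (m : ℕ) {Ω : Type*} [MeasurableSpace Ω]
    (P : (Fin m → ℤ) → Measure Ω) (S : ℝ → Ω → (Fin m → ℤ)) : Prop where
  prob : ∀ x, IsProbabilityMeasure (P x)
  meas : Measurable fun p : ℝ × Ω => S p.1 p.2
  start : ∀ x, ∀ᵐ ω ∂ P x, S 0 ω = x
  rightCont : ∀ x, ∀ᵐ ω ∂ P x, ∀ t : ℝ, 0 ≤ t →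
    ∃ ε > (0 : ℝ), ∀ u, t ≤ u → u < t + ε → S u ω = S t ω
  fdd : ∀ x (n : ℕ) (t : Fin (n + 1) → ℝ), 0 ≤ t 0 →
    (∀ i : Fin n, t i.castSucc ≤ t i.succ) →
    ∀ y : Fin (n + 1) → (Fin m → ℤ),
      (P x {ω | ∀ i, S (t i) ω = y i}).toReal
        = heatKernel m (t 0) x (y 0)
          * ∏ i : Fin n, heatKernel m (t i.succ - t i.castSucc) (y i.castSucc) (y i.succ)

/-- `z` is an i.i.d. nonnegative random scenery on `ℤ^d` whose common upper tail decays
like `r^{-α+o(1)}`. -/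
structure IsScenery (d : ℕ) (α : ℝ) {Ω : Type*} [MeasurableSpace Ω]
    (μ : Measure Ω) (z : (Fin d → ℤ) → Ω → ℝ) : Prop where
  prob : IsProbabilityMeasure μ
  meas : ∀ x, Measurable (z x)
  nonneg : ∀ x ω, 0 ≤ z x ω
  indep : iIndepFun z μ
  ident : ∀ x, IdentDistrib (z x) (z 0) μ μ
  tail : Tendsto (fun r : ℝ => Real.log (μ {ω | r < z 0 ω}).toReal / Real.log r)
    atTop (nhds (-α))

/-- The random walk in random scenery `A(t) = ∫₀ᵗ z(S_u) du`. -/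
def rwrs {Ωz Ωw : Type*} (d : ℕ) (z : (Fin d → ℤ) → Ωz → ℝ)
    (S : ℝ → Ωw → (Fin d → ℤ)) (t : ℝ) (ζ : Ωz) (ω : Ωw) : ℝ :=
  ∫ u in Set.Ioc (0 : ℝ) t, z (S u ω) ζ

end
open MeasureTheory ProbabilityTheory Filter Set

noncomputable section

/-- The clock process `A²(t) = ∫₀ᵗ z(S²_u) du`, where `S²` is the second (ℤ^d-valued)
component of the walk on `ℤ^{1+d}`. -/
def clock (d : ℕ) {Ωz Ωw : Type*} (z : (Fin d → ℤ) → Ωz → ℝ)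
    (S : ℝ → Ωw → (Fin (d + 1) → ℤ)) (t : ℝ) (ζ : Ωz) (ω : Ωw) : ℝ :=
  ∫ u in Set.Ioc (0 : ℝ) t, z (fun i => S u ω i.succ) ζ

/-- The variable-speed random walk `X_t = (S¹_{A²(t)}, S²_t)` in the layered conductance
field `ω(x, x±e₁) = z(x₂)`, `ω(x, x±e_i) = 1` for `i ≥ 2` (coordinate `0` of the walk on
`ℤ^{1+d}` is the ℤ-coordinate, coordinates `1,…,d` form the ℤ^d-coordinate). -/
def layeredWalk (d : ℕ) {Ωz Ωw : Type*} (z : (Fin d → ℤ) → Ωz → ℝ)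
    (S : ℝ → Ωw → (Fin (d + 1) → ℤ)) (t : ℝ) (ζ : Ωz) (ω : Ωw) : ℤ × (Fin d → ℤ) :=
  (S (clock d z S t ζ ω) ω 0, fun i => S t ω i.succ)

/-- Euclidean norm of a point of `ℤ^{1+d} = ℤ × ℤ^d`. -/
def euclNormProd (d : ℕ) (x : ℤ × (Fin d → ℤ)) : ℝ :=
  Real.sqrt ((x.1 : ℝ) ^ 2 + ∑ i, (x.2 i : ℝ) ^ 2)

end

/-- The Green function `g^ω(0,y) = ∫₀^∞ P₀^ω(X_t = y) dt` of the layered walk. -/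
noncomputable def layeredGreen (d : ℕ) {Ωz Ωw : Type*} [MeasurableSpace Ωw]
    (z : (Fin d → ℤ) → Ωz → ℝ) (S : ℝ → Ωw → (Fin (d + 1) → ℤ))
    (P : (Fin (d + 1) → ℤ) → Measure Ωw) (ζ : Ωz) (y : ℤ × (Fin d → ℤ)) : ℝ :=
  (∫⁻ t in Set.Ioi (0 : ℝ), (P 0) {ω | layeredWalk d z S t ζ ω = y}).toReal


section Part1
open MeasureTheory ProbabilityTheory Filter Set

namespace LG

/-- Lebesgue measure on one period. -/
noncomputable def per : Measure ℝ := (volume : Measure ℝ).restrict (Ioc (-Real.pi) Real.pi)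

instance : IsFiniteMeasure per := by unfold per; infer_instance

/-- complexified angle -/
noncomputable def cw (l θ : ℝ) : ℂ := (θ : ℂ) + Complex.I * l

lemma cw_cont (l : ℝ) : Continuous (cw l) := by unfold cw; fun_prop

lemma per_real : per.real univ = 2 * Real.pi := by
  unfold per
  rw [measureReal_restrict_apply_univ, Real.volume_real_Ioc_of_le (by linarith [Real.pi_pos])]
  ring

lemma per_int (k : ℤ) (l : ℝ) :
    ∫ θ, Complex.exp (Complex.I * k * cw l θ) ∂per = if k = 0 then (2 * Real.pi : ℂ) else 0 := by
  split_ifs with h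
  · subst h
    simp [per_real]
  · have hk : (k : ℂ) ≠ 0 := by exact_mod_cast h
    unfold per
    rw [← intervalIntegral.integral_of_le (by linarith [Real.pi_pos])]
    have : ∀ θ : ℝ, Complex.exp (Complex.I * k * cw l θ)
        = Complex.exp (- (k * l)) * Complex.exp ((Complex.I * k) * θ) := by
      intro θ
      rw [← Complex.exp_add]
      congr 1
      unfold cw
      linear_combination (k * l : ℂ) * Complex.I_mul_I
    simp_rw [this]
    rw [intervalIntegral.integral_const_mul, integral_exp_mul_complex (by simp [hk])]
    have e : Complex.exp (Complex.I * k * (Real.pi : ℝ))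
        = Complex.exp (Complex.I * k * ((-Real.pi : ℝ) : ℂ)) := by
      rw [Complex.exp_eq_exp_iff_exists_int]
      exact ⟨k, by push_cast; ring⟩
    rw [e]; simp

lemma srw_fourier (m : ℕ) (hm : 1 ≤ m) (l : Fin m → ℝ) (n : ℕ) (x y : Fin m → ℤ) :
    (srwKernel m n x y : ℂ) = ((2 * Real.pi : ℂ) ^ m)⁻¹ *
      ∫ θ : Fin m → ℝ, ((∑ i, Complex.cos (cw (l i) (θ i))) / m) ^ n *
        ∏ i, Complex.exp (Complex.I * (y i - x i : ℤ) * cw (l i) (θ i))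
        ∂(Measure.pi fun _ => per) := by
  have hpi : (2 * Real.pi : ℂ) ≠ 0 := by simp [Real.pi_ne_zero]
  induction n generalizing x with
  | zero =>
    simp only [pow_zero, one_mul]
    rw [integral_fintype_prod_eq_prod
      (f := fun i (t : ℝ) => Complex.exp (Complex.I * (y i - x i : ℤ) * cw (l i) t))]
    simp_rw [per_int]
    rw [srwKernel]
    split_ifs with h
    · subst h; simp [Finset.prod_const, hpi]
    · obtain ⟨i, hi⟩ := Function.ne_iff.mp h
      rw [Finset.prod_eq_zero (Finset.mem_univ i)]
      · simp
      · rw [if_neg]; omega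
  | succ n ih =>
    have hcont : ∀ x : Fin m → ℤ, Continuous (fun θ : Fin m → ℝ =>
        ((∑ i, Complex.cos (cw (l i) (θ i))) / m) ^ n *
        ∏ i, Complex.exp (Complex.I * (y i - x i : ℤ) * cw (l i) (θ i))) := by
      intro x
      unfold cw
      fun_prop
    have hInt : ∀ x : Fin m → ℤ, Integrable (fun θ : Fin m → ℝ =>
        ((∑ i, Complex.cos (cw (l i) (θ i))) / m) ^ n *
        ∏ i, Complex.exp (Complex.I * (y i - x i : ℤ) * cw (l i) (θ i)))
        (Measure.pi fun _ => per) := by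
      intro x
      have : (Measure.pi fun _ : Fin m => per) = (volume : Measure (Fin m → ℝ)).restrict
          (Set.pi univ fun _ => Ioc (-Real.pi) Real.pi) := by
        unfold per
        rw [volume_pi, Measure.restrict_pi_pi]
      rw [this]
      refine ((hcont x).continuousOn.integrableOn_compact
        (K := Set.pi univ fun _ => Icc (-Real.pi) Real.pi)
        (isCompact_univ_pi fun _ => isCompact_Icc)).mono_set ?_
      exact Set.pi_mono fun i _ => Ioc_subset_Icc_self
    rw [srwKernel]
    have hcast : ∀ a : Fin m → ℝ, ((((∑ i, a i) / (2 * m) : ℝ)) : ℂ) = (∑ i, (a i : ℂ)) / (2 * m) := by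
      intro a; push_cast; rfl
    rw [hcast]
    simp only [Complex.ofReal_add]
    simp_rw [ih]
    simp_rw [← mul_add]
    simp_rw [← integral_add (hInt _) (hInt _)]
    rw [← Finset.mul_sum, mul_div_assoc]
    have hs := integral_finsetSum (μ := Measure.pi fun _ : Fin m => per) Finset.univ
      (f := fun (i : Fin m) (θ : Fin m → ℝ) =>
        (((∑ i, Complex.cos (cw (l i) (θ i))) / m) ^ n *
        ∏ j, Complex.exp (Complex.I * (y j - Function.update x i (x i + 1) j : ℤ) * cw (l j) (θ j)))
        + (((∑ i, Complex.cos (cw (l i) (θ i))) / m) ^ n *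
        ∏ j, Complex.exp (Complex.I * (y j - Function.update x i (x i - 1) j : ℤ) * cw (l j) (θ j))))
      (fun i _ => (hInt _).add (hInt _))
    rw [← hs, ← integral_div]
    congr 1
    apply integral_congr_ae
    filter_upwards with θ
    have key : ∀ (i : Fin m) (s : ℤ), ∏ j, Complex.exp (Complex.I *
        (y j - (Function.update x i (x i + s)) j : ℤ) * cw (l j) (θ j))
        = Complex.exp (- (Complex.I * s * cw (l i) (θ i))) *
         ∏ j, Complex.exp (Complex.I * (y j - x j : ℤ) * cw (l j) (θ j)) := by
      intro i s
      rw [← Finset.mul_prod_erase _ _ (Finset.mem_univ i),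
        ← Finset.mul_prod_erase Finset.univ (fun j => Complex.exp (Complex.I * (y j - x j : ℤ) * cw (l j) (θ j))) (Finset.mem_univ i),
        ← mul_assoc, ← Complex.exp_add]
      congr 1
      · congr 1
        simp only [Function.update_self]
        push_cast
        ring
      · apply Finset.prod_congr rfl
        intro j hj
        rw [Function.update_of_ne (Finset.ne_of_mem_erase hj)]
    have k1 := fun i => key i 1
    have k2 := fun i => key i (-1)
    simp only [← sub_eq_add_neg] at k2
    simp_rw [k1, k2]
    have hm' : (m : ℂ) ≠ 0 := by exact_mod_cast (by omega : m ≠ 0)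
    set Pd := ∏ j, Complex.exp (Complex.I * (y j - x j : ℤ) * cw (l j) (θ j))
    rw [pow_succ]
    set c := ((∑ i, Complex.cos (cw (l i) (θ i))) / (m : ℂ)) ^ n
    have : ∀ i, c * (Complex.exp (- (Complex.I * (1 : ℤ) * cw (l i) (θ i))) * Pd)
        + c * (Complex.exp (- (Complex.I * (-1 : ℤ) * cw (l i) (θ i))) * Pd)
        = (2 * c * Pd) * Complex.cos (cw (l i) (θ i)) := by
      intro i
      rw [Complex.cos]
      have e1 : -(Complex.I * (1 : ℤ) * cw (l i) (θ i)) = -cw (l i) (θ i) * Complex.I := by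
        push_cast; ring
      have e2 : -(Complex.I * (-1 : ℤ) * cw (l i) (θ i)) = cw (l i) (θ i) * Complex.I := by
        push_cast; ring
      rw [e1, e2]
      ring
    simp_rw [this]
    rw [← Finset.mul_sum]
    field_simp

/-- tilted Fourier integral -/
noncomputable def qc (l t : ℝ) (k : ℤ) : ℂ :=
  (2 * Real.pi : ℂ)⁻¹ * ∫ θ, Complex.exp (2 * t * (Complex.cos (cw l θ) - 1)) *
    Complex.exp (Complex.I * k * cw l θ) ∂per

lemma srw_nonneg (m n : ℕ) (x y : Fin m → ℤ) : 0 ≤ srwKernel m n x y := by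
  induction n generalizing x with
  | zero => rw [srwKernel]; split_ifs <;> norm_num
  | succ n ih =>
    rw [srwKernel]
    apply div_nonneg _ (by positivity)
    exact Finset.sum_nonneg fun i _ => add_nonneg (ih _) (ih _)

lemma srw_le_one (m n : ℕ) (x y : Fin m → ℤ) : srwKernel m n x y ≤ 1 := by
  induction n generalizing x with
  | zero => rw [srwKernel]; split_ifs <;> norm_num
  | succ n ih =>
    rw [srwKernel]
    apply div_le_one_of_le₀ _ (by positivity)
    calc _ ≤ ∑ i : Fin m, (2 : ℝ) := Finset.sum_le_sum fun i _ => by linarith [ih (Function.update x i (x i + 1)), ih (Function.update x i (x i - 1))]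
      _ = _ := by simp [mul_comm]

lemma heat_nonneg (m : ℕ) (t : ℝ) (ht : 0 ≤ t) (x y : Fin m → ℤ) : 0 ≤ heatKernel m t x y := by
  unfold heatKernel
  apply tsum_nonneg
  intro n
  have := srw_nonneg m n x y
  positivity

lemma heat_eq (m : ℕ) (hm : 1 ≤ m) (l : Fin m → ℝ) (t : ℝ) (x y : Fin m → ℤ) :
    (heatKernel m t x y : ℂ) = ∏ i, qc (l i) t (y i - x i) := by
  have hm' : (m : ℂ) ≠ 0 := by exact_mod_cast (by omega : m ≠ 0)
  unfold heatKernel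
  rw [Complex.ofReal_tsum]
  push_cast
  simp_rw [srw_fourier m hm l]
  set P := (Measure.pi fun _ : Fin m => per)
  set c := fun θ : Fin m → ℝ => (∑ i, Complex.cos (cw (l i) (θ i))) / m
  set F := fun θ : Fin m → ℝ => ∏ i, Complex.exp (Complex.I * (y i - x i : ℤ) * cw (l i) (θ i))
  -- bound on the compact
  have hP : P = (volume : Measure (Fin m → ℝ)).restrict
          (Set.pi univ fun _ => Ioc (-Real.pi) Real.pi) := by
    unfold P per
    rw [volume_pi, Measure.restrict_pi_pi]
  have hc : Continuous c := by unfold c cw; fun_prop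
  have hF : Continuous F := by unfold F cw; fun_prop
  have hK : IsCompact (Set.pi (univ : Set (Fin m)) fun _ => Icc (-Real.pi) Real.pi) :=
    isCompact_univ_pi fun _ => isCompact_Icc
  obtain ⟨Bc, hBc⟩ := hK.exists_bound_of_continuousOn hc.continuousOn
  obtain ⟨BF, hBF⟩ := hK.exists_bound_of_continuousOn hF.continuousOn
  have hae : ∀ᵐ θ ∂P, ‖c θ‖ ≤ Bc ∧ ‖F θ‖ ≤ BF := by
    rw [hP]
    filter_upwards [ae_restrict_mem (MeasurableSet.univ_pi fun _ => measurableSet_Ioc)] with θ hθ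
    have := Set.pi_mono (fun i _ => Ioc_subset_Icc_self) hθ
    exact ⟨hBc θ this, hBF θ this⟩
  have hsum : HasSum (fun n : ℕ => ∫ θ, (2 * m * t : ℂ) ^ n / n.factorial * (c θ ^ n * F θ) ∂P)
      (∫ θ, Complex.exp (2 * m * t * c θ) * F θ ∂P) := by
    apply hasSum_integral_of_dominated_convergence
      (fun n _ => (‖(2 * m * t : ℂ)‖ * Bc) ^ n / n.factorial * BF)
    · intro n
      exact Continuous.aestronglyMeasurable (by fun_prop)
    · intro n
      filter_upwards [hae] with θ hθ
      rw [norm_mul, norm_mul, norm_div, norm_pow, norm_pow, mul_pow, Complex.norm_natCast]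
      have h0 : 0 ≤ ‖c θ‖ := norm_nonneg _
      have h1 : 0 ≤ ‖F θ‖ := norm_nonneg _
      calc ‖(2 * m * t : ℂ)‖ ^ n / n.factorial * (‖c θ‖ ^ n * ‖F θ‖)
          ≤ ‖(2 * m * t : ℂ)‖ ^ n / n.factorial * (Bc ^ n * BF) := by
            gcongr
            · exact pow_nonneg (h0.trans hθ.1) _
            · exact hθ.1
            · exact hθ.2
        _ = _ := by ring
    · filter_upwards with θ
      exact (Real.summable_pow_div_factorial _).mul_right _
    · apply integrable_const
    · filter_upwards with θ
      have := (NormedSpace.exp_series_hasSum_exp' (𝕂 := ℂ) (2 * m * t * c θ)).mul_right (F θ)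
      rw [← Complex.exp_eq_exp_ℂ] at this
      have e : (fun n : ℕ => (2 * m * t : ℂ) ^ n / n.factorial * (c θ ^ n * F θ)) = fun i : ℕ =>
          ((i.factorial : ℂ))⁻¹ • (2 * m * t * c θ) ^ i * F θ := by
        funext n
        simp only [smul_eq_mul, mul_pow, div_eq_mul_inv]
        ring
      rw [e]
      exact this
  have e1 : ∀ n : ℕ, Complex.exp (-(2 * m) * t) * (2 * m * t) ^ n / n.factorial *
      (((2 * Real.pi : ℂ) ^ m)⁻¹ * ∫ θ, c θ ^ n * F θ ∂P)
      = (Complex.exp (-(2 * m) * t) * ((2 * Real.pi : ℂ) ^ m)⁻¹) *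
        ∫ θ, (2 * m * t : ℂ) ^ n / n.factorial * (c θ ^ n * F θ) ∂P := by
    intro n
    rw [integral_const_mul]
    ring
  have e2 : ∑' n : ℕ, Complex.exp (-(2 * m) * t) * (2 * m * t) ^ n / n.factorial *
      (((2 * Real.pi : ℂ) ^ m)⁻¹ * ∫ θ, c θ ^ n * F θ ∂P) = 
      (Complex.exp (-(2 * m) * t) * ((2 * Real.pi : ℂ) ^ m)⁻¹) *
       (∫ θ, Complex.exp (2 * m * t * c θ) * F θ ∂P) := by
    simp_rw [e1]
    exact (hsum.mul_left _).tsum_eq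
  refine e2.trans ?_
  unfold qc
  rw [Finset.prod_mul_distrib, Finset.prod_const, Finset.card_univ, Fintype.card_fin,
    ← integral_fintype_prod_eq_prod (μ := fun _ => per)
      (f := fun i (θ : ℝ) => Complex.exp (2 * t * (Complex.cos (cw (l i) θ) - 1)) *
    Complex.exp (Complex.I * (y i - x i : ℤ) * cw (l i) θ)), mul_comm (Complex.exp _), mul_assoc,
    ← integral_const_mul, inv_pow]
  congr 1
  apply integral_congr_ae
  filter_upwards with θ
  rw [Finset.prod_mul_distrib, ← mul_assoc, ← Complex.exp_add, ← Complex.exp_sum]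
  congr 2
  rw [← Finset.mul_sum, Finset.sum_sub_distrib]
  simp only [c, Finset.sum_const, Finset.card_univ, Fintype.card_fin, nsmul_eq_mul, mul_one]
  field_simp
  ring

end LG
end Part1

section Part2
open MeasureTheory ProbabilityTheory Filter Set

namespace LG

/-- one-dimensional heat kernel -/
noncomputable def q (t : ℝ) (k : ℤ) : ℝ := heatKernel 1 t 0 (fun _ => k)

lemma q_nonneg {t : ℝ} (ht : 0 ≤ t) (k : ℤ) : 0 ≤ q t k := heat_nonneg 1 t ht _ _

lemma q_eq_qc (l t : ℝ) (k : ℤ) : (q t k : ℂ) = qc l t k := by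
  unfold q
  rw [heat_eq 1 le_rfl (fun _ => l)]
  simp

lemma heat_prod (m : ℕ) (hm : 1 ≤ m) (t : ℝ) (x y : Fin m → ℤ) :
    heatKernel m t x y = ∏ i, q t (y i - x i) := by
  have := heat_eq m hm 0 t x y
  simp only [Pi.zero_apply, ← q_eq_qc] at this
  exact_mod_cast this

lemma cw_cos_re (l θ : ℝ) : (Complex.cos (cw l θ)).re = Real.cos θ * Real.cosh l := by
  unfold cw
  rw [mul_comm Complex.I, Complex.cos_add_mul_I]
  simp [Complex.sub_re, Complex.mul_re, ← Complex.ofReal_cos, ← Complex.ofReal_sin,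
    ← Complex.ofReal_cosh, ← Complex.ofReal_sinh]

lemma qc_norm (l t θ : ℝ) (k : ℤ) : ‖Complex.exp (2 * t * (Complex.cos (cw l θ) - 1)) *
    Complex.exp (Complex.I * k * cw l θ)‖ = Real.exp (2 * t * (Real.cos θ * Real.cosh l - 1)) *
      Real.exp (-(l * k)) := by
  rw [norm_mul, Complex.norm_exp, Complex.norm_exp]
  congr 2
  · have : (2 * t * (Complex.cos (cw l θ) - 1)) = ((2 * t : ℝ) : ℂ) * (Complex.cos (cw l θ) - 1) := by
      push_cast; ring
    rw [this, Complex.re_ofReal_mul, Complex.sub_re, cw_cos_re]; simp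
  · have : Complex.I * k * cw l θ = Complex.I * ((k * θ : ℝ) : ℂ) - ((l * k : ℝ) : ℂ) := by
      unfold cw; push_cast
      linear_combination (k * l : ℂ) * Complex.I_mul_I
    rw [this]; simp

lemma cos_le_per {θ : ℝ} (h : θ ∈ Ioc (-Real.pi) Real.pi) :
    Real.cos θ ≤ 1 - 2 / Real.pi ^ 2 * θ ^ 2 :=
  Real.cos_le_one_sub_mul_cos_sq (abs_le.mpr ⟨h.1.le, h.2⟩)

lemma per_cont_int {f : ℝ → ℝ} (hf : Continuous f) : Integrable f per := by
  unfold per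
  exact (hf.integrableOn_Icc (a := -Real.pi) (b := Real.pi)).mono_set Ioc_subset_Icc_self

lemma per_ae {p : ℝ → Prop} (h : ∀ θ ∈ Ioc (-Real.pi) Real.pi, p θ) : ∀ᵐ θ ∂per, p θ := by
  unfold per
  filter_upwards [ae_restrict_mem measurableSet_Ioc] with θ hθ using h θ hθ

lemma per_gauss {b : ℝ} (hb : 0 < b) : ∫ θ, Real.exp (-b * θ ^ 2) ∂per ≤ Real.sqrt (Real.pi / b) := by
  rw [← integral_gaussian]
  exact setIntegral_le_integral (integrable_exp_neg_mul_sq hb)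
    (Eventually.of_forall fun x => (Real.exp_pos _).le)

lemma exp_cos_le {t θ : ℝ} (ht : 0 ≤ t) (h : θ ∈ Ioc (-Real.pi) Real.pi) :
    Real.exp (2 * t * (Real.cos θ - 1)) ≤ Real.exp (-(4 * t / Real.pi ^ 2) * θ ^ 2) := by
  apply Real.exp_le_exp.mpr
  have := cos_le_per h
  have : 2 * t * (Real.cos θ - 1) ≤ 2 * t * (- (2 / Real.pi ^ 2 * θ ^ 2)) := by
    apply mul_le_mul_of_nonneg_left _ (by positivity); linarith
  refine this.trans (le_of_eq ?_)
  ring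

lemma cos_int_le {t : ℝ} (ht : 0 ≤ t) :
    ∫ θ, Real.exp (2 * t * (Real.cos θ - 1)) ∂per ≤ 2 * Real.pi * (1 / Real.sqrt (max t 1)) := by
  have hpi := Real.pi_pos
  rcases le_total t 1 with h | h
  · rw [max_eq_right h]
    calc _ ≤ ∫ θ, (1 : ℝ) ∂per := by
          apply integral_mono (per_cont_int (by fun_prop)) (integrable_const _)
          intro θ
          apply Real.exp_le_one_iff.mpr
          nlinarith [Real.cos_le_one θ]
      _ = _ := by simp [per_real]
  · rw [max_eq_left h]
    have ht' : 0 < t := by linarith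
    calc _ ≤ ∫ θ, Real.exp (-(4 * t / Real.pi ^ 2) * θ ^ 2) ∂per := by
          apply integral_mono_ae (per_cont_int (by fun_prop)) (per_cont_int (by fun_prop))
          exact per_ae fun θ hθ => exp_cos_le ht hθ
      _ ≤ _ := per_gauss (by positivity)
      _ ≤ _ := by
        apply Real.sqrt_le_iff.mpr
        refine ⟨by positivity, ?_⟩
        have h2 : Real.sqrt t ^ 2 = t := Real.sq_sqrt ht
        rw [mul_pow, div_pow, h2]
        have : Real.pi / (4 * t / Real.pi ^ 2) = Real.pi ^ 3 / 4 * (1 ^ 2 / t) := by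
          field_simp
        rw [this]
        apply mul_le_mul_of_nonneg_right _ (by positivity)
        nlinarith [Real.pi_le_four, sq_nonneg Real.pi, mul_pos hpi hpi]

lemma cosh_sub_one_le {l : ℝ} (h : l ^ 2 ≤ 1) : Real.cosh l - 1 ≤ l ^ 2 := by
  have h1 := Real.cosh_le_exp_half_sq l
  have h2 := Real.exp_bound_div_one_sub_of_interval (x := l ^ 2 / 2) (by positivity) (by linarith)
  have h3 : 1 / (1 - l ^ 2 / 2) ≤ 1 + l ^ 2 := by
    rw [div_le_iff₀ (by linarith)]
    nlinarith [sq_nonneg l]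
  linarith

/-- main upper bound in dimension one -/
lemma q_le {t : ℝ} (ht : 0 ≤ t) (k : ℤ) :
    q t k ≤ Real.exp 2 * (1 / Real.sqrt (max t 1)) * Real.exp (-(|(k : ℝ)| / Real.sqrt (max t 1))) := by
  set τ := max t 1
  have hτ : 1 ≤ τ := le_max_right _ _
  have htτ : t ≤ τ := le_max_left _ _
  have hsq : Real.sqrt τ ^ 2 = τ := Real.sq_sqrt (by linarith)
  have hs : 0 < Real.sqrt τ := Real.sqrt_pos.mpr (by linarith)
  obtain ⟨l, hl2, hlk⟩ : ∃ l : ℝ, l ^ 2 = 1 / τ ∧ l * k = |(k : ℝ)| / Real.sqrt τ := by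
    rcases le_total 0 (k : ℝ) with h | h
    · exact ⟨1 / Real.sqrt τ, by rw [div_pow, hsq, one_pow], by rw [abs_of_nonneg h]; ring⟩
    · exact ⟨-(1 / Real.sqrt τ), by rw [neg_sq, div_pow, hsq, one_pow], by rw [abs_of_nonpos h]; ring⟩
  have hl1 : l ^ 2 ≤ 1 := by rw [hl2]; exact (div_le_one (by linarith)).mpr hτ
  have hch := cosh_sub_one_le hl1
  have hch1 := Real.one_le_cosh l
  have h1 : q t k = ‖qc l t k‖ := by
    rw [← q_eq_qc, Complex.norm_real, Real.norm_of_nonneg (q_nonneg ht k)]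
  rw [h1]
  unfold qc
  rw [norm_mul]
  have h2 : ‖(2 * Real.pi : ℂ)⁻¹‖ = (2 * Real.pi)⁻¹ := by
    rw [norm_inv, norm_mul]; simp [abs_of_pos Real.pi_pos]
  rw [h2]
  have h3 : ‖∫ θ, Complex.exp (2 * t * (Complex.cos (cw l θ) - 1)) *
    Complex.exp (Complex.I * k * cw l θ) ∂per‖ ≤
      2 * Real.pi * (1 / Real.sqrt τ) * (Real.exp 2 * Real.exp (-(l * k))) := by
    refine (norm_integral_le_integral_norm _).trans ?_
    simp_rw [qc_norm]
    calc _ ≤ ∫ θ, Real.exp (2 * t * (Real.cos θ - 1)) * (Real.exp 2 * Real.exp (-(l * k))) ∂per := by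
          apply integral_mono (per_cont_int (by fun_prop)) (per_cont_int (by fun_prop))
          intro θ
          simp only
          rw [← mul_assoc]
          apply mul_le_mul_of_nonneg_right _ (Real.exp_pos _).le
          rw [← Real.exp_add]
          apply Real.exp_le_exp.mpr
          have e1 : Real.cos θ * Real.cosh l - 1 ≤ (Real.cos θ - 1) + (Real.cosh l - 1) := by
            nlinarith [Real.cos_le_one θ]
          have e2 : t * (Real.cosh l - 1) ≤ τ * (1 / τ) :=
            mul_le_mul htτ (by rw [← hl2]; exact hch) (by linarith) (by linarith)
          rw [mul_one_div_cancel (by linarith)] at e2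
          have e3 : 2 * t * (Real.cos θ * Real.cosh l - 1) ≤ 2 * t * ((Real.cos θ - 1) + (Real.cosh l - 1)) :=
            mul_le_mul_of_nonneg_left e1 (by linarith)
          nlinarith
      _ ≤ _ := by
          rw [integral_mul_const]
          exact mul_le_mul_of_nonneg_right (cos_int_le ht) (by positivity)
  calc _ ≤ (2 * Real.pi)⁻¹ * (2 * Real.pi * (1 / Real.sqrt τ) * (Real.exp 2 * Real.exp (-(l * k)))) :=
        mul_le_mul_of_nonneg_left h3 (by have := Real.pi_pos; positivity)
    _ = _ := by rw [hlk]; have := Real.pi_pos; field_simp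

lemma q_cos (t : ℝ) (k : ℤ) : q t k = (2 * Real.pi)⁻¹ *
    ∫ θ, Real.exp (2 * t * (Real.cos θ - 1)) * Real.cos (k * θ) ∂per := by
  have h := congrArg Complex.re (q_eq_qc 0 t k)
  rw [Complex.ofReal_re] at h
  rw [h]
  unfold qc
  have e : (2 * Real.pi : ℂ)⁻¹ = (((2 * Real.pi)⁻¹ : ℝ) : ℂ) := by push_cast; ring
  rw [e, Complex.re_ofReal_mul]
  congr 1
  have hcont : Continuous fun θ => Complex.exp (2 * t * (Complex.cos (cw 0 θ) - 1)) *
    Complex.exp (Complex.I * k * cw 0 θ) := by unfold cw; fun_prop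
  have hi : Integrable (fun θ => Complex.exp (2 * t * (Complex.cos (cw 0 θ) - 1)) *
    Complex.exp (Complex.I * k * cw 0 θ)) per := by
    unfold per
    exact (hcont.integrableOn_Icc (a := -Real.pi) (b := Real.pi)).mono_set Ioc_subset_Icc_self
  rw [← Complex.reCLM_apply, ← Complex.reCLM.integral_comp_comm hi]
  congr 1
  funext θ
  have e1 : Complex.exp (2 * t * (Complex.cos (cw 0 θ) - 1)) =
      ((Real.exp (2 * t * (Real.cos θ - 1)) : ℝ) : ℂ) := by unfold cw; push_cast; simp
  have e2 : Complex.I * k * cw 0 θ = ((k * θ : ℝ) : ℂ) * Complex.I := by unfold cw; push_cast; ring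
  rw [e1, e2, Complex.reCLM_apply, Complex.re_ofReal_mul, Complex.exp_ofReal_mul_I_re]

lemma q_cont (k : ℤ) : Continuous fun t => q t k := by
  simp_rw [q_cos]
  apply Continuous.mul continuous_const
  rw [continuous_iff_continuousAt]
  intro t0
  apply continuousAt_of_dominated (bound := fun _ => Real.exp (4 * (|t0| + 1)))
  · filter_upwards with t
    exact Continuous.aestronglyMeasurable (by fun_prop)
  · have : ∀ᶠ t in nhds t0, |t| < |t0| + 1 :=
      (continuous_abs.tendsto t0).eventually (gt_mem_nhds (by linarith))
    filter_upwards [this] with t ht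
    filter_upwards with θ
    rw [norm_mul, Real.norm_of_nonneg (Real.exp_pos _).le]
    calc _ ≤ Real.exp (2 * t * (Real.cos θ - 1)) * 1 :=
          mul_le_mul_of_nonneg_left (Real.abs_cos_le_one _) (Real.exp_pos _).le
      _ ≤ _ := by
          rw [mul_one]
          apply Real.exp_le_exp.mpr
          have h1 := Real.neg_one_le_cos θ
          have h2 := Real.cos_le_one θ
          have : -|t| ≤ t := neg_abs_le t
          nlinarith [abs_nonneg t]
  · exact integrable_const _
  · filter_upwards with θ
    fun_prop

/-- lower bound in dimension one -/
lemma q_ge : ∃ c : ℝ, 0 < c ∧ ∀ t : ℝ, 1 ≤ t → ∀ k : ℤ, (k : ℝ) ^ 2 ≤ c * t →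
    c / Real.sqrt t ≤ q t k := by
  have hpi := Real.pi_pos
  -- constant in difference bound
  obtain ⟨C, hC0, hC⟩ : ∃ C : ℝ, 0 < C ∧ ∀ t : ℝ, 1 ≤ t → ∀ k : ℤ,
      q t 0 - q t k ≤ C * k ^ 2 / t / Real.sqrt t := by
    refine ⟨(2 * Real.pi)⁻¹ * (Real.pi ^ 2 / 4) * Real.sqrt (Real.pi ^ 3 / 2), by positivity, ?_⟩
    intro t ht k
    have ht0 : 0 < t := by linarith
    rw [q_cos, q_cos, ← mul_sub, ← integral_sub (per_cont_int (by fun_prop)) (per_cont_int (by fun_prop))]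
    have hb : 0 < 2 * t / Real.pi ^ 2 := by positivity
    have : ∫ θ, (Real.exp (2 * t * (Real.cos θ - 1)) * Real.cos ((0 : ℤ) * θ) -
        Real.exp (2 * t * (Real.cos θ - 1)) * Real.cos (k * θ)) ∂per ≤
        ∫ θ, (k ^ 2 * (Real.pi ^ 2 / (4 * t))) * Real.exp (-(2 * t / Real.pi ^ 2) * θ ^ 2) ∂per := by
      apply integral_mono_ae (per_cont_int (by fun_prop)) (per_cont_int (by fun_prop))
      refine per_ae fun θ hθ => ?_
      have h1 := exp_cos_le ht0.le hθ
      have h2 := Real.one_sub_sq_div_two_le_cos (x := k * θ)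
      have h3 : 2 * t / Real.pi ^ 2 * θ ^ 2 ≤ Real.exp (2 * t / Real.pi ^ 2 * θ ^ 2) := by
        linarith [Real.add_one_le_exp (2 * t / Real.pi ^ 2 * θ ^ 2)]
      have h4 : Real.exp (-(4 * t / Real.pi ^ 2) * θ ^ 2) = Real.exp (-(2 * t / Real.pi ^ 2) * θ ^ 2)
          * Real.exp (-(2 * t / Real.pi ^ 2 * θ ^ 2)) := by
        rw [← Real.exp_add]; congr 1; ring
      have h5 : Real.exp (-(2 * t / Real.pi ^ 2 * θ ^ 2)) * θ ^ 2 ≤ Real.pi ^ 2 / (2 * t) := by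
        rw [Real.exp_neg, inv_mul_le_iff₀ (Real.exp_pos _)]
        have : θ ^ 2 = (2 * t / Real.pi ^ 2 * θ ^ 2) * (Real.pi ^ 2 / (2 * t)) := by
          field_simp
        rw [this]
        exact mul_le_mul_of_nonneg_right (by rw [← this]; exact h3) (by positivity)
      simp only [Int.cast_zero, zero_mul, Real.cos_zero]
      calc _ = Real.exp (2 * t * (Real.cos θ - 1)) * (1 - Real.cos (k * θ)) := by ring
        _ ≤ Real.exp (-(4 * t / Real.pi ^ 2) * θ ^ 2) * ((k * θ) ^ 2 / 2) := by
            apply mul_le_mul h1 (by linarith) (by linarith [Real.cos_le_one (k * θ)]) (Real.exp_pos _).le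
        _ = (k ^ 2 / 2) * Real.exp (-(2 * t / Real.pi ^ 2) * θ ^ 2) *
            (Real.exp (-(2 * t / Real.pi ^ 2 * θ ^ 2)) * θ ^ 2) := by rw [h4]; ring
        _ ≤ (k ^ 2 / 2) * Real.exp (-(2 * t / Real.pi ^ 2) * θ ^ 2) * (Real.pi ^ 2 / (2 * t)) :=
            mul_le_mul_of_nonneg_left h5 (by positivity)
        _ = _ := by field_simp; ring
    rw [integral_const_mul] at this
    have h6 := per_gauss hb
    have h7 : Real.sqrt (Real.pi / (2 * t / Real.pi ^ 2)) = Real.sqrt (Real.pi ^ 3 / 2) / Real.sqrt t := by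
      rw [← Real.sqrt_div (by positivity)]; congr 1; field_simp
    rw [h7] at h6
    calc _ ≤ (2 * Real.pi)⁻¹ * ((k ^ 2 * (Real.pi ^ 2 / (4 * t))) * (Real.sqrt (Real.pi ^ 3 / 2) / Real.sqrt t)) := by
          apply mul_le_mul_of_nonneg_left _ (by positivity)
          exact this.trans (mul_le_mul_of_nonneg_left h6 (by positivity))
      _ = _ := by field_simp
  have hD : ∀ t : ℝ, 1 ≤ t → Real.exp (-1) / Real.pi / Real.sqrt t ≤ q t 0 := by
    intro t ht
    have hs : 1 ≤ Real.sqrt t := Real.one_le_sqrt.mpr ht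
    have hss : Real.sqrt t ^ 2 = t := Real.sq_sqrt (by linarith)
    rw [q_cos]
    have hsub : Ioc (-(1 / Real.sqrt t)) (1 / Real.sqrt t) ⊆ Ioc (-Real.pi) Real.pi := by
      have : 1 / Real.sqrt t ≤ Real.pi := by
        calc _ ≤ (1 : ℝ) := (div_le_one (by linarith)).mpr hs
          _ ≤ _ := by linarith [Real.pi_gt_three]
      exact Ioc_subset_Ioc (by linarith) this
    have : Real.exp (-1) * (2 / Real.sqrt t) ≤ ∫ θ, Real.exp (2 * t * (Real.cos θ - 1)) * Real.cos ((0 : ℤ) * θ) ∂per := by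
      unfold per
      calc _ = ∫ θ in Ioc (-(1 / Real.sqrt t)) (1 / Real.sqrt t), Real.exp (-1) := by
            rw [setIntegral_const, Real.volume_real_Ioc_of_le (by linarith [show 0 < 1 / Real.sqrt t by positivity]), smul_eq_mul]
            ring
        _ ≤ ∫ θ in Ioc (-(1 / Real.sqrt t)) (1 / Real.sqrt t), Real.exp (2 * t * (Real.cos θ - 1)) * Real.cos ((0 : ℤ) * θ) := by
            apply setIntegral_mono_on (integrableOn_const (by simp)) 
              ((Continuous.integrableOn_Icc (by fun_prop)).mono_set Ioc_subset_Icc_self) measurableSet_Ioc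
            intro θ hθ
            simp only [Int.cast_zero, zero_mul, Real.cos_zero, mul_one]
            apply Real.exp_le_exp.mpr
            have h2 := Real.one_sub_sq_div_two_le_cos (x := θ)
            have h3 : θ ^ 2 ≤ (1 / Real.sqrt t) ^ 2 := sq_le_sq' hθ.1.le hθ.2
            rw [div_pow, hss] at h3
            have h4 : t * θ ^ 2 ≤ 1 := by
              calc _ ≤ t * (1 ^ 2 / t) := mul_le_mul_of_nonneg_left h3 (by linarith)
                _ = 1 := by field_simp
            nlinarith
        _ ≤ _ := by
            apply setIntegral_mono_set ((Continuous.integrableOn_Icc (by fun_prop)).mono_set Ioc_subset_Icc_self)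
            · filter_upwards with θ
              simp [Real.exp_nonneg]
            · exact Eventually.of_forall hsub
    calc _ = (2 * Real.pi)⁻¹ * (Real.exp (-1) * (2 / Real.sqrt t)) := by field_simp
      _ ≤ _ := mul_le_mul_of_nonneg_left this (by positivity)
  set e := Real.exp (-1) / Real.pi with he
  have he0 : 0 < e := by positivity
  refine ⟨min (e / 2) (e / (2 * C)), by positivity, ?_⟩
  intro t ht k hk
  have hs : 0 < Real.sqrt t := Real.sqrt_pos.mpr (by linarith)
  have h1 := hC t ht k
  have h2 := hD t ht
  have h3 : C * k ^ 2 / t ≤ e / 2 := by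
    rw [div_le_iff₀ (by linarith)]
    calc C * k ^ 2 ≤ C * ((e / (2 * C)) * t) := by
          apply mul_le_mul_of_nonneg_left _ hC0.le
          exact hk.trans (mul_le_mul_of_nonneg_right (min_le_right _ _) (by linarith))
      _ = _ := by field_simp
  have h4 : C * k ^ 2 / t / Real.sqrt t ≤ e / 2 / Real.sqrt t := by gcongr
  have h5 : min (e / 2) (e / (2 * C)) / Real.sqrt t ≤ e / 2 / Real.sqrt t := by
    gcongr; exact min_le_left _ _
  have h6 : e / Real.sqrt t = e / 2 / Real.sqrt t + e / 2 / Real.sqrt t := by ring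
  linarith

end LG
end Part2

section Part3
open MeasureTheory ProbabilityTheory Filter Set

namespace LG

/-- `1 + |y|` -/
noncomputable def jb {d : ℕ} (y : Fin d → ℤ) : ℝ := 1 + ‖y‖

lemma one_le_jb {d : ℕ} (y : Fin d → ℤ) : 1 ≤ jb y := by unfold jb; linarith [norm_nonneg y]
lemma jb_pos {d : ℕ} (y : Fin d → ℤ) : 0 < jb y := by linarith [one_le_jb y]

lemma heat_cont (d : ℕ) (hd : 1 ≤ d) (x y : Fin d → ℤ) : Continuous fun t => heatKernel d t x y := by
  simp_rw [heat_prod d hd]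
  exact continuous_finsetProd _ fun i _ => q_cont _

lemma heat_trans (d : ℕ) (hd : 1 ≤ d) (t : ℝ) (x y : Fin d → ℤ) :
    heatKernel d t x y = heatKernel d t 0 (y - x) := by
  rw [heat_prod d hd, heat_prod d hd]; simp

lemma q_neg (t : ℝ) (k : ℤ) : q t (-k) = q t k := by
  rw [q_cos, q_cos]; simp

lemma heat_symm (d : ℕ) (hd : 1 ≤ d) (t : ℝ) (x y : Fin d → ℤ) :
    heatKernel d t x y = heatKernel d t y x := by
  rw [heat_prod d hd, heat_prod d hd]
  apply Finset.prod_congr rfl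
  intro i _
  rw [← q_neg]; congr 1; ring

lemma heat_le (d : ℕ) (hd : 1 ≤ d) {t : ℝ} (ht : 0 ≤ t) (x y : Fin d → ℤ) :
    heatKernel d t x y ≤ Real.exp 2 ^ d * (1 / Real.sqrt (max t 1)) ^ d *
      Real.exp (-(‖y - x‖ / Real.sqrt (max t 1))) := by
  rw [heat_prod d hd]
  set s := Real.sqrt (max t 1)
  have hs : 0 ≤ s := Real.sqrt_nonneg _
  calc _ ≤ ∏ i, (Real.exp 2 * (1 / s) * Real.exp (-(|((y i - x i : ℤ) : ℝ)| / s))) :=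
        Finset.prod_le_prod (fun i _ => q_nonneg ht _) fun i _ => q_le ht _
    _ = Real.exp 2 ^ d * (1 / s) ^ d * Real.exp (∑ i, -(|((y i - x i : ℤ) : ℝ)| / s)) := by
        rw [Finset.prod_mul_distrib, Finset.prod_const, ← Real.exp_sum, mul_pow]; simp
    _ ≤ _ := by
        apply mul_le_mul_of_nonneg_left _ (by positivity)
        apply Real.exp_le_exp.mpr
        rw [Finset.sum_neg_distrib, neg_le_neg_iff, ← Finset.sum_div]
        apply div_le_div_of_nonneg_right _ hs
        rw [pi_norm_le_iff_of_nonneg (Finset.sum_nonneg fun i _ => abs_nonneg _)]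
        intro i
        have := Finset.single_le_sum (f := fun i => |((y i - x i : ℤ) : ℝ)|) (fun i _ => abs_nonneg _) (Finset.mem_univ i)
        simpa [Int.norm_eq_abs] using this

lemma heat_diag (d : ℕ) (hd : 1 ≤ d) {t : ℝ} (ht : 0 ≤ t) (x y : Fin d → ℤ) :
    heatKernel d t x y ≤ Real.exp 2 ^ d * (1 / Real.sqrt (max t 1)) ^ d := by
  refine (heat_le d hd ht x y).trans ?_
  apply mul_le_of_le_one_right (by positivity)
  apply Real.exp_le_one_iff.mpr
  have : 0 ≤ ‖y - x‖ / Real.sqrt (max t 1) := by positivity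
  linarith

lemma heat_poly (d : ℕ) (hd : 1 ≤ d) (K : ℕ) : ∃ C : ℝ, 0 < C ∧ ∀ t : ℝ, 0 ≤ t → ∀ x y : Fin d → ℤ,
    heatKernel d t x y ≤ C * (1 / Real.sqrt (max t 1)) ^ d * (Real.sqrt (max t 1) / jb (y - x)) ^ K := by
  refine ⟨Real.exp 2 ^ d * (Real.exp 1 * K.factorial), by positivity, ?_⟩
  intro t ht x y
  refine (heat_le d hd ht x y).trans ?_
  set s := Real.sqrt (max t 1)
  have hs : 1 ≤ s := Real.one_le_sqrt.mpr (le_max_right _ _)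
  set r := ‖y - x‖
  have hr : 0 ≤ r := norm_nonneg _
  have h1 : Real.exp (-(r / s)) ≤ Real.exp 1 * K.factorial * (s / jb (y - x)) ^ K := by
    have h2 := Real.pow_div_factorial_le_exp (x := 1 + r / s) (by positivity) K
    have h3 : Real.exp (-(r / s)) = Real.exp 1 * (Real.exp (1 + r / s))⁻¹ := by
      rw [← Real.exp_neg, ← Real.exp_add]; congr 1; ring
    rw [h3, mul_assoc]
    apply mul_le_mul_of_nonneg_left _ (Real.exp_pos _).le
    have h4 : jb (y - x) / s ≤ 1 + r / s := by
      unfold jb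
      rw [add_div]
      have : 1 / s ≤ 1 := (div_le_one (by linarith)).mpr hs
      linarith
    have hj := jb_pos (y - x)
    have h5 : (jb (y - x) / s) ^ K / K.factorial ≤ Real.exp (1 + r / s) := by
      refine le_trans ?_ h2
      gcongr
    have h6 : (K.factorial : ℝ) * (s / jb (y - x)) ^ K = ((jb (y - x) / s) ^ K / K.factorial)⁻¹ := by
      rw [inv_div, div_pow, div_pow]; field_simp
    rw [h6]
    exact inv_anti₀ (by positivity) h5
  calc _ ≤ Real.exp 2 ^ d * (1 / s) ^ d * (Real.exp 1 * K.factorial * (s / jb (y - x)) ^ K) :=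
        mul_le_mul_of_nonneg_left h1 (by positivity)
    _ = _ := by ring

lemma heat_ge (d : ℕ) (hd : 1 ≤ d) : ∃ c : ℝ, 0 < c ∧ c ≤ 1 ∧ ∀ t : ℝ, 1 ≤ t → ∀ x y : Fin d → ℤ,
    ‖y - x‖ ^ 2 ≤ c * t → c * (1 / Real.sqrt t) ^ d ≤ heatKernel d t x y := by
  obtain ⟨c, hc, h⟩ := q_ge
  refine ⟨min 1 (min c (c ^ d)), by positivity, min_le_left _ _, ?_⟩
  intro t ht x y hxy
  rw [heat_prod d hd]
  have hs : 0 < Real.sqrt t := Real.sqrt_pos.mpr (by linarith)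
  calc _ ≤ c ^ d * (1 / Real.sqrt t) ^ d := by
        apply mul_le_mul_of_nonneg_right _ (by positivity)
        exact (min_le_right _ _).trans (min_le_right _ _)
    _ = ∏ i : Fin d, (c / Real.sqrt t) := by
        rw [Finset.prod_const, ← mul_pow, mul_one_div]; simp
    _ ≤ _ := by
        apply Finset.prod_le_prod (fun i _ => by positivity)
        intro i _
        apply h t ht
        have h1 := norm_le_pi_norm (y - x) i
        rw [Pi.sub_apply, Int.norm_eq_abs] at h1
        calc (((y i - x i : ℤ)) : ℝ) ^ 2 = |((y i - x i : ℤ) : ℝ)| ^ 2 := (sq_abs _).symm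
          _ ≤ ‖y - x‖ ^ 2 := by gcongr
          _ ≤ _ := hxy.trans (mul_le_mul_of_nonneg_right ((min_le_right _ _).trans (min_le_left _ _)) (by linarith))

lemma heat_term_summable (m : ℕ) (t : ℝ) (x y : Fin m → ℤ) : Summable fun n : ℕ =>
    Real.exp (-(2 * m) * t) * ((2 * m) * t) ^ n / n.factorial * srwKernel m n x y := by
  have : Summable fun n : ℕ => Real.exp (-(2 * m) * t) * (|(2 * m) * t| ^ n / n.factorial) :=
    (Real.summable_pow_div_factorial _).mul_left _
  refine this.of_norm_bounded (fun n => ?_)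
  rw [norm_mul, norm_div, norm_mul, Real.norm_of_nonneg (Real.exp_pos _).le, norm_pow, Real.norm_eq_abs,
    Real.norm_of_nonneg (srw_nonneg _ _ _ _), Real.norm_natCast, mul_div_assoc]
  exact mul_le_of_le_one_right (by positivity) (srw_le_one _ _ _ _)

lemma heat_self (m : ℕ) {t : ℝ} (ht : 0 ≤ t) (x : Fin m → ℤ) :
    Real.exp (-(2 * m) * t) ≤ heatKernel m t x x := by
  unfold heatKernel
  have := (heat_term_summable m t x x).le_tsum 0 (fun n _ => by
    have := srw_nonneg m n x x
    positivity)
  simpa [srwKernel] using this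

lemma tsum_cons {m : ℕ} (F : (Fin (m + 1) → ℤ) → ENNReal) :
    ∑' y, F y = ∑' k : ℤ, ∑' y : Fin m → ℤ, F (Fin.cons k y) := by
  rw [← ENNReal.tsum_prod (f := fun k y => F (Fin.cons k y))]
  exact ((Fin.consEquiv (fun _ : Fin (m + 1) => ℤ)).tsum_eq F).symm

lemma tsum_pi_prod (m : ℕ) (f : ℤ → ENNReal) :
    ∑' y : Fin m → ℤ, ∏ i, f (y i) = (∑' k, f k) ^ m := by
  induction m with
  | zero => rw [tsum_eq_single default (fun b hb => absurd (Subsingleton.elim _ _) hb)]; simp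
  | succ m ih =>
    rw [tsum_cons]
    simp_rw [Fin.prod_univ_succ, Fin.cons_zero, Fin.cons_succ, ENNReal.tsum_mul_left, ih,
      ENNReal.tsum_mul_right]
    rw [pow_succ, mul_comm]

lemma int_summable {r : ℝ} (hr : 1 < r) : Summable fun k : ℤ => (1 + |(k : ℝ)|) ^ (-r) := by
  have h : Summable fun n : ℕ => (1 + |(n : ℝ)|) ^ (-r) := by
    have := (Real.summable_one_div_nat_add_rpow 1 r).mpr hr
    refine this.congr fun n => ?_
    rw [Real.rpow_neg (by positivity), one_div, abs_of_nonneg (by positivity : (0 : ℝ) ≤ n + 1),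
      abs_of_nonneg (by positivity : (0 : ℝ) ≤ n), add_comm]
  apply Summable.of_nat_of_neg
  · simpa using h
  · simpa using h

/-- summability of negative powers of `jb` -/
lemma jb_tsum (d : ℕ) {s : ℝ} (hs : (d : ℝ) < s) :
    ∑' y : Fin d → ℤ, ENNReal.ofReal (jb y ^ (-s)) ≠ ⊤ := by
  rcases Nat.eq_zero_or_pos d with h0 | h0
  · subst h0
    rw [tsum_eq_single default (fun b hb => absurd (Subsingleton.elim _ _) hb)]
    exact ENNReal.ofReal_ne_top
  have hd : (0 : ℝ) < d := by exact_mod_cast h0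
  have hr : 1 < s / d := (one_lt_div hd).mpr hs
  have h1 : ∀ y : Fin d → ℤ, ENNReal.ofReal (jb y ^ (-s)) ≤
      ∏ i, ENNReal.ofReal ((1 + |(y i : ℝ)|) ^ (-(s / d))) := by
    intro y
    rw [← ENNReal.ofReal_prod_of_nonneg (fun i _ => by positivity)]
    apply ENNReal.ofReal_le_ofReal
    have : jb y ^ (-s) = ∏ i : Fin d, jb y ^ (-(s / d)) := by
      rw [Finset.prod_const, ← Real.rpow_mul_natCast (jb_pos y).le]; congr 1; simp; field_simp
    rw [this]
    apply Finset.prod_le_prod (fun i _ => by have := jb_pos y; positivity)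
    intro i _
    apply Real.rpow_le_rpow_of_nonpos (by positivity) _ (by linarith)
    unfold jb
    have := norm_le_pi_norm y i
    rw [Int.norm_eq_abs] at this
    linarith
  refine ne_top_of_le_ne_top ?_ (ENNReal.tsum_le_tsum h1)
  rw [tsum_pi_prod d (fun k => ENNReal.ofReal ((1 + |(k : ℝ)|) ^ (-(s / d))))]
  apply ENNReal.pow_ne_top
  exact (int_summable hr).tsum_ofReal_ne_top

end LG
end Part3

section Part4
open MeasureTheory ProbabilityTheory Filter Set
open scoped ENNReal

namespace LG

/-- heat kernel with values in `[0,∞]` -/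
noncomputable def pk (m : ℕ) (t : ℝ) (x y : Fin m → ℤ) : ℝ≥0∞ := ENNReal.ofReal (heatKernel m t x y)

/-- iterated kernel of a list of (increment, function) -/
noncomputable def RL (m : ℕ) : List (ℝ × ((Fin m → ℤ) → ℝ≥0∞)) → (Fin m → ℤ) → ℝ≥0∞
  | [], _ => 1
  | a :: l, x => ∑' y, pk m a.1 x y * (a.2 y * RL m l y)

/-- evaluation of a list along a path -/
noncomputable def EV {Ω E : Type*} (X : ℝ → Ω → E) : List (ℝ × (E → ℝ≥0∞)) → ℝ → Ω → ℝ≥0∞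
  | [], _, _ => 1
  | a :: l, s, ω => a.2 (X (s + a.1) ω) * EV X l (s + a.1) ω

section
variable {m : ℕ} {Ω : Type*} [MeasurableSpace Ω] {P : (Fin m → ℤ) → Measure Ω}
  {S : ℝ → Ω → (Fin m → ℤ)}

lemma S_meas (hS : IsCTSRW m P S) (t : ℝ) : Measurable (S t) :=
  hS.meas.comp (measurable_const.prodMk measurable_id)

lemma EV_meas {Ω E : Type*} [MeasurableSpace Ω] [MeasurableSpace E] [DiscreteMeasurableSpace E]
    {X : ℝ → Ω → E} (hX : ∀ t, Measurable (X t)) (l : List (ℝ × (E → ℝ≥0∞))) (s : ℝ) :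
    Measurable (EV X l s) := by
  induction l generalizing s with
  | nil => exact measurable_const
  | cons a l ih => exact ((Measurable.of_discrete (f := a.2)).comp (hX _)).mul (ih _)

lemma fdd_enn (hS : IsCTSRW m P S) (x : Fin m → ℤ) (n : ℕ) (t : Fin (n + 1) → ℝ) (h0 : 0 ≤ t 0)
    (hm : ∀ i : Fin n, t i.castSucc ≤ t i.succ) (y : Fin (n + 1) → (Fin m → ℤ)) :
    P x {ω | ∀ i, S (t i) ω = y i} = pk m (t 0) x (y 0) *
      ∏ i : Fin n, pk m (t i.succ - t i.castSucc) (y i.castSucc) (y i.succ) := by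
  have := hS.prob x
  unfold pk
  rw [← ENNReal.ofReal_prod_of_nonneg (fun i _ => heat_nonneg _ _ (by linarith [hm i]) _ _),
    ← ENNReal.ofReal_mul (heat_nonneg _ _ h0 _ _), ← hS.fdd x n t h0 hm y,
    ENNReal.ofReal_toReal (measure_ne_top _ _)]

lemma lintegral_split {Ω E : Type*} [MeasurableSpace Ω] [MeasurableSpace E] [Countable E]
    [MeasurableSingletonClass E] {μ : Measure Ω} {X : Ω → E} (hX : Measurable X)
    {f : Ω → ℝ≥0∞} (hf : Measurable f) :
    ∫⁻ ω, f ω ∂μ = ∑' w, ∫⁻ ω, (X ⁻¹' {w}).indicator f ω ∂μ := by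
  rw [← lintegral_tsum (fun w => (hf.indicator (hX (measurableSet_singleton w))).aemeasurable)]
  congr 1
  funext ω
  rw [tsum_eq_single (X ω)]
  · simp
  · intro b hb
    apply indicator_of_notMem
    simpa using hb.symm

lemma list_pfx (hS : IsCTSRW m P S) (x : Fin m → ℤ) (l : List (ℝ × ((Fin m → ℤ) → ℝ≥0∞)))
    (hl : ∀ a ∈ l, 0 ≤ a.1) : ∀ (n : ℕ) (t : Fin (n + 1) → ℝ) (_ : 0 ≤ t 0)
    (_ : ∀ i : Fin n, t i.castSucc ≤ t i.succ) (y : Fin (n + 1) → (Fin m → ℤ)),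
    ∫⁻ ω in {ω | ∀ i, S (t i) ω = y i}, EV S l (t (Fin.last n)) ω ∂(P x) =
      P x {ω | ∀ i, S (t i) ω = y i} * RL m l (y (Fin.last n)) := by
  induction l with
  | nil => intro n t _ _ y; simp [EV, RL]
  | cons a l ih =>
    intro n t h0 hm y
    have hl' := fun b hb => hl b (List.mem_cons_of_mem _ hb)
    have ha := hl a List.mem_cons_self
    have hms : ∀ u w, MeasurableSet {ω | S u ω = w} := fun u w =>
      (S_meas hS u) (measurableSet_singleton w)
    have hmA : MeasurableSet {ω | ∀ i, S (t i) ω = y i} := by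
      rw [Set.ofPred_forall]; exact MeasurableSet.iInter fun i => hms _ _
    simp only [EV, RL]
    rw [lintegral_split (f := fun ω => a.2 (S (t (Fin.last n) + a.1) ω) * EV S l (t (Fin.last n) + a.1) ω)
      (S_meas hS (t (Fin.last n) + a.1)) (((Measurable.of_discrete (f := a.2)).comp (S_meas hS _)).mul (EV_meas (S_meas hS) _ _)),
      ← ENNReal.tsum_mul_left]
    congr 1
    funext w
    have key := ih hl' (n + 1) (Fin.snoc t (t (Fin.last n) + a.1)) 
      (by rw [show (0 : Fin (n + 1 + 1)) = Fin.castSucc 0 from rfl, Fin.snoc_castSucc]; exact h0)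
      (by
        intro i
        refine Fin.lastCases ?_ (fun j => ?_) i
        · rw [Fin.snoc_castSucc, Fin.succ_last, Fin.snoc_last]; linarith
        · rw [Fin.snoc_castSucc, Fin.succ_castSucc, Fin.snoc_castSucc]; exact hm j)
      (Fin.snoc y w)
    have hset : {ω | ∀ i, S (Fin.snoc (α := fun _ => ℝ) t (t (Fin.last n) + a.1) i) ω
        = Fin.snoc (α := fun _ => (Fin m → ℤ)) y w i} =
        {ω | ∀ i, S (t i) ω = y i} ∩ {ω | S (t (Fin.last n) + a.1) ω = w} := by
      ext ω
      simp only [Set.mem_ofPred_eq, mem_inter_iff]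
      rw [Fin.forall_fin_succ']
      simp
    have hprob : P x {ω | ∀ i, S (Fin.snoc (α := fun _ => ℝ) t (t (Fin.last n) + a.1) i) ω
        = Fin.snoc (α := fun _ => (Fin m → ℤ)) y w i} =
        P x {ω | ∀ i, S (t i) ω = y i} * pk m a.1 (y (Fin.last n)) w := by
      rw [fdd_enn hS x n t h0 hm y, fdd_enn hS x (n + 1)]
      · rw [Fin.prod_univ_castSucc]
        simp only [Fin.snoc_castSucc, Fin.succ_castSucc, Fin.succ_last, Fin.snoc_last, add_sub_cancel_left]
        rw [show (0 : Fin (n + 1 + 1)) = Fin.castSucc 0 from rfl, Fin.snoc_castSucc, Fin.snoc_castSucc, mul_assoc]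
      · rw [show (0 : Fin (n + 1 + 1)) = Fin.castSucc 0 from rfl, Fin.snoc_castSucc]; exact h0
      · intro i
        refine Fin.lastCases ?_ (fun j => ?_) i
        · rw [Fin.snoc_castSucc, Fin.succ_last, Fin.snoc_last]; linarith
        · rw [Fin.snoc_castSucc, Fin.succ_castSucc, Fin.snoc_castSucc]; exact hm j
    rw [hprob, hset] at key
    simp only [Fin.snoc_last] at key
    have hpre : S (t (Fin.last n) + a.1) ⁻¹' {w} = {ω | S (t (Fin.last n) + a.1) ω = w} := rfl
    rw [hpre, lintegral_indicator (hms _ _), Measure.restrict_restrict (hms _ _), inter_comm]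
    calc _ = ∫⁻ ω in {ω | ∀ i, S (t i) ω = y i} ∩ {ω | S (t (Fin.last n) + a.1) ω = w},
          a.2 w * EV S l (t (Fin.last n) + a.1) ω ∂(P x) := by
          apply setLIntegral_congr_fun (hmA.inter (hms _ _))
          intro ω hω
          have : S (t (Fin.last n) + a.1) ω = w := hω.2
          simp only [this]
      _ = _ := by
          rw [lintegral_const_mul _ (EV_meas (S_meas hS) _ _), key]
          ring

lemma list_S (hS : IsCTSRW m P S) (x : Fin m → ℤ) (l : List (ℝ × ((Fin m → ℤ) → ℝ≥0∞)))
    (hl : ∀ a ∈ l, 0 ≤ a.1) : ∫⁻ ω, EV S l 0 ω ∂(P x) = RL m l x := by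
  have := hS.prob x
  have key := list_pfx hS x l hl 0 (fun _ => 0) le_rfl (fun i => i.elim0) (fun _ => x)
  have h1 : ∀ᵐ ω ∂(P x), ω ∈ {ω | ∀ i : Fin (0 + 1), S ((fun _ => (0 : ℝ)) i) ω = (fun _ => x) i} := by
    filter_upwards [hS.start x] with ω hω i using hω
  rw [Measure.restrict_eq_self_of_ae_mem h1] at key
  have h2 : P x {ω | ∀ i : Fin (0 + 1), S ((fun _ => (0 : ℝ)) i) ω = (fun _ => x) i} = 1 := by
    refine (mem_ae_iff_prob_eq_one ?_).mp h1
    rw [Set.ofPred_forall]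
    exact MeasurableSet.iInter fun i => (S_meas hS _) (measurableSet_singleton _)
  rw [h2, one_mul] at key
  exact key

lemma q_tsum [NeZero m] (hS : IsCTSRW m P S) {t : ℝ} (ht : 0 ≤ t) : ∑' k, ENNReal.ofReal (q t k) = 1 := by
  have := hS.prob 0
  have h := list_S hS 0 [(t, fun _ => 1)] (by simpa using ht)
  simp only [EV, RL, mul_one, lintegral_const, measure_univ] at h
  have hm : 1 ≤ m := Nat.one_le_iff_ne_zero.mpr (NeZero.ne m)
  simp only [pk, heat_prod m hm] at h
  simp_rw [ENNReal.ofReal_prod_of_nonneg (fun i _ => q_nonneg ht _)] at h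
  simp only [Pi.zero_apply, sub_zero] at h
  rw [tsum_pi_prod m (fun k => ENNReal.ofReal (q t k))] at h
  exact (ENNReal.pow_right_strictMono (NeZero.ne m)).injective (h.symm.trans (one_pow m).symm)

end

end LG
end Part4

section Part5
open MeasureTheory ProbabilityTheory Filter Set
open scoped ENNReal

namespace LG

/-- the abstract walk on `ℤ^d` -/
structure Wk (d : ℕ) {Ω : Type*} [MeasurableSpace Ω] (Q : (Fin d → ℤ) → Measure Ω)
    (Y : ℝ → Ω → (Fin d → ℤ)) : Prop where
  dpos : 1 ≤ d
  prob : ∀ x, IsProbabilityMeasure (Q x)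
  meas : Measurable fun p : ℝ × Ω => Y p.1 p.2
  start : ∀ x, ∀ᵐ ω ∂ Q x, Y 0 ω = x
  rc : ∀ x, ∀ᵐ ω ∂ Q x, ∀ t : ℝ, 0 ≤ t → ∃ ε > (0 : ℝ), ∀ u, t ≤ u → u < t + ε → Y u ω = Y t ω
  list : ∀ x (l : List (ℝ × ((Fin d → ℤ) → ℝ≥0∞))), (∀ a ∈ l, 0 ≤ a.1) →
    ∫⁻ ω, EV Y l 0 ω ∂(Q x) = RL d l x
  mass : ∀ t, 0 ≤ t → ∀ x, ∑' y, pk d t x y = 1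

lemma tsum_one {F : (Fin 1 → ℤ) → ℝ≥0∞} : ∑' y, F y = ∑' k : ℤ, F (fun _ => k) := by
  rw [tsum_cons]
  congr 1; funext k
  rw [tsum_eq_single default (fun b hb => absurd (Subsingleton.elim _ _) hb)]
  congr 1; funext i; refine Fin.cases rfl (fun j => j.elim0) i

lemma pk_succ (d : ℕ) (hd : 1 ≤ d) {t : ℝ} (ht : 0 ≤ t) (x : Fin (d + 1) → ℤ) (k : ℤ) (y : Fin d → ℤ) :
    pk (d + 1) t x (Fin.cons k y) = pk 1 t (fun _ => x 0) (fun _ => k) * pk d t (Fin.tail x) y := by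
  unfold pk
  rw [← ENNReal.ofReal_mul (heat_nonneg _ _ ht _ _), heat_prod (d + 1) (by omega), heat_prod 1 le_rfl,
    heat_prod d hd, Fin.prod_univ_succ]
  simp [Fin.tail]

lemma RL_tensor (d : ℕ) (hd : 1 ≤ d) (L : List (ℝ × ((Fin 1 → ℤ) → ℝ≥0∞) × ((Fin d → ℤ) → ℝ≥0∞)))
    (hL : ∀ a ∈ L, 0 ≤ a.1) (x : Fin (d + 1) → ℤ) :
    RL (d + 1) (L.map fun a => (a.1, fun z => a.2.1 (fun _ => z 0) * a.2.2 (Fin.tail z))) x =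
      RL 1 (L.map fun a => (a.1, a.2.1)) (fun _ => x 0) * RL d (L.map fun a => (a.1, a.2.2)) (Fin.tail x) := by
  induction L generalizing x with
  | nil => simp [RL]
  | cons a L ih =>
    have h0 := hL a List.mem_cons_self
    have ih' := ih fun b hb => hL b (List.mem_cons_of_mem _ hb)
    simp only [List.map_cons, RL]
    rw [tsum_cons, tsum_one, ← ENNReal.tsum_mul_right]
    congr 1; funext k
    rw [← ENNReal.tsum_mul_left]
    congr 1; funext y
    rw [ih', pk_succ d hd h0]
    simp only [Fin.cons_zero, Fin.tail_cons]
    ring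

lemma mass_of {m : ℕ} {d : ℕ} (hd : 1 ≤ d) [NeZero m] {Ω : Type*} [MeasurableSpace Ω]
    {P : (Fin m → ℤ) → Measure Ω} {S : ℝ → Ω → (Fin m → ℤ)} (hS : IsCTSRW m P S) {t : ℝ} (ht : 0 ≤ t)
    (x : Fin d → ℤ) : ∑' y, pk d t x y = 1 := by
  have h1 : ∀ y, pk d t x y = pk d t 0 (Equiv.subRight x y) := by
    intro y; unfold pk; rw [heat_trans d hd]; rfl
  simp_rw [h1]
  rw [(Equiv.subRight x).tsum_eq (fun y => pk d t 0 y)]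
  simp only [pk, heat_prod d hd]
  simp_rw [ENNReal.ofReal_prod_of_nonneg (fun i _ => q_nonneg ht _)]
  simp only [Pi.zero_apply, sub_zero]
  rw [tsum_pi_prod d (fun k => ENNReal.ofReal (q t k)), q_tsum hS ht, one_pow]

lemma RL_one {d : ℕ} (hmass : ∀ t, 0 ≤ t → ∀ x : Fin d → ℤ, ∑' y, pk d t x y = 1)
    (l : List ℝ) (hl : ∀ a ∈ l, 0 ≤ a) (x : Fin d → ℤ) :
    RL d (l.map fun a => (a, fun _ => 1)) x = 1 := by
  induction l generalizing x with
  | nil => rfl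
  | cons a l ih =>
    simp only [List.map_cons, RL]
    simp_rw [ih fun b hb => hl b (List.mem_cons_of_mem _ hb)]
    simp [hmass a (hl a List.mem_cons_self)]

lemma EV_comp {Ω E E' : Type*} (X : ℝ → Ω → E) (φ : E → E') (l : List (ℝ × (E' → ℝ≥0∞))) (s : ℝ) (ω : Ω) :
    EV (fun u ω => φ (X u ω)) l s ω = EV X (l.map fun a => (a.1, fun z => a.2 (φ z))) s ω := by
  induction l generalizing s with
  | nil => rfl
  | cons a l ih => simp only [List.map_cons, EV, ih]

section
variable {d : ℕ} {Ω : Type*} [MeasurableSpace Ω] {P : (Fin (d + 1) → ℤ) → Measure Ω}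
  {S : ℝ → Ω → (Fin (d + 1) → ℤ)}

lemma tail_Wk (hd : 1 ≤ d) (hS : IsCTSRW (d + 1) P S) :
    Wk d (fun x => P (Fin.cons 0 x)) (fun u ω i => S u ω i.succ) where
  dpos := hd
  prob x := hS.prob _
  meas := by
    apply measurable_pi_lambda
    intro i
    exact (measurable_pi_apply i.succ).comp hS.meas
  start x := by
    filter_upwards [hS.start (Fin.cons 0 x)] with ω hω
    funext i; rw [hω]; simp
  rc x := by
    filter_upwards [hS.rightCont (Fin.cons 0 x)] with ω hω t ht
    obtain ⟨ε, he, h⟩ := hω t ht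
    exact ⟨ε, he, fun u h1 h2 => by rw [h u h1 h2]⟩
  list x l hl := by
    have e1 : ∀ ω, EV (fun u ω (i : Fin d) => S u ω i.succ) l 0 ω = EV S
        ((l.map fun a => (a.1, (fun _ => (1 : ℝ≥0∞)), a.2)).map fun a => (a.1, fun z => a.2.1 (fun _ : Fin 1 => z 0) * a.2.2 (Fin.tail z))) 0 ω := by
      intro ω
      refine (EV_comp S (fun z (i : Fin d) => z i.succ) l 0 ω).trans ?_
      rw [List.map_map]
      simp only [Function.comp_def, one_mul]
      rfl
    simp_rw [e1]
    rw [list_S hS _ _ (by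
      intro a ha
      simp only [List.mem_map, exists_exists_and_eq_and] at ha
      obtain ⟨b, hb, rfl⟩ := ha
      exact hl b hb), RL_tensor d hd _ (by
      intro a ha
      simp only [List.mem_map] at ha
      obtain ⟨b, hb, rfl⟩ := ha
      exact hl b hb)]
    have e2 : ((l.map fun a => (a.1, (fun _ : Fin 1 → ℤ => (1 : ℝ≥0∞)), a.2)).map fun a => (a.1, a.2.1))
        = (l.map fun a => a.1).map fun a => (a, fun _ => 1) := by simp
    rw [e2, RL_one (fun t ht x => mass_of le_rfl hS ht x) _ (by simpa using hl), one_mul]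
    simp [Function.comp_def]
  mass t ht x := mass_of hd hS ht x

/-- law of the first coordinate -/
lemma head_list (hd : 1 ≤ d) (hS : IsCTSRW (d + 1) P S) (l : List (ℝ × ((Fin 1 → ℤ) → ℝ≥0∞))) (hl : ∀ a ∈ l, 0 ≤ a.1) :
    ∫⁻ ω, EV (fun u ω (_ : Fin 1) => S u ω 0) l 0 ω ∂(P 0) = RL 1 l 0 := by
  have e1 : ∀ ω, EV (fun u ω (_ : Fin 1) => S u ω 0) l 0 ω = EV S
      ((l.map fun a => (a.1, a.2, (fun _ => (1 : ℝ≥0∞)))).map fun a => (a.1, fun z => a.2.1 (fun _ : Fin 1 => z 0) * a.2.2 (Fin.tail (α := fun _ : Fin (d + 1) => ℤ) z))) 0 ω := by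
    intro ω
    rw [EV_comp S (fun z (_ : Fin 1) => z 0) l 0 ω, List.map_map]
    simp [Function.comp_def]
  simp_rw [e1]
  rw [list_S hS _ _ (by
      intro a ha
      simp only [List.mem_map, exists_exists_and_eq_and] at ha
      obtain ⟨b, hb, rfl⟩ := ha
      exact hl b hb), RL_tensor d hd _ (by
      intro a ha
      simp only [List.mem_map] at ha
      obtain ⟨b, hb, rfl⟩ := ha
      exact hl b hb)]
  have e2 : ((l.map fun a => (a.1, a.2, (fun _ : Fin d → ℤ => (1 : ℝ≥0∞)))).map fun a => (a.1, a.2.2))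
      = (l.map fun a => a.1).map fun a => (a, fun _ => 1) := by simp
  rw [e2, RL_one (fun t ht x => mass_of hd hS ht x) _ (by simpa using hl), mul_one]
  simp only [List.map_map, Function.comp_def, Prod.mk.eta, List.map_id', Pi.zero_apply]
  rfl

end
end LG
end Part5

section Part6
open MeasureTheory ProbabilityTheory Filter Set Topology
open scoped ENNReal

namespace LG

/-- right continuity (piecewise constancy) of a path -/
def RC {E : Type*} (y : ℝ → E) : Prop :=
  ∀ t : ℝ, 0 ≤ t → ∃ ε > (0 : ℝ), ∀ u, t ≤ u → u < t + ε → y u = y t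

lemma riemann {E : Type*} {y : ℝ → E} (hy : RC y) {V : E → ℝ} {B : ℝ} (hV : ∀ x, |V x| ≤ B)
    {s t : ℝ} (hs : 0 ≤ s) (ht : 0 ≤ t) :
    Tendsto (fun n : ℕ => ∑ j ∈ Finset.range (n + 1), (t / (n + 1)) * V (y (s + (j + 1) * (t / (n + 1)))))
      atTop (𝓝 (∫ u in s..(s + t), V (y u))) := by
  rcases ht.eq_or_lt with rfl | ht
  · simp
  set g : ℕ → ℝ → ℝ := fun n u => s + ⌈(u - s) / (t / (n + 1))⌉ * (t / (n + 1)) with hg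
  have hδ : ∀ n : ℕ, 0 < t / (n + 1) := fun n => by positivity
  have hgeq : ∀ n : ℕ, ∑ j ∈ Finset.range (n + 1), (t / (n + 1)) * V (y (s + (j + 1) * (t / (n + 1))))
      = ∫ u in s..(s + t), V (y (g n u)) := by
    intro n
    have hm : Measurable fun u => V (y (g n u)) := by
      have h1 : Measurable fun u : ℝ => ⌈(u - s) / (t / (n + 1))⌉ := by fun_prop
      exact (Measurable.of_discrete (f := fun k : ℤ => V (y (s + k * (t / (n + 1)))))).comp h1
    have hInt : ∀ a b : ℝ, IntervalIntegrable (fun u => V (y (g n u))) volume a b := by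
      intro a b
      rw [intervalIntegrable_iff]
      exact Measure.integrableOn_of_bounded (M := B) (by simp)
        hm.aestronglyMeasurable (Eventually.of_forall fun u => hV _)
    have := intervalIntegral.sum_integral_adjacent_intervals (μ := volume)
      (f := fun u => V (y (g n u))) (a := fun k : ℕ => s + k * (t / (n + 1))) (n := n + 1) (fun k _ => hInt _ _)
    have e : s + ((n + 1 : ℕ) : ℝ) * (t / (n + 1)) = s + t := by push_cast; field_simp
    rw [e] at this
    simp only [Nat.cast_zero, zero_mul, add_zero] at this
    rw [← this]
    apply Finset.sum_congr rfl
    intro j _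
    have : ∫ u in (s + j * (t / (n + 1)))..(s + (j + 1 : ℕ) * (t / (n + 1))), V (y (g n u)) =
        ∫ u in (s + j * (t / (n + 1)))..(s + (j + 1 : ℕ) * (t / (n + 1))), V (y (s + (j + 1) * (t / (n + 1)))) := by
      apply intervalIntegral.integral_congr_ae
      filter_upwards with u hu
      rw [uIoc_of_le (by push_cast; nlinarith [hδ n])] at hu
      have : ⌈(u - s) / (t / (n + 1))⌉ = (j : ℤ) + 1 := by
        rw [Int.ceil_eq_iff]
        push_cast
        constructor
        · rw [lt_div_iff₀ (hδ n)]; linarith [hu.1]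
        · rw [div_le_iff₀ (hδ n)]; have := hu.2; push_cast at this; linarith
      simp only [hg, this]
      push_cast
      rfl
    rw [this, intervalIntegral.integral_const]
    push_cast
    rw [smul_eq_mul]
    ring
  simp_rw [hgeq]
  apply intervalIntegral.tendsto_integral_filter_of_dominated_convergence (fun _ => B)
  · filter_upwards with n
    have h1 : Measurable fun u : ℝ => ⌈(u - s) / (t / (n + 1))⌉ := by fun_prop
    exact ((Measurable.of_discrete (f := fun k : ℤ => V (y (s + k * (t / (n + 1)))))).comp h1).aestronglyMeasurable
  · filter_upwards with n
    filter_upwards with u _ using hV _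
  · exact intervalIntegrable_const
  · filter_upwards with u hu
    rw [uIoc_of_le (by linarith)] at hu
    obtain ⟨ε, he, h⟩ := hy u (by linarith [hu.1])
    apply tendsto_const_nhds.congr'
    have h1 : Tendsto (fun n : ℕ => t / ((n : ℝ) + 1)) atTop (𝓝 0) :=
      tendsto_const_nhds.div_atTop (tendsto_natCast_atTop_atTop.atTop_add tendsto_const_nhds)
    filter_upwards [h1.eventually (gt_mem_nhds he)] with n hn
    have h2 := Int.le_ceil ((u - s) / (t / (n + 1)))
    have h3 := Int.ceil_lt_add_one ((u - s) / (t / (n + 1)))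
    rw [div_le_iff₀ (hδ n)] at h2
    have h4 : (⌈(u - s) / (t / (n + 1))⌉ - 1 : ℝ) * (t / (n + 1)) < u - s := by
      rw [← lt_div_iff₀ (hδ n)]; linarith
    rw [h (g n u) (by simp only [hg]; linarith) (by simp only [hg]; linarith)]

lemma EV_append {Ω E : Type*} (X : ℝ → Ω → E) (l1 l2 : List (ℝ × (E → ℝ≥0∞))) (s : ℝ) (ω : Ω) :
    EV X (l1 ++ l2) s ω = EV X l1 s ω * EV X l2 (s + (l1.map Prod.fst).sum) ω := by
  induction l1 generalizing s with
  | nil => simp [EV]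
  | cons a l ih => simp only [List.cons_append, EV, ih, List.map_cons, List.sum_cons, mul_assoc, add_assoc]

lemma EV_replicate {Ω E : Type*} (X : ℝ → Ω → E) (n : ℕ) (δ : ℝ) (f : E → ℝ≥0∞) (s : ℝ) (ω : Ω) :
    EV X (List.replicate n (δ, f)) s ω = ∏ j ∈ Finset.range n, f (X (s + (j + 1) * δ) ω) := by
  induction n generalizing s with
  | zero => simp [EV]
  | succ n ih =>
    rw [List.replicate_succ, EV, ih, Finset.prod_range_succ']
    rw [mul_comm]
    congr 1
    · apply Finset.prod_congr rfl
      intro j _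
      push_cast
      congr 2; ring
    · congr 2; push_cast; ring

/-- multiplicative block -/
noncomputable def blk {E : Type*} (V : E → ℝ) (t : ℝ) (n : ℕ) : List (ℝ × (E → ℝ≥0∞)) :=
  List.replicate (n + 1) (t / (n + 1), fun y => ENNReal.ofReal (Real.exp (t / (n + 1) * V y)))

lemma blk_nonneg {E : Type*} (V : E → ℝ) {t : ℝ} (ht : 0 ≤ t) (n : ℕ) : ∀ a ∈ blk V t n, 0 ≤ a.1 := by
  intro a ha
  rw [List.eq_of_mem_replicate ha]
  positivity

lemma blk_sum {E : Type*} (V : E → ℝ) (t : ℝ) (n : ℕ) : ((blk V t n).map Prod.fst).sum = t := by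
  unfold blk
  rw [List.map_replicate, List.sum_replicate, nsmul_eq_mul]
  push_cast
  field_simp

lemma EV_blk {Ω E : Type*} (X : ℝ → Ω → E) (V : E → ℝ) (t : ℝ) (n : ℕ) (s : ℝ) (ω : Ω) :
    EV X (blk V t n) s ω = ENNReal.ofReal (Real.exp (∑ j ∈ Finset.range (n + 1),
      (t / (n + 1)) * V (X (s + (j + 1) * (t / (n + 1))) ω))) := by
  unfold blk
  rw [EV_replicate, Real.exp_sum, ENNReal.ofReal_prod_of_nonneg (fun _ _ => (Real.exp_pos _).le)]

lemma EV_blk_le {Ω E : Type*} (X : ℝ → Ω → E) {V : E → ℝ} {B : ℝ} (hV : ∀ x, |V x| ≤ B) {t : ℝ} (ht : 0 ≤ t)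
    (n : ℕ) (s : ℝ) (ω : Ω) :
    EV X (blk V t n) s ω ≤ ENNReal.ofReal (Real.exp (t * B)) := by
  rw [EV_blk]
  apply ENNReal.ofReal_le_ofReal
  apply Real.exp_le_exp.mpr
  calc _ ≤ ∑ j ∈ Finset.range (n + 1), (t / (n + 1)) * B :=
        Finset.sum_le_sum fun j _ => mul_le_mul_of_nonneg_left ((le_abs_self _).trans (hV _)) (by positivity)
    _ = _ := by rw [Finset.sum_const, Finset.card_range, nsmul_eq_mul]; push_cast; field_simp

/-- exponential functional -/
noncomputable def FK {Ω E : Type*} (X : ℝ → Ω → E) (V : E → ℝ) (a b : ℝ) (ω : Ω) : ℝ≥0∞ :=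
  ENNReal.ofReal (Real.exp (∫ u in a..b, V (X u ω)))

lemma EV_blk_tendsto {Ω E : Type*} {X : ℝ → Ω → E} {ω : Ω} (hy : RC fun u => X u ω) {V : E → ℝ} {B : ℝ}
    (hV : ∀ x, |V x| ≤ B) {s t : ℝ} (hs : 0 ≤ s) (ht : 0 ≤ t) :
    Tendsto (fun n => EV X (blk V t n) s ω) atTop (𝓝 (FK X V s (s + t) ω)) := by
  simp_rw [EV_blk]
  exact ENNReal.tendsto_ofReal ((Real.continuous_exp.tendsto _).comp (riemann hy hV hs ht))

lemma RL_append_single {m : ℕ} (l1 l2 : List (ℝ × ((Fin m → ℤ) → ℝ≥0∞))) (δ : ℝ) (w x : Fin m → ℤ) :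
    RL m (l1 ++ (δ, ({w} : Set (Fin m → ℤ)).indicator 1) :: l2) x =
      RL m (l1 ++ [(δ, ({w} : Set (Fin m → ℤ)).indicator 1)]) x * RL m l2 w := by
  induction l1 generalizing x with
  | nil =>
    simp only [List.nil_append, RL, mul_one]
    rw [← ENNReal.tsum_mul_right]
    congr 1; funext y
    by_cases h : y = w
    · subst h; simp
    · simp [h]
  | cons a l ih =>
    simp only [List.cons_append, RL]
    rw [← ENNReal.tsum_mul_right]
    congr 1; funext y
    rw [ih]; ring

section
variable {d : ℕ} {Ω : Type*} [MeasurableSpace Ω] {Q : (Fin d → ℤ) → Measure Ω}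
  {Y : ℝ → Ω → (Fin d → ℤ)}

lemma Wk.Ymeas (h : Wk d Q Y) (t : ℝ) : Measurable (Y t) :=
  h.meas.comp (measurable_const.prodMk measurable_id)

lemma Wk.ae_rc (h : Wk d Q Y) (x : Fin d → ℤ) : ∀ᵐ ω ∂(Q x), RC fun u => Y u ω := h.rc x

lemma Wk.int_meas (h : Wk d Q Y) (V : (Fin d → ℤ) → ℝ) (a b : ℝ) :
    Measurable fun ω => ∫ u in a..b, V (Y u ω) := by
  have hm : Measurable fun p : ℝ × Ω => V (Y p.1 p.2) := (Measurable.of_discrete (f := V)).comp h.meas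
  unfold intervalIntegral
  have h1 : ∀ c e : ℝ, Measurable fun ω => ∫ u in Ioc c e, V (Y u ω) := fun c e =>
    (hm.stronglyMeasurable.integral_prod_left' (μ := volume.restrict (Ioc c e))).measurable
  exact (h1 _ _).sub (h1 _ _)

lemma Wk.FK_meas (h : Wk d Q Y) (V : (Fin d → ℤ) → ℝ) (a b : ℝ) : Measurable (FK Y V a b) :=
  (Real.measurable_exp.comp (h.int_meas V a b)).ennreal_ofReal

lemma Wk.path_int (h : Wk d Q Y) {V : (Fin d → ℤ) → ℝ} {B : ℝ} (hV : ∀ x, |V x| ≤ B) (ω : Ω) (a b : ℝ) :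
    IntervalIntegrable (fun u => V (Y u ω)) volume a b := by
  have hm : Measurable fun u : ℝ => V (Y u ω) :=
    ((Measurable.of_discrete (f := V)).comp h.meas).comp (measurable_id.prodMk measurable_const)
  rw [intervalIntegrable_iff]
  exact Measure.integrableOn_of_bounded (M := B) (by simp)
    hm.aestronglyMeasurable (Eventually.of_forall fun u => hV _)

/-- expectation limit: one block followed by a function -/
lemma Wk.lim_one (h : Wk d Q Y) {V : (Fin d → ℤ) → ℝ} {B : ℝ} (hV : ∀ x, |V x| ≤ B)
    {f : (Fin d → ℤ) → ℝ≥0∞} (hf : ∀ y, f y ≤ 1) {t : ℝ} (ht : 0 ≤ t) (x : Fin d → ℤ) :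
    Tendsto (fun n => RL d (blk V t n ++ [(0, f)]) x) atTop (𝓝 (∫⁻ ω, FK Y V 0 t ω * f (Y t ω) ∂(Q x))) := by
  have := h.prob x
  have e : ∀ n, RL d (blk V t n ++ [(0, f)]) x = ∫⁻ ω, EV Y (blk V t n) 0 ω * f (Y t ω) ∂(Q x) := by
    intro n
    rw [← h.list]
    · congr 1; funext ω
      rw [EV_append, blk_sum]
      simp [EV]
    · intro a ha
      rcases List.mem_append.mp ha with h1 | h1
      · exact blk_nonneg V ht n a h1
      · simp at h1; simp [h1]
  simp_rw [e]
  apply tendsto_lintegral_of_dominated_convergence (fun _ => ENNReal.ofReal (Real.exp (t * B)))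
  · intro n
    exact (EV_meas h.Ymeas _ _).mul ((Measurable.of_discrete (f := f)).comp (h.Ymeas t))
  · intro n
    filter_upwards with ω
    calc _ ≤ ENNReal.ofReal (Real.exp (t * B)) * 1 := mul_le_mul' (EV_blk_le Y hV ht n 0 ω) (hf _)
      _ = _ := mul_one _
  · simp
  · filter_upwards [h.ae_rc x] with ω hω
    have := EV_blk_tendsto (X := Y) hω hV le_rfl ht
    rw [zero_add] at this
    exact ENNReal.Tendsto.mul_const this (Or.inr (ne_top_of_le_ne_top ENNReal.one_ne_top (hf _)))

lemma Wk.markov (h : Wk d Q Y) {V W : (Fin d → ℤ) → ℝ} {B : ℝ} (hV : ∀ x, |V x| ≤ B) (hW : ∀ x, |W x| ≤ B)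
    {f : (Fin d → ℤ) → ℝ≥0∞} (hf : ∀ y, f y ≤ 1) {s t : ℝ} (hs : 0 ≤ s) (ht : 0 ≤ t) (x w : Fin d → ℤ) :
    ∫⁻ ω, FK Y V 0 s ω * ({w} : Set (Fin d → ℤ)).indicator 1 (Y s ω) * (FK Y W s (s + t) ω * f (Y (s + t) ω)) ∂(Q x)
      = (∫⁻ ω, FK Y V 0 s ω * ({w} : Set (Fin d → ℤ)).indicator 1 (Y s ω) ∂(Q x)) *
        ∫⁻ ω, FK Y W 0 t ω * f (Y t ω) ∂(Q w) := by
  have := h.prob x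
  have := h.prob w
  have hi : ∀ y, ({w} : Set (Fin d → ℤ)).indicator (1 : (Fin d → ℤ) → ℝ≥0∞) y ≤ 1 := by
    intro y; exact indicator_le_self' (by simp) y
  have l1 := h.lim_one hV hi hs x
  have l2 := h.lim_one hW hf ht w
  have fin : ∀ (V : (Fin d → ℤ) → ℝ) (_ : ∀ x, |V x| ≤ B) (f : (Fin d → ℤ) → ℝ≥0∞) (_ : ∀ y, f y ≤ 1) (t : ℝ) (_ : 0 ≤ t) x,
      ∫⁻ ω, FK Y V 0 t ω * f (Y t ω) ∂(Q x) ≠ ⊤ := by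
    intro V hV f hf t ht x
    have := h.prob x
    have : ∫⁻ ω, FK Y V 0 t ω * f (Y t ω) ∂(Q x) ≤ ∫⁻ ω, ENNReal.ofReal (Real.exp (t * B)) ∂(Q x) := by
      apply lintegral_mono_ae
      filter_upwards [h.ae_rc x] with ω hω
      have h1 := EV_blk_tendsto (X := Y) hω hV le_rfl ht
      rw [zero_add] at h1
      have h2 := le_of_tendsto' h1 (fun n => EV_blk_le Y hV ht n 0 ω)
      calc _ ≤ ENNReal.ofReal (Real.exp (t * B)) * 1 := mul_le_mul' h2 (hf _)
        _ = _ := mul_one _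
    refine ne_top_of_le_ne_top ?_ this
    simp
  have l3 := ENNReal.Tendsto.mul l1 (Or.inr (fin W hW f hf t ht w)) l2 (Or.inr (fin V hV _ hi s hs x))
  refine tendsto_nhds_unique ?_ l3
  have e : ∀ n, RL d (blk V s n ++ [(0, ({w} : Set (Fin d → ℤ)).indicator 1)]) x * RL d (blk W t n ++ [(0, f)]) w
      = ∫⁻ ω, EV Y (blk V s n) 0 ω * ({w} : Set (Fin d → ℤ)).indicator 1 (Y s ω) * (EV Y (blk W t n) s ω * f (Y (s + t) ω)) ∂(Q x) := by
    intro n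
    rw [← RL_append_single, ← h.list]
    · congr 1; funext ω
      rw [EV_append, EV, EV_append, blk_sum, blk_sum]
      simp only [EV, zero_add, add_zero, mul_one, mul_assoc]
    · intro a ha
      simp only [List.mem_append, List.mem_cons, List.mem_nil_iff, or_false] at ha
      rcases ha with h1 | h1 | h1 | h1
      · exact blk_nonneg V hs n a h1
      · simp [h1]
      · exact blk_nonneg W ht n a h1
      · simp [h1]
  simp_rw [e]
  apply tendsto_lintegral_of_dominated_convergence (fun _ => ENNReal.ofReal (Real.exp (s * B)) * ENNReal.ofReal (Real.exp (t * B)))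
  · intro n
    exact ((EV_meas h.Ymeas _ _).mul ((Measurable.of_discrete (f := ({w} : Set (Fin d → ℤ)).indicator (1 : (Fin d → ℤ) → ℝ≥0∞))).comp (h.Ymeas s))).mul
      ((EV_meas h.Ymeas _ _).mul ((Measurable.of_discrete (f := f)).comp (h.Ymeas _)))
  · intro n
    filter_upwards with ω
    calc _ ≤ (ENNReal.ofReal (Real.exp (s * B)) * 1) * (ENNReal.ofReal (Real.exp (t * B)) * 1) :=
          mul_le_mul' (mul_le_mul' (EV_blk_le Y hV hs n 0 ω) (hi _)) (mul_le_mul' (EV_blk_le Y hW ht n s ω) (hf _))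
      _ = _ := by rw [mul_one, mul_one]
  · simp [ENNReal.mul_eq_top]
  · filter_upwards [h.ae_rc x] with ω hω
    have t1 := EV_blk_tendsto (X := Y) hω hV le_rfl hs
    rw [zero_add] at t1
    have t2 := EV_blk_tendsto (X := Y) hω hW hs ht
    have n1 : ({w} : Set (Fin d → ℤ)).indicator (1 : (Fin d → ℤ) → ℝ≥0∞) (Y s ω) ≠ ⊤ := ne_top_of_le_ne_top ENNReal.one_ne_top (hi _)
    have n2 : f (Y (s + t) ω) ≠ ⊤ := ne_top_of_le_ne_top ENNReal.one_ne_top (hf _)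
    exact ENNReal.Tendsto.mul (ENNReal.Tendsto.mul_const t1 (Or.inr n1))
      (Or.inr (ENNReal.mul_ne_top ENNReal.ofReal_ne_top n2))
      (ENNReal.Tendsto.mul_const t2 (Or.inr n2)) (Or.inr (ENNReal.mul_ne_top ENNReal.ofReal_ne_top n1))

end
end LG
end Part6

section Part7
open MeasureTheory ProbabilityTheory Filter Set Topology
open scoped ENNReal

namespace LG

/-- truncated Green kernel -/
noncomputable def G (d : ℕ) (T : ℝ) (x y : Fin d → ℤ) : ℝ≥0∞ := ∫⁻ u in Ioc 0 T, pk d u x y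

lemma pk_meas {d : ℕ} (hd : 1 ≤ d) (x y : Fin d → ℤ) : Measurable fun u => pk d u x y :=
  (heat_cont d hd x y).measurable.ennreal_ofReal

lemma pk_ne_top {d : ℕ} (t : ℝ) (x y : Fin d → ℤ) : pk d t x y ≠ ⊤ := ENNReal.ofReal_ne_top

lemma G_mono {d : ℕ} {T T' : ℝ} (h : T ≤ T') (x y : Fin d → ℤ) : G d T x y ≤ G d T' x y :=
  lintegral_mono_set (Ioc_subset_Ioc_right h)

lemma pk_symm {d : ℕ} (hd : 1 ≤ d) (t : ℝ) (x y : Fin d → ℤ) : pk d t x y = pk d t y x := by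
  unfold pk; rw [heat_symm d hd]

lemma G_symm {d : ℕ} (hd : 1 ≤ d) (t : ℝ) (x y : Fin d → ℤ) : G d t x y = G d t y x := by
  unfold G; simp_rw [pk_symm hd _ x y]

lemma tsum_ind {E : Type*} (w : E) (F : E → ℝ≥0∞) : ∑' y, F y * ({w} : Set E).indicator 1 y = F w := by
  rw [tsum_eq_single w]
  · simp
  · intro b hb; simp [hb]

lemma RL_single {d : ℕ} (s : ℝ) (w x : Fin d → ℤ) :
    RL d [(s, ({w} : Set (Fin d → ℤ)).indicator 1)] x = pk d s x w := by
  simp only [RL, mul_one]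
  exact tsum_ind w _

section
variable {d : ℕ} {Ω : Type*} [MeasurableSpace Ω] {Q : (Fin d → ℤ) → Measure Ω}
  {Y : ℝ → Ω → (Fin d → ℤ)}

lemma Wk.CK (h : Wk d Q Y) {s t : ℝ} (hs : 0 ≤ s) (ht : 0 ≤ t) (x y : Fin d → ℤ) :
    pk d (s + t) x y = ∑' w, pk d s x w * pk d t w y := by
  have h1 := h.list x [(s, fun _ => 1), (t, ({y} : Set (Fin d → ℤ)).indicator 1)] (by simp [hs, ht])
  have h2 := h.list x [(s + t, ({y} : Set (Fin d → ℤ)).indicator 1)] (by simp; linarith)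
  rw [RL_single] at h2
  rw [← h2]
  simp only [EV, zero_add, one_mul, mul_one] at h1 ⊢
  rw [h1]
  simp only [RL, mul_one, one_mul]
  congr 1; funext w; congr 1
  exact tsum_ind y _

lemma Wk.pk_ge (h : Wk d Q Y) {s t : ℝ} (hs : 0 ≤ s) (ht : 0 ≤ t) (x w y : Fin d → ℤ) :
    pk d s x w * pk d t w y ≤ pk d (s + t) x y := by
  rw [h.CK hs ht]
  exact ENNReal.le_tsum (f := fun w => pk d s x w * pk d t w y) w

lemma pk_self {t : ℝ} (ht : 0 ≤ t) (x : Fin d → ℤ) :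
    ENNReal.ofReal (Real.exp (-(2 * d) * t)) ≤ pk d t x x := ENNReal.ofReal_le_ofReal (heat_self d ht x)

lemma Wk.ratio (h : Wk d Q Y) {s t e : ℝ} (hs : 0 ≤ s) (ht : s ≤ t) (hte : t ≤ s + e) (x y : Fin d → ℤ) :
    pk d s x y ≤ ENNReal.ofReal (Real.exp (2 * d * e)) * pk d t x y := by
  have h1 := h.pk_ge hs (sub_nonneg.mpr ht) x y y
  rw [add_sub_cancel] at h1
  have h2 := pk_self (d := d) (sub_nonneg.mpr ht) y
  calc pk d s x y = ENNReal.ofReal (Real.exp (2 * d * (t - s))) * (pk d s x y * ENNReal.ofReal (Real.exp (-(2 * d) * (t - s)))) := by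
        rw [mul_left_comm, ← ENNReal.ofReal_mul (Real.exp_pos _).le, ← Real.exp_add]
        simp
    _ ≤ ENNReal.ofReal (Real.exp (2 * d * e)) * pk d t x y := by
        apply mul_le_mul'
        · apply ENNReal.ofReal_le_ofReal
          apply Real.exp_le_exp.mpr
          have : (0 : ℝ) ≤ d := by positivity
          nlinarith
        · exact le_trans (mul_le_mul_right h2 _) h1

lemma Ioc_union_sum (f : ℝ → ℝ≥0∞) {δ : ℝ} (hδ : 0 ≤ δ) (a : ℝ) (n : ℕ) :
    ∫⁻ u in Ioc a (a + n * δ), f u = ∑ j ∈ Finset.range n, ∫⁻ u in Ioc (a + j * δ) (a + (j + 1) * δ), f u := by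
  induction n with
  | zero => simp
  | succ n ih =>
    rw [Finset.sum_range_succ, ← ih, ← lintegral_union measurableSet_Ioc]
    · rw [Ioc_union_Ioc_eq_Ioc]
      · push_cast; rfl
      · have : 0 ≤ n * δ := by positivity
        linarith
      · nlinarith
    · rw [Set.disjoint_left]
      intro u hu hu'
      exact absurd hu.2 (not_le.mpr hu'.1)

lemma Wk.sum_le_G (h : Wk d Q Y) {δ : ℝ} (hδ : 0 ≤ δ) (n : ℕ) (x y : Fin d → ℤ) :
    ∑ j ∈ Finset.range n, ENNReal.ofReal δ * pk d ((j + 1) * δ) x y ≤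
      ENNReal.ofReal (Real.exp (2 * d * δ)) * G d ((n + 1) * δ) x y := by
  have e := Ioc_union_sum (fun u => pk d u x y) hδ δ n
  have : ∫⁻ u in Ioc δ (δ + n * δ), pk d u x y ≤ G d ((n + 1) * δ) x y := by
    unfold G
    apply lintegral_mono_set
    intro u hu
    exact ⟨by linarith [hu.1], by linarith [hu.2]⟩
  refine le_trans ?_ (mul_le_mul_right this _)
  rw [e, Finset.mul_sum]
  apply Finset.sum_le_sum
  intro j _
  rw [← lintegral_const_mul _ (pk_meas h.dpos x y)]
  calc ENNReal.ofReal δ * pk d ((j + 1) * δ) x y = ∫⁻ u in Ioc (δ + j * δ) (δ + (j + 1) * δ), pk d ((j + 1) * δ) x y := by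
        rw [setLIntegral_const, Real.volume_Ioc, mul_comm]; congr 2; ring
    _ ≤ _ := by
        apply setLIntegral_mono' measurableSet_Ioc
        intro u hu
        exact h.ratio (by positivity) (by linarith [hu.1]) (by linarith [hu.2]) x y

lemma Wk.G_le_sum (h : Wk d Q Y) {δ : ℝ} (hδ : 0 ≤ δ) (n : ℕ) (x y : Fin d → ℤ) :
    G d (n * δ) x y ≤ ENNReal.ofReal (Real.exp (2 * d * δ)) *
      ∑ j ∈ Finset.range n, ENNReal.ofReal δ * pk d ((j + 1) * δ) x y := by
  have e := Ioc_union_sum (fun u => pk d u x y) hδ 0 n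
  unfold G
  rw [zero_add] at e
  rw [e, Finset.mul_sum]
  apply Finset.sum_le_sum
  intro j _
  calc ∫⁻ u in Ioc (0 + j * δ) (0 + (j + 1) * δ), pk d u x y ≤ ∫⁻ u in Ioc (0 + j * δ) (0 + (j + 1) * δ), 
         ENNReal.ofReal (Real.exp (2 * d * δ)) * pk d ((j + 1) * δ) x y := by
        apply setLIntegral_mono' measurableSet_Ioc
        intro u hu
        have : 0 ≤ j * δ := by positivity
        exact h.ratio (by linarith [hu.1]) (by linarith [hu.2]) (by linarith [hu.1]) x y
    _ = _ := by
        rw [setLIntegral_const, Real.volume_Ioc]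
        have : 0 + (j + 1) * δ - (0 + j * δ) = δ := by ring
        rw [this]; ring

lemma tel_up {Ω E : Type*} (X : ℝ → Ω → E) {a ψ : E → ℝ≥0∞} (ha : ∀ y, a y = 1 + ψ y) (δ : ℝ) (n : ℕ) (s : ℝ) (ω : Ω) :
    EV X (List.replicate n (δ, a)) s ω = 1 + ∑ j ∈ Finset.range n,
      EV X (((j + 1) * δ, ψ) :: List.replicate (n - 1 - j) (δ, a)) s ω := by
  induction n generalizing s with
  | zero => simp [EV]
  | succ n ih =>
    rw [List.replicate_succ, EV]
    simp only []
    rw [ha, add_mul, one_mul, Finset.sum_range_succ']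
    rw [ih]
    rw [add_assoc]
    congr 1
    congr 1
    · apply Finset.sum_congr rfl
      intro j _
      have e1 : n + 1 - 1 - (j + 1) = n - 1 - j := by omega
      have e2 : s + δ + (j + 1) * δ = s + (((j + 1 : ℕ) : ℝ) + 1) * δ := by push_cast; ring
      simp only [EV, e1, e2]
    · simp [EV, ih]

lemma tel_dn {Ω E : Type*} (X : ℝ → Ω → E) {a ψ : E → ℝ≥0∞} (ha : ∀ y, a y + ψ y = 1) (δ : ℝ) (n : ℕ) (s : ℝ) (ω : Ω) :
    EV X (List.replicate n (δ, a)) s ω + ∑ j ∈ Finset.range n,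
      EV X (((j + 1) * δ, ψ) :: List.replicate (n - 1 - j) (δ, a)) s ω = 1 := by
  induction n generalizing s with
  | zero => simp [EV]
  | succ n ih =>
    rw [List.replicate_succ, EV, Finset.sum_range_succ']
    have e : ∑ j ∈ Finset.range n, EV X (((((j + 1 : ℕ) : ℝ) + 1) * δ, ψ) :: List.replicate (n + 1 - 1 - (j + 1)) (δ, a)) s ω
       = ∑ j ∈ Finset.range n, EV X (((j + 1) * δ, ψ) :: List.replicate (n - 1 - j) (δ, a)) (s + δ) ω := by
      apply Finset.sum_congr rfl
      intro j _
      have e1 : n + 1 - 1 - (j + 1) = n - 1 - j := by omega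
      have e2 : s + δ + (j + 1) * δ = s + (((j + 1 : ℕ) : ℝ) + 1) * δ := by push_cast; ring
      simp only [EV, e1, e2]
    rw [e]
    have := ih (s + δ)
    simp only [EV, Nat.cast_zero, zero_add, one_mul, add_tsub_cancel_right, tsub_zero]
    calc _ = (a (X (s + δ) ω) + ψ (X (s + δ) ω)) * EV X (List.replicate n (δ, a)) (s + δ) ω + 
          ∑ j ∈ Finset.range n, EV X (((j + 1) * δ, ψ) :: List.replicate (n - 1 - j) (δ, a)) (s + δ) ω := by
            simp only [EV]; ring
      _ = 1 := by rw [ha, one_mul, this]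

lemma tel_first {Ω E : Type*} (X : ℝ → Ω → E) {a ψ : E → ℝ≥0∞} (ha : ∀ y, a y + ψ y = 1) (δ : ℝ) (n : ℕ) (s : ℝ) (ω : Ω) :
    EV X (List.replicate n (δ, a)) s ω + ∑ j ∈ Finset.range n,
      EV X (List.replicate j (δ, a) ++ [(δ, ψ)]) s ω = 1 := by
  induction n with
  | zero => simp [EV]
  | succ n ih =>
    rw [Finset.sum_range_succ, List.replicate_succ', EV_append, EV_append, ← ih]
    simp only [EV, mul_one]
    have : ∀ u v w z : ℝ≥0∞, u * v + (w + u * z) = u * (v + z) + w := by intro u v w z; ring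
    rw [this, ha, mul_one]

lemma Wk.RL_up (h : Wk d Q Y) {a ψ : (Fin d → ℤ) → ℝ≥0∞} (ha : ∀ y, a y = 1 + ψ y) {δ : ℝ} (hδ : 0 ≤ δ) (n : ℕ) (x : Fin d → ℤ) :
    RL d (List.replicate n (δ, a)) x = 1 + ∑ j ∈ Finset.range n,
      ∑' y, pk d ((j + 1) * δ) x y * (ψ y * RL d (List.replicate (n - 1 - j) (δ, a)) y) := by
  have := h.prob x
  rw [← h.list _ _ (fun b hb => by rw [List.eq_of_mem_replicate hb]; exact hδ)]
  simp_rw [tel_up Y ha]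
  rw [lintegral_add_left measurable_const, lintegral_finsetSum _ (fun j _ => EV_meas h.Ymeas _ _)]
  simp only [lintegral_const, measure_univ, mul_one]
  congr 1
  apply Finset.sum_congr rfl
  intro j _
  rw [h.list]
  · rfl
  · intro b hb
    rcases List.mem_cons.mp hb with h1 | h1
    · rw [h1]; positivity
    · rw [List.eq_of_mem_replicate h1]; exact hδ

lemma Wk.RL_dn (h : Wk d Q Y) {a ψ : (Fin d → ℤ) → ℝ≥0∞} (ha : ∀ y, a y + ψ y = 1) {δ : ℝ} (hδ : 0 ≤ δ) (n : ℕ) (x : Fin d → ℤ) :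
    RL d (List.replicate n (δ, a)) x + ∑ j ∈ Finset.range n,
      ∑' y, pk d ((j + 1) * δ) x y * (ψ y * RL d (List.replicate (n - 1 - j) (δ, a)) y) = 1 := by
  have := h.prob x
  have h1 : ∫⁻ ω, (EV Y (List.replicate n (δ, a)) 0 ω + ∑ j ∈ Finset.range n,
      EV Y (((j + 1) * δ, ψ) :: List.replicate (n - 1 - j) (δ, a)) 0 ω) ∂(Q x) = 1 := by
    simp_rw [tel_dn Y ha]; simp
  rw [← h1, lintegral_add_left (EV_meas h.Ymeas _ _), lintegral_finsetSum _ (fun j _ => EV_meas h.Ymeas _ _),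
    h.list _ _ (fun b hb => by rw [List.eq_of_mem_replicate hb]; exact hδ)]
  congr 1
  apply Finset.sum_congr rfl
  intro j _
  rw [h.list]
  · rfl
  · intro b hb
    rcases List.mem_cons.mp hb with h1 | h1
    · rw [h1]; positivity
    · rw [List.eq_of_mem_replicate h1]; exact hδ

end
end LG
end Part7

section Part8
open MeasureTheory ProbabilityTheory Filter Set Topology
open scoped ENNReal

namespace LG
section
variable {d : ℕ} {Ω : Type*} [MeasurableSpace Ω] {Q : (Fin d → ℤ) → Measure Ω}
  {Y : ℝ → Ω → (Fin d → ℤ)}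

lemma Wk.RL_snoc_one (h : Wk d Q Y) (l : List (ℝ × ((Fin d → ℤ) → ℝ≥0∞))) (hl : ∀ a ∈ l, 0 ≤ a.1) (x : Fin d → ℤ) :
    RL d (l ++ [(0, fun _ => 1)]) x = RL d l x := by
  rw [← h.list x l hl, ← h.list]
  · congr 1; funext ω; rw [EV_append]; simp [EV]
  · intro a ha
    rcases List.mem_append.mp ha with h1 | h1
    · exact hl a h1
    · simp at h1; simp [h1]

lemma Wk.lim_FK (h : Wk d Q Y) {V : (Fin d → ℤ) → ℝ} {B : ℝ} (hV : ∀ x, |V x| ≤ B)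
    {t : ℝ} (ht : 0 ≤ t) (x : Fin d → ℤ) :
    Tendsto (fun n : ℕ => RL d (List.replicate (n + 1) (t / (n + 1), fun y => ENNReal.ofReal (Real.exp (t / (n + 1) * V y)))) x) atTop
      (𝓝 (∫⁻ ω, FK Y V 0 t ω ∂(Q x))) := by
  have := h.lim_one hV (f := fun _ => 1) (fun _ => le_rfl) ht x
  simp_rw [mul_one, h.RL_snoc_one _ (blk_nonneg V ht _)] at this
  exact this

lemma mesh_ev (t b : ℝ) {e : ℝ} (he : 0 < e) : ∀ᶠ n : ℕ in atTop, t / ((n : ℝ) + 1) * b < e := by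
  have h1 : Tendsto (fun n : ℕ => t / ((n : ℝ) + 1) * b) atTop (𝓝 (0 * b)) :=
    (tendsto_const_nhds.div_atTop (tendsto_natCast_atTop_atTop.atTop_add tendsto_const_nhds)).mul_const _
  rw [zero_mul] at h1
  exact h1.eventually (gt_mem_nhds he)

lemma exp_le_two {x : ℝ} (hx : x < 1 / 2) : Real.exp x ≤ 2 := by
  have := Real.exp_bound_div_one_sub_of_interval' (x := 1/2) (by norm_num) (by norm_num)
  have h2 := Real.exp_le_exp.mpr hx.le
  have h3 : (1 : ℝ) / (1 - 1 / 2) = 2 := by norm_num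
  linarith

lemma Wk.khas (h : Wk d Q Y) {V : (Fin d → ℤ) → ℝ} {B : ℝ} (hV0 : ∀ x, 0 ≤ V x) (hV : ∀ x, V x ≤ B) {T : ℝ} (hT : 0 ≤ T)
    (x0 : Fin d → ℤ)
    (hyp : ∀ x, (V x ≠ 0 ∨ x = x0) → ∑' y, ENNReal.ofReal (V y) * G d (T + 1) x y ≤ ENNReal.ofReal (1 / 8)) :
    ∫⁻ ω, FK Y V 0 T ω ∂(Q x0) ≤ 2 := by
  have hV' : ∀ x, |V x| ≤ B := fun x => by rw [abs_of_nonneg (hV0 x)]; exact hV x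
  refine le_of_tendsto (h.lim_FK hV' hT x0) ?_
  filter_upwards [mesh_ev T 1 one_pos, mesh_ev T B one_pos, mesh_ev T (2 * d) (by norm_num : (0 : ℝ) < 1 / 2)] with n h1 h2 h3
  set δ := T / ((n : ℝ) + 1) with hδ
  have hδ0 : 0 ≤ δ := by positivity
  have hn : ((n + 1 : ℕ) : ℝ) * δ = T := by rw [hδ]; push_cast; field_simp
  set ψ : (Fin d → ℤ) → ℝ≥0∞ := fun y => ENNReal.ofReal (Real.exp (δ * V y) - 1) with hψ
  have hψa : ∀ y, ENNReal.ofReal (Real.exp (δ * V y)) = 1 + ψ y := by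
    intro y
    rw [hψ]
    have : 0 ≤ Real.exp (δ * V y) - 1 := by
      have := Real.add_one_le_exp (δ * V y)
      have := mul_nonneg hδ0 (hV0 y)
      linarith
    rw [← ENNReal.ofReal_one, ← ENNReal.ofReal_add (by norm_num) this]
    congr 1; ring
  have hψle : ∀ y, ψ y ≤ 2 * ENNReal.ofReal (V y) * ENNReal.ofReal δ := by
    intro y
    have e : (2 : ℝ≥0∞) = ENNReal.ofReal 2 := by simp
    rw [hψ, e, ← ENNReal.ofReal_mul (by norm_num), ← ENNReal.ofReal_mul (by have := hV0 y; positivity)]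
    apply ENNReal.ofReal_le_ofReal
    have hx0 : 0 ≤ δ * V y := mul_nonneg hδ0 (hV0 y)
    have hx1 : δ * V y ≤ 1 := le_trans (mul_le_mul_of_nonneg_left (hV y) hδ0) h2.le
    have := Real.abs_exp_sub_one_le (x := δ * V y) (by rw [abs_of_nonneg hx0]; exact hx1)
    rw [abs_of_nonneg hx0] at this
    linarith [le_abs_self (Real.exp (δ * V y) - 1)]
  have key : ∀ k, k ≤ n + 1 → ∀ x, (V x ≠ 0 ∨ x = x0) →
      RL d (List.replicate k (δ, fun y => ENNReal.ofReal (Real.exp (δ * V y)))) x ≤ 2 := by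
    intro k
    induction k using Nat.strong_induction_on with
    | _ k ih =>
      intro hk x hx
      rw [h.RL_up hψa hδ0]
      have : ∑ j ∈ Finset.range k, ∑' y, pk d ((j + 1) * δ) x y * (ψ y * RL d (List.replicate (k - 1 - j) (δ, fun y => ENNReal.ofReal (Real.exp (δ * V y)))) y)
        ≤ 1 := by
        calc _ ≤ ∑ j ∈ Finset.range k, ∑' y, pk d ((j + 1) * δ) x y * (2 * ENNReal.ofReal (V y) * ENNReal.ofReal δ * 2) := by
              apply Finset.sum_le_sum
              intro j hj
              apply ENNReal.tsum_le_tsum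
              intro y
              apply mul_le_mul_right
              by_cases hy : V y = 0
              · simp [hψ, hy]
              · exact mul_le_mul' (hψle y) (ih _ (by have := Finset.mem_range.mp hj; omega) (by omega) y (Or.inl hy))
          _ = ∑' y, 4 * ENNReal.ofReal (V y) * ∑ j ∈ Finset.range k, ENNReal.ofReal δ * pk d ((j + 1) * δ) x y := by
              rw [← Summable.tsum_finsetSum (fun _ _ => ENNReal.summable)]
              congr 1; funext y
              rw [Finset.mul_sum]
              apply Finset.sum_congr rfl
              intro j _
              ring
          _ ≤ ∑' y, 4 * ENNReal.ofReal (V y) * (2 * G d (T + 1) x y) := by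
              apply ENNReal.tsum_le_tsum
              intro y
              apply mul_le_mul_right
              refine (h.sum_le_G hδ0 k x y).trans ?_
              apply mul_le_mul'
              · have e : (2 : ℝ≥0∞) = ENNReal.ofReal 2 := by simp
                rw [e]
                apply ENNReal.ofReal_le_ofReal
                apply exp_le_two
                linarith
              · apply G_mono
                have : ((k : ℝ)) * δ ≤ (n + 1 : ℕ) * δ := mul_le_mul_of_nonneg_right (by exact_mod_cast hk) hδ0
                linarith
          _ = 8 * ∑' y, ENNReal.ofReal (V y) * G d (T + 1) x y := by
              rw [← ENNReal.tsum_mul_left]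
              congr 1; funext y; ring
          _ ≤ 8 * ENNReal.ofReal (1 / 8) := mul_le_mul_right (hyp x hx) _
          _ = 1 := by
              have e : (8 : ℝ≥0∞) = ENNReal.ofReal 8 := by simp
              rw [e, ← ENNReal.ofReal_mul (by norm_num)]; norm_num
      calc _ ≤ (1 : ℝ≥0∞) + 1 := add_le_add_right this _
        _ = 2 := by norm_num
  exact key (n + 1) le_rfl x0 (Or.inr rfl)

lemma Wk.LT1 (h : Wk d Q Y) (B : Set (Fin d → ℤ)) {η s : ℝ} (hη : 0 < η) (hs : 0 ≤ s)
    (hyp : ∀ x ∈ B, ENNReal.ofReal η * ∑' y, B.indicator (fun y => G d (s + 1) x y) y ≤ ENNReal.ofReal (1 / 4)) (x : Fin d → ℤ) :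
    ∫⁻ ω, FK Y (B.indicator fun _ => -η) 0 s ω ∂(Q x) +
      ENNReal.ofReal (η / 8) * ∑' y, B.indicator (fun y => G d s x y) y ≤ 1 := by
  classical
  have hV' : ∀ x, |B.indicator (fun _ => -η) x| ≤ η := fun x => by
    by_cases hx : x ∈ B <;> simp [hx, abs_of_pos hη, hη.le]
  refine le_of_tendsto ((h.lim_FK hV' hs x).add_const _) ?_
  filter_upwards [mesh_ev s 1 one_pos, mesh_ev s η (by norm_num : (0 : ℝ) < 1 / 2), mesh_ev s (2 * d) (by norm_num : (0 : ℝ) < 1 / 2)] with n h1 h2 h3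
  set δ := s / ((n : ℝ) + 1) with hδ
  have hδ0 : 0 ≤ δ := by positivity
  have hn : ((n + 1 : ℕ) : ℝ) * δ = s := by rw [hδ]; push_cast; field_simp
  set ψ : (Fin d → ℤ) → ℝ≥0∞ := B.indicator fun y => ENNReal.ofReal (1 - Real.exp (-(δ * η))) with hψ
  set a : (Fin d → ℤ) → ℝ≥0∞ := fun y => ENNReal.ofReal (Real.exp (δ * B.indicator (fun _ => -η) y)) with ha
  have hδη : 0 ≤ δ * η := by positivity
  have hx0 : Real.exp (-(δ * η)) ≤ 1 := Real.exp_le_one_iff.mpr (by linarith)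
  have hψa : ∀ y, a y + ψ y = 1 := by
    intro y
    simp only [ha, hψ]
    by_cases hy : y ∈ B
    · simp only [hy, indicator_of_mem, mul_neg]
      rw [← ENNReal.ofReal_add (Real.exp_pos _).le (by linarith)]
      simp
    · simp [hy]
  have e2 : (2 : ℝ≥0∞) = ENNReal.ofReal 2 := by simp
  have hexp : ENNReal.ofReal (Real.exp (2 * d * δ)) ≤ 2 := by
    rw [e2]
    apply ENNReal.ofReal_le_ofReal
    apply exp_le_two
    linarith
  have hψle : ∀ y, ψ y ≤ B.indicator (fun _ => ENNReal.ofReal η * ENNReal.ofReal δ) y := by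
    intro y
    simp only [hψ]
    by_cases hy : y ∈ B
    · simp only [hy, indicator_of_mem]
      rw [← ENNReal.ofReal_mul hη.le]
      apply ENNReal.ofReal_le_ofReal
      have := Real.add_one_le_exp (-(δ * η))
      linarith
    · simp [hy]
  have hψge : ∀ y, B.indicator (fun _ => ENNReal.ofReal (η / 2) * ENNReal.ofReal δ) y ≤ ψ y := by
    intro y
    simp only [hψ]
    by_cases hy : y ∈ B
    · simp only [hy, indicator_of_mem]
      rw [← ENNReal.ofReal_mul (by linarith)]
      apply ENNReal.ofReal_le_ofReal
      have := Real.abs_exp_sub_one_sub_id_le (x := -(δ * η)) (by rw [abs_neg, abs_of_nonneg hδη]; linarith)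
      have h5 := le_abs_self (Real.exp (-(δ * η)) - 1 - -(δ * η))
      nlinarith
    · simp [hy]
  have sumid : ∀ (k : ℕ) (x : Fin d → ℤ) (c : ℝ≥0∞), ∑ j ∈ Finset.range k, ∑' y, pk d ((j + 1) * δ) x y * (B.indicator (fun _ => c * ENNReal.ofReal δ) y)
      = c * ∑' y, B.indicator (fun y => ∑ j ∈ Finset.range k, ENNReal.ofReal δ * pk d ((j + 1) * δ) x y) y := by
    intro k x c
    rw [← Summable.tsum_finsetSum (fun _ _ => ENNReal.summable), ← ENNReal.tsum_mul_left]
    congr 1; funext y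
    by_cases hy : y ∈ B
    · simp only [hy, indicator_of_mem]
      rw [Finset.mul_sum]
      apply Finset.sum_congr rfl
      intro j _
      ring
    · simp [hy]
  have half : ENNReal.ofReal (1 / 2) + ENNReal.ofReal (1 / 2) = 1 := by
    rw [← ENNReal.ofReal_add (by norm_num) (by norm_num)]; norm_num
  have RLle : ∀ k y, RL d (List.replicate k (δ, a)) y ≤ 1 := by
    intro k y
    rw [← h.RL_dn hψa hδ0 k y]
    exact le_self_add
  have key : ∀ k, k ≤ n + 1 → ∀ x ∈ B, ENNReal.ofReal (1 / 2) ≤ RL d (List.replicate k (δ, a)) x := by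
    intro k hk x hx
    have e := h.RL_dn hψa hδ0 k x
    have : ∑ j ∈ Finset.range k, ∑' y, pk d ((j + 1) * δ) x y * (ψ y * RL d (List.replicate (k - 1 - j) (δ, a)) y) ≤ ENNReal.ofReal (1 / 2) := by
      calc _ ≤ ∑ j ∈ Finset.range k, ∑' y, pk d ((j + 1) * δ) x y * (B.indicator (fun _ => ENNReal.ofReal η * ENNReal.ofReal δ) y) := by
            apply Finset.sum_le_sum
            intro j hj
            apply ENNReal.tsum_le_tsum
            intro y
            apply mul_le_mul_right
            calc _ ≤ ψ y * 1 := mul_le_mul_right (RLle _ _) _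
              _ ≤ _ := by rw [mul_one]; exact hψle y
        _ = _ := sumid k x _
        _ ≤ ENNReal.ofReal η * ∑' y, 2 * B.indicator (fun y => G d (s + 1) x y) y := by
            apply mul_le_mul_right
            apply ENNReal.tsum_le_tsum
            intro y
            by_cases hy : y ∈ B
            · simp only [hy, indicator_of_mem]
              refine (h.sum_le_G hδ0 k x y).trans ?_
              apply mul_le_mul' hexp
              apply G_mono
              have : ((k : ℝ)) * δ ≤ (n + 1 : ℕ) * δ := mul_le_mul_of_nonneg_right (by exact_mod_cast hk) hδ0
              linarith
            · simp [hy]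
        _ = 2 * (ENNReal.ofReal η * ∑' y, B.indicator (fun y => G d (s + 1) x y) y) := by
            rw [ENNReal.tsum_mul_left]; ring
        _ ≤ 2 * ENNReal.ofReal (1 / 4) := mul_le_mul_right (hyp x hx) _
        _ = _ := by rw [e2, ← ENNReal.ofReal_mul (by norm_num)]; norm_num
    by_contra hlt
    push Not at hlt
    have := ENNReal.add_lt_add_of_lt_of_le (ne_top_of_le_ne_top ENNReal.ofReal_ne_top this) hlt this
    rw [e, half] at this
    exact lt_irrefl _ this
  have e := h.RL_dn hψa hδ0 (n + 1) x
  calc _ ≤ _ := ?_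
    _ = _ := e
  apply add_le_add_right
  calc ENNReal.ofReal (η / 8) * ∑' y, B.indicator (fun y => G d s x y) y
      ≤ ENNReal.ofReal (η / 8) * ∑' y, 2 * B.indicator (fun y => ∑ j ∈ Finset.range (n + 1), ENNReal.ofReal δ * pk d ((j + 1) * δ) x y) y := by
        apply mul_le_mul_right
        apply ENNReal.tsum_le_tsum
        intro y
        by_cases hy : y ∈ B
        · simp only [hy, indicator_of_mem]
          have := h.G_le_sum hδ0 (n + 1) x y
          rw [hn] at this
          exact this.trans (mul_le_mul_left hexp _)
        · simp [hy]
    _ = ENNReal.ofReal (η / 4) * ∑' y, B.indicator (fun y => ∑ j ∈ Finset.range (n + 1), ENNReal.ofReal δ * pk d ((j + 1) * δ) x y) y := by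
        rw [ENNReal.tsum_mul_left, ← mul_assoc, e2, ← ENNReal.ofReal_mul (by positivity)]
        congr 2; ring
    _ = ∑ j ∈ Finset.range (n + 1), ∑' y, pk d ((j + 1) * δ) x y * (B.indicator (fun _ => ENNReal.ofReal (η / 4) * ENNReal.ofReal δ) y) := (sumid _ _ _).symm
    _ ≤ _ := by
        apply Finset.sum_le_sum
        intro j hj
        apply ENNReal.tsum_le_tsum
        intro y
        apply mul_le_mul_right
        by_cases hy : y ∈ B
        · calc _ = B.indicator (fun _ => ENNReal.ofReal (η / 2) * ENNReal.ofReal δ) y * ENNReal.ofReal (1 / 2) := by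
                simp only [hy, indicator_of_mem]
                have : ENNReal.ofReal (η / 4) = ENNReal.ofReal (η / 2) * ENNReal.ofReal (1 / 2) := by
                  rw [← ENNReal.ofReal_mul (by positivity)]; congr 1; ring
                rw [this]; ring
            _ ≤ _ := mul_le_mul' (hψge y) (key _ (by omega) y hy)
        · simp [hy]

end
end LG
end Part8

section Part9
open MeasureTheory ProbabilityTheory Filter Set Topology
open scoped ENNReal

namespace LG

/-- first hit list -/
noncomputable def fhl {d : ℕ} (w : Fin d → ℤ) (δ : ℝ) (j : ℕ) : List (ℝ × ((Fin d → ℤ) → ℝ≥0∞)) :=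
  List.replicate j (δ, ({w}ᶜ : Set (Fin d → ℤ)).indicator 1) ++ [(δ, ({w} : Set (Fin d → ℤ)).indicator 1)]

lemma fhl_nonneg {d : ℕ} (w : Fin d → ℤ) {δ : ℝ} (hδ : 0 ≤ δ) (j : ℕ) : ∀ a ∈ fhl w δ j, 0 ≤ a.1 := by
  intro a ha
  rcases List.mem_append.mp ha with h1 | h1
  · rw [List.eq_of_mem_replicate h1]; exact hδ
  · simp at h1; simp [h1, hδ]

lemma fhl_sum {d : ℕ} (w : Fin d → ℤ) (δ : ℝ) (j : ℕ) : ((fhl w δ j).map Prod.fst).sum = (j + 1) * δ := by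
  simp [fhl]; ring

lemma ind_compl {E : Type*} (w : E) (y : E) : ({w}ᶜ : Set E).indicator (1 : E → ℝ≥0∞) y + ({w} : Set E).indicator 1 y = 1 := by
  by_cases h : y = w <;> simp [h]

lemma ind_le_one {E : Type*} (s : Set E) (y : E) : s.indicator (1 : E → ℝ≥0∞) y ≤ 1 := 
  indicator_le_self' (by simp) y

lemma fhl_sum_le {d : ℕ} {Ω : Type*} (X : ℝ → Ω → (Fin d → ℤ)) (w : Fin d → ℤ) (δ : ℝ) (n : ℕ) (ω : Ω) :
    ∑ j ∈ Finset.range n, EV X (fhl w δ j) 0 ω ≤ 1 := by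
  rw [← tel_first X (ind_compl w) δ n 0 ω]
  exact le_add_self

lemma fhl_hit {d : ℕ} {Ω : Type*} (X : ℝ → Ω → (Fin d → ℤ)) (w : Fin d → ℤ) (δ : ℝ) (n k : ℕ) (hk : k < n) (ω : Ω)
    (hX : X ((k + 1) * δ) ω = w) :
    ∑ j ∈ Finset.range n, EV X (fhl w δ j) 0 ω = 1 := by
  have e := tel_first X (ind_compl w) δ n 0 ω
  rw [EV_replicate, Finset.prod_eq_zero (Finset.mem_range.mpr hk), zero_add] at e
  · exact e
  · simp [hX]

section
variable {d : ℕ} {Ω : Type*} [MeasurableSpace Ω] {Q : (Fin d → ℤ) → Measure Ω}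
  {Y : ℝ → Ω → (Fin d → ℤ)}

lemma Wk.ind_meas (h : Wk d Q Y) (s : Set (Fin d → ℤ)) (t : ℝ) :
    Measurable fun ω => s.indicator (1 : (Fin d → ℤ) → ℝ≥0∞) (Y t ω) :=
  (Measurable.of_discrete (f := s.indicator (1 : (Fin d → ℤ) → ℝ≥0∞))).comp (h.Ymeas t)

lemma Wk.law (h : Wk d Q Y) {t : ℝ} (ht : 0 ≤ t) (x y : Fin d → ℤ) :
    ∫⁻ ω, ({y} : Set (Fin d → ℤ)).indicator 1 (Y t ω) ∂(Q x) = pk d t x y := by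
  rw [← RL_single, ← h.list _ _ (by simpa using ht)]
  simp [EV]

lemma Wk.fh_term (h : Wk d Q Y) (w : Fin d → ℤ) {δ t : ℝ} (hδ : 0 ≤ δ) (j : ℕ) (hj : (j + 1) * δ ≤ t) (x y : Fin d → ℤ) :
    ∫⁻ ω, EV Y (fhl w δ j) 0 ω * ({y} : Set (Fin d → ℤ)).indicator 1 (Y t ω) ∂(Q x) =
      RL d (fhl w δ j) x * pk d (t - (j + 1) * δ) w y := by
  have e := RL_append_single (List.replicate j (δ, ({w}ᶜ : Set (Fin d → ℤ)).indicator 1))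
    [(t - (j + 1) * δ, ({y} : Set (Fin d → ℤ)).indicator 1)] δ w x
  rw [RL_single] at e
  have e' : List.replicate j (δ, ({w}ᶜ : Set (Fin d → ℤ)).indicator (1 : (Fin d → ℤ) → ℝ≥0∞)) ++ (δ, ({w} : Set (Fin d → ℤ)).indicator 1) ::
    [(t - (j + 1) * δ, ({y} : Set (Fin d → ℤ)).indicator 1)] = fhl w δ j ++ [(t - (j + 1) * δ, ({y} : Set (Fin d → ℤ)).indicator 1)] := by
    simp [fhl]
  rw [e'] at e
  refine Eq.trans ?_ e
  rw [← h.list]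
  · congr 1; funext ω
    rw [EV_append, fhl_sum]
    simp only [EV, zero_add, mul_one, add_sub_cancel]
  · intro a ha
    rcases List.mem_append.mp ha with h1 | h1
    · exact fhl_nonneg w hδ j a h1
    · simp only [List.mem_singleton] at h1; rw [h1]; simpa using hj

lemma Wk.EVind_meas (h : Wk d Q Y) (l : List (ℝ × ((Fin d → ℤ) → ℝ≥0∞))) (s : Set (Fin d → ℤ)) (t : ℝ) :
    Measurable fun ω => EV Y l 0 ω * s.indicator (1 : (Fin d → ℤ) → ℝ≥0∞) (Y t ω) :=
  (EV_meas h.Ymeas _ _).mul (h.ind_meas _ t)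

lemma pk_shift_meas (hd : 1 ≤ d) (c : ℝ) (w y : Fin d → ℤ) : Measurable fun t => pk d (t - c) w y :=
  (pk_meas hd w y).comp (measurable_id.sub_const _)

lemma Wk.fh_le (h : Wk d Q Y) (w : Fin d → ℤ) {δ t : ℝ} (hδ : 0 ≤ δ) (n : ℕ) (ht : 0 ≤ t) (x y : Fin d → ℤ) :
    ∑ j ∈ Finset.range n, (Ici ((j + 1) * δ)).indicator (fun t => RL d (fhl w δ j) x * pk d (t - (j + 1) * δ) w y) t ≤
      pk d t x y := by
  rw [← h.law ht x y]
  calc _ ≤ ∑ j ∈ Finset.range n, ∫⁻ ω, EV Y (fhl w δ j) 0 ω * ({y} : Set (Fin d → ℤ)).indicator 1 (Y t ω) ∂(Q x) := by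
        apply Finset.sum_le_sum
        intro j _
        by_cases hj : t ∈ Ici ((j + 1) * δ)
        · rw [indicator_of_mem hj, h.fh_term w hδ j hj]
        · rw [indicator_of_notMem hj]; simp
    _ = ∫⁻ ω, (∑ j ∈ Finset.range n, EV Y (fhl w δ j) 0 ω) * ({y} : Set (Fin d → ℤ)).indicator 1 (Y t ω) ∂(Q x) := by
        rw [← lintegral_finsetSum _ (fun j _ => h.EVind_meas _ _ t)]
        simp_rw [Finset.sum_mul]
    _ ≤ _ := by
        apply lintegral_mono
        intro ω
        calc _ ≤ 1 * ({y} : Set (Fin d → ℤ)).indicator (1 : (Fin d → ℤ) → ℝ≥0∞) (Y t ω) := mul_le_mul_left (fhl_sum_le Y w δ n ω) _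
          _ = _ := one_mul _

lemma shift_int (f : ℝ → ℝ≥0∞) (b c e : ℝ) : ∫⁻ t in Ioc (c + b) (c + e), f (t - c) = ∫⁻ u in Ioc b e, f u := by
  have := (measurePreserving_sub_right (volume : Measure ℝ) c).setLIntegral_comp_preimage_emb
    (MeasurableEquiv.subRight c).measurableEmbedding f (Ioc b e)
  rw [← this]
  congr 2
  ext t
  simp only [mem_Ioc, mem_preimage]
  constructor <;> intro ⟨h1, h2⟩ <;> constructor <;> linarith

lemma Wk.fh_sum (h : Wk d Q Y) (w : Fin d → ℤ) {δ T : ℝ} (hδ : 0 ≤ δ) (n : ℕ) (hT : n * δ ≤ T) (x : Fin d → ℤ) :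
    ∑ j ∈ Finset.range n, RL d (fhl w δ j) x ≤ ENNReal.ofReal (Real.exp (2 * d)) * G d (T + 1) x w := by
  have key : ∑ j ∈ Finset.range n, RL d (fhl w δ j) x * ENNReal.ofReal (Real.exp (-(2 * d))) ≤ G d (T + 1) x w := by
    calc _ ≤ ∑ j ∈ Finset.range n, ∫⁻ t in Ioc 0 (T + 1), (Ici ((j + 1) * δ)).indicator (fun t => RL d (fhl w δ j) x * pk d (t - (j + 1) * δ) w w) t := by
          apply Finset.sum_le_sum
          intro j hj
          have hjn : ((j : ℝ) + 1) * δ ≤ T := by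
            have : (j : ℝ) + 1 ≤ n := by exact_mod_cast Finset.mem_range.mp hj
            nlinarith
          have h0 : 0 ≤ ((j : ℝ) + 1) * δ := by positivity
          calc _ = ∫⁻ t in Ioc ((j + 1) * δ) ((j + 1) * δ + 1), RL d (fhl w δ j) x * ENNReal.ofReal (Real.exp (-(2 * d))) := by
                rw [setLIntegral_const, Real.volume_Ioc]; simp
            _ ≤ ∫⁻ t in Ioc ((j + 1) * δ) ((j + 1) * δ + 1), (Ici ((j + 1) * δ)).indicator (fun t => RL d (fhl w δ j) x * pk d (t - (j + 1) * δ) w w) t := by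
                apply setLIntegral_mono' measurableSet_Ioc
                intro t ht
                rw [indicator_of_mem (by exact ht.1.le)]
                apply mul_le_mul_right
                refine le_trans ?_ (pk_self (d := d) (by linarith [ht.1]) w)
                apply ENNReal.ofReal_le_ofReal
                apply Real.exp_le_exp.mpr
                have : (0 : ℝ) ≤ d := by positivity
                nlinarith [ht.2]
            _ ≤ _ := lintegral_mono_set (Ioc_subset_Ioc h0 (by linarith))
      _ = ∫⁻ t in Ioc 0 (T + 1), ∑ j ∈ Finset.range n, (Ici ((j + 1) * δ)).indicator (fun t => RL d (fhl w δ j) x * pk d (t - (j + 1) * δ) w w) t := by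
          rw [lintegral_finsetSum]
          intro j _
          exact (((pk_meas h.dpos w w).comp (measurable_id.sub_const _)).const_mul _).indicator measurableSet_Ici
      _ ≤ _ := setLIntegral_mono' measurableSet_Ioc fun t ht => h.fh_le w hδ n ht.1.le x w
  rw [← Finset.sum_mul] at key
  calc _ = ENNReal.ofReal (Real.exp (2 * d)) * ((∑ j ∈ Finset.range n, RL d (fhl w δ j) x) * ENNReal.ofReal (Real.exp (-(2 * d)))) := by
        rw [mul_left_comm, ← ENNReal.ofReal_mul (Real.exp_pos _).le, ← Real.exp_add]
        simp
    _ ≤ _ := mul_le_mul_right key _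

/-- the hitting event -/
def Hit (Y : ℝ → Ω → (Fin d → ℤ)) (W : Set (Fin d → ℤ)) (t : ℝ) : Set Ω := {ω | ∃ u ∈ Ioo 0 t, Y u ω ∈ W}

lemma Hit_iUnion (W : Set (Fin d → ℤ)) (t : ℝ) : Hit Y W t = ⋃ w : W, Hit Y {(w : Fin d → ℤ)} t := by
  ext ω
  simp only [Hit, mem_iUnion, mem_ofPred_eq, mem_singleton_iff, Subtype.exists]
  constructor
  · rintro ⟨u, hu, h⟩; exact ⟨_, h, u, hu, rfl⟩
  · rintro ⟨w, hw, u, hu, h⟩; exact ⟨u, hu, h ▸ hw⟩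

lemma hit_grid {ω : Ω} (hy : RC fun u => Y u ω) {w : Fin d → ℤ} {t : ℝ} (hω : ω ∈ Hit Y {w} t) :
    ∀ᶠ m : ℕ in atTop, ∃ k : ℕ, ((k : ℝ) + 1) * (1 / ((m : ℝ) + 1)) < t ∧ Y ((k + 1) * (1 / ((m : ℝ) + 1))) ω = w := by
  obtain ⟨u, hu, hw⟩ := hω
  obtain ⟨ε, he, hε⟩ := hy u hu.1.le
  have : 0 < min ε (t - u) := lt_min he (by linarith [hu.2])
  filter_upwards [mesh_ev 1 1 this] with m hm
  set δ := 1 / ((m : ℝ) + 1)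
  have hδ : 0 < δ := by positivity
  have hc : 0 < ⌈u / δ⌉₊ := Nat.ceil_pos.mpr (div_pos hu.1 hδ)
  obtain ⟨k, hk⟩ := Nat.exists_eq_succ_of_ne_zero hc.ne'
  have h1 := Nat.le_ceil (u / δ)
  have h2 := Nat.ceil_lt_add_one (div_pos hu.1 hδ).le
  rw [hk] at h1 h2
  push_cast at h1 h2
  rw [div_le_iff₀ hδ] at h1
  have h3 : (k : ℝ) * δ < u := by rw [← lt_div_iff₀ hδ]; linarith
  have h4 := lt_min_iff.mp hm
  refine ⟨k, by linarith, ?_⟩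
  have h5 := hε ((k + 1) * δ) h1 (by linarith)
  simp only at h5
  rw [h5]
  exact hw

lemma Wk.hit_bound (h : Wk d Q Y) (w x y : Fin d → ℤ) {T : ℝ} (hT : 0 ≤ T) : ∃ ψ : ℝ → ℝ≥0∞, Measurable ψ ∧
    (∀ t ∈ Ioc 0 T, Q x (Hit Y {w} t ∩ {ω | Y t ω = y}) ≤ ψ t) ∧
    ∫⁻ t in Ioc 0 T, ψ t ≤ ENNReal.ofReal (Real.exp (2 * d)) * (G d (T + 2) x w * G d T w y) := by
  set δ : ℕ → ℝ := fun m => 1 / ((m : ℝ) + 1) with hδd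
  have hδ : ∀ m, 0 < δ m := fun m => by positivity
  have hδ1 : ∀ m, δ m ≤ 1 := fun m => by
    rw [hδd]; simp only; rw [div_le_one (by positivity)]; linarith [(Nat.cast_nonneg m : (0 : ℝ) ≤ m)]
  set N : ℕ → ℕ := fun m => ⌈T / δ m⌉₊
  have hN1 : ∀ m, T ≤ N m * δ m := fun m => by rw [← div_le_iff₀ (hδ m)]; exact Nat.le_ceil _
  have hN2 : ∀ m, N m * δ m ≤ T + 1 := fun m => by
    have := Nat.ceil_lt_add_one (div_nonneg hT (hδ m).le)
    have h2 : (N m : ℝ) * δ m ≤ (T / δ m + 1) * δ m := mul_le_mul_of_nonneg_right this.le (hδ m).le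
    rw [add_mul, div_mul_cancel₀ _ (hδ m).ne'] at h2
    linarith [hδ1 m]
  set Φ : ℕ → ℝ → ℝ≥0∞ := fun m t => ∑ j ∈ Finset.range (N m),
    (Ici ((j + 1) * δ m)).indicator (fun t => RL d (fhl w (δ m) j) x * pk d (t - (j + 1) * δ m) w y) t with hΦ
  have hΦm : ∀ m, Measurable (Φ m) := fun m => by
    apply Finset.measurable_fun_sum
    intro j _
    exact (((pk_meas h.dpos w y).comp (measurable_id.sub_const _)).const_mul _).indicator measurableSet_Ici
  refine ⟨fun t => liminf (fun m => Φ m t) atTop, Measurable.liminf hΦm, ?_, ?_⟩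
  · intro t ht
    set g : ℕ → Ω → ℝ≥0∞ := fun m ω => ∑ j ∈ Finset.range (N m), (if (j + 1) * δ m ≤ t then 1 else 0) * 
      (EV Y (fhl w (δ m) j) 0 ω * ({y} : Set (Fin d → ℤ)).indicator 1 (Y t ω)) with hg
    have hgm : ∀ m, Measurable (g m) := fun m => by
      apply Finset.measurable_fun_sum
      intro j _
      exact ((EV_meas h.Ymeas _ _).mul (h.ind_meas _ t)).const_mul _
    have hgi : ∀ m, ∫⁻ ω, g m ω ∂(Q x) = Φ m t := by
      intro m
      rw [hg, hΦ]
      simp only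
      rw [lintegral_finsetSum _ (fun j _ => (h.EVind_meas _ _ t).const_mul _)]
      apply Finset.sum_congr rfl
      intro j _
      by_cases hj : (j + 1) * δ m ≤ t
      · rw [indicator_of_mem (by exact hj), ← h.fh_term w (hδ m).le j hj]
        simp [hj]
      · rw [indicator_of_notMem (by exact hj)]
        simp [hj]
    simp_rw [← hgi]
    refine le_trans ?_ (lintegral_liminf_le hgm)
    have hae : ∀ᵐ ω ∂(Q x), ω ∈ Hit Y {w} t ∩ {ω | Y t ω = y} → 1 ≤ liminf (fun m => g m ω) atTop := by
      filter_upwards [h.ae_rc x] with ω hω hmem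
      apply le_liminf_of_le
      · isBoundedDefault
      filter_upwards [hit_grid hω hmem.1] with m ⟨k, hk, hkw⟩
      have hYt : Y t ω = y := hmem.2
      have hkN : k + 1 ≤ N m := by
        have : ((k : ℝ) + 1) * δ m < N m * δ m := by linarith [hN1 m, ht.2]
        have := lt_of_mul_lt_mul_right this (hδ m).le
        exact_mod_cast this.le
      have e := fhl_hit Y w (δ m) (k + 1) k (Nat.lt_succ_self k) ω hkw
      rw [← e]
      simp only [hg]
      calc _ ≤ ∑ j ∈ Finset.range (k + 1), (if (j + 1) * δ m ≤ t then 1 else 0) * 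
            (EV Y (fhl w (δ m) j) 0 ω * ({y} : Set (Fin d → ℤ)).indicator 1 (Y t ω)) := by
            apply Finset.sum_le_sum
            intro j hj
            have : (j + 1) * δ m ≤ t := by
              have : (j : ℝ) ≤ k := by exact_mod_cast Nat.lt_succ_iff.mp (Finset.mem_range.mp hj)
              have := mul_le_mul_of_nonneg_right (add_le_add_left this 1) (hδ m).le
              exact this.trans hk.le
            simp [this, hYt]
        _ ≤ _ := Finset.sum_le_sum_of_subset (Finset.range_subset_range.mpr hkN)
    have hms : Measurable fun ω => liminf (fun m => g m ω) atTop := Measurable.liminf hgm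
    calc Q x (Hit Y {w} t ∩ {ω | Y t ω = y}) ≤ Q x {ω | 1 ≤ liminf (fun m => g m ω) atTop} := measure_mono_ae hae
      _ = 1 * Q x {ω | 1 ≤ liminf (fun m => g m ω) atTop} := (one_mul _).symm
      _ ≤ _ := mul_meas_ge_le_lintegral hms 1
  · refine (lintegral_liminf_le hΦm).trans ?_
    apply liminf_le_of_le
    · isBoundedDefault
    intro b hb
    obtain ⟨m, hm⟩ := hb.exists
    refine hm.trans ?_
    rw [hΦ]
    simp only
    rw [lintegral_finsetSum]
    · calc _ ≤ ∑ j ∈ Finset.range (N m), RL d (fhl w (δ m) j) x * G d T w y := by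
            apply Finset.sum_le_sum
            intro j _
            have h0 : 0 ≤ ((j : ℝ) + 1) * δ m := by have := hδ m; positivity
            rw [setLIntegral_indicator measurableSet_Ici, lintegral_const_mul _ (pk_shift_meas h.dpos _ w y)]
            apply mul_le_mul_right
            calc _ ≤ ∫⁻ t in Icc ((j + 1) * δ m + 0) ((j + 1) * δ m + (T - (j + 1) * δ m)), pk d (t - (j + 1) * δ m) w y := by
                  apply lintegral_mono_set
                  rintro t ⟨h1, h2, h3⟩
                  have h1' : (j + 1) * δ m ≤ t := h1
                  constructor <;> linarith
              _ = ∫⁻ t in Ioc ((j + 1) * δ m + 0) ((j + 1) * δ m + (T - (j + 1) * δ m)), pk d (t - (j + 1) * δ m) w y :=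
                  setLIntegral_congr Ioc_ae_eq_Icc.symm
              _ = G d (T - (j + 1) * δ m) w y := shift_int (fun t => pk d t w y) 0 _ _
              _ ≤ _ := G_mono (by linarith) _ _
        _ = (∑ j ∈ Finset.range (N m), RL d (fhl w (δ m) j) x) * G d T w y := by rw [Finset.sum_mul]
        _ ≤ (ENNReal.ofReal (Real.exp (2 * d)) * G d (T + 1 + 1) x w) * G d T w y :=
            mul_le_mul_left (h.fh_sum w (hδ m).le (N m) (hN2 m) x) _
        _ = _ := by rw [mul_assoc]; congr 3; ring_nf
    · intro j _
      exact (((pk_meas h.dpos w y).comp (measurable_id.sub_const _)).const_mul _).indicator measurableSet_Ici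

end
end LG
end Part9

section Part10
open MeasureTheory ProbabilityTheory Filter Set Topology
open scoped ENNReal

namespace LG
section
variable {d : ℕ} {Ω : Type*} [MeasurableSpace Ω] {Q : (Fin d → ℤ) → Measure Ω} {Y : ℝ → Ω → (Fin d → ℤ)}

lemma Wk.G_sum (h : Wk d Q Y) {T : ℝ} (_ : 0 ≤ T) (x : Fin d → ℤ) : ∑' y, G d T x y = ENNReal.ofReal T := by
  unfold G
  rw [← lintegral_tsum (fun y => (pk_meas h.dpos x y).aemeasurable)]
  rw [setLIntegral_congr_fun (g := fun _ => 1) measurableSet_Ioc (fun u hu => h.mass u hu.1.le x)]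
  simp

/-- Green bound for the probability to hit `W` before `t` and be at `y` at time `t` -/
lemma Wk.hit2 (h : Wk d Q Y) (W : Set (Fin d → ℤ)) (x y : Fin d → ℤ) {T : ℝ} (hT : 0 ≤ T) : ∃ ψ : ℝ → ℝ≥0∞, Measurable ψ ∧
    (∀ t ∈ Ioc 0 T, Q x (Hit Y W t ∩ {ω | Y t ω = y}) ≤ ψ t) ∧
    ∫⁻ t in Ioc 0 T, ψ t ≤ ENNReal.ofReal (Real.exp (2 * d)) * ∑' w, W.indicator (fun w => G d (T + 2) x w * G d T w y) w := by
  choose ψ h1 h2 h3 using fun w => h.hit_bound w x y hT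
  refine ⟨fun t => ∑' w : W, ψ w t, Measurable.ennreal_tsum fun w => h1 w, ?_, ?_⟩
  · intro t ht
    rw [Hit_iUnion, iUnion_inter]
    exact (measure_iUnion_le _).trans (ENNReal.tsum_le_tsum fun w => h2 w t ht)
  · rw [lintegral_tsum (fun w : W => (h1 w).aemeasurable), ← tsum_subtype W, ← ENNReal.tsum_mul_left]
    exact ENNReal.tsum_le_tsum fun w => h3 w

lemma Hit_mono {W : Set (Fin d → ℤ)} {s t : ℝ} (hst : s ≤ t) : Hit Y W s ⊆ Hit Y W t :=
  fun _ ⟨u, hu, hw⟩ => ⟨u, ⟨hu.1, hu.2.trans_le hst⟩, hw⟩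

lemma Wk.hit1 (h : Wk d Q Y) (W : Set (Fin d → ℤ)) (x : Fin d → ℤ) {T : ℝ} (hT : 0 ≤ T) :
    Q x (Hit Y W T) ≤ ENNReal.ofReal (Real.exp (2 * d) * (T + 1)) * ∑' w, W.indicator (fun w => G d (T + 3) x w) w := by
  choose ψ h1 h2 h3 using fun y => h.hit2 W x y (T := T + 1) (by linarith)
  have e1 : ∀ t ∈ Ioc T (T + 1), Q x (Hit Y W T) ≤ ∑' y, ψ y t := by
    intro t ht
    have : Hit Y W T ⊆ ⋃ y, (Hit Y W t ∩ {ω | Y t ω = y}) := by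
      intro ω hω
      exact mem_iUnion.mpr ⟨Y t ω, Hit_mono ht.1.le hω, rfl⟩
    refine (measure_mono this).trans ((measure_iUnion_le _).trans (ENNReal.tsum_le_tsum fun y => h2 y t ⟨by linarith [ht.1], ht.2⟩))
  calc Q x (Hit Y W T) = ∫⁻ t in Ioc T (T + 1), Q x (Hit Y W T) := by simp
    _ ≤ ∫⁻ t in Ioc T (T + 1), ∑' y, ψ y t := setLIntegral_mono (Measurable.ennreal_tsum fun w => h1 w) e1
    _ ≤ ∫⁻ t in Ioc 0 (T + 1), ∑' y, ψ y t := lintegral_mono_set (Ioc_subset_Ioc_left hT)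
    _ = ∑' y, ∫⁻ t in Ioc 0 (T + 1), ψ y t := lintegral_tsum fun w => (h1 w).aemeasurable
    _ ≤ ∑' y, ENNReal.ofReal (Real.exp (2 * d)) * ∑' w, W.indicator (fun w => G d (T + 1 + 2) x w * G d (T + 1) w y) w :=
      ENNReal.tsum_le_tsum fun y => h3 y
    _ = ENNReal.ofReal (Real.exp (2 * d)) * ∑' w, ∑' y, W.indicator (fun w => G d (T + 1 + 2) x w * G d (T + 1) w y) w := by
      rw [ENNReal.tsum_mul_left, ENNReal.tsum_comm]
    _ = ENNReal.ofReal (Real.exp (2 * d)) * ∑' w, ENNReal.ofReal (T + 1) * W.indicator (fun w => G d (T + 3) x w) w := by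
      congr 1; congr 1; funext w
      by_cases hw : w ∈ W
      · simp only [indicator_of_mem hw]
        rw [ENNReal.tsum_mul_left, h.G_sum (by linarith), mul_comm]
        congr 2; ring
      · simp [indicator_of_notMem hw]
    _ = _ := by
      rw [ENNReal.tsum_mul_left, ← mul_assoc, ENNReal.ofReal_mul (Real.exp_nonneg _)]

/-- bounded range on bounded time intervals -/
lemma Wk.range_one (h : Wk d Q Y) (x : Fin d → ℤ) {T : ℝ} (hT : 0 ≤ T) :
    ∀ᵐ ω ∂(Q x), ∃ s : Finset (Fin d → ℤ), ∀ u ∈ Ioo 0 T, Y u ω ∈ s := by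
  rw [ae_iff]
  have hs : ∑' w, G d (T + 3) x w ≠ ⊤ := by rw [h.G_sum (by linarith)]; exact ENNReal.ofReal_ne_top
  have ht := ENNReal.tendsto_tsum_compl_atTop_zero hs
  have ht2 := ENNReal.Tendsto.const_mul (a := ENNReal.ofReal (Real.exp (2 * d) * (T + 1))) ht (Or.inr ENNReal.ofReal_ne_top)
  rw [mul_zero] at ht2
  refine le_antisymm (ge_of_tendsto ht2 (Eventually.of_forall fun s => ?_)) zero_le
  have := h.hit1 ((s : Set (Fin d → ℤ))ᶜ) x hT
  rw [← tsum_subtype] at this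
  refine le_trans (measure_mono ?_) this
  intro ω hω
  have hω' : ¬ ∃ s : Finset (Fin d → ℤ), ∀ u ∈ Ioo 0 T, Y u ω ∈ s := hω
  push Not at hω'
  obtain ⟨u, hu, hs⟩ := hω' s
  exact ⟨u, hu, by simpa using hs⟩

lemma Wk.range (h : Wk d Q Y) (x : Fin d → ℤ) :
    ∀ᵐ ω ∂(Q x), ∀ T : ℝ, ∃ s : Finset (Fin d → ℤ), ∀ u ∈ Ioc 0 T, Y u ω ∈ s := by
  have := ae_all_iff.mpr fun n : ℕ => h.range_one x (T := n) (Nat.cast_nonneg n)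
  filter_upwards [this] with ω hω T
  obtain ⟨n, hn⟩ := exists_nat_gt T
  obtain ⟨s, hs⟩ := hω n
  exact ⟨s, fun u hu => hs u ⟨hu.1, hu.2.trans_lt hn⟩⟩

/-- the additive functional -/
noncomputable def AF (Y : ℝ → Ω → (Fin d → ℤ)) (v : (Fin d → ℤ) → ℝ) (t : ℝ) (ω : Ω) : ℝ := ∫ u in Ioc 0 t, v (Y u ω)

lemma Wk.AF_meas2 (h : Wk d Q Y) (v : (Fin d → ℤ) → ℝ) : Measurable fun p : ℝ × Ω => AF Y v p.1 p.2 := by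
  have e : (fun p : ℝ × Ω => AF Y v p.1 p.2) = fun p => ∫ u, (Ioc 0 p.1).indicator (fun u => v (Y u p.2)) u := by
    funext p
    rw [integral_indicator measurableSet_Ioc]; rfl
  rw [e]
  have hm : Measurable fun w : (ℝ × Ω) × ℝ => (Ioc 0 w.1.1).indicator (fun u => v (Y u w.1.2)) w.2 := by
    have : (fun w : (ℝ × Ω) × ℝ => (Ioc 0 w.1.1).indicator (fun u => v (Y u w.1.2)) w.2) =
      {w : (ℝ × Ω) × ℝ | 0 < w.2 ∧ w.2 ≤ w.1.1}.indicator (fun w => v (Y w.2 w.1.2)) := by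
      funext w
      simp only [indicator, mem_Ioc, mem_ofPred_eq]
    rw [this]
    apply Measurable.indicator
    · have h1 : Measurable fun w : (ℝ × Ω) × ℝ => Y w.2 w.1.2 :=
        h.meas.comp (measurable_snd.prodMk (measurable_snd.comp measurable_fst))
      exact (measurable_of_countable v).comp h1
    · exact (measurableSet_lt measurable_const measurable_snd).inter
        (measurableSet_le measurable_snd (measurable_fst.comp measurable_fst))
  exact (hm.stronglyMeasurable.integral_prod_right (ν := volume)).measurable

lemma Wk.AF_meas (h : Wk d Q Y) (v : (Fin d → ℤ) → ℝ) (t : ℝ) : Measurable (AF Y v t) :=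
  (h.AF_meas2 v).comp measurable_prodMk_left

lemma Wk.path_int2 (h : Wk d Q Y) (v : (Fin d → ℤ) → ℝ) {ω : Ω} {T : ℝ} {s : Finset (Fin d → ℤ)}
    (hs : ∀ u ∈ Ioc 0 T, Y u ω ∈ s) : IntegrableOn (fun u => v (Y u ω)) (Ioc 0 T) := by
  have hm : Measurable fun u => v (Y u ω) := (measurable_of_countable v).comp (h.meas.comp measurable_prodMk_right)
  obtain ⟨C, hC⟩ : ∃ C, ∀ y ∈ s, ‖v y‖ ≤ C := by
    obtain ⟨C, hC⟩ := (s.image fun y => ‖v y‖).bddAbove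
    exact ⟨C, fun y hy => hC (by simpa using ⟨y, hy, rfl⟩)⟩
  refine Measure.integrableOn_of_bounded (M := C) (by simp) hm.aestronglyMeasurable ?_
  filter_upwards [ae_restrict_mem measurableSet_Ioc] with u hu
  exact hC _ (hs u hu)

end
end LG
end Part10

section Part11
open MeasureTheory ProbabilityTheory Filter Set Topology
open scoped ENNReal

namespace LG
section
variable {d : ℕ} {Ω : Type*} [MeasurableSpace Ω] {Q : (Fin d → ℤ) → Measure Ω} {Y : ℝ → Ω → (Fin d → ℤ)}

lemma Wk.AF_le_of_not_hit (h : Wk d Q Y) {v : (Fin d → ℤ) → ℝ} (hv : ∀ y, 0 ≤ v y) {Bad : Set (Fin d → ℤ)} {M : ℝ} 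
    (hM : ∀ y, Badᶜ.indicator v y ≤ M) {t T : ℝ} (htT : t ≤ T) {ω : Ω} (hω : ω ∉ Hit Y Bad t) :
    AF Y v t ω ≤ AF Y (Badᶜ.indicator v) T ω := by
  have h0 : ∀ y, 0 ≤ Badᶜ.indicator v y := fun y => indicator_nonneg (fun y _ => hv y) y
  have hInt : IntegrableOn (fun u => Badᶜ.indicator v (Y u ω)) (Ioc 0 T) := by
    refine Measure.integrableOn_of_bounded (M := M) (by simp) ?_ (Eventually.of_forall fun u => ?_)
    · have hm : Measurable fun u => Badᶜ.indicator v (Y u ω) :=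
        (measurable_of_countable (Badᶜ.indicator v)).comp (h.meas.comp measurable_prodMk_right)
      exact hm.aestronglyMeasurable
    · rw [Real.norm_of_nonneg (h0 _)]; exact hM _
  have e : AF Y v t ω = ∫ u in Ioc 0 t, Badᶜ.indicator v (Y u ω) := by
    unfold AF
    rw [integral_Ioc_eq_integral_Ioo, integral_Ioc_eq_integral_Ioo]
    apply setIntegral_congr_fun measurableSet_Ioo
    intro u hu
    have : Y u ω ∈ Badᶜ := fun hb => hω ⟨u, hu, hb⟩
    simp [indicator_of_mem this]
  rw [e]
  exact setIntegral_mono_set hInt (Eventually.of_forall fun u => h0 _) (Ioc_subset_Ioc_right htT).eventuallyLE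

/-- upper bound for the time spent at the start while the clock is large -/
lemma Wk.Udet (h : Wk d Q Y) {v : (Fin d → ℤ) → ℝ} (hv : ∀ y, 0 ≤ v y) {Bad : Set (Fin d → ℤ)} {M D : ℝ} 
    (hM : ∀ y, Badᶜ.indicator v y ≤ M) (hD : 0 < D) {T : ℝ} (hT : 0 ≤ T) (a : ℝ) (x0 : Fin d → ℤ)
    (hyp : ∀ x, (x ∈ Badᶜ ∨ x = x0) → ∑' y, ENNReal.ofReal (Badᶜ.indicator v y) * G d (T + 1) x y ≤ ENNReal.ofReal D) :
    ∫⁻ t in Ioc 0 T, Q x0 ({ω | a ≤ AF Y v t ω} ∩ {ω | Y t ω = x0}) ≤ 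
      ENNReal.ofReal (2 * T * Real.exp (-(a / (8 * D)))) + 
      ENNReal.ofReal (Real.exp (2 * d)) * ∑' w, Bad.indicator (fun w => G d (T + 2) x0 w * G d T w x0) w := by
  obtain ⟨ψ, h1, h2, h3⟩ := h.hit2 Bad x0 x0 hT
  have h0 : ∀ y, 0 ≤ Badᶜ.indicator v y := fun y => indicator_nonneg (fun y _ => hv y) y
  set V : (Fin d → ℤ) → ℝ := fun y => Badᶜ.indicator v y / (8 * D) with hVd
  have hV0 : ∀ y, 0 ≤ V y := fun y => div_nonneg (h0 y) (by linarith)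
  have hVB : ∀ y, V y ≤ M / (8 * D) := fun y => by rw [hVd]; simp only; gcongr; exact hM y
  have hk := h.khas hV0 hVB hT x0 (by
    intro x hx
    have hx' : x ∈ Badᶜ ∨ x = x0 := by
      refine hx.imp_left fun hx => ?_
      by_contra hb
      exact hx (by simp [hVd, indicator_of_notMem hb])
    have := hyp x hx'
    calc _ = ENNReal.ofReal (1 / (8 * D)) * ∑' y, ENNReal.ofReal (Badᶜ.indicator v y) * G d (T + 1) x y := by
          rw [← ENNReal.tsum_mul_left]
          congr 1; funext y
          rw [← mul_assoc, ← ENNReal.ofReal_mul (by positivity), hVd]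
          congr 2; simp only; ring
      _ ≤ ENNReal.ofReal (1 / (8 * D)) * ENNReal.ofReal D := mul_le_mul_right this _
      _ = _ := by rw [← ENNReal.ofReal_mul (by positivity)]; congr 1; field_simp)
  have hA : Q x0 {ω | a ≤ AF Y (Badᶜ.indicator v) T ω} ≤ ENNReal.ofReal (2 * Real.exp (-(a / (8 * D)))) := by
    have hsub : {ω | a ≤ AF Y (Badᶜ.indicator v) T ω} ⊆ {ω | ENNReal.ofReal (Real.exp (a / (8 * D))) ≤ FK Y V 0 T ω} := by
      intro ω hω
      have hω' : a ≤ AF Y (Badᶜ.indicator v) T ω := hω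
      simp only [mem_ofPred_eq, FK]
      apply ENNReal.ofReal_le_ofReal
      rw [Real.exp_le_exp, intervalIntegral.integral_of_le hT, hVd]
      simp only
      rw [integral_div]
      gcongr
      exact hω'
    have hm := mul_meas_ge_le_lintegral (μ := Q x0) (h.FK_meas V 0 T) (ENNReal.ofReal (Real.exp (a / (8 * D))))
    calc _ ≤ _ := measure_mono hsub
      _ = ENNReal.ofReal (Real.exp (-(a / (8 * D)))) * (ENNReal.ofReal (Real.exp (a / (8 * D))) * 
          Q x0 {ω | ENNReal.ofReal (Real.exp (a / (8 * D))) ≤ FK Y V 0 T ω}) := by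
        rw [← mul_assoc, ← ENNReal.ofReal_mul (Real.exp_nonneg _), ← Real.exp_add]; simp
      _ ≤ ENNReal.ofReal (Real.exp (-(a / (8 * D)))) * 2 := mul_le_mul_right (hm.trans hk) _
      _ = _ := by
        rw [mul_comm 2 (Real.exp _), ENNReal.ofReal_mul (Real.exp_nonneg _)]; norm_num
  calc _ ≤ ∫⁻ t in Ioc 0 T, (ENNReal.ofReal (2 * Real.exp (-(a / (8 * D)))) + ψ t) := by
        apply setLIntegral_mono (h1.const_add _)
        intro t ht
        calc _ ≤ Q x0 ({ω | a ≤ AF Y (Badᶜ.indicator v) T ω} ∪ (Hit Y Bad t ∩ {ω | Y t ω = x0})) := by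
              apply measure_mono
              rintro ω ⟨hω1, hω2⟩
              by_cases hh : ω ∈ Hit Y Bad t
              · exact Or.inr ⟨hh, hω2⟩
              · left
                have hω1' : a ≤ AF Y v t ω := hω1
                exact hω1'.trans (h.AF_le_of_not_hit hv hM ht.2 hh)
          _ ≤ _ := (measure_union_le _ _).trans (add_le_add hA (h2 t ht))
    _ ≤ _ := by
      rw [lintegral_add_left measurable_const]
      apply add_le_add _ h3
      rw [lintegral_const, Measure.restrict_apply MeasurableSet.univ, univ_inter, Real.volume_Ioc, sub_zero,
        ← ENNReal.ofReal_mul (by positivity)]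
      apply le_of_eq; congr 1; ring

lemma FK_split (h : Wk d Q Y) {V : (Fin d → ℤ) → ℝ} {B : ℝ} (hV : ∀ x, |V x| ≤ B) (a b c : ℝ) (ω : Ω) :
    FK Y V a c ω = FK Y V a b ω * FK Y V b c ω := by
  unfold FK
  rw [← ENNReal.ofReal_mul (Real.exp_nonneg _), ← Real.exp_add,
    intervalIntegral.integral_add_adjacent_intervals (h.path_int hV _ _ _) (h.path_int hV _ _ _)]

lemma tsum_ind1 {E : Type*} (x : E) : ∑' w : E, ({w} : Set E).indicator (1 : E → ℝ≥0∞) x = 1 := by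
  rw [tsum_eq_single x]
  · simp
  · intro b hb
    exact indicator_of_notMem (fun h => hb (by simpa using h.symm)) _

lemma Wk.LT2 (h : Wk d Q Y) (B Box : Set (Fin d → ℤ)) {η s c : ℝ} (hη : 0 < η) (hs : 0 ≤ s) (hc : 0 ≤ c) (hc1 : c ≤ 1)
    (hyp : ∀ x ∈ B, ENNReal.ofReal η * ∑' y, B.indicator (fun y => G d (s + 1) x y) y ≤ ENNReal.ofReal (1 / 4))
    (hBox : ∀ x ∈ Box, ENNReal.ofReal c ≤ ENNReal.ofReal (η / 8) * ∑' y, B.indicator (fun y => G d s x y) y) 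
    {κ : ℝ} (hκ : 0 ≤ κ) {T : ℝ} (x : Fin d → ℤ) (hT : ∀ t ∈ Icc 0 T, ∑' w, Boxᶜ.indicator (fun w => pk d t x w) w ≤ ENNReal.ofReal κ)
    (J : ℕ) (hJ : J * s ≤ T) :
    ∫⁻ ω, FK Y (B.indicator fun _ => -η) 0 (J * s) ω ∂(Q x) ≤ ENNReal.ofReal ((1 - c) ^ J + J * κ) := by
  have := h.prob x
  set V : (Fin d → ℤ) → ℝ := B.indicator fun _ => -η with hVd
  have hV' : ∀ x, |V x| ≤ η := fun x => by
    by_cases hx : x ∈ B <;> simp [hVd, hx, abs_of_pos hη, hη.le]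
  have hle1 : ∀ {t : ℝ}, 0 ≤ t → ∀ ω, FK Y V 0 t ω ≤ 1 := by
    intro t ht ω
    unfold FK
    rw [← ENNReal.ofReal_one]
    apply ENNReal.ofReal_le_ofReal
    rw [Real.exp_le_one_iff]
    rw [intervalIntegral.integral_of_le ht]
    apply integral_nonpos
    intro u
    by_cases hx : Y u ω ∈ B <;> simp [hVd, hx, hη.le]
  induction J with
  | zero => simp [FK]
  | succ J ih =>
    push_cast at hJ
    have hJ' : J * s ≤ T := by linarith
    have hJ0 : 0 ≤ J * s := by positivity
    have hF : ∀ w, ∫⁻ ω, FK Y V 0 s ω ∂(Q w) ≤ 1 := fun w => by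
      have := h.prob w
      calc _ ≤ ∫⁻ ω, 1 ∂(Q w) := lintegral_mono fun ω => hle1 hs ω
        _ = 1 := by simp
    have hFB : ∀ w ∈ Box, ∫⁻ ω, FK Y V 0 s ω ∂(Q w) ≤ ENNReal.ofReal (1 - c) := fun w hw => by
      have h1 := h.LT1 B hη hs hyp w
      have h2 := (add_le_add_right (hBox w hw) (∫⁻ ω, FK Y V 0 s ω ∂(Q w))).trans h1
      rw [ENNReal.ofReal_sub _ hc, ENNReal.ofReal_one]
      exact ENNReal.le_sub_of_add_le_right ENNReal.ofReal_ne_top h2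
    have hmeas : ∀ w, Measurable fun ω => FK Y V 0 (J * s) ω * ({w} : Set (Fin d → ℤ)).indicator 1 (Y (J * s) ω) := 
      fun w => (h.FK_meas _ _ _).mul (h.ind_meas _ _)
    have e1 : ∫⁻ ω, FK Y V 0 ((J + 1 : ℕ) * s) ω ∂(Q x) = 
        ∑' w, (∫⁻ ω, FK Y V 0 (J * s) ω * ({w} : Set (Fin d → ℤ)).indicator 1 (Y (J * s) ω) ∂(Q x)) *
        ∫⁻ ω, FK Y V 0 s ω ∂(Q w) := by
      have e2 : ∀ w, (∫⁻ ω, FK Y V 0 (J * s) ω * ({w} : Set (Fin d → ℤ)).indicator 1 (Y (J * s) ω) ∂(Q x)) *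
        ∫⁻ ω, FK Y V 0 s ω ∂(Q w) = ∫⁻ ω, FK Y V 0 (J * s) ω * ({w} : Set (Fin d → ℤ)).indicator 1 (Y (J * s) ω) * FK Y V (J * s) (J * s + s) ω ∂(Q x) := by
        intro w
        have := h.markov hV' hV' (f := fun _ => 1) (fun _ => le_rfl) hJ0 hs x w
        simp only [mul_one] at this
        exact this.symm
      simp_rw [e2]
      have hmeas2 : ∀ w, Measurable fun ω => FK Y V 0 (J * s) ω * ({w} : Set (Fin d → ℤ)).indicator 1 (Y (J * s) ω) * FK Y V (J * s) (J * s + s) ω :=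
        fun w => (hmeas w).mul (h.FK_meas _ _ _)
      rw [← lintegral_tsum (fun w => (hmeas2 w).aemeasurable)]
      apply lintegral_congr
      intro ω
      simp_rw [mul_right_comm _ _ (FK Y V (J * s) (J * s + s) ω)]
      rw [ENNReal.tsum_mul_left, tsum_ind1, mul_one, ← FK_split h hV']
      congr 1; push_cast; ring
    have e3 : ∑' w, (∫⁻ ω, FK Y V 0 (J * s) ω * ({w} : Set (Fin d → ℤ)).indicator 1 (Y (J * s) ω) ∂(Q x)) = 
        ∫⁻ ω, FK Y V 0 (J * s) ω ∂(Q x) := by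
      rw [← lintegral_tsum (fun w => (hmeas w).aemeasurable)]
      simp_rw [ENNReal.tsum_mul_left, tsum_ind1, mul_one]
    rw [e1]
    calc _ ≤ ∑' w, ((∫⁻ ω, FK Y V 0 (J * s) ω * ({w} : Set (Fin d → ℤ)).indicator 1 (Y (J * s) ω) ∂(Q x)) * ENNReal.ofReal (1 - c)
            + Boxᶜ.indicator (fun w => pk d (J * s) x w) w) := by
          apply ENNReal.tsum_le_tsum
          intro w
          by_cases hw : w ∈ Box
          · exact le_add_right (mul_le_mul_right (hFB w hw) _)
          · rw [indicator_of_mem (show w ∈ Boxᶜ from hw)]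
            refine le_add_left ?_
            calc _ ≤ (∫⁻ ω, FK Y V 0 (J * s) ω * ({w} : Set (Fin d → ℤ)).indicator 1 (Y (J * s) ω) ∂(Q x)) * 1 := mul_le_mul_right (hF w) _
              _ ≤ ∫⁻ ω, ({w} : Set (Fin d → ℤ)).indicator 1 (Y (J * s) ω) ∂(Q x) := by
                rw [mul_one]
                apply lintegral_mono
                intro ω
                calc _ ≤ 1 * _ := mul_le_mul_left (hle1 hJ0 ω) _
                  _ = _ := one_mul _
              _ = _ := h.law hJ0 x w
      _ = (∫⁻ ω, FK Y V 0 (J * s) ω ∂(Q x)) * ENNReal.ofReal (1 - c) + ∑' w, Boxᶜ.indicator (fun w => pk d (J * s) x w) w := by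
          rw [ENNReal.tsum_add, ENNReal.tsum_mul_right, e3]
      _ ≤ ENNReal.ofReal ((1 - c) ^ J + J * κ) * ENNReal.ofReal (1 - c) + ENNReal.ofReal κ :=
          add_le_add (mul_le_mul_left (ih hJ') _) (hT _ ⟨hJ0, hJ'⟩)
      _ ≤ _ := by
          have h1c : 0 ≤ 1 - c := by linarith
          rw [← ENNReal.ofReal_mul (by positivity), ← ENNReal.ofReal_add (by positivity) hκ]
          apply ENNReal.ofReal_le_ofReal
          push_cast
          have : J * κ * (1 - c) ≤ J * κ * 1 := mul_le_mul_of_nonneg_left (by linarith) (by positivity)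
          rw [pow_succ]
          nlinarith

lemma Wk.LT3 (h : Wk d Q Y) {v : (Fin d → ℤ) → ℝ} (hv : ∀ y, 0 ≤ v y) (B Box : Set (Fin d → ℤ)) {m : ℝ} (hm : 0 < m) (hB : ∀ y ∈ B, m ≤ v y)
     {η s c : ℝ} (hη : 0 < η) (hs : 0 ≤ s) (hc : 0 ≤ c) (hc1 : c ≤ 1)
    (hyp : ∀ x ∈ B, ENNReal.ofReal η * ∑' y, B.indicator (fun y => G d (s + 1) x y) y ≤ ENNReal.ofReal (1 / 4))
    (hBox : ∀ x ∈ Box, ENNReal.ofReal c ≤ ENNReal.ofReal (η / 8) * ∑' y, B.indicator (fun y => G d s x y) y) 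
    {κ : ℝ} (hκ : 0 ≤ κ) {T : ℝ} (x : Fin d → ℤ) (hT : ∀ t ∈ Icc 0 T, ∑' w, Boxᶜ.indicator (fun w => pk d t x w) w ≤ ENNReal.ofReal κ)
    (J : ℕ) (hJ : J * s = T) (a : ℝ) :
    Q x {ω | AF Y v T ω ≤ a} ≤ ENNReal.ofReal (Real.exp (η * a / m) * ((1 - c) ^ J + J * κ)) := by
  have hT0 : 0 ≤ T := by rw [← hJ]; positivity
  have key := h.LT2 B Box hη hs hc hc1 hyp hBox hκ x hT J hJ.le
  rw [hJ] at key
  set V : (Fin d → ℤ) → ℝ := B.indicator fun _ => -η with hVd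
  have hmk := mul_meas_ge_le_lintegral (μ := Q x) (h.FK_meas V 0 T) (ENNReal.ofReal (Real.exp (-(η * a / m))))
  have hae : ∀ᵐ ω ∂(Q x), AF Y v T ω ≤ a → ENNReal.ofReal (Real.exp (-(η * a / m))) ≤ FK Y V 0 T ω := by
    filter_upwards [h.range x] with ω hω ha
    obtain ⟨s, hs⟩ := hω T
    unfold FK
    apply ENNReal.ofReal_le_ofReal
    rw [Real.exp_le_exp, intervalIntegral.integral_of_le hT0]
    have i1 := h.path_int2 (fun y => -(η / m) * v y) hs
    have i2 := h.path_int2 V hs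
    have : ∫ u in Ioc 0 T, -(η / m) * v (Y u ω) ≤ ∫ u in Ioc 0 T, V (Y u ω) := by
      apply setIntegral_mono i1 i2
      intro u
      simp only
      by_cases hb : Y u ω ∈ B
      · simp only [hVd, indicator_of_mem hb]
        have := hB _ hb
        have h2 : η / m * m ≤ η / m * v (Y u ω) := mul_le_mul_of_nonneg_left this (by positivity)
        rw [div_mul_cancel₀ _ hm.ne'] at h2
        linarith
      · simp only [hVd, indicator_of_notMem hb]
        have := mul_nonneg (div_nonneg hη.le hm.le) (hv (Y u ω))
        linarith
    refine le_trans ?_ this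
    rw [integral_const_mul]
    have h3 : η / m * AF Y v T ω ≤ η / m * a := mul_le_mul_of_nonneg_left ha (by positivity)
    have e : ∫ u in Ioc 0 T, v (Y u ω) = AF Y v T ω := rfl
    rw [e]
    have : η * a / m = η / m * a := by ring
    linarith
  have h1c : 0 ≤ 1 - c := by linarith
  calc _ ≤ Q x {ω | ENNReal.ofReal (Real.exp (-(η * a / m))) ≤ FK Y V 0 T ω} := measure_mono_ae hae
    _ = ENNReal.ofReal (Real.exp (η * a / m)) * (ENNReal.ofReal (Real.exp (-(η * a / m))) * 
          Q x {ω | ENNReal.ofReal (Real.exp (-(η * a / m))) ≤ FK Y V 0 T ω}) := by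
        rw [← mul_assoc, ← ENNReal.ofReal_mul (Real.exp_nonneg _), ← Real.exp_add]; simp
    _ ≤ _ := by
      rw [ENNReal.ofReal_mul (Real.exp_nonneg _)]
      exact mul_le_mul_right (hmk.trans key) _

end
end LG
end Part11

section Part12
open MeasureTheory ProbabilityTheory Filter Set Topology
open scoped ENNReal NNReal

namespace LG

/-- list of increments from a list of times -/
def dl {E : Type*} (g : ℝ → E → ℝ≥0∞) : ℝ → List ℝ → List (ℝ × (E → ℝ≥0∞))
  | _, [] => []
  | s, t :: ts => (t - s, g t) :: dl g t ts

lemma EV_dl {Ω E : Type*} (X : ℝ → Ω → E) (g : ℝ → E → ℝ≥0∞) (s : ℝ) (ts : List ℝ) (ω : Ω) :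
    EV X (dl g s ts) s ω = (ts.map fun t => g t (X t ω)).prod := by
  induction ts generalizing s with
  | nil => rfl
  | cons t ts ih => simp [dl, EV, ih]

lemma dl_nonneg {E : Type*} (g : ℝ → E → ℝ≥0∞) (s : ℝ) (ts : List ℝ) (h : (s :: ts).Pairwise (· ≤ ·)) :
    ∀ a ∈ dl g s ts, 0 ≤ a.1 := by
  induction ts generalizing s with
  | nil => simp [dl]
  | cons t ts ih =>
    intro a ha
    simp only [dl, List.mem_cons] at ha
    rw [List.pairwise_cons] at h
    rcases ha with rfl | ha
    · simp only [sub_nonneg]; exact h.1 t List.mem_cons_self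
    · exact ih t h.2 a ha

/-- joint version -/
def dl2 {E E' : Type*} (g : ℝ → E → ℝ≥0∞) (g' : ℝ → E' → ℝ≥0∞) : ℝ → List ℝ → List (ℝ × (E → ℝ≥0∞) × (E' → ℝ≥0∞))
  | _, [] => []
  | s, t :: ts => (t - s, g t, g' t) :: dl2 g g' t ts

lemma dl2_left {E E' : Type*} (g : ℝ → E → ℝ≥0∞) (g' : ℝ → E' → ℝ≥0∞) (s : ℝ) (ts : List ℝ) :
    ((dl2 g g' s ts).map fun a => (a.1, a.2.1)) = dl g s ts := by
  induction ts generalizing s with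
  | nil => rfl
  | cons t ts ih => simp [dl, dl2, ih]

lemma dl2_right {E E' : Type*} (g : ℝ → E → ℝ≥0∞) (g' : ℝ → E' → ℝ≥0∞) (s : ℝ) (ts : List ℝ) :
    ((dl2 g g' s ts).map fun a => (a.1, a.2.2)) = dl g' s ts := by
  induction ts generalizing s with
  | nil => rfl
  | cons t ts ih => simp [dl, dl2, ih]

lemma dl2_map {E E' F : Type*} (g : ℝ → E → ℝ≥0∞) (g' : ℝ → E' → ℝ≥0∞) (φ : (E → ℝ≥0∞) → (E' → ℝ≥0∞) → F → ℝ≥0∞) (s : ℝ) (ts : List ℝ) :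
    ((dl2 g g' s ts).map fun a => (a.1, φ a.2.1 a.2.2)) = dl (fun t => φ (g t) (g' t)) s ts := by
  induction ts generalizing s with
  | nil => rfl
  | cons t ts ih => simp [dl, dl2, ih]

section
variable {d : ℕ} {Ω : Type*} [MeasurableSpace Ω] {P : (Fin (d + 1) → ℤ) → Measure Ω}
  {S : ℝ → Ω → (Fin (d + 1) → ℤ)}

lemma fdd_fac (hd : 1 ≤ d) (hS : IsCTSRW (d + 1) P S) (g : ℝ → (Fin 1 → ℤ) → ℝ≥0∞) (g' : ℝ → (Fin d → ℤ) → ℝ≥0∞)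
    (J : Finset ℝ) (hJ : ∀ t ∈ J, 0 ≤ t) :
    ∫⁻ ω, (∏ t ∈ J, g t (fun _ => S t ω 0)) * ∏ t ∈ J, g' t (fun i => S t ω i.succ) ∂(P 0) =
     (∫⁻ ω, ∏ t ∈ J, g t (fun _ => S t ω 0) ∂(P 0)) * ∫⁻ ω, ∏ t ∈ J, g' t (fun i => S t ω i.succ) ∂(P 0) := by
  set ts := J.sort (· ≤ ·) with hts
  have hp : (0 :: ts).Pairwise (· ≤ ·) := by
    rw [List.pairwise_cons]
    exact ⟨fun t ht => hJ t ((Finset.mem_sort _).mp ht), Finset.pairwise_sort _ _⟩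
  have hprod : ∀ f : ℝ → ℝ≥0∞, ∏ t ∈ J, f t = (ts.map f).prod := by
    intro f
    rw [Finset.prod_eq_multiset_prod, ← Finset.sort_eq J (· ≤ ·), Multiset.map_coe, Multiset.prod_coe]
  have e1 : ∀ ω, (∏ t ∈ J, g t (fun _ => S t ω 0)) = EV (fun u ω (_ : Fin 1) => S u ω 0) (dl g 0 ts) 0 ω := by
    intro ω; rw [EV_dl, hprod]
  have e2 : ∀ ω, (∏ t ∈ J, g' t (fun i => S t ω i.succ)) = EV (fun u ω (i : Fin d) => S u ω i.succ) (dl g' 0 ts) 0 ω := by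
    intro ω; rw [EV_dl, hprod]
  have e3 : ∀ ω, (∏ t ∈ J, g t (fun _ => S t ω 0)) * ∏ t ∈ J, g' t (fun i => S t ω i.succ) =
     EV S (dl (fun t z => g t (fun _ => z 0) * g' t (Fin.tail z)) 0 ts) 0 ω := by
    intro ω; rw [EV_dl, ← Finset.prod_mul_distrib, hprod]; rfl
  simp_rw [e3, e1, e2]
  rw [head_list hd hS _ (dl_nonneg _ _ _ hp), list_S hS _ _ (dl_nonneg _ _ _ hp)]
  have e4 := (tail_Wk hd hS).list 0 (dl g' 0 ts) (dl_nonneg _ _ _ hp)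
  have e0 : (Fin.cons 0 0 : Fin (d + 1) → ℤ) = 0 := by
    funext i; refine Fin.cases rfl (fun _ => rfl) i
  simp only [e0] at e4
  rw [e4]
  have e5 := RL_tensor d hd (dl2 g g' 0 ts) (by
    intro a ha
    have : (a.1, a.2.1) ∈ dl g 0 ts := by rw [← dl2_left g g']; exact List.mem_map.mpr ⟨a, ha, rfl⟩
    exact dl_nonneg _ _ _ hp _ this) 0
  rw [dl2_left, dl2_right, dl2_map g g' (fun f f' (z : Fin (d + 1) → ℤ) => f (fun _ => z 0) * f' (Fin.tail z))] at e5
  exact e5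

lemma indep_proc (hd : 1 ≤ d) (hS : IsCTSRW (d + 1) P S) {a : ℝ} (ha : 0 ≤ a) :
    IndepFun (fun ω => S a ω 0) (fun ω (u : ℝ≥0) (i : Fin d) => S u ω i.succ) (P 0) := by
  classical
  have := hS.prob 0
  have mX : Measurable fun ω => S a ω 0 := (measurable_pi_apply 0).comp (S_meas hS a)
  have mY : ∀ u : ℝ, Measurable fun ω (i : Fin d) => S u ω i.succ := fun u => (tail_Wk hd hS).Ymeas u
  refine IndepFun.indepFun_process (Y := fun (u : ℝ≥0) ω (i : Fin d) => S u ω i.succ) mX (fun u => mY u) fun I => ?_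
  have mYI : Measurable fun ω (u : I) (i : Fin d) => S (u : ℝ≥0) ω i.succ := measurable_pi_lambda _ fun u => mY _
  rw [indepFun_iff_map_prod_eq_prod_map_map mX.aemeasurable mYI.aemeasurable]
  have := Measure.isProbabilityMeasure_map (μ := P 0) mX.aemeasurable
  have := Measure.isProbabilityMeasure_map (μ := P 0) mYI.aemeasurable
  refine Measure.ext_of_singleton fun p => ?_
  obtain ⟨k, y⟩ := p
  rw [← singleton_prod_singleton, Measure.prod_prod, Measure.map_apply mX (measurableSet_singleton _),
    Measure.map_apply mYI (measurableSet_singleton _), Measure.map_apply (mX.prodMk mYI) ((measurableSet_singleton _).prod (measurableSet_singleton _))]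
  set J : Finset ℝ := insert a (I.image fun u : ℝ≥0 => (u : ℝ)) with hJ
  set g : ℝ → (Fin 1 → ℤ) → ℝ≥0∞ := fun t w => if t = a then (if w 0 = k then 1 else 0) else 1 with hg
  set g' : ℝ → (Fin d → ℤ) → ℝ≥0∞ := fun t w => if ∀ u : I, (u : ℝ≥0) = t → w = y u then 1 else 0 with hg'
  have key := fdd_fac hd hS g g' J (by
    intro t ht
    rw [hJ, Finset.mem_insert, Finset.mem_image] at ht
    rcases ht with rfl | ⟨u, _, rfl⟩
    · exact ha
    · exact u.2)
  have p1 : ∀ ω, ∏ t ∈ J, g t (fun _ => S t ω 0) = ((fun ω => S a ω 0) ⁻¹' {k}).indicator 1 ω := by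
    intro ω
    rw [Finset.prod_eq_single_of_mem a (Finset.mem_insert_self _ _) (fun t _ hne => by simp [hg, hne])]
    simp [hg, indicator]
  have p2 : ∀ ω, ∏ t ∈ J, g' t (fun i => S t ω i.succ) = ((fun ω (u : I) (i : Fin d) => S (u : ℝ≥0) ω i.succ) ⁻¹' {y}).indicator 1 ω := by
    intro ω
    by_cases hω : (fun (u : I) (i : Fin d) => S (u : ℝ≥0) ω i.succ) = y
    · rw [indicator_of_mem (by exact hω)]
      apply Finset.prod_eq_one
      intro t _
      simp only [hg']
      rw [if_pos]
      intro u hu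
      rw [← hω]
      simp only [hu]
    · rw [indicator_of_notMem (by exact hω)]
      have : ∃ u : I, (fun i : Fin d => S (u : ℝ≥0) ω i.succ) ≠ y u := by
        by_contra hc
        push Not at hc
        exact hω (funext hc)
      obtain ⟨u, hu⟩ := this
      apply Finset.prod_eq_zero (i := ((u : ℝ≥0) : ℝ))
      · rw [hJ]; exact Finset.mem_insert_of_mem (Finset.mem_image.mpr ⟨u, u.2, rfl⟩)
      · simp only [hg']
        rw [if_neg]
        intro hc
        exact hu (hc u rfl)
  simp_rw [p1, p2] at key
  have m1 : MeasurableSet ((fun ω => S a ω 0) ⁻¹' {k}) := mX (measurableSet_singleton _)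
  have m2 : MeasurableSet ((fun ω (u : I) (i : Fin d) => S (u : ℝ≥0) ω i.succ) ⁻¹' {y}) := mYI (measurableSet_singleton _)
  rw [lintegral_indicator_one m1, lintegral_indicator_one m2] at key
  rw [← key, ← lintegral_indicator_one]
  · apply lintegral_congr
    intro ω
    rw [show (fun ω => (S a ω 0, fun (u : I) (i : Fin d) => S (u : ℝ≥0) ω i.succ)) ⁻¹' ({k} ×ˢ {y}) = 
      ((fun ω => S a ω 0) ⁻¹' {k}) ∩ ((fun ω (u : I) (i : Fin d) => S (u : ℝ≥0) ω i.succ) ⁻¹' {y}) from by ext; simp]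
    rw [← Set.inter_indicator_mul]
    simp
    rfl
  · exact (mX.prodMk mYI) ((measurableSet_singleton _).prod (measurableSet_singleton _))

lemma S1_law (hd : 1 ≤ d) (hS : IsCTSRW (d + 1) P S) {a : ℝ} (ha : 0 ≤ a) (k : ℤ) :
    P 0 {ω | S a ω 0 = k} = ENNReal.ofReal (q a k) := by
  have := head_list hd hS [(a, ({fun _ => k} : Set (Fin 1 → ℤ)).indicator 1)] (by simpa using ha)
  rw [RL_single] at this
  simp only [EV, zero_add, mul_one] at this
  have mX : Measurable fun ω => S a ω 0 := (measurable_pi_apply 0).comp (S_meas hS a)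
  have hms : MeasurableSet {ω | S a ω 0 = k} := mX (measurableSet_singleton k)
  rw [← lintegral_indicator_one hms]
  rw [show ENNReal.ofReal (q a k) = pk 1 a 0 (fun _ => k) from rfl, ← this]
  apply lintegral_congr
  intro ω
  have : (fun _ : Fin 1 => S a ω 0) = (fun _ => k) ↔ S a ω 0 = k := by
    constructor
    · intro h; exact congrFun h 0
    · intro h; rw [h]
  by_cases hk : S a ω 0 = k
  · rw [indicator_of_mem (by exact hk), indicator_of_mem (by exact this.mpr hk)]; rfl
  · rw [indicator_of_notMem (by exact hk), indicator_of_notMem (by exact fun hh => hk (this.mp hh))]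

/-- the clock as a functional of the path on nonnegative times -/
noncomputable def Afun (v : (Fin d → ℤ) → ℝ) (t : ℝ) (y : ℝ≥0 → (Fin d → ℤ)) : ℝ :=
  limsup (fun M : ℕ => limsup (fun n : ℕ => ∑ j ∈ Finset.range (n + 1), (t / (n + 1)) * 
    min (v (y (Real.toNNReal (0 + (j + 1) * (t / (n + 1)))))) M) atTop) atTop

lemma Afun_meas (v : (Fin d → ℤ) → ℝ) (t : ℝ) : Measurable (Afun v t) := by
  apply Measurable.limsup
  intro M
  apply Measurable.limsup
  intro n
  apply Finset.measurable_fun_sum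
  intro j _
  apply Measurable.const_mul
  apply Measurable.min _ measurable_const
  exact (measurable_of_countable v).comp (measurable_pi_apply _)

lemma Afun_eq {Q : (Fin d → ℤ) → Measure Ω} {Y : ℝ → Ω → (Fin d → ℤ)} (h : Wk d Q Y) {v : (Fin d → ℤ) → ℝ} (hv : ∀ y, 0 ≤ v y)
    {t : ℝ} (ht : 0 ≤ t) (x : Fin d → ℤ) : ∀ᵐ ω ∂(Q x), Afun v t (fun u => Y u ω) = AF Y v t ω := by
  filter_upwards [h.range x, h.ae_rc x] with ω h1 h2
  obtain ⟨s, hs⟩ := h1 t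
  obtain ⟨C, hC⟩ : ∃ C, ∀ y ∈ s, v y ≤ C := by
    obtain ⟨C, hC⟩ := (s.image fun y => v y).bddAbove
    exact ⟨C, fun y hy => hC (by simpa using ⟨y, hy, rfl⟩)⟩
  unfold Afun
  apply Tendsto.limsup_eq
  apply tendsto_const_nhds.congr'
  filter_upwards [eventually_ge_atTop ⌈C⌉₊] with M hM
  have hMC : C ≤ M := (Nat.le_ceil C).trans (by exact_mod_cast hM)
  symm
  apply Tendsto.limsup_eq
  have key := riemann h2 (V := fun y => min (v y) M) (B := M) (fun y => by
    rw [abs_of_nonneg (le_min (hv y) (Nat.cast_nonneg M))]; exact min_le_right _ _) le_rfl ht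
  have e : ∫ u in (0 : ℝ)..(0 + t), min (v (Y u ω)) M = AF Y v t ω := by
    rw [zero_add, intervalIntegral.integral_of_le ht]
    apply setIntegral_congr_fun measurableSet_Ioc
    intro u hu
    exact min_eq_left ((hC _ (hs u hu)).trans hMC)
  rw [e] at key
  refine key.congr fun n => ?_
  apply Finset.sum_congr rfl
  intro j _
  rw [Real.coe_toNNReal _ (by positivity)]

lemma AF_nonneg {Ω : Type*} {Y : ℝ → Ω → (Fin d → ℤ)} {v : (Fin d → ℤ) → ℝ} (hv : ∀ y, 0 ≤ v y) (t : ℝ) (ω : Ω) : 0 ≤ AF Y v t ω :=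
  integral_nonneg fun _ => hv _

lemma green_step (hd : 1 ≤ d) (hS : IsCTSRW (d + 1) P S) {v : (Fin d → ℤ) → ℝ} (hv : ∀ y, 0 ≤ v y) {t : ℝ} (ht : 0 ≤ t) (n : ℤ) (m : ℕ) :
    P 0 {ω | S ((⌊(m + 1) * AF (fun u ω (i : Fin d) => S u ω i.succ) v t ω⌋₊ + 1) / (m + 1)) ω 0 = n ∧ (fun i : Fin d => S t ω i.succ) = 0} =
    ∫⁻ ω, ENNReal.ofReal (q ((⌊(m + 1) * AF (fun u ω (i : Fin d) => S u ω i.succ) v t ω⌋₊ + 1) / (m + 1)) n) * 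
      ({0} : Set (Fin d → ℤ)).indicator 1 (fun i : Fin d => S t ω i.succ) ∂(P 0) := by
  have e0 : (Fin.cons 0 0 : Fin (d + 1) → ℤ) = 0 := by
    funext i; refine Fin.cases rfl (fun _ => rfl) i
  have hW := tail_Wk hd hS
  set Y : ℝ → Ω → (Fin d → ℤ) := fun u ω (i : Fin d) => S u ω i.succ with hY
  have hAm := hW.AF_meas v t
  have hEv : ∀ j : ℕ, MeasurableSet {ω | ⌊((m : ℝ) + 1) * AF Y v t ω⌋₊ = j ∧ Y t ω = 0} := fun j =>
    ((Nat.measurable_floor.comp (hAm.const_mul _)) (measurableSet_singleton j)).inter (hW.Ymeas t (measurableSet_singleton 0))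
  have mX : ∀ a : ℝ, Measurable fun ω => S a ω 0 := fun a => (measurable_pi_apply 0).comp (S_meas hS a)
  have hmj : ∀ j : ℕ, MeasurableSet {ω | S ((j + 1) / (m + 1)) ω 0 = n} := fun j => mX _ (measurableSet_singleton _)
  have hind : ∀ j : ℕ, P 0 ({ω | S ((j + 1) / (m + 1)) ω 0 = n} ∩ {ω | ⌊((m : ℝ) + 1) * AF Y v t ω⌋₊ = j ∧ Y t ω = 0}) = 
      ENNReal.ofReal (q ((j + 1) / (m + 1)) n) * P 0 {ω | ⌊((m : ℝ) + 1) * AF Y v t ω⌋₊ = j ∧ Y t ω = 0} := by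
    intro j
    have hj0 : (0 : ℝ) ≤ (j + 1) / (m + 1) := by positivity
    have hI := indep_proc hd hS hj0
    have hae := Afun_eq hW hv ht 0
    simp only [e0] at hae
    set E : Set (ℝ≥0 → (Fin d → ℤ)) := {y | ⌊((m : ℝ) + 1) * Afun v t y⌋₊ = j ∧ y (Real.toNNReal t) = 0} with hE
    have hEm : MeasurableSet E := ((Nat.measurable_floor.comp ((Afun_meas v t).const_mul _)) (measurableSet_singleton j)).inter 
      (measurable_pi_apply (Real.toNNReal t) (measurableSet_singleton 0))
    set R : Set Ω := (fun ω (u : ℝ≥0) (i : Fin d) => S u ω i.succ) ⁻¹' E with hR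
    set L : Set Ω := {ω | ⌊((m : ℝ) + 1) * AF Y v t ω⌋₊ = j ∧ Y t ω = 0} with hL
    have hEe : ∀ᵐ ω ∂(P 0), ω ∈ L ↔ ω ∈ R := by
      filter_upwards [hae] with ω hω
      change (⌊((m : ℝ) + 1) * AF Y v t ω⌋₊ = j ∧ Y t ω = 0) ↔ (⌊((m : ℝ) + 1) * Afun v t (fun u => Y u ω)⌋₊ = j ∧ Y (Real.toNNReal t) ω = 0)
      rw [hω, Real.coe_toNNReal _ ht]
    have c1 : ∀ X : Set Ω, P 0 (X ∩ L) = P 0 (X ∩ R) := fun X => le_antisymm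
      (measure_mono_ae (by filter_upwards [hEe] with ω hω hh using ⟨hh.1, hω.mp hh.2⟩))
      (measure_mono_ae (by filter_upwards [hEe] with ω hω hh using ⟨hh.1, hω.mpr hh.2⟩))
    have c2 := c1 univ
    rw [univ_inter, univ_inter] at c2
    rw [c1, c2, ← S1_law hd hS hj0 n]
    exact hI.measure_inter_preimage_eq_mul {n} E (measurableSet_singleton _) hEm
  have hun : {ω | S ((⌊(m + 1) * AF Y v t ω⌋₊ + 1) / (m + 1)) ω 0 = n ∧ (fun i : Fin d => S t ω i.succ) = 0} = 
      ⋃ j : ℕ, ({ω | S ((j + 1) / (m + 1)) ω 0 = n} ∩ {ω | ⌊((m : ℝ) + 1) * AF Y v t ω⌋₊ = j ∧ Y t ω = 0}) := by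
    ext ω
    simp only [mem_iUnion, mem_inter_iff, mem_ofPred_eq]
    constructor
    · rintro ⟨h1, h2⟩
      exact ⟨_, h1, rfl, h2⟩
    · rintro ⟨j, h1, h2, h3⟩
      subst h2
      exact ⟨h1, h3⟩
  rw [hun, measure_iUnion]
  · simp_rw [hind]
    have : ∀ ω, ENNReal.ofReal (q ((⌊(m + 1) * AF Y v t ω⌋₊ + 1) / (m + 1)) n) * 
      ({0} : Set (Fin d → ℤ)).indicator 1 (fun i : Fin d => S t ω i.succ) = ∑' j : ℕ, 
        {ω | ⌊((m : ℝ) + 1) * AF Y v t ω⌋₊ = j ∧ Y t ω = 0}.indicator (fun _ => ENNReal.ofReal (q ((j + 1) / (m + 1)) n)) ω := by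
      intro ω
      rw [tsum_eq_single ⌊((m : ℝ) + 1) * AF Y v t ω⌋₊]
      · by_cases h0 : Y t ω = 0
        · rw [indicator_of_mem (show ω ∈ {ω' | ⌊((m : ℝ) + 1) * AF Y v t ω'⌋₊ = ⌊((m : ℝ) + 1) * AF Y v t ω⌋₊ ∧ Y t ω' = 0} from ⟨rfl, h0⟩),
            indicator_of_mem (by exact h0)]
          simp
        · rw [indicator_of_notMem (show ω ∉ {ω' | ⌊((m : ℝ) + 1) * AF Y v t ω'⌋₊ = ⌊((m : ℝ) + 1) * AF Y v t ω⌋₊ ∧ Y t ω' = 0} from fun hh => h0 hh.2),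
            indicator_of_notMem (by exact h0)]
          simp
      · intro j hj
        exact indicator_of_notMem (fun hh => hj hh.1.symm) _
    simp_rw [this]
    rw [lintegral_tsum (fun j => (measurable_const.indicator (hEv j)).aemeasurable)]
    congr 1; funext j
    rw [lintegral_indicator_const (hEv j)]
  · intro i j hij
    apply disjoint_left.mpr
    rintro ω ⟨_, h1, _⟩ ⟨_, h2, _⟩
    exact hij (h1.symm.trans h2)
  · exact fun j => (hmj j).inter (hEv j)

/-- conditioning on the second component -/
lemma green_formula (hd : 1 ≤ d) (hS : IsCTSRW (d + 1) P S) {v : (Fin d → ℤ) → ℝ} (hv : ∀ y, 0 ≤ v y) {t : ℝ} (ht : 0 ≤ t) (n : ℤ) :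
    P 0 {ω | S (AF (fun u ω (i : Fin d) => S u ω i.succ) v t ω) ω 0 = n ∧ (fun i : Fin d => S t ω i.succ) = 0} =
    ∫⁻ ω, ENNReal.ofReal (q (AF (fun u ω (i : Fin d) => S u ω i.succ) v t ω) n) * 
      ({0} : Set (Fin d → ℤ)).indicator 1 (fun i : Fin d => S t ω i.succ) ∂(P 0) := by
  have := hS.prob 0
  have hW := tail_Wk hd hS
  set Y : ℝ → Ω → (Fin d → ℤ) := fun u ω (i : Fin d) => S u ω i.succ with hY
  have hAm := hW.AF_meas v t
  set A : ℕ → Ω → ℝ := fun m ω => (⌊(m + 1) * AF Y v t ω⌋₊ + 1) / (m + 1) with hA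
  have hAmm : ∀ m, Measurable (A m) := fun m => by
    apply Measurable.div_const
    apply Measurable.add_const
    exact (measurable_of_countable (fun k : ℕ => (k : ℝ))).comp (Nat.measurable_floor.comp (hAm.const_mul _))
  have hA0 : ∀ m ω, 0 ≤ A m ω := fun m ω => by positivity
  have hA1 : ∀ m ω, AF Y v t ω ≤ A m ω := fun m ω => by
    rw [hA]; simp only
    rw [le_div_iff₀ (by positivity), mul_comm]
    exact (Nat.lt_floor_add_one _).le
  have hA2 : ∀ m ω, A m ω ≤ AF Y v t ω + 1 / (m + 1) := fun m ω => by
    have h0 : 0 ≤ (m + 1) * AF Y v t ω := mul_nonneg (by positivity) (AF_nonneg hv t ω)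
    rw [hA]; simp only
    rw [div_le_iff₀ (by positivity)]
    have h1 : (AF Y v t ω + 1 / (m + 1)) * ((m : ℝ) + 1) = (m + 1) * AF Y v t ω + 1 := by field_simp
    rw [h1]
    linarith [Nat.floor_le h0]
  have hAl : ∀ ω, Tendsto (fun m => A m ω) atTop (𝓝 (AF Y v t ω)) := fun ω => by
    refine tendsto_of_tendsto_of_tendsto_of_le_of_le tendsto_const_nhds ?_ (fun m => hA1 m ω) (fun m => hA2 m ω)
    simpa using tendsto_const_nhds.add (tendsto_one_div_add_atTop_nhds_zero_nat (𝕜 := ℝ))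
  have hi1 : ∀ y : Fin d → ℤ, ({0} : Set (Fin d → ℤ)).indicator (1 : (Fin d → ℤ) → ℝ≥0∞) y ≤ 1 := fun y => ind_le_one _ _
  have hqm : Measurable fun a => ENNReal.ofReal (q a n) := (q_cont n).measurable.ennreal_ofReal
  have l1 : Tendsto (fun m => ∫⁻ ω, ENNReal.ofReal (q (A m ω) n) * ({0} : Set (Fin d → ℤ)).indicator 1 (Y t ω) ∂(P 0)) atTop
      (𝓝 (∫⁻ ω, ENNReal.ofReal (q (AF Y v t ω) n) * ({0} : Set (Fin d → ℤ)).indicator 1 (Y t ω) ∂(P 0))) := by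
    apply tendsto_lintegral_of_dominated_convergence (fun _ => 1)
    · exact fun m => (hqm.comp (hAmm m)).mul (hW.ind_meas _ t)
    · intro m
      refine Eventually.of_forall fun ω => ?_
      calc _ ≤ (1 : ℝ≥0∞) * 1 := mul_le_mul' (by rw [← S1_law hd hS (hA0 m ω) n]; exact prob_le_one) (hi1 _)
        _ = 1 := one_mul 1
    · simp
    · refine Eventually.of_forall fun ω => ?_
      apply ENNReal.Tendsto.mul_const
      · exact ENNReal.tendsto_ofReal (((q_cont n).tendsto _).comp (hAl ω))
      · exact Or.inr ((hi1 _).trans_lt ENNReal.one_lt_top).ne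
  have hset : ∀ b : Ω → ℝ, Measurable b → MeasurableSet {ω | S (b ω) ω 0 = n ∧ Y t ω = 0} := fun b hb => by
    have : Measurable fun ω => S (b ω) ω 0 := (measurable_pi_apply 0).comp (hS.meas.comp (hb.prodMk measurable_id))
    exact (this (measurableSet_singleton n)).inter (hW.Ymeas t (measurableSet_singleton 0))
  have l2 : Tendsto (fun m => P 0 {ω | S (A m ω) ω 0 = n ∧ Y t ω = 0}) atTop (𝓝 (P 0 {ω | S (AF Y v t ω) ω 0 = n ∧ Y t ω = 0})) := by
    have e : ∀ b : Ω → ℝ, Measurable b → P 0 {ω | S (b ω) ω 0 = n ∧ Y t ω = 0} = ∫⁻ ω, {ω | S (b ω) ω 0 = n ∧ Y t ω = 0}.indicator 1 ω ∂(P 0) := 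
      fun b hb => (lintegral_indicator_one (hset b hb)).symm
    simp_rw [fun m => e _ (hAmm m)]
    rw [e _ hAm]
    apply tendsto_lintegral_of_dominated_convergence (fun _ => 1)
    · exact fun m => measurable_one.indicator (hset _ (hAmm m))
    · exact fun m => Eventually.of_forall fun ω => ind_le_one _ _
    · simp
    · filter_upwards [hS.rightCont 0] with ω hω
      obtain ⟨ε, he, h2⟩ := hω _ (AF_nonneg hv t ω)
      apply tendsto_const_nhds.congr'
      filter_upwards [(hAl ω).eventually (gt_mem_nhds (show AF Y v t ω < AF Y v t ω + ε by linarith))] with m hm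
      have := h2 _ (hA1 m ω) hm
      simp only [indicator, mem_ofPred_eq, this]
      split_ifs <;> rfl
  refine tendsto_nhds_unique l2 ?_
  refine l1.congr fun m => ?_
  exact (green_step hd hS hv ht n m).symm

end
end LG
end Part12

section Part13
open MeasureTheory ProbabilityTheory Filter Set Topology
open scoped ENNReal

namespace LG

/-- the exponent of the truncated Green kernel -/
noncomputable def om (d : ℕ) : ℝ := if d = 1 then 1 / 2 else 0

lemma om_nonneg (d : ℕ) : 0 ≤ om d := by unfold om; split_ifs <;> norm_num
lemma om_le (d : ℕ) : om d ≤ 1 / 2 := by unfold om; split_ifs <;> norm_num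

lemma inv_sqrt_pow {M : ℝ} (hM : 0 < M) (d : ℕ) : (1 / Real.sqrt M) ^ d = M ^ (-((d : ℝ) / 2)) := by
  rw [Real.sqrt_eq_rpow, one_div, ← Real.rpow_neg hM.le, ← Real.rpow_natCast, ← Real.rpow_mul hM.le]
  congr 1; ring

lemma lint_rpow {r T : ℝ} (hr : 0 < r) (hT : 0 ≤ T) :
    ∫⁻ t in Ioc 0 T, ENNReal.ofReal (t ^ (r - 1)) = ENNReal.ofReal (T ^ r / r) := by
  rw [← ofReal_integral_eq_lintegral_ofReal]
  · rw [← intervalIntegral.integral_of_le hT, integral_rpow (Or.inl (by linarith))]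
    congr 1
    rw [Real.zero_rpow (by linarith)]; simp
  · have := (intervalIntegral.intervalIntegrable_rpow' (a := 0) (b := T) (r := r - 1) (by linarith))
    exact (intervalIntegrable_iff_integrableOn_Ioc_of_le hT).mp this
  · refine (ae_restrict_iff' measurableSet_Ioc).mpr (Eventually.of_forall fun t ht => ?_)
    exact Real.rpow_nonneg ht.1.le _

lemma G_sup (d : ℕ) (hd : 1 ≤ d) {e : ℝ} (he : 0 < e) (he2 : e < 1 / 2) : ∃ C : ℝ, 0 < C ∧ ∀ T : ℝ, 0 ≤ T →
    ∀ x y : Fin d → ℤ, G d T x y ≤ ENNReal.ofReal (C * T ^ (om d + e)) := by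
  have ho := om_nonneg d
  have ho2 := om_le d
  refine ⟨Real.exp 2 ^ d / (om d + e), by positivity, ?_⟩
  intro T hT x y
  unfold G
  calc _ ≤ ∫⁻ t in Ioc 0 T, ENNReal.ofReal (Real.exp 2 ^ d) * ENNReal.ofReal (t ^ (om d + e - 1)) := by
        apply setLIntegral_mono_ae (by fun_prop)
        refine Eventually.of_forall fun t ht => ?_
        unfold pk
        rw [← ENNReal.ofReal_mul (by positivity)]
        apply ENNReal.ofReal_le_ofReal
        refine (heat_diag d hd ht.1.le x y).trans ?_
        gcongr
        have h1 : 1 ≤ max t 1 := le_max_right _ _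
        rw [inv_sqrt_pow (by linarith)]
        calc (max t 1) ^ (-((d : ℝ) / 2)) ≤ (max t 1) ^ (om d + e - 1) := by
              apply Real.rpow_le_rpow_of_exponent_le h1
              unfold om
              split_ifs with h
              · subst h; push_cast; linarith
              · have : 2 ≤ d := by omega
                have : (2 : ℝ) ≤ d := by exact_mod_cast this
                linarith
          _ ≤ t ^ (om d + e - 1) :=
              Real.rpow_le_rpow_of_nonpos ht.1 (le_max_left _ _) (by linarith)
    _ = ENNReal.ofReal (Real.exp 2 ^ d) * ENNReal.ofReal (T ^ (om d + e) / (om d + e)) := by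
        rw [lintegral_const_mul _ (by fun_prop), lint_rpow (by linarith) hT]
    _ = _ := by
        rw [← ENNReal.ofReal_mul (by positivity)]; congr 1; ring

lemma G_far (d : ℕ) (hd : 1 ≤ d) (K : ℕ) : ∃ C : ℝ, 0 < C ∧ ∀ T : ℝ, 1 ≤ T →
    ∀ x y : Fin d → ℤ, G d T x y ≤ ENNReal.ofReal (C * T * (Real.sqrt T / jb (y - x)) ^ K) := by
  obtain ⟨C, hC, h⟩ := heat_poly d hd K
  refine ⟨C, hC, fun T hT x y => ?_⟩
  have hj := jb_pos (y - x)
  unfold G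
  calc _ ≤ ∫⁻ t in Ioc 0 T, ENNReal.ofReal (C * (Real.sqrt T / jb (y - x)) ^ K) := by
        apply setLIntegral_mono_ae (by fun_prop)
        refine Eventually.of_forall fun t ht => ?_
        apply ENNReal.ofReal_le_ofReal
        refine (h t ht.1.le x y).trans ?_
        have h1 : max t 1 ≤ T := max_le ht.2 hT
        have h3 : (1 : ℝ) ≤ max t 1 := le_max_right _ _
        have h2 : (1 / Real.sqrt (max t 1)) ^ d ≤ 1 := by
          apply pow_le_one₀ (by positivity)
          rw [div_le_one (by positivity)]
          exact Real.one_le_sqrt.mpr h3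
        gcongr
        nlinarith
    _ = _ := by
        rw [setLIntegral_const, Real.volume_Ioc, ← ENNReal.ofReal_mul (by positivity)]
        congr 1; ring

lemma G_high (d : ℕ) (hd : 3 ≤ d) : ∃ C : ℝ, 0 < C ∧ ∀ T : ℝ,
    ∀ x y : Fin d → ℤ, G d T x y ≤ ENNReal.ofReal (C * jb (y - x) ^ (2 - (d : ℝ))) := by
  have hd1 : 1 ≤ d := by omega
  have hd3 : (3 : ℝ) ≤ d := by exact_mod_cast hd
  obtain ⟨C, hC, h⟩ := heat_poly d hd1 d
  refine ⟨C + Real.exp 2 ^ d / ((d : ℝ) / 2 - 1), by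
    have : 0 < (d : ℝ) / 2 - 1 := by linarith
    positivity, fun T x y => ?_⟩
  set j := jb (y - x) with hjd
  have hj : 0 < j := jb_pos (y - x)
  have hj1 : 1 ≤ j := one_le_jb (y - x)
  have hx : j ^ (2 - (d : ℝ)) = j ^ 2 * (1 / j) ^ d := by
    rw [Real.rpow_sub hj, Real.rpow_natCast, div_eq_mul_inv, one_div, inv_pow]
    norm_num
  unfold G
  calc _ ≤ ∫⁻ t in Ioc 0 (j ^ 2) ∪ Ioi (j ^ 2), pk d t x y := by
        apply lintegral_mono_set
        rw [Ioc_union_Ioi_eq_Ioi (by positivity)]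
        exact fun t ht => ht.1
    _ ≤ (∫⁻ t in Ioc 0 (j ^ 2), pk d t x y) + ∫⁻ t in Ioi (j ^ 2), pk d t x y := lintegral_union_le _ _ _
    _ ≤ ENNReal.ofReal (C * j ^ (2 - (d : ℝ))) + ENNReal.ofReal (Real.exp 2 ^ d / ((d : ℝ) / 2 - 1) * j ^ (2 - (d : ℝ))) := by
        gcongr
        · calc _ ≤ ∫⁻ t in Ioc 0 (j ^ 2), ENNReal.ofReal (C * (1 / j) ^ d) := by
                apply setLIntegral_mono_ae (by fun_prop)
                refine Eventually.of_forall fun t ht => ?_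
                apply ENNReal.ofReal_le_ofReal
                refine (h t ht.1.le x y).trans (le_of_eq ?_)
                have h3 : (1 : ℝ) ≤ max t 1 := le_max_right _ _
                have : 0 < Real.sqrt (max t 1) := by positivity
                rw [mul_assoc, ← mul_pow, ← hjd]
                congr 2
                field_simp
            _ = _ := by
                rw [setLIntegral_const, Real.volume_Ioc, ← ENNReal.ofReal_mul (by positivity), hx]
                congr 1; ring
        · calc _ ≤ ∫⁻ t in Ioi (j ^ 2), ENNReal.ofReal (Real.exp 2 ^ d * t ^ (-((d : ℝ) / 2))) := by
                apply setLIntegral_mono_ae (by fun_prop)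
                refine Eventually.of_forall fun t ht => ?_
                apply ENNReal.ofReal_le_ofReal
                have ht1 : 1 ≤ t := le_trans (by nlinarith) (le_of_lt ht)
                refine (heat_diag d hd1 (by linarith) x y).trans (le_of_eq ?_)
                rw [max_eq_left ht1, inv_sqrt_pow (by linarith)]
            _ = _ := by
                rw [← ofReal_integral_eq_lintegral_ofReal]
                · congr 1
                  rw [integral_const_mul, integral_Ioi_rpow_of_lt (by linarith) (by positivity)]
                  have e1 : (j ^ 2) ^ (-((d : ℝ) / 2) + 1) = j ^ (2 - (d : ℝ)) := by
                    rw [← Real.rpow_natCast j 2, ← Real.rpow_mul hj.le]; congr 1; push_cast; ring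
                  rw [e1]
                  have e2 : -((d : ℝ) / 2) + 1 = -((d : ℝ) / 2 - 1) := by ring
                  rw [e2, neg_div_neg_eq]
                  ring
                · exact (integrableOn_Ioi_rpow_of_lt (by linarith) (by positivity)).const_mul _
                · refine (ae_restrict_iff' measurableSet_Ioi).mpr (Eventually.of_forall fun t ht => ?_)
                  have : 0 < t := lt_trans (by positivity) ht
                  positivity
    _ = _ := by
        have : 0 < (d : ℝ) / 2 - 1 := by linarith
        rw [← ENNReal.ofReal_add (by positivity) (by positivity)]
        congr 1; ring

lemma G_low (d : ℕ) (hd : 1 ≤ d) : ∃ c : ℝ, 0 < c ∧ ∀ T : ℝ,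
    ∀ x y : Fin d → ℤ, jb (y - x) ^ 2 ≤ c * T → ENNReal.ofReal (c * jb (y - x) ^ (2 - (d : ℝ))) ≤ G d T x y := by
  obtain ⟨c, hc, hc1, h⟩ := heat_ge d hd
  set c0 : ℝ := min (c / 2) (c ^ (d + 1) ) with hc0
  have c0p : 0 < c0 := by positivity
  refine ⟨min (c / 2) (c / c * (c * (1 / Real.sqrt (2 / c)) ^ d)), by positivity, fun T x y hT => ?_⟩
  set j := jb (y - x) with hjd
  have hj : 0 < j := jb_pos (y - x)
  have hj1 : 1 ≤ j := one_le_jb (y - x)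
  have hx : j ^ (2 - (d : ℝ)) = j ^ 2 * (1 / j) ^ d := by
    rw [Real.rpow_sub hj, Real.rpow_natCast, div_eq_mul_inv, one_div, inv_pow]
    norm_num
  have hTT : 2 * j ^ 2 / c ≤ T := by
    rw [div_le_iff₀ hc]
    have hT0 : 0 < T := by
      by_contra hn
      push Not at hn
      have : min (c / 2) (c / c * (c * (1 / Real.sqrt (2 / c)) ^ d)) * T ≤ 0 :=
        mul_nonpos_of_nonneg_of_nonpos (by positivity) hn
      nlinarith
    have : min (c / 2) (c / c * (c * (1 / Real.sqrt (2 / c)) ^ d)) * T ≤ c / 2 * T :=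
      mul_le_mul_of_nonneg_right (min_le_left _ _) hT0.le
    nlinarith
  unfold G
  calc _ ≤ ENNReal.ofReal ((j ^ 2 / c) * (c * ((1 / Real.sqrt (2 / c)) * (1 / j)) ^ d)) := by
        apply ENNReal.ofReal_le_ofReal
        rw [hx, mul_pow]
        have : min (c / 2) (c / c * (c * (1 / Real.sqrt (2 / c)) ^ d)) ≤ (1 / c) * (c * (1 / Real.sqrt (2 / c)) ^ d) := by
          refine (min_le_right _ _).trans ?_
          gcongr
        calc _ ≤ ((1 / c) * (c * (1 / Real.sqrt (2 / c)) ^ d)) * (j ^ 2 * (1 / j) ^ d) := by gcongr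
          _ = _ := by ring
    _ = ∫⁻ t in Ioc (j ^ 2 / c) (2 * j ^ 2 / c), ENNReal.ofReal (c * ((1 / Real.sqrt (2 / c)) * (1 / j)) ^ d) := by
        rw [setLIntegral_const, Real.volume_Ioc, ← ENNReal.ofReal_mul (by positivity)]
        congr 1; ring
    _ ≤ ∫⁻ t in Ioc (j ^ 2 / c) (2 * j ^ 2 / c), pk d t x y := by
        apply setLIntegral_mono_ae (pk_meas hd x y).aemeasurable
        refine Eventually.of_forall fun t ht => ?_
        apply ENNReal.ofReal_le_ofReal
        have h1 : 1 ≤ j ^ 2 / c := by rw [le_div_iff₀ hc]; nlinarith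
        refine le_trans ?_ (h t (by linarith [ht.1]) x y ?_)
        · gcongr
          rw [one_div_mul_one_div_rev]
          apply one_div_le_one_div_of_le (Real.sqrt_pos.mpr (by linarith [ht.1]))
          rw [Real.sqrt_le_left (by positivity), mul_pow, Real.sq_sqrt (by positivity)]
          calc t ≤ _ := ht.2
            _ = _ := by ring
        · have : ‖y - x‖ ≤ j := by rw [hjd]; unfold jb; linarith
          have h2 : j ^ 2 ≤ c * t := by
            have := ht.1
            rw [div_lt_iff₀ hc] at this; linarith
          nlinarith [norm_nonneg (y - x)]
    _ ≤ _ := by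
        apply lintegral_mono_set
        exact Ioc_subset_Ioc (by positivity) hTT

end LG
end Part13

section Part14
open MeasureTheory ProbabilityTheory Filter Set Topology
open scoped ENNReal

namespace LG

lemma jb_tsum_shift (d : ℕ) (x : Fin d → ℤ) (F : (Fin d → ℤ) → ℝ≥0∞) :
    ∑' y : Fin d → ℤ, F (y - x) = ∑' y, F y := (Equiv.subRight x).tsum_eq F

lemma jb_add {d : ℕ} (x y : Fin d → ℤ) : jb y ≤ jb (y - x) + jb x := by
  unfold jb
  have : ‖y‖ ≤ ‖y - x‖ + ‖x‖ := by simpa using norm_add_le (y - x) x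
  linarith

lemma pk_tail (d : ℕ) (hd : 1 ≤ d) (K : ℕ) : ∃ C : ℝ, 0 < C ∧ ∀ N : ℝ, 1 ≤ N → ∀ t ∈ Icc 0 N, ∀ x : Fin d → ℤ,
    ∑' y, {y | N ^ 2 < jb (y - x)}.indicator (pk d t x) y ≤ ENNReal.ofReal (C * (1 / N) ^ K) := by
  set m := K + d + 1 with hm
  obtain ⟨C, hC, h⟩ := heat_poly d hd (2 * m)
  have hfin := jb_tsum d (s := (d : ℝ) + 1) (by linarith)
  set Z := ∑' y : Fin d → ℤ, ENNReal.ofReal (jb y ^ (-((d : ℝ) + 1))) with hZ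
  refine ⟨C * (Z.toReal + 1), by positivity, fun N hN t ht x => ?_⟩
  have hN0 : 0 < N := by linarith
  calc _ ≤ ∑' y, ENNReal.ofReal (C * (1 / N) ^ K) * ENNReal.ofReal (jb (y - x) ^ (-((d : ℝ) + 1))) := by
        refine ENNReal.tsum_le_tsum fun y => ?_
        by_cases hy : N ^ 2 < jb (y - x)
        · rw [indicator_of_mem (by exact hy), ← ENNReal.ofReal_mul (by positivity)]
          apply ENNReal.ofReal_le_ofReal
          refine (h t ht.1 x y).trans ?_
          set j := jb (y - x)
          have hj1 : 1 ≤ j := one_le_jb _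
          have h3 : (1 : ℝ) ≤ max t 1 := le_max_right _ _
          have h4 : max t 1 ≤ N := max_le ht.2 hN
          have h2 : (1 / Real.sqrt (max t 1)) ^ d ≤ 1 := by
            apply pow_le_one₀ (by positivity)
            rw [div_le_one (by positivity)]
            exact Real.one_le_sqrt.mpr h3
          rw [mul_assoc, mul_assoc]
          apply mul_le_mul_of_nonneg_left _ hC.le
          calc (1 / Real.sqrt (max t 1)) ^ d * (Real.sqrt (max t 1) / j) ^ (2 * m)
              ≤ 1 * (Real.sqrt (max t 1) / j) ^ (2 * m) := by gcongr
            _ = (max t 1 / j * (1 / j)) ^ m := by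
                rw [one_mul, pow_mul, div_pow, Real.sq_sqrt (by linarith)]; congr 1; field_simp
            _ ≤ (1 / N * (1 / j)) ^ m := by
                apply pow_le_pow_left₀ (by positivity)
                apply mul_le_mul_of_nonneg_right _ (by positivity)
                rw [div_le_div_iff₀ (by linarith) hN0]
                nlinarith
            _ = (1 / N) ^ m * (1 / j) ^ m := mul_pow _ _ _
            _ ≤ (1 / N) ^ K * j ^ (-((d : ℝ) + 1)) := by
                have e : j ^ (-((d : ℝ) + 1)) = (1 / j) ^ (d + 1) := by
                  rw [Real.rpow_neg (by linarith), one_div, inv_pow]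
                  congr 1
                  exact_mod_cast Real.rpow_natCast j (d + 1)
                rw [e]
                have i1 : 1 / N ≤ 1 := by rw [div_le_one hN0]; exact hN
                have i2 : 1 / j ≤ 1 := by rw [div_le_one (by linarith)]; exact hj1
                apply mul_le_mul _ _ (by positivity) (by positivity)
                · exact pow_le_pow_of_le_one (by positivity) i1 (by omega)
                · exact pow_le_pow_of_le_one (by positivity) i2 (by omega)
        · rw [indicator_of_notMem (by exact hy)]; exact bot_le
    _ = ENNReal.ofReal (C * (1 / N) ^ K) * Z := by
        rw [ENNReal.tsum_mul_left, jb_tsum_shift d x (fun y => ENNReal.ofReal (jb y ^ (-((d : ℝ) + 1))))]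
    _ ≤ ENNReal.ofReal (C * (1 / N) ^ K) * ENNReal.ofReal (Z.toReal + 1) := by
        gcongr
        rw [← ENNReal.ofReal_toReal hfin]
        apply ENNReal.ofReal_le_ofReal
        rw [ENNReal.toReal_ofReal (by positivity)]
        linarith
    _ = _ := by rw [← ENNReal.ofReal_mul (by positivity)]; congr 1; ring

lemma box_fin (d : ℕ) (R : ℝ) : {y : Fin d → ℤ | jb y ≤ R}.Finite := by
  have : {y : Fin d → ℤ | jb y ≤ R} ⊆ Metric.closedBall 0 R := by
    intro y hy
    rw [mem_closedBall_zero_iff]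
    have : 1 + ‖y‖ ≤ R := hy
    linarith
  exact ((isCompact_closedBall (0 : Fin d → ℤ) R).finite_of_discrete).subset this

/-- lattice box -/
noncomputable def bx (d : ℕ) (R : ℝ) : Finset (Fin d → ℤ) := (box_fin d R).toFinset

lemma mem_bx {d : ℕ} {R : ℝ} {y : Fin d → ℤ} : y ∈ bx d R ↔ jb y ≤ R := by simp [bx]

lemma bx_card (d : ℕ) : ∃ C : ℝ, 0 < C ∧ ∀ R : ℝ, 0 < R → ((bx d R).card : ℝ) ≤ C * R ^ (d + 1) := by
  have hfin := jb_tsum d (s := (d : ℝ) + 1) (by linarith)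
  set Z := ∑' y : Fin d → ℤ, ENNReal.ofReal (jb y ^ (-((d : ℝ) + 1))) with hZ
  refine ⟨Z.toReal + 1, by positivity, fun R hR => ?_⟩
  have h1 : ENNReal.ofReal ((bx d R).card * R ^ (-((d : ℝ) + 1))) ≤ Z := by
    calc _ = ∑ y ∈ bx d R, ENNReal.ofReal (R ^ (-((d : ℝ) + 1))) := by
          rw [Finset.sum_const, nsmul_eq_mul, ENNReal.ofReal_mul (by positivity)]; simp
      _ ≤ ∑ y ∈ bx d R, ENNReal.ofReal (jb y ^ (-((d : ℝ) + 1))) := by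
          refine Finset.sum_le_sum fun y hy => ENNReal.ofReal_le_ofReal ?_
          exact Real.rpow_le_rpow_of_nonpos (jb_pos y) (mem_bx.mp hy) (by linarith [(Nat.cast_nonneg d : (0:ℝ) ≤ d)])
      _ ≤ Z := ENNReal.sum_le_tsum _
  have h2 : (bx d R).card * R ^ (-((d : ℝ) + 1)) ≤ Z.toReal := by
    rw [← ENNReal.ofReal_le_iff_le_toReal hfin]; exact h1
  have e : R ^ (-((d : ℝ) + 1)) = (R ^ (d + 1))⁻¹ := by
    rw [Real.rpow_neg hR.le]
    congr 1
    exact_mod_cast Real.rpow_natCast R (d + 1)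
  rw [e, ← div_eq_mul_inv, div_le_iff₀ (by positivity)] at h2
  nlinarith [pow_pos hR (d + 1)]

section
variable {d : ℕ} {Ω : Type*} [MeasurableSpace Ω] {Q : (Fin d → ℤ) → Measure Ω}
  {Y : ℝ → Ω → (Fin d → ℤ)}

lemma Wk.G_box (h : Wk d Q Y) : ∃ N0 : ℝ, ∀ N : ℝ, N0 ≤ N → ∀ s ∈ Icc 0 N, ∀ x : Fin d → ℤ, jb x ≤ N ^ 2 →
    ENNReal.ofReal (s / 2) ≤ ∑ y ∈ bx d (2 * N ^ 2), G d s x y := by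
  obtain ⟨C, hC, hT⟩ := pk_tail d h.dpos 1
  refine ⟨max 1 (2 * C), fun N hN s hs x hx => ?_⟩
  have hN1 : 1 ≤ N := (le_max_left _ _).trans hN
  have hN2 : 2 * C ≤ N := (le_max_right _ _).trans hN
  have h1 := h.G_sum hs.1 x
  have h2 : ∑' y, {y | N ^ 2 < jb (y - x)}.indicator (G d s x) y ≤ ENNReal.ofReal (s / 2) := by
    have e : ∀ y, {y | N ^ 2 < jb (y - x)}.indicator (G d s x) y =
        ∫⁻ u in Ioc 0 s, {y | N ^ 2 < jb (y - x)}.indicator (pk d u x) y := by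
      intro y
      by_cases hy : y ∈ {y | N ^ 2 < jb (y - x)}
      · simp only [indicator_of_mem hy]; rfl
      · simp only [indicator_of_notMem hy]; simp
    simp_rw [e]
    rw [← lintegral_tsum]
    · calc _ ≤ ∫⁻ u in Ioc 0 s, ENNReal.ofReal (1 / 2) := by
            apply setLIntegral_mono_ae (by fun_prop)
            refine Eventually.of_forall fun u hu => ?_
            refine (hT N hN1 u ⟨hu.1.le, hu.2.trans hs.2⟩ x).trans (ENNReal.ofReal_le_ofReal ?_)
            rw [pow_one, mul_one_div, div_le_div_iff₀ (by linarith) (by norm_num)]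
            linarith
        _ = _ := by
            rw [setLIntegral_const, Real.volume_Ioc, ← ENNReal.ofReal_mul (by norm_num)]
            congr 1; ring
    · intro y
      by_cases hy : y ∈ {y | N ^ 2 < jb (y - x)}
      · simp only [indicator_of_mem hy]; exact (pk_meas h.dpos x y).aemeasurable
      · simp only [indicator_of_notMem hy]; fun_prop
  have h3 : ENNReal.ofReal s ≤ (∑ y ∈ bx d (2 * N ^ 2), G d s x y) + ENNReal.ofReal (s / 2) := by
    rw [← h1]
    calc _ ≤ ∑' y, (((bx d (2 * N ^ 2) : Finset _) : Set (Fin d → ℤ)).indicator (G d s x) y + {y | N ^ 2 < jb (y - x)}.indicator (G d s x) y) := by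
          refine ENNReal.tsum_le_tsum fun y => ?_
          by_cases hy : N ^ 2 < jb (y - x)
          · rw [indicator_of_mem (s := {y | N ^ 2 < jb (y - x)}) (by exact hy)]
            exact le_add_left le_rfl
          · rw [indicator_of_mem (s := ((bx d (2 * N ^ 2) : Finset _) : Set (Fin d → ℤ)))]
            · exact le_add_right le_rfl
            · rw [Finset.mem_coe, mem_bx]
              push Not at hy
              linarith [jb_add x y]
      _ = (∑ y ∈ bx d (2 * N ^ 2), G d s x y) + ∑' y, {y | N ^ 2 < jb (y - x)}.indicator (G d s x) y := by
          rw [ENNReal.tsum_add, sum_eq_tsum_indicator]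
      _ ≤ _ := by gcongr
  have h4 : ENNReal.ofReal s = ENNReal.ofReal (s / 2) + ENNReal.ofReal (s / 2) := by
    rw [← ENNReal.ofReal_add (by linarith [hs.1]) (by linarith [hs.1])]; congr 1; ring
  rw [h4] at h3
  exact (ENNReal.add_le_add_iff_right ENNReal.ofReal_ne_top).mp h3

end

end LG
end Part14

section Part15
open MeasureTheory ProbabilityTheory Filter Set Topology
open scoped ENNReal

namespace LG

section
variable {d : ℕ} {Ω : Type*} [MeasurableSpace Ω] {Q : (Fin d → ℤ) → Measure Ω}
  {Y : ℝ → Ω → (Fin d → ℤ)}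

/-- indicator of a point -/
noncomputable def nd (y : Fin d → ℤ) : (Fin d → ℤ) → ℝ≥0∞ := ({y} : Set (Fin d → ℤ)).indicator 1

lemma tsum_nd (x w : Fin d → ℤ) (s : ℝ) (F : (Fin d → ℤ) → ℝ≥0∞) :
    ∑' y, pk d s x y * (nd w y * F y) = pk d s x w * F w := by
  rw [tsum_eq_single w]
  · simp [nd]
  · intro b hb; simp [nd, hb]

lemma Wk.two (h : Wk d Q Y) {u s : ℝ} (hu : 0 ≤ u) (hs : 0 ≤ s) (x y w : Fin d → ℤ) :
    ∫⁻ ω, nd y (Y u ω) * nd w (Y (u + s) ω) ∂(Q x) = pk d u x y * pk d s y w := by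
  have h1 := h.list x [(u, nd y), (s, nd w)] (by simp [hu, hs])
  simp only [EV, RL, zero_add, mul_one] at h1
  rw [h1, tsum_nd]
  congr 1
  have := tsum_nd y w s (fun _ => 1)
  simpa using this

lemma Wk.three (h : Wk d Q Y) {u r s : ℝ} (hu : 0 ≤ u) (hr : 0 ≤ r) (hs : 0 ≤ s) (x y y' w : Fin d → ℤ) :
    ∫⁻ ω, nd y (Y u ω) * (nd y' (Y (u + r) ω) * nd w (Y (u + r + s) ω)) ∂(Q x) = pk d u x y * (pk d r y y' * pk d s y' w) := by
  have h1 := h.list x [(u, nd y), (r, nd y'), (s, nd w)] (by simp [hu, hs, hr])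
  simp only [EV, RL, zero_add, mul_one] at h1
  rw [h1, tsum_nd, tsum_nd]
  congr 2
  have := tsum_nd y' w s (fun _ => 1)
  simpa using this

lemma Wk.nd_meas2 (h : Wk d Q Y) (y : Fin d → ℤ) : Measurable fun p : ℝ × Ω => nd y (Y p.1 p.2) :=
  (Measurable.of_discrete (f := nd y)).comp h.meas

lemma Wk.nd_measL (h : Wk d Q Y) (y : Fin d → ℤ) (ω : Ω) : Measurable fun u : ℝ => nd y (Y u ω) :=
  (h.nd_meas2 y).comp measurable_prodMk_right

lemma Wk.nd_measR (h : Wk d Q Y) (y : Fin d → ℤ) (u : ℝ) : Measurable fun ω : Ω => nd y (Y u ω) :=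
  (h.nd_meas2 y).comp measurable_prodMk_left

lemma Wk.AF_nd (h : Wk d Q Y) (y : Fin d → ℤ) (t : ℝ) (ω : Ω) :
    ENNReal.ofReal (AF Y (({y} : Set (Fin d → ℤ)).indicator 1) t ω) = ∫⁻ u in Ioc 0 t, nd y (Y u ω) := by
  have e : ∀ u, nd y (Y u ω) = ENNReal.ofReal (({y} : Set (Fin d → ℤ)).indicator 1 (Y u ω)) := by
    intro u
    unfold nd
    by_cases hy : Y u ω ∈ ({y} : Set (Fin d → ℤ))
    · simp only [indicator_of_mem hy]; simp
    · simp only [indicator_of_notMem hy]; simp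
  have hm : Measurable fun u : ℝ => (({y} : Set (Fin d → ℤ)).indicator (1 : (Fin d → ℤ) → ℝ) (Y u ω)) :=
    ((Measurable.of_discrete (f := ({y} : Set (Fin d → ℤ)).indicator (1 : (Fin d → ℤ) → ℝ))).comp h.meas).comp measurable_prodMk_right
  have hb : ∀ u, 0 ≤ (({y} : Set (Fin d → ℤ)).indicator (1 : (Fin d → ℤ) → ℝ) (Y u ω)) :=
    fun u => indicator_nonneg (fun _ _ => zero_le_one) _
  unfold AF
  rw [ofReal_integral_eq_lintegral_ofReal]
  · simp_rw [e]
  · refine Integrable.of_bound (C := 1) hm.aestronglyMeasurable (Eventually.of_forall fun u => ?_)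
    rw [Real.norm_eq_abs, abs_of_nonneg (hb u)]
    exact indicator_le_self' (fun _ _ => zero_le_one) _
  · exact Eventually.of_forall hb

/-- truncated kernel on the line -/
noncomputable def kk (A : Set ℝ) (x y : Fin d → ℤ) : ℝ → ℝ≥0∞ := A.indicator fun u => pk d u x y

lemma kk_meas (hd : 1 ≤ d) {A : Set ℝ} (hA : MeasurableSet A) (x y : Fin d → ℤ) : Measurable (kk A x y) :=
  (pk_meas hd x y).indicator hA

lemma kk_int (T : ℝ) (x y : Fin d → ℤ) : ∫⁻ u, kk (Icc 0 T) x y u = G d T x y := by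
  unfold kk G
  rw [lintegral_indicator measurableSet_Icc]
  exact (setLIntegral_congr Ioc_ae_eq_Icc).symm

lemma kk_int2 (T : ℝ) (x y : Fin d → ℤ) : ∫⁻ u, kk (Ioc 0 T) x y u = G d T x y := by
  unfold kk G
  rw [lintegral_indicator measurableSet_Ioc]

lemma conv_int (f g : ℝ → ℝ≥0∞) (hf : Measurable f) (hg : Measurable g) : ∫⁻ u, ∫⁻ t, f u * g (t - u) = (∫⁻ u, f u) * ∫⁻ t, g t := by
  have : ∀ u, ∫⁻ t, f u * g (t - u) = f u * ∫⁻ t, g t := by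
    intro u
    rw [lintegral_const_mul (f u) (f := fun t => g (t - u)) (by fun_prop), lintegral_sub_right_eq_self (fun t => g t)]
  simp_rw [this]
  exact lintegral_mul_const _ hf

lemma Wk.m1 (h : Wk d Q Y) (x y w : Fin d → ℤ) (t : ℝ) :
    ∫⁻ ω, (∫⁻ u in Ioc 0 t, nd y (Y u ω)) * nd w (Y t ω) ∂(Q x) = ∫⁻ u in Ioc 0 t, pk d u x y * pk d (t - u) y w := by
  have := h.prob x
  have e1 : ∀ ω, (∫⁻ u in Ioc 0 t, nd y (Y u ω)) * nd w (Y t ω) = ∫⁻ u in Ioc 0 t, nd y (Y u ω) * nd w (Y t ω) :=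
    fun ω => (lintegral_mul_const _ (h.nd_measL y ω)).symm
  simp_rw [e1]
  rw [lintegral_lintegral_swap]
  · apply setLIntegral_congr_fun measurableSet_Ioc
    intro u hu
    have := h.two hu.1.le (sub_nonneg.mpr hu.2) x y w
    simpa using this
  · exact (((h.nd_meas2 y).comp measurable_swap).mul ((h.nd_measR w t).comp measurable_fst)).aemeasurable

lemma Wk.mom1 (h : Wk d Q Y) (x y w : Fin d → ℤ) (T : ℝ) :
    G d (T / 2) x y * G d (T / 2) y w ≤ ∫⁻ t in Ioc 0 T, ∫⁻ ω, (∫⁻ u in Ioc 0 t, nd y (Y u ω)) * nd w (Y t ω) ∂(Q x) := by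
  simp_rw [h.m1]
  have m1 := kk_meas h.dpos (measurableSet_Ioc (a := (0 : ℝ)) (b := T / 2)) x y
  have m2 := kk_meas h.dpos (measurableSet_Ioc (a := (0 : ℝ)) (b := T / 2)) y w
  rw [← kk_int2, ← kk_int2, ← conv_int _ _ m1 m2, lintegral_lintegral_swap (by fun_prop), ← lintegral_indicator measurableSet_Ioc]
  apply lintegral_mono
  intro t
  by_cases ht : t ∈ Ioc 0 T
  · simp only [indicator_of_mem ht]
    rw [← lintegral_indicator measurableSet_Ioc]
    apply lintegral_mono
    intro u
    by_cases h1 : u ∈ Ioc 0 (T / 2)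
    · by_cases h2 : t - u ∈ Ioc 0 (T / 2)
      · have h3 : u ∈ Ioc 0 t := ⟨h1.1, by linarith [h2.1]⟩
        simp only [kk, indicator_of_mem h1, indicator_of_mem h2, indicator_of_mem h3]
        exact le_rfl
      · simp [kk, indicator_of_notMem h2]
    · simp [kk, indicator_of_notMem h1]
  · simp only [indicator_of_notMem ht]
    rw [nonpos_iff_eq_zero]
    convert lintegral_zero with u
    by_cases h1 : u ∈ Ioc 0 (T / 2)
    · have h2 : t - u ∉ Ioc 0 (T / 2) := fun h2 => ht ⟨by linarith [h1.1, h2.1], by linarith [h1.2, h2.2]⟩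
      simp [kk, indicator_of_notMem h2]
    · simp [kk, indicator_of_notMem h1]

/-- three-fold kernel -/
noncomputable def k3 (T : ℝ) (x y w : Fin d → ℤ) (u u' t : ℝ) : ℝ≥0∞ :=
  kk (Icc 0 T) x y u * (kk (Icc 0 T) y y (u' - u) * kk (Icc 0 T) y w (t - u'))

lemma Wk.k3_bound (h : Wk d Q Y) (x y w : Fin d → ℤ) {T u u' t : ℝ} (hu : 0 < u) (huu : u ≤ u') (hut : u' ≤ t) (htT : t ≤ T) :
    ∫⁻ ω, nd y (Y u ω) * (nd y (Y u' ω) * nd w (Y t ω)) ∂(Q x) ≤ k3 T x y w u u' t := by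
  have := h.three hu.le (sub_nonneg.mpr huu) (sub_nonneg.mpr hut) x y y w
  simp only [add_sub_cancel] at this
  rw [this]
  unfold k3 kk
  rw [indicator_of_mem, indicator_of_mem, indicator_of_mem]
  all_goals constructor <;> linarith

lemma k3_meas (hd : 1 ≤ d) (T : ℝ) (x y w : Fin d → ℤ) :
    Measurable fun p : (ℝ × ℝ) × ℝ => k3 T x y w p.1.1 p.1.2 p.2 := by
  have m1 := kk_meas hd (measurableSet_Icc (a := (0 : ℝ)) (b := T)) x y
  have m2 := kk_meas hd (measurableSet_Icc (a := (0 : ℝ)) (b := T)) y y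
  have m3 := kk_meas hd (measurableSet_Icc (a := (0 : ℝ)) (b := T)) y w
  unfold k3
  fun_prop

lemma k3_int (hd : 1 ≤ d) (T : ℝ) (x y w : Fin d → ℤ) :
    ∫⁻ u, ∫⁻ u', ∫⁻ t, k3 T x y w u u' t = G d T x y * (G d T y y * G d T y w) := by
  have m1 := kk_meas hd (measurableSet_Icc (a := (0 : ℝ)) (b := T)) x y
  have m2 := kk_meas hd (measurableSet_Icc (a := (0 : ℝ)) (b := T)) y y
  have m3 := kk_meas hd (measurableSet_Icc (a := (0 : ℝ)) (b := T)) y w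
  unfold k3
  have e1 : ∀ u u', ∫⁻ t, kk (Icc 0 T) x y u * (kk (Icc 0 T) y y (u' - u) * kk (Icc 0 T) y w (t - u')) =
      kk (Icc 0 T) x y u * (kk (Icc 0 T) y y (u' - u) * G d T y w) := by
    intro u u'
    rw [lintegral_const_mul _ (f := fun t => kk (Icc 0 T) y y (u' - u) * kk (Icc 0 T) y w (t - u')) (by fun_prop),
      lintegral_const_mul _ (f := fun t => kk (Icc 0 T) y w (t - u')) (by fun_prop),
      lintegral_sub_right_eq_self (fun t => kk (Icc 0 T) y w t), kk_int]
  simp_rw [e1]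
  rw [conv_int _ (fun s => kk (Icc 0 T) y y s * G d T y w) m1 (by fun_prop), lintegral_mul_const _ m2, kk_int, kk_int]

lemma Wk.mom2 (h : Wk d Q Y) (x y w : Fin d → ℤ) (T : ℝ) :
    ∫⁻ t in Ioc 0 T, ∫⁻ ω, (∫⁻ u in Ioc 0 t, nd y (Y u ω)) * ((∫⁻ u in Ioc 0 t, nd y (Y u ω)) * nd w (Y t ω)) ∂(Q x)
      ≤ 2 * (G d T x y * (G d T y y * G d T y w)) := by
  have hk := k3_meas h.dpos T x y w
  have step : ∀ t ∈ Ioc 0 T, ∫⁻ ω, (∫⁻ u in Ioc 0 t, nd y (Y u ω)) * ((∫⁻ u in Ioc 0 t, nd y (Y u ω)) * nd w (Y t ω)) ∂(Q x)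
      ≤ 2 * ∫⁻ u, ∫⁻ u', k3 T x y w u u' t := by
    intro t ht
    have := h.prob x
    have e1 : ∀ ω, (∫⁻ u in Ioc 0 t, nd y (Y u ω)) * ((∫⁻ u in Ioc 0 t, nd y (Y u ω)) * nd w (Y t ω)) =
        ∫⁻ u in Ioc 0 t, ∫⁻ u' in Ioc 0 t, nd y (Y u ω) * (nd y (Y u' ω) * nd w (Y t ω)) := by
      intro ω
      have := h.nd_measL y ω
      rw [← lintegral_mul_const _ this]
      apply lintegral_congr
      intro u
      rw [← lintegral_mul_const _ this, lintegral_const_mul _ (by fun_prop)]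
    simp_rw [e1]
    have mm : Measurable fun p : (Ω × ℝ) × ℝ => nd y (Y p.1.2 p.1.1) * (nd y (Y p.2 p.1.1) * nd w (Y t p.1.1)) := by
      refine Measurable.mul ?_ (Measurable.mul ?_ ?_)
      · exact (h.nd_meas2 y).comp ((measurable_snd.comp measurable_fst).prodMk (measurable_fst.comp measurable_fst))
      · exact (h.nd_meas2 y).comp (measurable_snd.prodMk (measurable_fst.comp measurable_fst))
      · exact (h.nd_measR w t).comp (measurable_fst.comp measurable_fst)
    rw [lintegral_lintegral_swap mm.lintegral_prod_right.aemeasurable]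
    have e2 : ∀ u, ∫⁻ ω, (∫⁻ u' in Ioc 0 t, nd y (Y u ω) * (nd y (Y u' ω) * nd w (Y t ω))) ∂(Q x) =
        ∫⁻ u' in Ioc 0 t, ∫⁻ ω, nd y (Y u ω) * (nd y (Y u' ω) * nd w (Y t ω)) ∂(Q x) := by
      intro u
      apply lintegral_lintegral_swap
      exact (mm.comp (f := fun p : Ω × ℝ => ((p.1, u), p.2)) (by fun_prop)).aemeasurable
    simp_rw [e2]
    calc _ ≤ ∫⁻ u in Ioc 0 t, ∫⁻ u' in Ioc 0 t, (k3 T x y w u u' t + k3 T x y w u' u t) := by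
          apply setLIntegral_mono' measurableSet_Ioc
          intro u hu
          apply setLIntegral_mono' measurableSet_Ioc
          intro u' hu'
          rcases le_total u u' with hle | hle
          · exact (h.k3_bound x y w hu.1 hle hu'.2 ht.2).trans (le_add_right le_rfl)
          · refine le_trans ?_ (le_add_left le_rfl)
            refine le_trans (le_of_eq ?_) (h.k3_bound x y w hu'.1 hle hu.2 ht.2)
            congr 1; funext ω; ring
      _ ≤ ∫⁻ u, ∫⁻ u', (k3 T x y w u u' t + k3 T x y w u' u t) := by
          refine (setLIntegral_le_lintegral _ _).trans ?_
          exact lintegral_mono fun u => setLIntegral_le_lintegral _ _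
      _ = (∫⁻ u, ∫⁻ u', k3 T x y w u u' t) + ∫⁻ u, ∫⁻ u', k3 T x y w u' u t := by
          have n1 : Measurable fun p : ℝ × ℝ => k3 T x y w p.1 p.2 t :=
            hk.comp (f := fun p : ℝ × ℝ => ((p.1, p.2), t)) (by fun_prop)
          rw [← lintegral_add_left n1.lintegral_prod_right]
          apply lintegral_congr
          intro u
          exact lintegral_add_left (n1.comp (f := fun u' : ℝ => (u, u')) (by fun_prop)) _
      _ = _ := by
          have n2 : Measurable fun p : ℝ × ℝ => k3 T x y w p.2 p.1 t :=
            hk.comp (f := fun p : ℝ × ℝ => ((p.2, p.1), t)) (by fun_prop)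
          rw [lintegral_lintegral_swap (f := fun u u' => k3 T x y w u' u t) n2.aemeasurable, two_mul]
  calc _ ≤ ∫⁻ t in Ioc 0 T, 2 * ∫⁻ u, ∫⁻ u', k3 T x y w u u' t := setLIntegral_mono' measurableSet_Ioc step
    _ ≤ ∫⁻ t, 2 * ∫⁻ u, ∫⁻ u', k3 T x y w u u' t := setLIntegral_le_lintegral _ _
    _ = 2 * ∫⁻ t, ∫⁻ u, ∫⁻ u', k3 T x y w u u' t := lintegral_const_mul' _ _ (by simp)
    _ = 2 * ∫⁻ u, ∫⁻ u', ∫⁻ t, k3 T x y w u u' t := by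
        congr 1
        have n3 : Measurable fun p : (ℝ × ℝ) × ℝ => k3 T x y w p.1.2 p.2 p.1.1 :=
          hk.comp (f := fun p : (ℝ × ℝ) × ℝ => ((p.1.2, p.2), p.1.1)) (by fun_prop)
        rw [lintegral_lintegral_swap n3.lintegral_prod_right.aemeasurable]
        apply lintegral_congr
        intro u
        exact lintegral_lintegral_swap (n3.comp (f := fun p : ℝ × ℝ => ((p.1, u), p.2)) (by fun_prop)).aemeasurable
    _ = _ := by rw [k3_int h.dpos]

end

end LG
end Part15

section Part16
open MeasureTheory ProbabilityTheory Filter Set Topology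
open scoped ENNReal

namespace LG

section
variable {d : ℕ} {Ω : Type*} [MeasurableSpace Ω] {Q : (Fin d → ℤ) → Measure Ω}
  {Y : ℝ → Ω → (Fin d → ℤ)}

lemma Wk.AFset (h : Wk d Q Y) (v : (Fin d → ℤ) → ℝ) (a : ℝ) (w : Fin d → ℤ) :
    MeasurableSet {p : ℝ × Ω | a ≤ AF Y v p.1 p.2 ∧ Y p.1 p.2 = w} :=
  (measurableSet_le measurable_const (h.AF_meas2 v)).inter (h.meas (measurableSet_singleton w))

lemma Wk.AFset1 (h : Wk d Q Y) (v : (Fin d → ℤ) → ℝ) (a : ℝ) (w : Fin d → ℤ) (t : ℝ) :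
    MeasurableSet ({ω : Ω | a ≤ AF Y v t ω} ∩ {ω | Y t ω = w}) :=
  (measurableSet_le measurable_const (h.AF_meas v t)).inter (h.Ymeas t (measurableSet_singleton w))

lemma Wk.AFset_fun (h : Wk d Q Y) (v : (Fin d → ℤ) → ℝ) (a : ℝ) (x w : Fin d → ℤ) :
    Measurable fun t => Q x ({ω : Ω | a ≤ AF Y v t ω} ∩ {ω | Y t ω = w}) := by
  have := h.prob x
  exact measurable_measure_prodMk_left (h.AFset v a w)

lemma pz (L : ℝ≥0∞) {lam K : ℝ} (hK : 0 < K) (i : Prop) [Decidable i] :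
    L * (if i then 1 else 0) ≤ ENNReal.ofReal lam * (if 0 < L ∧ i then 1 else 0) +
      (ENNReal.ofReal K * (if ENNReal.ofReal lam ≤ L ∧ i then 1 else 0) + ENNReal.ofReal (1 / K) * (L * (L * (if i then 1 else 0)))) := by
  by_cases hi : i
  · simp only [hi, and_true, if_true, mul_one]
    by_cases h0 : 0 < L
    · rw [if_pos h0, mul_one]
      by_cases h1 : ENNReal.ofReal lam ≤ L
      · rw [if_pos h1, mul_one]
        by_cases h2 : L ≤ ENNReal.ofReal K
        · exact (h2.trans (le_add_right le_rfl)).trans (le_add_left le_rfl)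
        · refine (le_trans ?_ (le_add_left le_rfl)).trans (le_add_left le_rfl)
          push Not at h2
          rw [← mul_assoc]
          calc L = (ENNReal.ofReal (1 / K) * ENNReal.ofReal K) * L := by
                rw [← ENNReal.ofReal_mul (by positivity), one_div_mul_cancel hK.ne']; simp
            _ ≤ _ := by gcongr
      · push Not at h1
        exact h1.le.trans (le_add_right le_rfl)
    · have : L = 0 := by simpa using h0
      simp [this]
  · simp [hi]

lemma Wk.low_hit (h : Wk d Q Y) (hd : 3 ≤ d) : ∃ c : ℝ, 0 < c ∧ ∃ lam : ℝ, 0 < lam ∧ ∀ (y : Fin d → ℤ) (T : ℝ),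
    jb y ^ 2 ≤ c * T → ENNReal.ofReal (c * jb y ^ (4 - 2 * (d : ℝ))) ≤
      ∫⁻ t in Ioc 0 T, Q 0 ({ω | lam ≤ AF Y (({y} : Set (Fin d → ℤ)).indicator 1) t ω} ∩ {ω | Y t ω = 0}) := by
  classical
  obtain ⟨C, hC, hCG⟩ := G_high d hd
  obtain ⟨c, hc, hcG⟩ := G_low d h.dpos
  set E := Real.exp (2 * d) with hE
  have hEp : 0 < E := Real.exp_pos _
  set lam : ℝ := c ^ 2 / (4 * E * C ^ 2) with hlam
  set K : ℝ := 8 * C ^ 3 / c ^ 2 with hK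
  have hlp : 0 < lam := by positivity
  have hKp : 0 < K := by positivity
  refine ⟨min (c / 2) (c ^ 2 / (2 * K)), by positivity, lam, hlp, ?_⟩
  intro y T hT
  have hj := jb_pos y
  have hT0 : 0 < T := by
    by_contra hn
    push Not at hn
    have : min (c / 2) (c ^ 2 / (2 * K)) * T ≤ 0 := mul_nonpos_of_nonneg_of_nonpos (by positivity) hn
    nlinarith
  have hT2 : jb y ^ 2 ≤ c * (T / 2) := by
    have : min (c / 2) (c ^ 2 / (2 * K)) * T ≤ c / 2 * T := mul_le_mul_of_nonneg_right (min_le_left _ _) hT0.le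
    linarith
  set X := jb y ^ (4 - 2 * (d : ℝ)) with hX
  have hXp : 0 < X := by positivity
  have hXX : jb y ^ (2 - (d : ℝ)) * jb y ^ (2 - (d : ℝ)) = X := by
    rw [← Real.rpow_add hj, hX]; congr 1; ring
  have js : jb (0 - y) = jb y := by unfold jb; rw [zero_sub, norm_neg]
  have j0 : jb (y - 0) = jb y := by rw [sub_zero]
  have jy : jb (y - y) = 1 := by unfold jb; simp
  -- Green bounds
  have g1 : ENNReal.ofReal (c ^ 2 * X) ≤ G d (T / 2) 0 y * G d (T / 2) y 0 := by
    have a1 := hcG (T / 2) 0 y (by rw [j0]; exact hT2)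
    have a2 := hcG (T / 2) y 0 (by rw [js]; exact hT2)
    rw [j0] at a1; rw [js] at a2
    refine le_trans (le_of_eq ?_) (mul_le_mul' a1 a2)
    rw [← ENNReal.ofReal_mul (by positivity), ← hXX]; congr 1; ring
  have g2 : ∀ T T', G d T 0 y * G d T' y 0 ≤ ENNReal.ofReal (C ^ 2 * X) := by
    intro T T'
    have a1 := hCG T 0 y
    have a2 := hCG T' y 0
    rw [j0] at a1; rw [js] at a2
    refine (mul_le_mul' a1 a2).trans (le_of_eq ?_)
    rw [← ENNReal.ofReal_mul (by positivity), ← hXX]; congr 1; ring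
  have g3 : G d T 0 y * (G d T y y * G d T y 0) ≤ ENNReal.ofReal (C ^ 3 * X) := by
    have a1 := g2 T T
    have a2 := hCG T y y
    rw [jy, Real.one_rpow, mul_one] at a2
    calc _ = (G d T 0 y * G d T y 0) * G d T y y := by ring
      _ ≤ ENNReal.ofReal (C ^ 2 * X) * ENNReal.ofReal C := mul_le_mul' a1 a2
      _ = _ := by rw [← ENNReal.ofReal_mul (by positivity)]; congr 1; ring
  obtain ⟨ψ, hψm, hψ1, hψ2⟩ := h.hit2 {y} 0 0 hT0.le
  have hψ3 : ∫⁻ t in Ioc 0 T, ψ t ≤ ENNReal.ofReal (E * (C ^ 2 * X)) := by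
    refine hψ2.trans ?_
    rw [ENNReal.ofReal_mul hEp.le]
    gcongr
    rw [tsum_eq_single y]
    · rw [indicator_of_mem (mem_singleton y)]; exact g2 _ _
    · intro b hb; exact indicator_of_notMem (by simpa using hb) _
  set v : (Fin d → ℤ) → ℝ := ({y} : Set (Fin d → ℤ)).indicator 1 with hv
  have hv0 : ∀ x, 0 ≤ v x := fun x => indicator_nonneg (fun _ _ => zero_le_one) _
  have m1 := h.mom1 0 y 0 T
  have m2 := h.mom2 0 y 0 T
  simp_rw [← h.AF_nd y] at m1 m2
  set B := fun t => {ω | lam ≤ AF Y v t ω} ∩ {ω | Y t ω = 0} with hB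
  have nde : ∀ t ω, nd 0 (Y t ω) = if Y t ω = 0 then (1 : ℝ≥0∞) else 0 := by
    intro t ω; simp [nd, indicator]
  have key : ∀ t ∈ Ioc 0 T, ∫⁻ ω, ENNReal.ofReal (AF Y v t ω) * nd 0 (Y t ω) ∂(Q 0) ≤ ENNReal.ofReal lam * ψ t +
      (ENNReal.ofReal K * Q 0 (B t) + ENNReal.ofReal (1 / K) * ∫⁻ ω, ENNReal.ofReal (AF Y v t ω) * (ENNReal.ofReal (AF Y v t ω) * nd 0 (Y t ω)) ∂(Q 0)) := by
    intro t ht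
    set A : Set Ω := {ω | 0 < AF Y v t ω} ∩ {ω | Y t ω = 0} with hA
    have mA : MeasurableSet A := (measurableSet_lt measurable_const (h.AF_meas v t)).inter (h.Ymeas t (measurableSet_singleton 0))
    have mB : MeasurableSet (B t) := h.AFset1 v lam 0 t
    have hAH : Q 0 A ≤ ψ t := by
      refine (measure_mono ?_).trans (hψ1 t ht)
      rintro ω ⟨h1, h2⟩
      refine ⟨?_, h2⟩
      by_contra hn
      have hz : AF Y v t ω = 0 := by
        unfold AF
        rw [integral_Ioc_eq_integral_Ioo]
        apply setIntegral_eq_zero_of_forall_eq_zero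
        intro u hu
        have : Y u ω ∉ ({y} : Set (Fin d → ℤ)) := fun hy => hn ⟨u, hu, hy⟩
        exact indicator_of_notMem this _
      exact absurd h1 (by show ¬ (0 < AF Y v t ω); rw [hz]; exact lt_irrefl _)
    calc _ ≤ ∫⁻ ω, (ENNReal.ofReal lam * A.indicator 1 ω + (ENNReal.ofReal K * (B t).indicator 1 ω +
            ENNReal.ofReal (1 / K) * (ENNReal.ofReal (AF Y v t ω) * (ENNReal.ofReal (AF Y v t ω) * nd 0 (Y t ω))))) ∂(Q 0) := by
          apply lintegral_mono
          intro ω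
          have := pz (ENNReal.ofReal (AF Y v t ω)) (lam := lam) hKp (Y t ω = 0)
          simp only [nde]
          refine this.trans (le_of_eq ?_)
          congr 2
          · simp [indicator, hA, ENNReal.ofReal_pos]
          · congr 1
            simp [indicator, hB, ENNReal.ofReal_le_ofReal_iff (AF_nonneg hv0 t ω)]
      _ = ENNReal.ofReal lam * Q 0 A +
      (ENNReal.ofReal K * Q 0 (B t) + ENNReal.ofReal (1 / K) * ∫⁻ ω, ENNReal.ofReal (AF Y v t ω) * (ENNReal.ofReal (AF Y v t ω) * nd 0 (Y t ω)) ∂(Q 0)) := by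
          rw [lintegral_add_left ((measurable_one.indicator mA).const_mul _), lintegral_add_left ((measurable_one.indicator mB).const_mul _),
            lintegral_const_mul _ (measurable_one.indicator mA), lintegral_const_mul _ (measurable_one.indicator mB),
            lintegral_const_mul' _ _ ENNReal.ofReal_ne_top, lintegral_indicator_one mA, lintegral_indicator_one mB]
      _ ≤ _ := by gcongr
  have tot : ENNReal.ofReal (c ^ 2 * X) ≤ ENNReal.ofReal (c ^ 2 * X / 2) + ENNReal.ofReal K * ∫⁻ t in Ioc 0 T, Q 0 (B t) := by
    calc _ ≤ _ := g1.trans m1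
      _ ≤ ∫⁻ t in Ioc 0 T, (ENNReal.ofReal lam * ψ t +
      (ENNReal.ofReal K * Q 0 (B t) + ENNReal.ofReal (1 / K) * ∫⁻ ω, ENNReal.ofReal (AF Y v t ω) * (ENNReal.ofReal (AF Y v t ω) * nd 0 (Y t ω)) ∂(Q 0))) :=
          setLIntegral_mono' measurableSet_Ioc key
      _ = ENNReal.ofReal lam * (∫⁻ t in Ioc 0 T, ψ t) + (ENNReal.ofReal K * (∫⁻ t in Ioc 0 T, Q 0 (B t)) + ENNReal.ofReal (1 / K) * 
            ∫⁻ t in Ioc 0 T, ∫⁻ ω, ENNReal.ofReal (AF Y v t ω) * (ENNReal.ofReal (AF Y v t ω) * nd 0 (Y t ω)) ∂(Q 0)) := by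
          rw [lintegral_add_left (hψm.const_mul _), lintegral_add_left ((h.AFset_fun v lam 0 0).const_mul _),
            lintegral_const_mul _ hψm, lintegral_const_mul _ (h.AFset_fun v lam 0 0),
            lintegral_const_mul' _ _ ENNReal.ofReal_ne_top]
      _ ≤ ENNReal.ofReal lam * ENNReal.ofReal (E * (C ^ 2 * X)) + (ENNReal.ofReal K * (∫⁻ t in Ioc 0 T, Q 0 (B t)) + ENNReal.ofReal (1 / K) * 
            (2 * ENNReal.ofReal (C ^ 3 * X))) := by
          gcongr
          exact m2.trans (by gcongr)
      _ = _ := by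
          have e2 : (2 : ℝ≥0∞) = ENNReal.ofReal 2 := by simp
          rw [e2, ← ENNReal.ofReal_mul (by positivity), ← ENNReal.ofReal_mul (by positivity), ← ENNReal.ofReal_mul (by positivity)]
          rw [add_left_comm, ← ENNReal.ofReal_add (by positivity) (by positivity), add_comm]
          congr 2
          rw [hlam, hK]; field_simp; norm_num
  have e4 : ENNReal.ofReal (c ^ 2 * X) = ENNReal.ofReal (c ^ 2 * X / 2) + ENNReal.ofReal (c ^ 2 * X / 2) := by
    rw [← ENNReal.ofReal_add (by positivity) (by positivity)]; congr 1; ring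
  rw [e4] at tot
  have t2 := (ENNReal.add_le_add_iff_left ENNReal.ofReal_ne_top).mp tot
  calc _ ≤ ENNReal.ofReal (1 / K * (c ^ 2 * X / 2)) := by
        apply ENNReal.ofReal_le_ofReal
        calc _ ≤ c ^ 2 / (2 * K) * X := mul_le_mul_of_nonneg_right (min_le_right _ _) hXp.le
          _ = _ := by field_simp
    _ = ENNReal.ofReal (1 / K) * ENNReal.ofReal (c ^ 2 * X / 2) := ENNReal.ofReal_mul (by positivity)
    _ ≤ ENNReal.ofReal (1 / K) * (ENNReal.ofReal K * ∫⁻ t in Ioc 0 T, Q 0 (B t)) := by gcongr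
    _ = _ := by
        rw [← mul_assoc, ← ENNReal.ofReal_mul (by positivity), one_div_mul_cancel hKp.ne', ENNReal.ofReal_one, one_mul]

end

end LG
end Part16

section Part17
open MeasureTheory ProbabilityTheory Filter Set Topology
open scoped ENNReal

namespace LG

lemma chern {ι Ωz : Type*} [MeasurableSpace Ωz] {μ : Measure Ωz} (X : ι → Ωz → ℝ) (hX : iIndepFun X μ)
    (hm : ∀ i, Measurable (X i)) (F : Finset ι) (b : ι → ℝ)
    (hb : ∀ i ∈ F, ∫⁻ ω, ENNReal.ofReal (Real.exp (X i ω)) ∂μ ≤ ENNReal.ofReal (Real.exp (b i))) (s : ℝ) :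
    μ {ω | ∑ i ∈ F, b i + s ≤ ∑ i ∈ F, X i ω} ≤ ENNReal.ofReal (Real.exp (-s)) := by
  have h1 : ∫⁻ ω, ∏ i ∈ F, ENNReal.ofReal (Real.exp (X i ω)) ∂μ ≤ ENNReal.ofReal (Real.exp (∑ i ∈ F, b i)) := by
    rw [lintegral_prod_eq_prod_lintegral_of_indepFun F (fun i ω => ENNReal.ofReal (Real.exp (X i ω)))
      (hX.comp (fun _ t => ENNReal.ofReal (Real.exp t)) (fun _ => by fun_prop)) (fun i => by have := hm i; fun_prop)]
    rw [Real.exp_sum, ENNReal.ofReal_prod_of_nonneg (fun i _ => (Real.exp_pos _).le)]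
    exact Finset.prod_le_prod' hb
  have h2 : ∀ ω, ∏ i ∈ F, ENNReal.ofReal (Real.exp (X i ω)) = ENNReal.ofReal (Real.exp (∑ i ∈ F, X i ω)) := by
    intro ω
    rw [Real.exp_sum, ENNReal.ofReal_prod_of_nonneg (fun i _ => (Real.exp_pos _).le)]
  simp_rw [h2] at h1
  set B := ∑ i ∈ F, b i
  calc _ ≤ μ {ω | ENNReal.ofReal (Real.exp (B + s)) ≤ ENNReal.ofReal (Real.exp (∑ i ∈ F, X i ω))} := by
        apply measure_mono
        intro ω hω
        exact ENNReal.ofReal_le_ofReal (Real.exp_le_exp.mpr hω)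
    _ ≤ (∫⁻ ω, ENNReal.ofReal (Real.exp (∑ i ∈ F, X i ω)) ∂μ) / ENNReal.ofReal (Real.exp (B + s)) := by
        apply meas_ge_le_lintegral_div
        · have : Measurable fun ω => ∑ i ∈ F, X i ω := Finset.measurable_fun_sum F (fun i _ => hm i)
          fun_prop
        · simpa using Real.exp_pos _
        · exact ENNReal.ofReal_ne_top
    _ ≤ ENNReal.ofReal (Real.exp B) / ENNReal.ofReal (Real.exp (B + s)) := by gcongr
    _ = _ := by
        rw [← ENNReal.ofReal_div_of_pos (Real.exp_pos _), ← Real.exp_sub]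
        congr 2; ring

section
variable {d : ℕ} {α : ℝ} {Ωz : Type*} [MeasurableSpace Ωz] {μ : Measure Ωz} {z : (Fin d → ℤ) → Ωz → ℝ}

lemma exp_le_lin {x : ℝ} (h0 : 0 ≤ x) (h1 : x ≤ 1) : Real.exp x ≤ 1 + 2 * x := by
  have h := Real.abs_exp_sub_one_sub_id_le (x := x) (by rw [abs_of_nonneg h0]; exact h1)
  rw [abs_le] at h
  nlinarith [h.2]

lemma exp_neg_le_lin {x : ℝ} (h0 : 0 ≤ x) (h1 : x ≤ 1) : Real.exp (-x) ≤ 1 - x / 2 := by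
  have h := Real.abs_exp_sub_one_sub_id_le (x := -x) (by rw [abs_neg, abs_of_nonneg h0]; exact h1)
  rw [abs_le] at h
  have h3 : Real.exp (-x) ≤ 1 / (1 + x) := by
    rw [Real.exp_neg, ← one_div]
    apply one_div_le_one_div_of_le (by linarith)
    linarith [Real.add_one_le_exp x]
  refine h3.trans ?_
  rw [div_le_iff₀ (by linarith)]
  nlinarith

lemma chern_up (hz : IsScenery d α μ z) (f : ℝ → ℝ) (hf : Measurable f) {Mx W e : ℝ} (hM : 0 < Mx) (hW : 0 < W)
    (hf0 : ∀ r, 0 ≤ f r) (hf1 : ∀ r, f r ≤ Mx) (he0 : 0 ≤ e)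
    (he : ∫⁻ ω, ENNReal.ofReal (f (z 0 ω)) ∂μ ≤ ENNReal.ofReal e)
    (F : Finset (Fin d → ℤ)) (w : (Fin d → ℤ) → ℝ) (hw0 : ∀ y ∈ F, 0 ≤ w y) (hw1 : ∀ y ∈ F, w y ≤ W) (s : ℝ) :
    μ {ω | W * Mx * s + 2 * e * ∑ y ∈ F, w y ≤ ∑ y ∈ F, w y * f (z y ω)} ≤ ENNReal.ofReal (Real.exp (-s)) := by
  have := hz.prob
  set θ : ℝ := 1 / (W * Mx) with hθ
  have hθp : 0 < θ := by positivity
  have key := chern (μ := μ) (fun y ω => θ * w y * f (z y ω))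
    (hz.indep.comp (fun y t => θ * w y * f t) (fun y => by fun_prop))
    (fun y => by have := hz.meas y; fun_prop) F (fun y => 2 * (θ * w y * e)) ?_ s
  · refine (measure_mono ?_).trans key
    intro ω hω
    have hω' : W * Mx * s + 2 * e * ∑ y ∈ F, w y ≤ ∑ y ∈ F, w y * f (z y ω) := hω
    show ∑ y ∈ F, 2 * (θ * w y * e) + s ≤ ∑ y ∈ F, θ * w y * f (z y ω)
    have e1 : ∑ y ∈ F, 2 * (θ * w y * e) + s = θ * (W * Mx * s + 2 * e * ∑ y ∈ F, w y) := by
      rw [mul_add, ← mul_assoc θ (2 * e), Finset.mul_sum]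
      have : θ * (W * Mx * s) = s := by rw [hθ]; field_simp
      rw [this, add_comm]
      congr 1
      exact Finset.sum_congr rfl fun y _ => by ring
    have e2 : ∑ y ∈ F, θ * w y * f (z y ω) = θ * ∑ y ∈ F, w y * f (z y ω) := by
      rw [Finset.mul_sum]; exact Finset.sum_congr rfl fun y _ => by ring
    rw [e1, e2]
    exact mul_le_mul_of_nonneg_left hω' hθp.le
  · intro y hy
    have h0 := hw0 y hy
    have h1 := hw1 y hy
    have e0 : ∫⁻ ω, ENNReal.ofReal (f (z y ω)) ∂μ ≤ ENNReal.ofReal e := by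
      refine le_trans (le_of_eq ?_) he
      have := (hz.ident y).comp (u := fun t => ENNReal.ofReal (f t)) (by fun_prop)
      exact this.lintegral_eq
    calc _ ≤ ∫⁻ ω, (1 + ENNReal.ofReal (2 * (θ * w y)) * ENNReal.ofReal (f (z y ω))) ∂μ := by
          apply lintegral_mono
          intro ω
          have a0 : 0 ≤ θ * w y * f (z y ω) := by have := hf0 (z y ω); positivity
          have a1 : θ * w y * f (z y ω) ≤ 1 := by
            calc _ ≤ θ * W * Mx := by
                  have := hf0 (z y ω); have := hf1 (z y ω); gcongr
              _ = 1 := by rw [hθ]; field_simp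
          show ENNReal.ofReal _ ≤ 1 + ENNReal.ofReal _ * ENNReal.ofReal _
          rw [← ENNReal.ofReal_one, ← ENNReal.ofReal_mul (by positivity), ← ENNReal.ofReal_add (by norm_num) (by nlinarith)]
          apply ENNReal.ofReal_le_ofReal
          linarith [exp_le_lin a0 a1]
      _ ≤ 1 + ENNReal.ofReal (2 * (θ * w y)) * ENNReal.ofReal e := by
          rw [lintegral_add_left measurable_const, lintegral_const_mul' _ _ ENNReal.ofReal_ne_top]
          simp only [lintegral_const, measure_univ, mul_one]
          gcongr
      _ ≤ _ := by
          rw [← ENNReal.ofReal_one, ← ENNReal.ofReal_mul (by positivity), ← ENNReal.ofReal_add (by norm_num) (by positivity)]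
          apply ENNReal.ofReal_le_ofReal
          have := Real.add_one_le_exp (2 * (θ * w y * e))
          linarith

lemma chern_lo (hz : IsScenery d α μ z) (B : Set ℝ) (hB : MeasurableSet B) {W ρ : ℝ} (hW : 0 < W) (hρ0 : 0 ≤ ρ)
    (hρ : ENNReal.ofReal ρ ≤ μ {ω | z 0 ω ∈ B})
    (F : Finset (Fin d → ℤ)) (w : (Fin d → ℤ) → ℝ) (hw0 : ∀ y ∈ F, 0 ≤ w y) (hw1 : ∀ y ∈ F, w y ≤ W) :
    μ {ω | ∑ y ∈ F, w y * B.indicator 1 (z y ω) ≤ ρ * (∑ y ∈ F, w y) / 4} ≤ ENNReal.ofReal (Real.exp (-(ρ * (∑ y ∈ F, w y) / (4 * W)))) := by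
  have := hz.prob
  set θ : ℝ := 1 / W with hθ
  have hθp : 0 < θ := by positivity
  have mB : Measurable (B.indicator (1 : ℝ → ℝ)) := measurable_one.indicator hB
  have key := chern (μ := μ) (fun y ω => -(θ * w y) * B.indicator (1 : ℝ → ℝ) (z y ω))
    (hz.indep.comp (fun y t => -(θ * w y) * B.indicator (1 : ℝ → ℝ) t) (fun y => mB.const_mul _))
    (fun y => (mB.comp (hz.meas y)).const_mul _) F (fun y => -(θ * w y * ρ / 2)) ?_ (ρ * (∑ y ∈ F, w y) / (4 * W))
  · refine (measure_mono ?_).trans key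
    intro ω hω
    have hω' : ∑ y ∈ F, w y * B.indicator 1 (z y ω) ≤ ρ * (∑ y ∈ F, w y) / 4 := hω
    show ∑ y ∈ F, -(θ * w y * ρ / 2) + ρ * (∑ y ∈ F, w y) / (4 * W) ≤ ∑ y ∈ F, -(θ * w y) * B.indicator (1 : ℝ → ℝ) (z y ω)
    have e1 : ∑ y ∈ F, -(θ * w y * ρ / 2) = -(θ * ρ / 2) * ∑ y ∈ F, w y := by
      rw [Finset.mul_sum]; exact Finset.sum_congr rfl fun y _ => by ring
    have e2 : ∑ y ∈ F, -(θ * w y) * B.indicator (1 : ℝ → ℝ) (z y ω) = -θ * ∑ y ∈ F, w y * B.indicator 1 (z y ω) := by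
      rw [Finset.mul_sum]; exact Finset.sum_congr rfl fun y _ => by ring
    have e3 : ρ * (∑ y ∈ F, w y) / (4 * W) = θ * (ρ * (∑ y ∈ F, w y) / 4) := by rw [hθ]; field_simp
    rw [e1, e2, e3]
    nlinarith [mul_le_mul_of_nonneg_left hω' hθp.le]
  · intro y hy
    have h0 := hw0 y hy
    have h1 := hw1 y hy
    set x := θ * w y with hx
    have x0 : 0 ≤ x := by positivity
    have x1 : x ≤ 1 := by
      calc x ≤ θ * W := by rw [hx]; gcongr
        _ = 1 := by rw [hθ]; field_simp
    have hid : μ {ω | z 0 ω ∈ B} = μ {ω | z y ω ∈ B} := ((hz.ident y).symm.measure_mem_eq hB)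
    have mS : MeasurableSet {ω | z y ω ∈ B} := hz.meas y hB
    set p := μ {ω | z y ω ∈ B} with hp
    have hp1 : p ≤ 1 := prob_le_one
    have hpt : p ≠ ⊤ := (hp1.trans_lt ENNReal.one_lt_top).ne
    have e5 : ∀ ω, Real.exp (-x * B.indicator (1 : ℝ → ℝ) (z y ω)) = 1 - (1 - Real.exp (-x)) * {ω | z y ω ∈ B}.indicator 1 ω := by
      intro ω
      by_cases hb : z y ω ∈ B
      · simp [indicator, hb]
      · simp [indicator, hb]
    have hex : Real.exp (-x) ≤ 1 := Real.exp_le_one_iff.mpr (by linarith)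
    rw [← ofReal_integral_eq_lintegral_ofReal]
    · apply ENNReal.ofReal_le_ofReal
      simp_rw [e5]
      rw [integral_sub (integrable_const _), integral_const_mul, integral_indicator_one mS]
      · have hpr : ρ ≤ μ.real {ω | z y ω ∈ B} := by
          rw [hid] at hρ
          exact (ENNReal.ofReal_le_iff_le_toReal hpt).mp hρ
        have a1 := exp_neg_le_lin x0 x1
        have a2 := Real.add_one_le_exp (-(x * ρ / 2))
        simp only [integral_const, probReal_univ, smul_eq_mul, mul_one]
        have : x / 2 * ρ ≤ (1 - Real.exp (-x)) * μ.real {ω | z y ω ∈ B} := by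
          apply mul_le_mul _ hpr hρ0 (by linarith)
          linarith
        linarith
      · exact ((integrable_const (1 : ℝ)).indicator mS).const_mul _
    · refine Integrable.of_bound (C := 1) ?_ (Eventually.of_forall fun ω => ?_)
      · exact (Real.measurable_exp.comp ((mB.comp (hz.meas y)).const_mul _)).aestronglyMeasurable
      · rw [Real.norm_eq_abs, abs_of_pos (Real.exp_pos _), Real.exp_le_one_iff]
        have : 0 ≤ B.indicator (1 : ℝ → ℝ) (z y ω) := indicator_nonneg (fun _ _ => zero_le_one) _
        nlinarith
    · exact Eventually.of_forall fun ω => (Real.exp_pos _).le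

end

end LG
end Part17

section Part18
open MeasureTheory ProbabilityTheory Filter Set Topology
open scoped ENNReal

namespace LG

lemma ev_pow {a b : ℝ} (h : a < b) (C : ℝ) : ∀ᶠ n : ℕ in atTop, C * (n : ℝ) ^ a ≤ (n : ℝ) ^ b := by
  have h1 : Tendsto (fun n : ℕ => (n : ℝ) ^ (b - a)) atTop atTop :=
    (tendsto_rpow_atTop (by linarith)).comp tendsto_natCast_atTop_atTop
  filter_upwards [h1.eventually_ge_atTop C, eventually_gt_atTop 0] with n hn hn0
  have hp : (0 : ℝ) < n := by exact_mod_cast hn0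
  calc C * (n : ℝ) ^ a ≤ (n : ℝ) ^ (b - a) * (n : ℝ) ^ a := by gcongr
    _ = _ := by rw [← Real.rpow_add hp]; ring_nf

lemma ev_exp {c e : ℝ} (hc : 0 < c) (he : 0 < e) (C k K : ℝ) :
    ∀ᶠ n : ℕ in atTop, C * (n : ℝ) ^ k * Real.exp (-(c * (n : ℝ) ^ e)) ≤ (n : ℝ) ^ (-K) := by
  have h0 : Tendsto (fun x : ℝ => x ^ ((K + k + 1) / e) * Real.exp (-c * x)) atTop (𝓝 0) :=
    tendsto_rpow_mul_exp_neg_mul_atTop_nhds_zero _ _ hc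
  have h1 : Tendsto (fun n : ℕ => (n : ℝ) ^ e) atTop atTop :=
    (tendsto_rpow_atTop he).comp tendsto_natCast_atTop_atTop
  have h2 := h0.comp h1
  filter_upwards [h2.eventually_le_const (show (0 : ℝ) < 1 by norm_num), eventually_gt_atTop 0,
    ev_pow (show (-K - 1) < -K by linarith) (max C 0)] with n hn hn0 hn1
  have hp : (0 : ℝ) < n := by exact_mod_cast hn0
  simp only [Function.comp] at hn
  rw [← Real.rpow_mul hp.le, mul_div_cancel₀ _ he.ne'] at hn
  have h3 : (n : ℝ) ^ k * Real.exp (-(c * (n : ℝ) ^ e)) ≤ (n : ℝ) ^ (-K - 1) := by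
    have : (n : ℝ) ^ k = (n : ℝ) ^ (-K - 1) * (n : ℝ) ^ (K + k + 1) := by
      rw [← Real.rpow_add hp]; ring_nf
    rw [this, mul_assoc]
    rw [neg_mul] at hn
    have h4 : (0 : ℝ) ≤ (n : ℝ) ^ (-K - 1) := by positivity
    nlinarith
  calc C * (n : ℝ) ^ k * Real.exp (-(c * (n : ℝ) ^ e)) ≤ max C 0 * ((n : ℝ) ^ k * Real.exp (-(c * (n : ℝ) ^ e))) := by
        rw [mul_assoc]; exact mul_le_mul_of_nonneg_right (le_max_left _ _) (by positivity)
    _ ≤ max C 0 * (n : ℝ) ^ (-K - 1) := by gcongr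
    _ ≤ _ := hn1

lemma bc {Ωz : Type*} [MeasurableSpace Ωz] {μ : Measure Ωz} [IsProbabilityMeasure μ] (E : ℕ → Set Ωz)
    (h : ∀ᶠ n : ℕ in atTop, μ (E n) ≤ ENNReal.ofReal ((n : ℝ) ^ (-2 : ℝ))) :
    ∀ᵐ ζ ∂μ, ∀ᶠ n in atTop, ζ ∉ E n := by
  obtain ⟨N, hN⟩ := eventually_atTop.1 h
  have h1 := ae_eventually_notMem (μ := μ) (s := fun n => if N ≤ n then E n else ∅) ?_
  · filter_upwards [h1] with ζ hζ
    filter_upwards [hζ, eventually_ge_atTop N] with n hn hn2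
    simpa [hn2] using hn
  · have h2 : Summable (fun n : ℕ => (n : ℝ) ^ (-2 : ℝ)) := Real.summable_nat_rpow.2 (by norm_num)
    refine ne_top_of_le_ne_top (h2.tsum_ofReal_ne_top) ?_
    refine ENNReal.tsum_le_tsum fun n => ?_
    by_cases hn : N ≤ n
    · simpa [hn] using hN n hn
    · simp [hn]

section
variable {d : ℕ} {α : ℝ} {Ωz : Type*} [MeasurableSpace Ωz] {μ : Measure Ωz} {z : (Fin d → ℤ) → Ωz → ℝ}

lemma tail_up (hz : IsScenery d α μ z) {β : ℝ} (hβ0 : 0 < β) (hβ : β < α) :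
    ∃ C : ℝ, 0 < C ∧ ∀ r : ℝ, 0 < r → μ {ω | r < z 0 ω} ≤ ENNReal.ofReal (C * r ^ (-β)) := by
  have := hz.prob
  have h1 := hz.tail.eventually_lt_const (show -α < -β by linarith)
  obtain ⟨r0, h2⟩ := eventually_atTop.1 (h1.and (eventually_gt_atTop (1 : ℝ)))
  set r1 := max r0 1 with hr1
  have hr1p : 0 < r1 := by positivity
  refine ⟨max 1 (r1 ^ β), by positivity, fun r hr => ?_⟩
  by_cases hrr : r1 ≤ r
  · obtain ⟨h3, h4⟩ := h2 r ((le_max_left _ _).trans hrr)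
    have hl := Real.log_pos h4
    rw [div_lt_iff₀ hl] at h3
    rw [← ENNReal.ofReal_toReal (measure_ne_top μ {ω | r < z 0 ω})]
    apply ENNReal.ofReal_le_ofReal
    have h5 : (μ {ω | r < z 0 ω}).toReal ≤ r ^ (-β) := by
      rcases eq_or_lt_of_le (ENNReal.toReal_nonneg (a := μ {ω | r < z 0 ω})) with h | h
      · rw [← h]; positivity
      · rw [← Real.log_le_log_iff h (by positivity), Real.log_rpow hr]; exact h3.le
    refine h5.trans ?_
    have : (0 : ℝ) ≤ r ^ (-β) := by positivity
    nlinarith [le_max_left 1 (r1 ^ β)]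
  · push Not at hrr
    refine prob_le_one.trans ?_
    rw [← ENNReal.ofReal_one]
    apply ENNReal.ofReal_le_ofReal
    calc (1 : ℝ) = r ^ β * r ^ (-β) := by rw [← Real.rpow_add hr]; simp
      _ ≤ max 1 (r1 ^ β) * r ^ (-β) := by
        gcongr
        exact (Real.rpow_le_rpow hr.le hrr.le hβ0.le).trans (le_max_right _ _)

lemma tail_lo (hz : IsScenery d α μ z) (hα : 0 < α) {β : ℝ} (hβ : α < β) :
    ∀ᶠ r : ℝ in atTop, ENNReal.ofReal (r ^ (-β)) ≤ μ {ω | r < z 0 ω} := by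
  have := hz.prob
  filter_upwards [hz.tail.eventually_const_lt (show -β < -α by linarith),
    hz.tail.eventually_lt_const (show -α < 0 by linarith), eventually_gt_atTop (1 : ℝ)] with r h1 h2 h3
  have hl := Real.log_pos h3
  rw [lt_div_iff₀ hl] at h1
  have h4 : 0 < (μ {ω | r < z 0 ω}).toReal := by
    rcases eq_or_lt_of_le (ENNReal.toReal_nonneg (a := μ {ω | r < z 0 ω})) with h | h
    · rw [← h] at h2; simp at h2
    · exact h
  rw [← ENNReal.ofReal_toReal (measure_ne_top μ {ω | r < z 0 ω})]
  apply ENNReal.ofReal_le_ofReal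
  rw [← Real.log_le_log_iff (by positivity) h4, Real.log_rpow (by linarith)]
  exact h1.le

noncomputable def tr (M : ℝ) (r : ℝ) : ℝ := (Icc 0 M).indicator id r

lemma tr_meas (M : ℝ) : Measurable (tr M) := measurable_id.indicator measurableSet_Icc
lemma tr_nonneg (M r : ℝ) : 0 ≤ tr M r := by
  unfold tr; apply indicator_nonneg; intro x hx; exact hx.1
lemma tr_le {M : ℝ} (hM : 0 ≤ M) (r : ℝ) : tr M r ≤ M := by
  unfold tr; by_cases h : r ∈ Icc 0 M
  · rw [indicator_of_mem h]; exact h.2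
  · rw [indicator_of_notMem h]; exact hM

lemma tr_mean (hz : IsScenery d α μ z) {β : ℝ} (hβ0 : 0 < β) (hβ : β < α) (hβ1 : β < 1) :
    ∃ C : ℝ, 0 < C ∧ ∀ M : ℝ, 0 < M → ∫⁻ ω, ENNReal.ofReal (tr M (z 0 ω)) ∂μ ≤ ENNReal.ofReal (C * M ^ (1 - β)) := by
  obtain ⟨C, hC, h⟩ := tail_up hz hβ0 hβ
  refine ⟨C / (1 - β), div_pos hC (by linarith), fun M hM => ?_⟩
  rw [lintegral_eq_lintegral_meas_lt μ (Eventually.of_forall fun ω => tr_nonneg M _)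
    ((tr_meas M).comp (hz.meas 0)).aemeasurable]
  calc ∫⁻ t in Ioi 0, μ {ω | t < tr M (z 0 ω)} ≤ ∫⁻ t in Ioi 0, (Ioc 0 M).indicator (fun t => ENNReal.ofReal C * ENNReal.ofReal (t ^ ((1 - β) - 1))) t := by
        apply setLIntegral_mono' measurableSet_Ioi
        intro t ht
        by_cases htM : t ≤ M
        · rw [indicator_of_mem (show t ∈ Ioc 0 M from ⟨ht, htM⟩)]
          rw [← ENNReal.ofReal_mul hC.le]
          refine (measure_mono ?_).trans ((h t ht).trans_eq (by ring_nf))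
          intro ω hω
          simp only [mem_ofPred_eq] at hω ⊢
          refine hω.trans_le ?_
          unfold tr
          by_cases hh : z 0 ω ∈ Icc 0 M
          · rw [indicator_of_mem hh]; rfl
          · rw [indicator_of_notMem hh]; exact hz.nonneg 0 ω
        · push Not at htM
          have : {ω | t < tr M (z 0 ω)} = ∅ := by
            ext ω; simp only [mem_ofPred_eq, mem_empty_iff_false, iff_false, not_lt]
            exact (tr_le hM.le _).trans htM.le
          rw [this]; simp
    _ = ∫⁻ t in Ioc 0 M, ENNReal.ofReal C * ENNReal.ofReal (t ^ ((1 - β) - 1)) := by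
        rw [lintegral_indicator measurableSet_Ioc, Measure.restrict_restrict measurableSet_Ioc]
        congr 2
        ext t; simp
    _ = ENNReal.ofReal C * ENNReal.ofReal (M ^ (1 - β) / (1 - β)) := by
        rw [lintegral_const_mul _ (by fun_prop), lint_rpow (by linarith) hM.le]
    _ = _ := by rw [← ENNReal.ofReal_mul hC.le]; congr 1; ring

lemma meas_z (hz : IsScenery d α μ z) (y : Fin d → ℤ) (B : Set ℝ) (hB : MeasurableSet B) : μ {ω | z y ω ∈ B} = μ {ω | z 0 ω ∈ B} :=
  (hz.ident y).measure_mem_eq hB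

lemma growth (hz : IsScenery d α μ z) (hd : 1 ≤ d) (hα : 0 < α) {κ : ℝ} (hκ : (d : ℝ) / α < κ) :
    ∀ᵐ ω ∂μ, ∃ C : ℝ, 0 < C ∧ ∀ y, z y ω ≤ C * jb y ^ κ := by
  have hdp : (0 : ℝ) < d := by exact_mod_cast hd
  have hκp : 0 < κ := (by positivity : 0 < (d : ℝ) / α).trans hκ
  obtain ⟨β, h1, h2⟩ := exists_between (show (d : ℝ) / κ < α by rw [div_lt_iff₀ hα] at hκ; rw [div_lt_iff₀ hκp]; linarith)
  have hβ0 : 0 < β := (by positivity : 0 < (d : ℝ) / κ).trans h1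
  obtain ⟨C, hC, h⟩ := tail_up hz hβ0 h2
  have h3 := ae_finite_setOf_mem (μ := μ) (s := fun y : Fin d → ℤ => {ω | jb y ^ κ < z y ω}) ?_
  · filter_upwards [h3] with ω hω
    obtain ⟨C', hC'⟩ := (hω.image (fun y => z y ω)).bddAbove
    refine ⟨max C' 1, by positivity, fun y => ?_⟩
    have hj : 1 ≤ jb y ^ κ := Real.one_le_rpow (one_le_jb y) hκp.le
    by_cases hy : jb y ^ κ < z y ω
    · have := hC' ⟨y, hy, rfl⟩
      simp only at this
      nlinarith [le_max_left C' 1, le_max_right C' 1]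
    · push Not at hy
      nlinarith [le_max_left C' 1, le_max_right C' 1]
  · have h4 := jb_tsum d (s := κ * β) (by rw [div_lt_iff₀ hκp] at h1; linarith)
    refine ne_top_of_le_ne_top (ENNReal.mul_ne_top ENNReal.ofReal_ne_top h4 : ENNReal.ofReal C * _ ≠ ⊤) ?_
    rw [← ENNReal.tsum_mul_left]
    refine ENNReal.tsum_le_tsum fun y => ?_
    have := meas_z hz y (Ioi (jb y ^ κ)) measurableSet_Ioi
    simp only [mem_Ioi] at this
    rw [this, ← ENNReal.ofReal_mul hC.le]
    have hj := jb_pos y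
    refine (h _ (by positivity)).trans_eq ?_
    rw [← Real.rpow_mul hj.le]; ring_nf

lemma bx_card_lo (d : ℕ) {R : ℝ} (hR : 1 ≤ R) : (R / 2) ^ d ≤ ((bx d R).card : ℝ) := by
  have h1 : (Fintype.piFinset fun _ : Fin d => Finset.Icc (0 : ℤ) (⌊R⌋₊ - 1 : ℤ)) ⊆ bx d R := by
    intro y hy
    rw [mem_bx]
    have : ‖y‖ ≤ R - 1 := by
      rw [pi_norm_le_iff_of_nonneg (by linarith)]
      intro i
      have hi := Fintype.mem_piFinset.1 hy i
      rw [Finset.mem_Icc] at hi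
      rw [Int.norm_eq_abs, abs_of_nonneg (by exact_mod_cast hi.1)]
      have h3 : (y i : ℝ) ≤ (⌊R⌋₊ : ℝ) - 1 := by exact_mod_cast hi.2
      linarith [Nat.floor_le (show 0 ≤ R by linarith)]
    unfold jb; linarith
  have h2 := Finset.card_le_card h1
  rw [Fintype.card_piFinset] at h2
  simp only [Int.card_Icc, Finset.prod_const, Finset.card_univ, Fintype.card_fin] at h2
  have h3 : ((⌊R⌋₊ : ℤ) - 1 + 1 - 0).toNat = ⌊R⌋₊ := by simp
  rw [h3] at h2
  have h4 : R / 2 ≤ (⌊R⌋₊ : ℝ) := by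
    have h5 := Nat.lt_floor_add_one R
    have h6 : (1 : ℝ) ≤ ⌊R⌋₊ := by exact_mod_cast (Nat.one_le_floor_iff R).2 hR
    linarith
  calc (R / 2) ^ d ≤ (⌊R⌋₊ : ℝ) ^ d := by gcongr
    _ ≤ _ := by exact_mod_cast h2

lemma high_pt (hz : IsScenery d α μ z) (hd : 1 ≤ d) (hα : 0 < α) {δ C : ℝ} (hδ : 0 < δ) (hC : 0 < C) :
    ∀ᵐ ω ∂μ, ∀ᶠ n : ℕ in atTop, ∃ y : Fin d → ℤ, jb y ≤ (n : ℝ) ^ (2 * α / d + δ) ∧ C * (n : ℝ) ^ 2 ≤ z y ω := by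
  have := hz.prob
  have hdp : (0 : ℝ) < d := by exact_mod_cast hd
  set β := α + d * δ / 4 with hβ
  have h1 := tail_lo hz hα (β := β) (by rw [hβ]; linarith [mul_pos hdp hδ])
  have h2 : Tendsto (fun n : ℕ => C * (n : ℝ) ^ 2) atTop atTop :=
    Tendsto.const_mul_atTop hC ((tendsto_pow_atTop (by norm_num)).comp tendsto_natCast_atTop_atTop)
  have h3 := h2.eventually h1
  set c0 : ℝ := C ^ (-β) * (1 / 2) ^ d / 4 with hc0
  have hc0p : 0 < c0 := by positivity
  have key := bc (μ := μ) (fun n : ℕ => {ω | ∑ y ∈ bx d ((n : ℝ) ^ (2 * α / d + δ)), 1 * (Ioi (C * (n : ℝ) ^ 2)).indicator (1 : ℝ → ℝ) (z y ω) ≤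
      (C * (n : ℝ) ^ 2) ^ (-β) * (∑ y ∈ bx d ((n : ℝ) ^ (2 * α / d + δ)), 1) / 4}) ?_
  · filter_upwards [key] with ω hω
    filter_upwards [hω] with n hn
    by_contra! hcon
    apply hn
    show _ ≤ _
    rw [Finset.sum_eq_zero]
    · positivity
    · intro y hy
      rw [indicator_of_notMem, mul_zero]
      rw [mem_Ioi, not_lt]
      exact (hcon y (mem_bx.1 hy)).le
  · filter_upwards [h3, ev_exp hc0p (show 0 < d * δ / 2 by positivity) 1 0 2, eventually_gt_atTop 0] with n hn hn2 hn0
    have hp : (0 : ℝ) < n := by exact_mod_cast hn0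
    have hp1 : (1 : ℝ) ≤ n := by exact_mod_cast hn0
    refine (chern_lo hz _ measurableSet_Ioi one_pos (by positivity) hn _ (fun _ => 1) (by simp) (by simp)).trans ?_
    apply ENNReal.ofReal_le_ofReal
    rw [Real.rpow_zero, mul_one, one_mul] at hn2
    refine le_trans ?_ hn2
    apply Real.exp_le_exp.2
    apply neg_le_neg
    have h5 := bx_card_lo d (R := (n : ℝ) ^ (2 * α / d + δ)) (Real.one_le_rpow hp1 (by positivity))
    simp only [Finset.sum_const, nsmul_eq_mul, mul_one]
    have h6 : ((n : ℝ) ^ (2 * α / d + δ) / 2) ^ d = (1 / 2) ^ d * (n : ℝ) ^ (2 * α + d * δ) := by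
      rw [div_eq_mul_one_div, mul_pow, ← Real.rpow_natCast ((n : ℝ) ^ _), ← Real.rpow_mul hp.le, mul_comm]
      congr 2; field_simp
    have h7 : (C * (n : ℝ) ^ 2) ^ (-β) = C ^ (-β) * (n : ℝ) ^ (-(2 * β)) := by
      rw [Real.mul_rpow hC.le (by positivity), ← Real.rpow_natCast (n : ℝ), ← Real.rpow_mul hp.le]
      congr 2; push_cast; ring
    have h8 : (n : ℝ) ^ (d * δ / 2) = (n : ℝ) ^ (-(2 * β)) * (n : ℝ) ^ (2 * α + d * δ) := by
      rw [← Real.rpow_add hp]; congr 1; rw [hβ]; ring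
    rw [h7, h8, hc0]
    rw [h6] at h5
    have h9 : 0 ≤ C ^ (-β) * (n : ℝ) ^ (-(2 * β)) := by positivity
    nlinarith [mul_le_mul_of_nonneg_left h5 h9]

end
end LG
end Part18

section Part19
open MeasureTheory ProbabilityTheory Filter Set Topology
open scoped ENNReal

namespace LG

lemma bcu {ι Ωz : Type*} [MeasurableSpace Ωz] {μ : Measure Ωz} [IsProbabilityMeasure μ] (F : ℕ → Finset ι) {C k c e : ℝ}
    (hc : 0 < c) (he : 0 < e)
    (hF : ∀ᶠ n : ℕ in atTop, ((F n).card : ℝ) ≤ C * (n : ℝ) ^ k) (E : ℕ → ι → Set Ωz)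
    (h : ∀ᶠ n : ℕ in atTop, ∀ x ∈ F n, μ (E n x) ≤ ENNReal.ofReal (Real.exp (-(c * (n : ℝ) ^ e)))) :
    ∀ᵐ ζ ∂μ, ∀ᶠ n in atTop, ∀ x ∈ F n, ζ ∉ E n x := by
  have key := bc (μ := μ) (fun n => ⋃ x ∈ F n, E n x) ?_
  · filter_upwards [key] with ζ hζ
    filter_upwards [hζ] with n hn x hx hc
    exact hn (mem_iUnion₂.2 ⟨x, hx, hc⟩)
  · filter_upwards [h, hF, ev_exp hc he C k 2] with n h1 h2 h3
    refine (measure_biUnion_finset_le _ _).trans ((Finset.sum_le_sum h1).trans ?_)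
    rw [Finset.sum_const, nsmul_eq_mul, ← ENNReal.ofReal_natCast, ← ENNReal.ofReal_mul (by positivity)]
    apply ENNReal.ofReal_le_ofReal
    refine le_trans ?_ h3
    gcongr

/-- real-valued truncated Green function -/
noncomputable def gr (d : ℕ) (T : ℝ) (x y : Fin d → ℤ) : ℝ := (G d T x y).toReal

lemma gr_nonneg (d : ℕ) (T : ℝ) (x y : Fin d → ℤ) : 0 ≤ gr d T x y := ENNReal.toReal_nonneg

lemma G_ne_top (d : ℕ) (hd : 1 ≤ d) {T : ℝ} (hT : 0 ≤ T) (x y : Fin d → ℤ) : G d T x y ≠ ⊤ := by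
  obtain ⟨C, hC, h⟩ := G_sup d hd (e := 1 / 4) (by norm_num) (by norm_num)
  exact ne_top_of_le_ne_top ENNReal.ofReal_ne_top (h T hT x y)

lemma ofReal_gr (d : ℕ) (hd : 1 ≤ d) {T : ℝ} (hT : 0 ≤ T) (x y : Fin d → ℤ) : ENNReal.ofReal (gr d T x y) = G d T x y :=
  ENNReal.ofReal_toReal (G_ne_top d hd hT x y)

lemma gr_sup (d : ℕ) (hd : 1 ≤ d) {e : ℝ} (he : 0 < e) (he2 : e < 1 / 2) : ∃ C : ℝ, 0 < C ∧ ∀ T : ℝ, 0 ≤ T →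
    ∀ x y : Fin d → ℤ, gr d T x y ≤ C * T ^ (om d + e) := by
  obtain ⟨C, hC, h⟩ := G_sup d hd he he2
  refine ⟨C, hC, fun T hT x y => ?_⟩
  exact ENNReal.toReal_le_of_le_ofReal (by positivity) (h T hT x y)

section
variable {d : ℕ} {Ω : Type*} [MeasurableSpace Ω] {Q : (Fin d → ℤ) → Measure Ω} {Y : ℝ → Ω → (Fin d → ℤ)}

lemma Wk.gr_sum_le (h : Wk d Q Y) {T : ℝ} (hT : 0 ≤ T) (x : Fin d → ℤ) (F : Finset (Fin d → ℤ)) : ∑ y ∈ F, gr d T x y ≤ T := by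
  rw [← ENNReal.ofReal_le_ofReal_iff hT, ENNReal.ofReal_sum_of_nonneg (fun _ _ => gr_nonneg _ _ _ _)]
  simp_rw [ofReal_gr d h.dpos hT]
  rw [← h.G_sum hT x]
  exact ENNReal.sum_le_tsum F

lemma Wk.gr_sum_ge (h : Wk d Q Y) : ∃ N0 : ℝ, ∀ N : ℝ, N0 ≤ N → ∀ s ∈ Icc 0 N, ∀ x : Fin d → ℤ, jb x ≤ N ^ 2 →
    s / 2 ≤ ∑ y ∈ bx d (2 * N ^ 2), gr d s x y := by
  obtain ⟨N0, hN⟩ := h.G_box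
  refine ⟨N0, fun N hN0 s hs x hx => ?_⟩
  have := hN N hN0 s hs x hx
  simp_rw [← ofReal_gr d h.dpos hs.1] at this
  rw [← ENNReal.ofReal_sum_of_nonneg (fun _ _ => gr_nonneg _ _ _ _)] at this
  exact (ENNReal.ofReal_le_ofReal_iff (Finset.sum_nonneg fun _ _ => gr_nonneg _ _ _ _)).1 this

lemma bx_card_ev (d : ℕ) : ∃ C : ℝ, ∀ᶠ n : ℕ in atTop, ((bx d (2 * (n : ℝ) ^ 2)).card : ℝ) ≤ C * (n : ℝ) ^ (2 * ((d : ℝ) + 1)) := by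
  obtain ⟨C, hC, h⟩ := bx_card d
  refine ⟨C * 2 ^ (d + 1), ?_⟩
  filter_upwards [eventually_gt_atTop 0] with n hn
  have hp : (0 : ℝ) < n := by exact_mod_cast hn
  refine (h _ (by positivity)).trans_eq ?_
  rw [mul_pow, ← pow_mul, ← Real.rpow_natCast (n : ℝ)]
  push_cast; ring

/-- the number of blocks -/
noncomputable def Jn (δ : ℝ) (N : ℕ) : ℕ := ⌈(N : ℝ) ^ δ⌉₊

lemma Jn_ge (δ : ℝ) (N : ℕ) : (N : ℝ) ^ δ ≤ Jn δ N := Nat.le_ceil _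

lemma Jn_le {δ : ℝ} (hδ : 0 ≤ δ) {N : ℕ} (hN : 1 ≤ N) : (Jn δ N : ℝ) ≤ 2 * (N : ℝ) ^ δ := by
  have h1 : (1 : ℝ) ≤ (N : ℝ) ^ δ := Real.one_le_rpow (by exact_mod_cast hN) hδ
  have := Nat.ceil_lt_add_one (show (0 : ℝ) ≤ (N : ℝ) ^ δ by linarith)
  unfold Jn; linarith

lemma Jn_pos {δ : ℝ} (hδ : 0 ≤ δ) {N : ℕ} (hN : 1 ≤ N) : (1 : ℝ) ≤ Jn δ N :=
  (Real.one_le_rpow (by exact_mod_cast hN) hδ).trans (Jn_ge δ N)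

variable {α : ℝ} {Ωz : Type*} [MeasurableSpace Ωz] {μ : Measure Ωz} {z : (Fin d → ℤ) → Ωz → ℝ}

lemma env_LT (h : Wk d Q Y) (hz : IsScenery d α μ z) (hα : 0 < α) {β m δ : ℝ} (hβ : α < β) (hm : 0 < m) (hδ : 0 < δ)
    (hc : om d + m * β + 3 * δ < 1) :
    ∀ᵐ ω ∂μ, ∀ᶠ N : ℕ in atTop,
      1 ≤ (N : ℝ) / Jn δ N ∧ (N : ℝ) ^ (-(m * β)) ≤ (μ {ω | (N : ℝ) ^ m < z 0 ω}).toReal ∧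
      (∀ x ∈ bx d (2 * (N : ℝ) ^ 2), ∑ y ∈ bx d (2 * (N : ℝ) ^ 2), gr d ((N : ℝ) / Jn δ N + 1) x y * (Ioi ((N : ℝ) ^ m)).indicator 1 (z y ω)
        ≤ 5 * (μ {ω | (N : ℝ) ^ m < z 0 ω}).toReal * ((N : ℝ) / Jn δ N)) ∧
      (∀ x ∈ bx d (2 * (N : ℝ) ^ 2), jb x ≤ (N : ℝ) ^ 2 → (μ {ω | (N : ℝ) ^ m < z 0 ω}).toReal * ((N : ℝ) / Jn δ N) / 8 ≤
        ∑ y ∈ bx d (2 * (N : ℝ) ^ 2), gr d ((N : ℝ) / Jn δ N) x y * (Ioi ((N : ℝ) ^ m)).indicator 1 (z y ω)) := by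
  have := hz.prob
  have ho := om_nonneg d
  have hmb : 0 < m * β := mul_pos hm (hα.trans hβ)
  obtain ⟨C, hC, hG⟩ := gr_sup d h.dpos hδ (by linarith)
  obtain ⟨N0, hN0⟩ := h.gr_sum_ge
  obtain ⟨C2, hC2⟩ := bx_card_ev d
  set ρ : ℕ → ℝ := fun N => (μ {ω | (N : ℝ) ^ m < z 0 ω}).toReal with hρ
  set s : ℕ → ℝ := fun N => (N : ℝ) / Jn δ N with hs
  set W : ℕ → ℝ := fun N => 2 * C * (N : ℝ) ^ (om d + δ) with hW
  have hM : Tendsto (fun N : ℕ => (N : ℝ) ^ m) atTop atTop := (tendsto_rpow_atTop hm).comp tendsto_natCast_atTop_atTop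
  -- basic eventual facts
  have B : ∀ᶠ N : ℕ in atTop, 0 < N ∧ N0 ≤ N ∧ (N : ℝ) ^ (-(m * β)) ≤ ρ N ∧ 1 ≤ s N ∧ s N ≤ N ∧ 0 < W N ∧ W N * (N : ℝ) ^ δ ≤ ρ N * s N
      ∧ (∀ x y, gr d (s N + 1) x y ≤ W N) ∧ (∀ x y, gr d (s N) x y ≤ W N) := by
    filter_upwards [eventually_gt_atTop 0, tendsto_natCast_atTop_atTop.eventually_ge_atTop N0, hM.eventually (tail_lo hz hα hβ),
      ev_pow (show om d + 2 * δ < 1 - m * β - δ by linarith) (4 * C), ev_pow (show 0 < 1 - δ by linarith) 2] with N h1 h2 h3 h4 h5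
    have hp : (0 : ℝ) < N := by exact_mod_cast h1
    have hp1 : (1 : ℝ) ≤ N := by exact_mod_cast h1
    have hJ1 := Jn_pos hδ.le h1
    have hJ2 := Jn_le hδ.le h1
    have hJ0 : (0 : ℝ) < Jn δ N := by linarith
    have e3 : (N : ℝ) ^ (-(m * β)) ≤ ρ N := by
      have := ENNReal.toReal_mono (measure_ne_top _ _) h3
      rw [ENNReal.toReal_ofReal (by positivity)] at this
      rw [← Real.rpow_mul hp.le] at this
      convert this using 2; ring
    have hsl : (N : ℝ) ^ (1 - δ) / 2 ≤ s N := by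
      rw [hs]; simp only
      rw [le_div_iff₀ hJ0]
      calc (N : ℝ) ^ (1 - δ) / 2 * Jn δ N ≤ (N : ℝ) ^ (1 - δ) / 2 * (2 * (N : ℝ) ^ δ) := by gcongr
        _ = (N : ℝ) ^ (1 - δ) * (N : ℝ) ^ δ := by ring
        _ = N := by rw [← Real.rpow_add hp]; simp
    have hs1 : 1 ≤ s N := by rw [Real.rpow_zero] at h5; linarith
    have hsN : s N ≤ N := div_le_self hp.le hJ1
    have hWp : 0 < W N := by positivity
    have hg : ∀ T : ℝ, 0 ≤ T → T ≤ 2 * N → ∀ x y, gr d T x y ≤ W N := by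
      intro T hT hT2 x y
      refine (hG T hT x y).trans ?_
      calc C * T ^ (om d + δ) ≤ C * (2 * N) ^ (om d + δ) := by gcongr
        _ = C * (2 ^ (om d + δ) * (N : ℝ) ^ (om d + δ)) := by rw [Real.mul_rpow (by norm_num) hp.le]
        _ ≤ C * (2 ^ (1 : ℝ) * (N : ℝ) ^ (om d + δ)) := by
            gcongr
            · norm_num
            · linarith
        _ = _ := by rw [hW]; simp only [Real.rpow_one]; ring
    have q1 : 0 ≤ s N + 1 := add_nonneg (zero_le_one.trans hs1) zero_le_one
    have q2 : s N + 1 ≤ 2 * N := (add_le_add hsN hp1).trans_eq (by ring)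
    have q3 : (N : ℝ) ≤ 2 * N := by linarith
    refine ⟨h1, h2, e3, hs1, hsN, hWp, ?_, hg _ q1 q2, hg _ (zero_le_one.trans hs1) (hsN.trans q3)⟩
    calc W N * (N : ℝ) ^ δ = (4 * C * (N : ℝ) ^ (om d + 2 * δ)) / 2 := by
          rw [hW]; simp only
          rw [show om d + 2 * δ = (om d + δ) + δ by ring, Real.rpow_add hp (om d + δ)]; ring
      _ ≤ (N : ℝ) ^ (1 - m * β - δ) / 2 := by gcongr
      _ = (N : ℝ) ^ (-(m * β)) * ((N : ℝ) ^ (1 - δ) / 2) := by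
          rw [show 1 - m * β - δ = -(m * β) + (1 - δ) by ring, Real.rpow_add hp]; ring
      _ ≤ _ := by gcongr
  have hmeas : ∀ N : ℕ, ∫⁻ ω, ENNReal.ofReal ((Ioi ((N : ℝ) ^ m)).indicator (1 : ℝ → ℝ) (z 0 ω)) ∂μ ≤ ENNReal.ofReal (ρ N) := by
    intro N
    rw [hρ, ENNReal.ofReal_toReal (measure_ne_top _ _)]
    rw [← lintegral_indicator_one (measurableSet_lt measurable_const (hz.meas 0))]
    apply lintegral_mono
    intro ω
    by_cases hh : (N : ℝ) ^ m < z 0 ω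
    · simp [indicator, hh]
    · simp [indicator, hh]
  have U := bcu (μ := μ) (fun N : ℕ => bx d (2 * (N : ℝ) ^ 2)) one_pos hδ hC2
    (fun N x => {ω | W N * 1 * (N : ℝ) ^ δ + 2 * ρ N * ∑ y ∈ bx d (2 * (N : ℝ) ^ 2), gr d (s N + 1) x y ≤
      ∑ y ∈ bx d (2 * (N : ℝ) ^ 2), gr d (s N + 1) x y * (Ioi ((N : ℝ) ^ m)).indicator (1 : ℝ → ℝ) (z y ω)}) ?_
  · have L := bcu (μ := μ) (fun N : ℕ => bx d (2 * (N : ℝ) ^ 2)) (show (0 : ℝ) < 1 / 8 by norm_num) hδ hC2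
      (fun N x => {ω | jb x ≤ (N : ℝ) ^ 2 ∧ ∑ y ∈ bx d (2 * (N : ℝ) ^ 2), gr d (s N) x y * (Ioi ((N : ℝ) ^ m)).indicator (1 : ℝ → ℝ) (z y ω)
        ≤ ρ N * (∑ y ∈ bx d (2 * (N : ℝ) ^ 2), gr d (s N) x y) / 4}) ?_
    · filter_upwards [U, L] with ω hU hL
      filter_upwards [B, hU, hL] with N hB hU hL
      obtain ⟨h1, h2, h3, h4, h5, h6, h7, h8, h9⟩ := hB
      have hρ0 : 0 ≤ ρ N := ENNReal.toReal_nonneg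
      refine ⟨h4, h3, fun x hx => ?_, fun x hx hx2 => ?_⟩
      · have := not_le.1 (hU x hx)
        refine this.le.trans ?_
        have e1 := h.gr_sum_le (show 0 ≤ s N + 1 by linarith) x (bx d (2 * (N : ℝ) ^ 2))
        have e2 : 2 * ρ N * ∑ y ∈ bx d (2 * (N : ℝ) ^ 2), gr d (s N + 1) x y ≤ 2 * ρ N * (2 * s N) := by
          gcongr; linarith
        nlinarith
      · have := not_le.1 (fun hc => hL x hx ⟨hx2, hc⟩)
        refine le_trans ?_ this.le
        have e1 := hN0 N h2 (s N) ⟨by linarith, h5⟩ x hx2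
        have := mul_le_mul_of_nonneg_left e1 hρ0
        show ρ N * s N / 8 ≤ _
        linarith
    · filter_upwards [B] with N hB x hx
      obtain ⟨h1, h2, h3, h4, h5, h6, h7, h8, h9⟩ := hB
      by_cases hx2 : jb x ≤ (N : ℝ) ^ 2
      · have hρ0 : 0 ≤ ρ N := ENNReal.toReal_nonneg
        refine (measure_mono (fun ω hω => hω.2)).trans ((chern_lo hz (Ioi ((N : ℝ) ^ m)) measurableSet_Ioi h6 hρ0 ?_ (bx d (2 * (N : ℝ) ^ 2)) (gr d (s N) x)
          (fun y _ => gr_nonneg _ _ _ _) (fun y _ => h9 x y)).trans ?_)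
        · rw [hρ, ENNReal.ofReal_toReal (measure_ne_top _ _)]; rfl
        · apply ENNReal.ofReal_le_ofReal
          apply Real.exp_le_exp.2
          apply neg_le_neg
          rw [le_div_iff₀ (by positivity)]
          have e1 := hN0 N h2 (s N) ⟨by linarith, h5⟩ x hx2
          have := mul_le_mul_of_nonneg_left e1 hρ0
          nlinarith
      · have : {ω | jb x ≤ (N : ℝ) ^ 2 ∧ ∑ y ∈ bx d (2 * (N : ℝ) ^ 2), gr d (s N) x y * (Ioi ((N : ℝ) ^ m)).indicator (1 : ℝ → ℝ) (z y ω)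
          ≤ ρ N * (∑ y ∈ bx d (2 * (N : ℝ) ^ 2), gr d (s N) x y) / 4} = ∅ := by
          ext ω; simp [hx2]
        rw [this]; simp
  · filter_upwards [B] with N hB x hx
    obtain ⟨h1, h2, h3, h4, h5, h6, h7, h8, h9⟩ := hB
    have := chern_up hz ((Ioi ((N : ℝ) ^ m)).indicator (1 : ℝ → ℝ)) (measurable_one.indicator measurableSet_Ioi) (Mx := 1) one_pos h6
      (fun r => indicator_nonneg (fun _ _ => zero_le_one) r)
      (fun r => indicator_le' (fun _ _ => le_rfl) (fun _ _ => zero_le_one) r) (show 0 ≤ ρ N from ENNReal.toReal_nonneg) (hmeas N) (bx d (2 * (N : ℝ) ^ 2))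
      (gr d (s N + 1) x) (fun y _ => gr_nonneg _ _ _ _) (fun y _ => h8 x y) ((N : ℝ) ^ δ)
    rw [one_mul]
    exact this

end
end LG
end Part19

section Part20
open MeasureTheory ProbabilityTheory Filter Set Topology
open scoped ENNReal

namespace LG

/-- growth exponent of the clock -/
noncomputable def aex (d : ℕ) (α : ℝ) : ℝ := 1 + (1 - om d) * max (1 / α - 1) 0

lemma one_le_aex (d : ℕ) (α : ℝ) : 1 ≤ aex d α := by
  unfold aex
  have : om d ≤ 1 / 2 := om_le d
  nlinarith [mul_nonneg (show 0 ≤ 1 - om d by linarith) (le_max_right (1 / α - 1) 0)]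

lemma LT_par (d : ℕ) {α : ℝ} (hα : 0 < α) {ε : ℝ} (hε : 0 < ε) : ∃ β m δ : ℝ, α < β ∧ 0 < m ∧ 0 < δ ∧ om d + m * β + 3 * δ < 1 ∧
    aex d α - ε + δ < 1 + m * (1 - β) := by
  have ho := om_nonneg d
  have ho2 : om d ≤ 1 / 2 := om_le d
  by_cases h1 : α < 1
  · have ha : aex d α = 1 + ((1 - om d) / (α + 0) - 0) * (1 - (α + 0)) := by
      unfold aex
      rw [max_eq_left]
      · field_simp; ring
      · have : 1 ≤ 1 / α := by rw [le_div_iff₀ hα]; linarith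
        linarith
    have c1 : ContinuousAt (fun t : ℝ => 1 + ((1 - om d) / (α + t) - t) * (1 - (α + t)) - t * (α + t) / 4) 0 := by
      apply ContinuousAt.sub _ (by fun_prop)
      apply ContinuousAt.add (by fun_prop)
      apply ContinuousAt.mul _ (by fun_prop)
      apply ContinuousAt.sub _ (by fun_prop)
      apply ContinuousAt.div (by fun_prop) (by fun_prop)
      simp; linarith
    have c2 : ContinuousAt (fun t : ℝ => ((1 - om d) / (α + t) - t)) 0 := by
      apply ContinuousAt.sub _ (by fun_prop)
      apply ContinuousAt.div (by fun_prop) (by fun_prop)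
      simp; linarith
    have e1 := c1.eventually (lt_mem_nhds (show aex d α - ε < _ by rw [ha]; simp; linarith))
    have e2 := c2.eventually (lt_mem_nhds (show (0 : ℝ) < _ by simp; apply div_pos <;> linarith))
    have e3 := ((e1.and e2).filter_mono nhdsWithin_le_nhds).and (self_mem_nhdsWithin (s := Ioi (0 : ℝ)))
    obtain ⟨t, ⟨h2, h3⟩, h4⟩ := e3.exists
    have h4 : 0 < t := h4
    have hat : 0 < α + t := by linarith
    have htt := mul_pos h4 hat
    refine ⟨α + t, (1 - om d) / (α + t) - t, t * (α + t) / 4, by linarith, h3, by positivity, ?_, ?_⟩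
    · rw [sub_mul, div_mul_cancel₀ _ hat.ne']; linarith
    · linarith
  · push Not at h1
    have ha : aex d α = 1 := by
      unfold aex
      rw [max_eq_right]
      · ring
      · have : 1 / α ≤ 1 := by rw [div_le_iff₀ hα]; linarith
        linarith
    set t := min (ε / (2 * (1 + α))) (1 / (4 * (α + 4))) with ht
    have ht0 : 0 < t := by positivity
    have ht1 : t * (2 * (1 + α)) ≤ ε := by
      rw [← le_div_iff₀ (by positivity)]; exact min_le_left _ _
    have ht2 : t * (4 * (α + 4)) ≤ 1 := by
      rw [← le_div_iff₀ (by positivity)]; exact min_le_right _ _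
    refine ⟨α + 1, t, t, by linarith, ht0, ht0, by nlinarith, ?_⟩
    rw [ha]; nlinarith

section
variable {d : ℕ} {Ω : Type*} [MeasurableSpace Ω] {Q : (Fin d → ℤ) → Measure Ω} {Y : ℝ → Ω → (Fin d → ℤ)}

lemma tsum_bx (hd : 1 ≤ d) {T : ℝ} (hT : 0 ≤ T) (x : Fin d → ℤ) (R M : ℝ) (v : (Fin d → ℤ) → ℝ) :
    ∑' y, {y | y ∈ bx d R ∧ M < v y}.indicator (fun y => G d T x y) y =
      ENNReal.ofReal (∑ y ∈ bx d R, gr d T x y * (Ioi M).indicator 1 (v y)) := by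
  rw [tsum_eq_sum (s := bx d R)]
  · rw [ENNReal.ofReal_sum_of_nonneg]
    · refine Finset.sum_congr rfl fun y hy => ?_
      by_cases hM : M < v y
      · rw [indicator_of_mem (show y ∈ {y | y ∈ bx d R ∧ M < v y} from ⟨hy, hM⟩), indicator_of_mem (show v y ∈ Ioi M from hM)]
        simp [ofReal_gr d hd hT]
      · rw [indicator_of_notMem (fun hh => hM hh.2), indicator_of_notMem (show v y ∉ Ioi M from fun hh => hM hh)]
        simp
    · intro y _
      exact mul_nonneg (gr_nonneg _ _ _ _) (indicator_nonneg (fun _ _ => zero_le_one) _)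
  · intro y hy
    exact indicator_of_notMem (fun hh => hy hh.1) _

variable {α : ℝ} {Ωz : Type*} [MeasurableSpace Ωz] {μ : Measure Ωz} {z : (Fin d → ℤ) → Ωz → ℝ}

lemma Wk.LTas (h : Wk d Q Y) (hz : IsScenery d α μ z) (hα : 0 < α) {ε : ℝ} (hε : 0 < ε) (K : ℝ) :
    ∀ᵐ ζ ∂μ, ∀ᶠ N : ℕ in atTop, Q 0 {ω | AF Y (fun y => z y ζ) N ω ≤ (N : ℝ) ^ (aex d α - ε)} ≤ ENNReal.ofReal ((N : ℝ) ^ (-K)) := by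
  obtain ⟨β, m, δ, hβ, hm, hδ, hp1, hp2⟩ := LT_par d hα hε
  have ho := om_nonneg d
  have hmb : 0 < m * β := mul_pos hm (hα.trans hβ)
  have hδ1 : δ < 1 := by linarith
  set K' : ℕ := ⌈K + 3⌉₊ with hK'
  have hK : K + 3 ≤ K' := Nat.le_ceil _
  obtain ⟨C, hC, hT⟩ := pk_tail d h.dpos K'
  filter_upwards [env_LT h hz hα hβ hm hδ hp1] with ζ hζ
  filter_upwards [hζ, eventually_gt_atTop 0, ev_exp (show (0 : ℝ) < 1 / 1280 by norm_num) hδ (2 * Real.exp 1) 0 K,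
    ev_pow (show -K - 1 < -K by linarith) (4 * Real.exp 1 * C),
    ev_pow hp2 1] with N hN hN0 hx1 hx2 hx3
  obtain ⟨h1, h2, h3, h4⟩ := hN
  set ρ : ℝ := (μ {ω | (N : ℝ) ^ m < z 0 ω}).toReal with hρ
  set s : ℝ := (N : ℝ) / Jn δ N with hs
  clear_value ρ s
  have hp : (0 : ℝ) < N := by exact_mod_cast hN0
  have hp1 : (1 : ℝ) ≤ N := by exact_mod_cast hN0
  have hJ1 := Jn_pos hδ.le hN0
  have hJ2 := Jn_le hδ.le hN0
  have hJ3 := Jn_ge δ N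
  have hJ0 : (0 : ℝ) < Jn δ N := by linarith
  have hρ0 : 0 < ρ := lt_of_lt_of_le (by positivity) h2
  have hs0 : 0 < s := by linarith
  set η : ℝ := 1 / (20 * ρ * s) with hη
  have hη0 : 0 < η := by positivity
  have hηs : η * (ρ * s) = 1 / 20 := by rw [hη]; field_simp
  have key := h.LT3 (v := fun y => z y ζ) (fun y => hz.nonneg y ζ) {y | y ∈ bx d (2 * (N : ℝ) ^ 2) ∧ (N : ℝ) ^ m < z y ζ}
    {y | jb y ≤ (N : ℝ) ^ 2} (m := (N : ℝ) ^ m) (by positivity) (fun y hy => hy.2.le) (η := η) (s := s) (c := 1 / 1280) hη0 hs0.le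
    (by norm_num) (by norm_num) ?_ ?_ (κ := C * (1 / (N : ℝ)) ^ K') (by positivity) (T := N) 0 ?_ (Jn δ N) (by rw [hs]; field_simp)
    ((N : ℝ) ^ (aex d α - ε))
  · refine key.trans (ENNReal.ofReal_le_ofReal ?_)
    have e1 : η * (N : ℝ) ^ (aex d α - ε) / (N : ℝ) ^ m ≤ 1 := by
      have e2 : (N : ℝ) ^ (1 - m * β) ≤ ρ * s * (2 * (N : ℝ) ^ δ) := by
        have : s * Jn δ N = N := by rw [hs]; field_simp
        calc (N : ℝ) ^ (1 - m * β) = (N : ℝ) ^ (-(m * β)) * N := by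
              rw [show 1 - m * β = -(m * β) + 1 by ring, Real.rpow_add hp, Real.rpow_one]
          _ ≤ ρ * N := by gcongr
          _ = ρ * s * Jn δ N := by rw [mul_assoc, this]
          _ ≤ _ := by gcongr
      have e3 : (N : ℝ) ^ (aex d α - ε) * (N : ℝ) ^ δ ≤ (N : ℝ) ^ (1 - m * β) * (N : ℝ) ^ m := by
        rw [← Real.rpow_add hp, ← Real.rpow_add hp]
        refine (one_mul ((N : ℝ) ^ _)).symm.trans_le (hx3.trans_eq ?_)
        ring_nf
      rw [div_le_one (by positivity)]
      have hd0 : 0 < (N : ℝ) ^ δ := by positivity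
      have hm0 : 0 < (N : ℝ) ^ m := by positivity
      have e4 : η * (N : ℝ) ^ (aex d α - ε) * (N : ℝ) ^ δ ≤ (N : ℝ) ^ m * (N : ℝ) ^ δ := by
        calc η * (N : ℝ) ^ (aex d α - ε) * (N : ℝ) ^ δ = η * ((N : ℝ) ^ (aex d α - ε) * (N : ℝ) ^ δ) := by ring
          _ ≤ η * ((N : ℝ) ^ (1 - m * β) * (N : ℝ) ^ m) := by gcongr
          _ ≤ η * ((ρ * s * (2 * (N : ℝ) ^ δ)) * (N : ℝ) ^ m) := by gcongr
          _ = (η * (ρ * s)) * 2 * ((N : ℝ) ^ m * (N : ℝ) ^ δ) := by ring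
          _ ≤ _ := by rw [hηs]; nlinarith [mul_pos hm0 hd0]
      exact le_of_mul_le_mul_right e4 hd0
    have e5 : ((1 : ℝ) - 1 / 1280) ^ (Jn δ N) ≤ Real.exp (-(1 / 1280 * (N : ℝ) ^ δ)) := by
      calc ((1 : ℝ) - 1 / 1280) ^ (Jn δ N) ≤ (Real.exp (-(1 / 1280))) ^ (Jn δ N) := by
            gcongr
            have := Real.add_one_le_exp (-(1 / 1280 : ℝ))
            linarith
        _ = Real.exp (-(1 / 1280 * Jn δ N)) := by rw [← Real.exp_nat_mul]; ring_nf
        _ ≤ _ := by gcongr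
    have e6 : (Jn δ N : ℝ) * (C * (1 / (N : ℝ)) ^ K') ≤ 2 * C * (N : ℝ) ^ (-K - 1) := by
      have e7 : (1 / (N : ℝ)) ^ K' ≤ (N : ℝ) ^ (-(K + 3)) := by
        rw [one_div, inv_pow, ← Real.rpow_natCast, ← Real.rpow_neg hp.le]
        apply Real.rpow_le_rpow_of_exponent_le hp1; linarith
      have e8 : (N : ℝ) ^ δ ≤ (N : ℝ) ^ (2 : ℝ) := Real.rpow_le_rpow_of_exponent_le hp1 (by linarith)
      calc (Jn δ N : ℝ) * (C * (1 / (N : ℝ)) ^ K') ≤ (2 * (N : ℝ) ^ (2 : ℝ)) * (C * (N : ℝ) ^ (-(K + 3))) := by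
            gcongr; linarith
        _ = 2 * C * ((N : ℝ) ^ (2 : ℝ) * (N : ℝ) ^ (-(K + 3))) := by ring
        _ = _ := by rw [← Real.rpow_add hp]; ring_nf
    calc Real.exp (η * (N : ℝ) ^ (aex d α - ε) / (N : ℝ) ^ m) * ((1 - 1 / 1280) ^ (Jn δ N) + (Jn δ N) * (C * (1 / (N : ℝ)) ^ K'))
        ≤ Real.exp 1 * (Real.exp (-(1 / 1280 * (N : ℝ) ^ δ)) + 2 * C * (N : ℝ) ^ (-K - 1)) := by
          gcongr
      _ = (2 * Real.exp 1 * (N : ℝ) ^ (0 : ℝ) * Real.exp (-(1 / 1280 * (N : ℝ) ^ δ)) + 4 * Real.exp 1 * C * (N : ℝ) ^ (-K - 1)) / 2 := by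
          rw [Real.rpow_zero]; ring
      _ ≤ _ := by linarith
  · intro x hx
    rw [tsum_bx h.dpos (by linarith), ← ENNReal.ofReal_mul hη0.le]
    apply ENNReal.ofReal_le_ofReal
    have := mul_le_mul_of_nonneg_left (h3 x hx.1) hη0.le
    refine this.trans ?_
    rw [show η * (5 * ρ * s) = 5 * (η * (ρ * s)) by ring, hηs]; norm_num
  · intro x hx
    rw [tsum_bx h.dpos hs0.le, ← ENNReal.ofReal_mul (by positivity)]
    apply ENNReal.ofReal_le_ofReal
    have hx' : jb x ≤ (N : ℝ) ^ 2 := hx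
    have := mul_le_mul_of_nonneg_left (h4 x (mem_bx.2 (by nlinarith)) hx') (show 0 ≤ η / 8 by positivity)
    refine le_trans ?_ this
    rw [show η / 8 * (ρ * s / 8) = (η * (ρ * s)) / 64 by ring, hηs]; norm_num
  · intro t ht
    refine le_trans (ENNReal.tsum_le_tsum fun w => ?_) (hT N hp1 t ht 0)
    refine (indicator_le_indicator_of_subset ?_ (fun _ => zero_le) w)
    intro y hy
    have : ¬ jb y ≤ (N : ℝ) ^ 2 := hy
    simp only [mem_ofPred_eq, sub_zero]; linarith

end
end LG
end Part20

section Part21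
open MeasureTheory ProbabilityTheory Filter Set Topology
open scoped ENNReal

namespace LG

section
variable {d : ℕ} {Ω : Type*} [MeasurableSpace Ω] {Q : (Fin d → ℤ) → Measure Ω} {Y : ℝ → Ω → (Fin d → ℤ)}
variable {α : ℝ} {Ωz : Type*} [MeasurableSpace Ωz] {μ : Measure Ωz} {z : (Fin d → ℤ) → Ωz → ℝ}

lemma bx_card_pow (d : ℕ) (k : ℝ) : ∃ C : ℝ, ∀ᶠ n : ℕ in atTop, ((bx d ((n : ℝ) ^ k)).card : ℝ) ≤ C * (n : ℝ) ^ (k * ((d : ℝ) + 1)) := by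
  obtain ⟨C, hC, h⟩ := bx_card d
  refine ⟨C, ?_⟩
  filter_upwards [eventually_gt_atTop 0] with n hn
  have hp : (0 : ℝ) < n := by exact_mod_cast hn
  refine (h _ (by positivity)).trans_eq ?_
  rw [← Real.rpow_natCast, ← Real.rpow_mul hp.le]
  push_cast; ring

lemma env_U (h : Wk d Q Y) (hz : IsScenery d α μ z) {β m τ σ k : ℝ} (hβ0 : 0 < β) (hβ : β < α) (hβ1 : β < 1) 
    (hτ : 0 < τ) (h1 : τ * om d + m < σ) (h2 : τ + m * (1 - β) < σ) : ∃ δ : ℝ, 0 < δ ∧ 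
    ∀ᵐ ω ∂μ, ∀ᶠ n : ℕ in atTop, ∀ x ∈ bx d ((n : ℝ) ^ k),
      ∑ y ∈ bx d ((n : ℝ) ^ k), gr d ((n : ℝ) ^ τ + 1) x y * tr ((n : ℝ) ^ m) (z y ω) ≤ (n : ℝ) ^ (σ - δ) := by
  have := hz.prob
  have ho := om_nonneg d
  have ho2 := om_le d
  obtain ⟨C2, hC2⟩ := bx_card_pow d k
  obtain ⟨Ce, hCe, he⟩ := tr_mean hz hβ0 hβ hβ1
  obtain ⟨δ, hδ, hδ1, hδ2, hδ3⟩ : ∃ δ : ℝ, 0 < δ ∧ δ < 1 / 2 ∧ τ * (om d + δ) + m + δ < σ - δ ∧ m * (1 - β) + τ < σ - δ := by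
    set δ := min (1 / 4) (min ((σ - (τ * om d + m)) / (2 * (τ + 2))) ((σ - (τ + m * (1 - β))) / 2)) with hδ
    have e1 : δ * (2 * (τ + 2)) ≤ σ - (τ * om d + m) := by
      rw [← le_div_iff₀ (by positivity)]; exact (min_le_right _ _).trans (min_le_left _ _)
    have e2 : δ ≤ (σ - (τ + m * (1 - β))) / 2 := (min_le_right _ _).trans (min_le_right _ _)
    have e3 : δ ≤ 1 / 4 := min_le_left _ _
    have e0 : 0 < δ := by
      apply lt_min (by norm_num)
      apply lt_min
      · apply div_pos <;> linarith
      · linarith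
    refine ⟨δ, e0, by linarith, by nlinarith [mul_pos e0 hτ], by linarith⟩
  obtain ⟨C, hC, hG⟩ := gr_sup d h.dpos hδ (by linarith)
  refine ⟨δ, hδ, ?_⟩
  have key := bcu (μ := μ) (fun n : ℕ => bx d ((n : ℝ) ^ k)) one_pos hδ hC2
    (fun n x => {ω | (2 * C * (n : ℝ) ^ (τ * (om d + δ))) * (n : ℝ) ^ m * (n : ℝ) ^ δ + 2 * (Ce * ((n : ℝ) ^ m) ^ (1 - β)) * ∑ y ∈ bx d ((n : ℝ) ^ k), gr d ((n : ℝ) ^ τ + 1) x y ≤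
      ∑ y ∈ bx d ((n : ℝ) ^ k), gr d ((n : ℝ) ^ τ + 1) x y * tr ((n : ℝ) ^ m) (z y ω)}) ?_
  · filter_upwards [key] with ω hω
    filter_upwards [hω, eventually_gt_atTop 0, ev_pow hδ2 (4 * C), ev_pow hδ3 (8 * Ce)] with n hn hn0 hx1 hx2 x hx
    have hp : (0 : ℝ) < n := by exact_mod_cast hn0
    have hp1 : (1 : ℝ) ≤ n := by exact_mod_cast hn0
    have hT1 : (1 : ℝ) ≤ (n : ℝ) ^ τ := Real.one_le_rpow hp1 hτ.le
    have e0 := not_le.1 (hn x hx)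
    refine e0.le.trans ?_
    have e1 := h.gr_sum_le (show 0 ≤ (n : ℝ) ^ τ + 1 by linarith) x (bx d ((n : ℝ) ^ k))
    have e2 : 2 * (Ce * ((n : ℝ) ^ m) ^ (1 - β)) * ∑ y ∈ bx d ((n : ℝ) ^ k), gr d ((n : ℝ) ^ τ + 1) x y ≤ 2 * (Ce * ((n : ℝ) ^ m) ^ (1 - β)) * (2 * (n : ℝ) ^ τ) := by
      gcongr; linarith
    have e3 : 2 * (Ce * ((n : ℝ) ^ m) ^ (1 - β)) * (2 * (n : ℝ) ^ τ) = (8 * Ce * (n : ℝ) ^ (m * (1 - β) + τ)) / 2 := by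
      rw [Real.rpow_add hp, Real.rpow_mul hp.le]; ring
    have e4 : (2 * C * (n : ℝ) ^ (τ * (om d + δ))) * (n : ℝ) ^ m * (n : ℝ) ^ δ = (4 * C * (n : ℝ) ^ (τ * (om d + δ) + m + δ)) / 2 := by
      rw [Real.rpow_add hp, Real.rpow_add hp]; ring
    rw [e4]; linarith
  · filter_upwards [eventually_gt_atTop 0] with n hn0 x hx
    have hp : (0 : ℝ) < n := by exact_mod_cast hn0
    have hp1 : (1 : ℝ) ≤ n := by exact_mod_cast hn0
    have hT1 : (1 : ℝ) ≤ (n : ℝ) ^ τ := Real.one_le_rpow hp1 hτ.le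
    have := chern_up hz (tr ((n : ℝ) ^ m)) (tr_meas _) (Mx := (n : ℝ) ^ m) (W := 2 * C * (n : ℝ) ^ (τ * (om d + δ))) (by positivity) (by positivity)
      (tr_nonneg _) (tr_le (by positivity)) (e := Ce * ((n : ℝ) ^ m) ^ (1 - β)) (by positivity) (he _ (by positivity)) (bx d ((n : ℝ) ^ k))
      (gr d ((n : ℝ) ^ τ + 1) x) (fun y _ => gr_nonneg _ _ _ _) (fun y _ => ?_) ((n : ℝ) ^ δ)
    · rw [one_mul]; exact this
    · refine (hG _ (by linarith) x y).trans ?_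
      calc C * ((n : ℝ) ^ τ + 1) ^ (om d + δ) ≤ C * (2 * (n : ℝ) ^ τ) ^ (om d + δ) := by gcongr; linarith
        _ = C * (2 ^ (om d + δ) * (n : ℝ) ^ (τ * (om d + δ))) := by rw [Real.mul_rpow (by norm_num) (by positivity), Real.rpow_mul hp.le]
        _ ≤ C * (2 ^ (1 : ℝ) * (n : ℝ) ^ (τ * (om d + δ))) := by
            gcongr
            · norm_num
            · linarith
        _ = _ := by rw [Real.rpow_one]; ring

lemma far_U (d : ℕ) (hd : 1 ≤ d) {τ k : ℝ} (hτ : 0 < τ) (hk : τ / 2 < k) (κ : ℝ) : ∀ᶠ n : ℕ in atTop,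
    ∑' w : Fin d → ℤ, {w | (n : ℝ) ^ k < jb w}.indicator (fun w => G d ((n : ℝ) ^ τ + 2) 0 w * G d ((n : ℝ) ^ τ) w 0) w ≤ ENNReal.ofReal ((n : ℝ) ^ (-κ)) := by
  have hk0 : 0 < k := by linarith
  obtain ⟨K, hK0⟩ := exists_nat_gt (max ((2 * τ + k * (d + 1) + κ) / (2 * k - τ)) (d + 1))
  have hK := (le_max_left _ _).trans_lt hK0
  have hKd := (le_max_right _ _).trans_lt hK0
  rw [div_lt_iff₀ (by linarith)] at hK
  obtain ⟨C, hC, hG⟩ := G_far d hd K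
  have hfin := jb_tsum d (s := (d : ℝ) + 1) (by linarith)
  set Z := ∑' y : Fin d → ℤ, ENNReal.ofReal (jb y ^ (-((d : ℝ) + 1))) with hZ
  have hK2 : τ * (K + 2) - k * (2 * K - (d + 1)) < -κ := by nlinarith
  set A : ℝ := C ^ 2 * 3 ^ (K + 2) with hA
  filter_upwards [eventually_gt_atTop 0, ev_pow hK2 (A * Z.toReal)] with n hn0 hx1
  have hp : (0 : ℝ) < n := by exact_mod_cast hn0
  have hp1 : (1 : ℝ) ≤ n := by exact_mod_cast hn0
  have hT1 : (1 : ℝ) ≤ (n : ℝ) ^ τ := Real.one_le_rpow hp1 hτ.le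
  have term : ∀ w : Fin d → ℤ, {w | (n : ℝ) ^ k < jb w}.indicator (fun w => G d ((n : ℝ) ^ τ + 2) 0 w * G d ((n : ℝ) ^ τ) w 0) w ≤
      ENNReal.ofReal (A * (n : ℝ) ^ (τ * (K + 2) - k * (2 * K - (d + 1)))) * ENNReal.ofReal (jb w ^ (-((d : ℝ) + 1))) := by
    intro w
    by_cases hw : (n : ℝ) ^ k < jb w
    swap
    · rw [indicator_of_notMem (show w ∉ {w | (n : ℝ) ^ k < jb w} from hw)]; exact zero_le
    rw [indicator_of_mem (show w ∈ {w | (n : ℝ) ^ k < jb w} from hw)]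
    have hj := jb_pos w
    have g1 := hG ((n : ℝ) ^ τ + 2) (by linarith) 0 w
    rw [sub_zero] at g1
    have g2 : G d ((n : ℝ) ^ τ) w 0 ≤ G d ((n : ℝ) ^ τ + 2) 0 w := by
      rw [G_symm hd]; exact G_mono (by linarith) _ _
    refine (mul_le_mul' g1 (g2.trans g1)).trans ?_
    rw [← ENNReal.ofReal_mul (by positivity), ← ENNReal.ofReal_mul (by positivity)]
    apply ENNReal.ofReal_le_ofReal
    set U := (n : ℝ) ^ τ + 2 with hU
    have hU3 : U ≤ 3 * (n : ℝ) ^ τ := by linarith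
    have hU0 : 0 < U := by linarith
    calc C * U * (Real.sqrt U / jb w) ^ K * (C * U * (Real.sqrt U / jb w) ^ K) = C ^ 2 * U ^ (K + 2) * (jb w ^ (2 * K))⁻¹ := by
          rw [div_pow]
          have : Real.sqrt U ^ K * Real.sqrt U ^ K = U ^ K := by rw [← mul_pow, Real.mul_self_sqrt hU0.le]
          field_simp
          rw [pow_add, pow_mul, ← this]
          rw [← pow_mul, ← pow_mul]; ring
      _ ≤ C ^ 2 * (3 * (n : ℝ) ^ τ) ^ (K + 2) * (jb w ^ (2 * K))⁻¹ := by gcongr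
      _ = A * (n : ℝ) ^ (τ * (K + 2)) * (jb w ^ (-(2 * (K : ℝ) - (d + 1))) * jb w ^ (-((d : ℝ) + 1))) := by
          rw [mul_pow, ← Real.rpow_natCast ((n : ℝ) ^ τ), ← Real.rpow_mul hp.le, ← Real.rpow_natCast (jb w), ← Real.rpow_neg hj.le, ← Real.rpow_add hj, hA]
          push_cast
          ring_nf
      _ ≤ A * (n : ℝ) ^ (τ * (K + 2)) * (((n : ℝ) ^ k) ^ (-(2 * (K : ℝ) - (d + 1))) * jb w ^ (-((d : ℝ) + 1))) := by
          gcongr A * (n : ℝ) ^ (τ * (K + 2)) * (?_ * _)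
          exact Real.rpow_le_rpow_of_nonpos (by positivity) hw.le (by linarith [show (0 : ℝ) ≤ K from Nat.cast_nonneg K])
      _ = _ := by
          rw [sub_eq_add_neg (τ * ((K : ℝ) + 2)), Real.rpow_add hp, ← Real.rpow_mul hp.le]; ring_nf
  refine (ENNReal.tsum_le_tsum term).trans ?_
  rw [ENNReal.tsum_mul_left, ← hZ, ← ENNReal.ofReal_toReal hfin, ← ENNReal.ofReal_mul (by positivity)]
  apply ENNReal.ofReal_le_ofReal
  refine le_trans (le_of_eq ?_) hx1
  ring

end
end LG
end Part21

section Part22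
open MeasureTheory ProbabilityTheory Filter Set Topology
open scoped ENNReal

namespace LG

section
variable {d : ℕ} {Ω : Type*} [MeasurableSpace Ω] {Q : (Fin d → ℤ) → Measure Ω} {Y : ℝ → Ω → (Fin d → ℤ)}
variable {α : ℝ} {Ωz : Type*} [MeasurableSpace Ωz] {μ : Measure Ωz} {z : (Fin d → ℤ) → Ωz → ℝ}

lemma jb_zero (d : ℕ) : jb (0 : Fin d → ℤ) = 1 := by unfold jb; simp

lemma U_abs (h : Wk d Q Y) (hz : IsScenery d α μ z) {β m τ σ k κ κ' : ℝ} (hβ0 : 0 < β) (hβ : β < α) (hβ1 : β < 1)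
    (hτ : 0 < τ) (h1 : τ * om d + m < σ) (h2 : τ + m * (1 - β) < σ) (hk : τ / 2 < k) (hκ : κ < κ')
    (hN : ∀ᵐ ζ ∂μ, ∀ᶠ n : ℕ in atTop, ∑' w : Fin d → ℤ, {w | jb w ≤ (n : ℝ) ^ k ∧ (n : ℝ) ^ m < z w ζ}.indicator
      (fun w => G d ((n : ℝ) ^ τ + 2) 0 w * G d ((n : ℝ) ^ τ) w 0) w ≤ ENNReal.ofReal ((n : ℝ) ^ (-κ'))) :
    ∀ᵐ ζ ∂μ, ∀ᶠ n : ℕ in atTop, ∫⁻ t in Ioc 0 ((n : ℝ) ^ τ), Q 0 ({ω | (n : ℝ) ^ σ ≤ AF Y (fun y => z y ζ) t ω} ∩ {ω | Y t ω = 0})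
      ≤ ENNReal.ofReal ((n : ℝ) ^ (-κ)) := by
  obtain ⟨δ, hδ, hE⟩ := env_U h hz (k := k) hβ0 hβ hβ1 hτ h1 h2
  filter_upwards [hE, hN] with ζ hE hN
  filter_upwards [hE, hN, eventually_gt_atTop 0, far_U d h.dpos hτ hk κ', ev_exp (show (0 : ℝ) < 1 / 8 by norm_num) hδ 4 τ κ,
    ev_pow (show -κ' < -κ by linarith) (4 * Real.exp (2 * d))] with n hE hN hn0 hF hx1 hx2
  have hp : (0 : ℝ) < n := by exact_mod_cast hn0
  have hp1 : (1 : ℝ) ≤ n := by exact_mod_cast hn0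
  have hT1 : (1 : ℝ) ≤ (n : ℝ) ^ τ := Real.one_le_rpow hp1 hτ.le
  have hk1 : (1 : ℝ) ≤ (n : ℝ) ^ k := Real.one_le_rpow hp1 (by linarith)
  set Bad : Set (Fin d → ℤ) := {w | (n : ℝ) ^ k < jb w ∨ (n : ℝ) ^ m < z w ζ} with hBad
  have hBc : ∀ y, y ∉ Bad → jb y ≤ (n : ℝ) ^ k ∧ z y ζ ≤ (n : ℝ) ^ m := by
    intro y hy
    have hy2 : ¬ ((n : ℝ) ^ k < jb y ∨ (n : ℝ) ^ m < z y ζ) := hy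
    push Not at hy2; exact hy2
  have hBi : ∀ y, Badᶜ.indicator (fun y => z y ζ) y ≤ tr ((n : ℝ) ^ m) (z y ζ) := by
    intro y
    by_cases hy : y ∈ Bad
    · rw [indicator_of_notMem (show y ∉ Badᶜ from fun hh => hh hy)]; exact tr_nonneg _ _
    · rw [indicator_of_mem (show y ∈ Badᶜ from hy)]
      unfold tr
      rw [indicator_of_mem (show z y ζ ∈ Icc 0 ((n : ℝ) ^ m) from ⟨hz.nonneg y ζ, (hBc y hy).2⟩)]
      exact le_rfl
  have key := h.Udet (v := fun y => z y ζ) (fun y => hz.nonneg y ζ) (Bad := Bad) (M := (n : ℝ) ^ m) (D := (n : ℝ) ^ (σ - δ))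
    (fun y => (hBi y).trans (tr_le (by positivity) _)) (by positivity) (T := (n : ℝ) ^ τ) (by positivity) ((n : ℝ) ^ σ) 0 ?_
  · refine key.trans ?_
    have b1 : ∑' w, Bad.indicator (fun w => G d ((n : ℝ) ^ τ + 2) 0 w * G d ((n : ℝ) ^ τ) w 0) w ≤ ENNReal.ofReal ((n : ℝ) ^ (-κ')) + ENNReal.ofReal ((n : ℝ) ^ (-κ')) := by
      refine le_trans ?_ (add_le_add hF hN)
      rw [← ENNReal.tsum_add]
      refine ENNReal.tsum_le_tsum fun w => ?_
      by_cases hw : w ∈ Bad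
      · rw [indicator_of_mem hw]
        by_cases hw2 : (n : ℝ) ^ k < jb w
        · rw [indicator_of_mem (show w ∈ {w | (n : ℝ) ^ k < jb w} from hw2)]
          exact le_add_right le_rfl
        · have hw3 : (n : ℝ) ^ m < z w ζ := by
            rcases hw with hw | hw
            · exact absurd hw hw2
            · exact hw
          rw [indicator_of_mem (show w ∈ {w | jb w ≤ (n : ℝ) ^ k ∧ (n : ℝ) ^ m < z w ζ} from ⟨not_lt.1 hw2, hw3⟩)]
          exact le_add_left le_rfl
      · rw [indicator_of_notMem hw]; exact zero_le
    have b2 : (n : ℝ) ^ σ / (8 * (n : ℝ) ^ (σ - δ)) = 1 / 8 * (n : ℝ) ^ δ := by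
      have : (n : ℝ) ^ σ = (n : ℝ) ^ (σ - δ) * (n : ℝ) ^ δ := by rw [← Real.rpow_add hp]; ring_nf
      rw [this]; field_simp
    rw [b2]
    refine (add_le_add le_rfl (mul_le_mul_right b1 _)).trans ?_
    rw [← ENNReal.ofReal_add (by positivity) (by positivity), ← ENNReal.ofReal_mul (by positivity), ← ENNReal.ofReal_add (by positivity) (by positivity)]
    apply ENNReal.ofReal_le_ofReal
    linarith
  · intro x hx
    have hx' : x ∈ bx d ((n : ℝ) ^ k) := by
      rw [mem_bx]
      rcases hx with hx | hx
      · exact (hBc x hx).1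
      · rw [hx, jb_zero]; exact hk1
    refine le_trans ?_ (ENNReal.ofReal_le_ofReal (hE x hx'))
    rw [ENNReal.ofReal_sum_of_nonneg (fun y _ => mul_nonneg (gr_nonneg _ _ _ _) (tr_nonneg _ _))]
    rw [tsum_eq_sum (s := bx d ((n : ℝ) ^ k))]
    · refine Finset.sum_le_sum fun y _ => ?_
      rw [ENNReal.ofReal_mul (gr_nonneg _ _ _ _), ofReal_gr d h.dpos (by linarith), mul_comm]
      exact mul_le_mul_right (ENNReal.ofReal_le_ofReal (hBi y)) _
    · intro y hy
      rw [indicator_of_notMem]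
      · simp
      · intro hy2
        exact hy (mem_bx.2 (hBc y hy2).1)

lemma U_empty (h : Wk d Q Y) (hz : IsScenery d α μ z) (hα : 0 < α) {β m τ σ k g : ℝ} (κ : ℝ) (hβ0 : 0 < β) (hβ : β < α) (hβ1 : β < 1)
    (hτ : 0 < τ) (h1 : τ * om d + m < σ) (h2 : τ + m * (1 - β) < σ) (hk : τ / 2 < k) (hg : d / α < g) (hkg : k * g < m) :
    ∀ᵐ ζ ∂μ, ∀ᶠ n : ℕ in atTop, ∫⁻ t in Ioc 0 ((n : ℝ) ^ τ), Q 0 ({ω | (n : ℝ) ^ σ ≤ AF Y (fun y => z y ζ) t ω} ∩ {ω | Y t ω = 0})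
      ≤ ENNReal.ofReal ((n : ℝ) ^ (-κ)) := by
  refine U_abs h hz (κ' := κ + 1) hβ0 hβ hβ1 hτ h1 h2 hk (by linarith) ?_
  have hg0 : 0 ≤ g := le_trans (by positivity) hg.le
  filter_upwards [growth hz h.dpos hα hg] with ζ hζ
  obtain ⟨C, hC, hgr⟩ := hζ
  filter_upwards [eventually_gt_atTop 0, ev_pow hkg C] with n hn0 hx1
  have hp : (0 : ℝ) < n := by exact_mod_cast hn0
  have : ∀ w : Fin d → ℤ, {w | jb w ≤ (n : ℝ) ^ k ∧ (n : ℝ) ^ m < z w ζ}.indicator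
      (fun w => G d ((n : ℝ) ^ τ + 2) 0 w * G d ((n : ℝ) ^ τ) w 0) w = 0 := by
    intro w
    apply indicator_of_notMem
    rintro ⟨hw1, hw2⟩
    have := hgr w
    have e1 : C * jb w ^ g ≤ C * ((n : ℝ) ^ k) ^ g := by
      have := (jb_pos w).le
      gcongr
    rw [← Real.rpow_mul hp.le] at e1
    linarith
  simp_rw [this]; simp

lemma mid_sum (d : ℕ) {θ r k : ℝ} (hθ : 0 < θ) : ∃ C : ℝ, 0 < C ∧ ∀ n : ℕ, 0 < n → ∀ F : Finset (Fin d → ℤ),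
    (∀ w ∈ F, (n : ℝ) ^ r < jb w ∧ jb w ≤ (n : ℝ) ^ k) →
    ∑ w ∈ F, jb w ^ (4 - 2 * (d : ℝ)) ≤ C * ((n : ℝ) ^ (r * (4 - d + θ)) + (n : ℝ) ^ (k * (4 - d + θ))) := by
  have hfin := jb_tsum d (s := (d : ℝ) + θ) (by linarith)
  set Z := ∑' y : Fin d → ℤ, ENNReal.ofReal (jb y ^ (-((d : ℝ) + θ))) with hZ
  refine ⟨Z.toReal + 1, by positivity, fun n hn0 F hF => ?_⟩
  have hp : (0 : ℝ) < n := by exact_mod_cast hn0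
  set B := (n : ℝ) ^ (r * (4 - d + θ)) + (n : ℝ) ^ (k * (4 - d + θ)) with hB
  have hB0 : 0 < B := by positivity
  have hs : ∑ w ∈ F, jb w ^ (-((d : ℝ) + θ)) ≤ Z.toReal := by
    rw [← ENNReal.ofReal_le_ofReal_iff ENNReal.toReal_nonneg, ENNReal.ofReal_toReal hfin,
      ENNReal.ofReal_sum_of_nonneg (fun w _ => by have := jb_pos w; positivity)]
    exact ENNReal.sum_le_tsum F
  calc ∑ w ∈ F, jb w ^ (4 - 2 * (d : ℝ)) ≤ ∑ w ∈ F, B * jb w ^ (-((d : ℝ) + θ)) := by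
        refine Finset.sum_le_sum fun w hw => ?_
        have hj := jb_pos w
        rw [show 4 - 2 * (d : ℝ) = (4 - d + θ) + (-((d : ℝ) + θ)) by ring, Real.rpow_add hj]
        apply mul_le_mul_of_nonneg_right _ (by positivity)
        rw [hB, Real.rpow_mul hp.le, Real.rpow_mul hp.le]
        rcases le_total 0 (4 - (d : ℝ) + θ) with h0 | h0
        · refine (Real.rpow_le_rpow hj.le (hF w hw).2 h0).trans ?_
          linarith [show 0 ≤ ((n : ℝ) ^ r) ^ (4 - d + θ) by positivity]
        · refine (Real.rpow_le_rpow_of_nonpos (by positivity) (hF w hw).1.le h0).trans ?_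
          linarith [show 0 ≤ ((n : ℝ) ^ k) ^ (4 - d + θ) by positivity]
    _ = B * ∑ w ∈ F, jb w ^ (-((d : ℝ) + θ)) := by rw [Finset.mul_sum]
    _ ≤ B * Z.toReal := by gcongr
    _ ≤ _ := by nlinarith

lemma U_near (hz : IsScenery d α μ z) (hα : 0 < α) (hd : 3 ≤ d) {β m τ k g r κ θ : ℝ} (hβ0 : 0 < β) (hβ : β < α)
    (hg : d / α < g) (hr : r * g < m) (hr0 : 0 < r) (hθ : 0 < θ) (hκ1 : κ < r * (2 * d - 4)) (hκ2 : κ < m * β + r * (d - 4 - θ))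
    (hκ3 : κ < m * β + k * (d - 4 - θ)) : ∀ᵐ ζ ∂μ, ∀ᶠ n : ℕ in atTop, 
      ∑' w : Fin d → ℤ, {w | jb w ≤ (n : ℝ) ^ k ∧ (n : ℝ) ^ m < z w ζ}.indicator
      (fun w => G d ((n : ℝ) ^ τ + 2) 0 w * G d ((n : ℝ) ^ τ) w 0) w ≤ ENNReal.ofReal ((n : ℝ) ^ (-κ)) := by
  classical
  have := hz.prob
  have hd1 : 1 ≤ d := by omega
  have hd3 : (3 : ℝ) ≤ d := by exact_mod_cast hd
  have hg0 : 0 ≤ g := le_trans (by positivity) hg.le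
  obtain ⟨Ct, hCt, ht⟩ := tail_up hz hβ0 hβ
  obtain ⟨Cm, hCm, hmid⟩ := mid_sum d (θ := θ) (r := r) (k := k) hθ
  obtain ⟨CG, hCG, hG⟩ := G_high d hd
  obtain ⟨δ, hδ, hδκ⟩ : ∃ δ, 0 < δ ∧ r * (4 - 2 * d) + δ < -κ := 
    ⟨(r * (2 * d - 4) - κ) / 2, by linarith, by linarith⟩
  set F : ℕ → Finset (Fin d → ℤ) := fun n => (bx d ((n : ℝ) ^ k)).filter (fun w => (n : ℝ) ^ r < jb w) with hF
  have hFm : ∀ n, ∀ w ∈ F n, (n : ℝ) ^ r < jb w ∧ jb w ≤ (n : ℝ) ^ k := by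
    intro n w hw
    rw [hF] at hw
    simp only [Finset.mem_filter, mem_bx] at hw
    exact ⟨hw.2, hw.1⟩
  have key := bc (μ := μ) (fun n : ℕ => {ω | ((n : ℝ) ^ r) ^ (4 - 2 * (d : ℝ)) * 1 * (n : ℝ) ^ δ + 2 * (Ct * ((n : ℝ) ^ m) ^ (-β)) * ∑ y ∈ F n, jb y ^ (4 - 2 * (d : ℝ)) ≤
      ∑ y ∈ F n, jb y ^ (4 - 2 * (d : ℝ)) * (Ioi ((n : ℝ) ^ m)).indicator (1 : ℝ → ℝ) (z y ω)}) ?_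
  · filter_upwards [key, growth hz hd1 hα hg] with ζ hζ hgr
    obtain ⟨C, hC, hgr⟩ := hgr
    filter_upwards [hζ, eventually_gt_atTop 0, ev_pow hr C, ev_pow hδκ (3 * CG ^ 2), 
      ev_pow (show -(m * β) + r * (4 - d + θ) < -κ by linarith) (3 * CG ^ 2 * (2 * Ct * Cm)),
      ev_pow (show -(m * β) + k * (4 - d + θ) < -κ by linarith) (3 * CG ^ 2 * (2 * Ct * Cm))] with n hn hn0 hx1 hx2 hx3 hx4
    have hp : (0 : ℝ) < n := by exact_mod_cast hn0
    have hn := (not_le.1 hn).le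
    have hms := hmid n hn0 (F n) (hFm n)
    have t1 : ∑' w : Fin d → ℤ, {w | jb w ≤ (n : ℝ) ^ k ∧ (n : ℝ) ^ m < z w ζ}.indicator
      (fun w => G d ((n : ℝ) ^ τ + 2) 0 w * G d ((n : ℝ) ^ τ) w 0) w ≤ 
      ENNReal.ofReal (∑ y ∈ F n, CG ^ 2 * (jb y ^ (4 - 2 * (d : ℝ)) * (Ioi ((n : ℝ) ^ m)).indicator (1 : ℝ → ℝ) (z y ζ))) := by
      have hnn : ∀ y ∈ F n, 0 ≤ CG ^ 2 * (jb y ^ (4 - 2 * (d : ℝ)) * (Ioi ((n : ℝ) ^ m)).indicator (1 : ℝ → ℝ) (z y ζ)) := by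
        intro y _
        have := jb_pos y
        exact mul_nonneg (by positivity) (mul_nonneg (by positivity) (indicator_nonneg (fun _ _ => zero_le_one) _))
      rw [ENNReal.ofReal_sum_of_nonneg hnn]
      rw [tsum_eq_sum (s := F n)]
      · refine Finset.sum_le_sum fun y hy => ?_
        by_cases hM : (n : ℝ) ^ m < z y ζ
        · rw [indicator_of_mem (show y ∈ {w | jb w ≤ (n : ℝ) ^ k ∧ (n : ℝ) ^ m < z w ζ} from ⟨(hFm n y hy).2, hM⟩),
            indicator_of_mem (show z y ζ ∈ Ioi ((n : ℝ) ^ m) from hM)]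
          have g1 := hG ((n : ℝ) ^ τ + 2) 0 y
          have g2 := hG ((n : ℝ) ^ τ) 0 y
          rw [sub_zero] at g1 g2
          rw [G_symm hd1 _ y 0]
          have hj := jb_pos y
          refine (mul_le_mul' g1 g2).trans ?_
          rw [← ENNReal.ofReal_mul (by positivity)]
          apply ENNReal.ofReal_le_ofReal
          rw [show 4 - 2 * (d : ℝ) = (2 - d) + (2 - d) by ring, Real.rpow_add hj, Pi.one_apply]
          apply le_of_eq; ring
        · rw [indicator_of_notMem (show y ∉ {w | jb w ≤ (n : ℝ) ^ k ∧ (n : ℝ) ^ m < z w ζ} from fun hh => hM hh.2)]; exact zero_le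
      · intro w hw
        apply indicator_of_notMem
        rintro ⟨hw1, hw2⟩
        apply hw
        rw [hF]; simp only [Finset.mem_filter, mem_bx]
        refine ⟨hw1, ?_⟩
        by_contra hcon
        push Not at hcon
        have e0 := hgr w
        have e1 : C * jb w ^ g ≤ C * ((n : ℝ) ^ r) ^ g := by
          have := (jb_pos w).le
          gcongr
        rw [← Real.rpow_mul hp.le] at e1
        linarith
    refine t1.trans (ENNReal.ofReal_le_ofReal ?_)
    rw [← Finset.mul_sum]
    have t2 : ((n : ℝ) ^ r) ^ (4 - 2 * (d : ℝ)) * 1 * (n : ℝ) ^ δ = (n : ℝ) ^ (r * (4 - 2 * d) + δ) := by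
      rw [mul_one, ← Real.rpow_mul hp.le, ← Real.rpow_add hp]
    have t3 : 2 * (Ct * ((n : ℝ) ^ m) ^ (-β)) * ∑ y ∈ F n, jb y ^ (4 - 2 * (d : ℝ)) ≤ 
       2 * Ct * Cm * ((n : ℝ) ^ (-(m * β) + r * (4 - d + θ)) + (n : ℝ) ^ (-(m * β) + k * (4 - d + θ))) := by
      calc _ ≤ 2 * (Ct * ((n : ℝ) ^ m) ^ (-β)) * (Cm * ((n : ℝ) ^ (r * (4 - d + θ)) + (n : ℝ) ^ (k * (4 - d + θ)))) := by gcongr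
        _ = _ := by
          rw [← Real.rpow_mul hp.le, Real.rpow_add hp, Real.rpow_add hp, show m * -β = -(m * β) by ring]; ring
    rw [t2] at hn
    have t4 := mul_le_mul_of_nonneg_left (hn.trans (add_le_add le_rfl t3)) (show 0 ≤ CG ^ 2 by positivity)
    refine t4.trans ?_
    nlinarith
  · filter_upwards [eventually_gt_atTop 0, ev_exp one_pos hδ 1 0 2] with n hn0 hx
    have hp : (0 : ℝ) < n := by exact_mod_cast hn0
    refine (chern_up hz ((Ioi ((n : ℝ) ^ m)).indicator (1 : ℝ → ℝ)) (measurable_one.indicator measurableSet_Ioi) (Mx := 1) one_pos 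
      (W := ((n : ℝ) ^ r) ^ (4 - 2 * (d : ℝ))) (by positivity)
      (fun r => indicator_nonneg (fun _ _ => zero_le_one) r)
      (fun r => indicator_le' (fun _ _ => le_rfl) (fun _ _ => zero_le_one) r) (e := Ct * ((n : ℝ) ^ m) ^ (-β)) (by positivity) ?_ (F n)
      (fun y => jb y ^ (4 - 2 * (d : ℝ))) (fun y _ => by have := jb_pos y; positivity) (fun y hy => 
        Real.rpow_le_rpow_of_nonpos (by positivity) (hFm n y hy).1.le (by linarith)) ((n : ℝ) ^ δ)).trans ?_
    · refine le_trans ?_ (ht ((n : ℝ) ^ m) (by positivity))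
      rw [← lintegral_indicator_one (measurableSet_lt measurable_const (hz.meas 0))]
      apply lintegral_mono
      intro ω
      by_cases hh : (n : ℝ) ^ m < z 0 ω
      · simp [indicator, hh]
      · simp [indicator, hh]
    · apply ENNReal.ofReal_le_ofReal
      rw [Real.rpow_zero, mul_one, one_mul, one_mul] at hx
      exact hx

end
end LG
end Part22

section Part23
open MeasureTheory ProbabilityTheory Filter Set Topology
open scoped ENNReal
namespace LG
section
variable {d : ℕ} {Ω : Type*} [MeasurableSpace Ω] {Q : (Fin d → ℤ) → Measure Ω} {Y : ℝ → Ω → (Fin d → ℤ)}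
variable {α : ℝ} {Ωz : Type*} [MeasurableSpace Ωz] {μ : Measure Ωz} {z : (Fin d → ℤ) → Ωz → ℝ}

lemma ev_lt {f g : ℝ → ℝ} (hf : ContinuousAt f 0) (hg : ContinuousAt g 0) (h : f 0 < g 0) : ∀ᶠ t in 𝓝[>] (0 : ℝ), f t < g t :=
  nhdsWithin_le_nhds (hf.eventually_lt hg h)

lemma U12 (h : Wk d Q Y) (hz : IsScenery d α μ z) (hα : 0 < α) (hd : d ≤ 2) {τ σ : ℝ} (κ : ℝ) (hτ : 0 < τ)
    (hσ : τ * aex d α < σ) :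
    ∀ᵐ ζ ∂μ, ∀ᶠ n : ℕ in atTop, ∫⁻ t in Ioc 0 ((n : ℝ) ^ τ), Q 0 ({ω | (n : ℝ) ^ σ ≤ AF Y (fun y => z y ζ) t ω} ∩ {ω | Y t ω = 0})
      ≤ ENNReal.ofReal ((n : ℝ) ^ (-κ)) := by
  have hdp := h.dpos
  have L1 : τ * om d + (τ / 2) * (d / α) < σ := by
    refine lt_of_le_of_lt ?_ hσ
    rw [show τ * om d + (τ / 2) * (d / α) = τ * (om d + d / 2 * (1 / α)) by ring]
    apply mul_le_mul_of_nonneg_left _ hτ.le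
    unfold aex om
    have h1 := le_max_left (1 / α - 1) 0
    have h2 := le_max_right (1 / α - 1) 0
    generalize max (1 / α - 1) 0 = M at *
    generalize 1 / α = w at *
    rcases (by omega : d = 1 ∨ d = 2) with rfl | rfl
    · rw [if_pos rfl]; push_cast; linarith
    · rw [if_neg (by norm_num)]; push_cast; linarith
  have L2 : τ + (τ / 2) * (d / α) * (1 - min 1 α) < σ := by
    refine lt_of_le_of_lt ?_ hσ
    have h1 := le_max_left (1 / α - 1) 0
    have h2 := le_max_right (1 / α - 1) 0
    rw [show τ + (τ / 2) * (d / α) * (1 - min 1 α) = τ * (1 + d / 2 * ((1 / α) * (1 - min 1 α))) by ring]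
    apply mul_le_mul_of_nonneg_left _ hτ.le
    have h3 : (1 / α) * (1 - min 1 α) ≤ max (1 / α - 1) 0 := by
      rcases le_total α 1 with h | h
      · rw [min_eq_right h]; refine le_trans (le_of_eq ?_) h1; field_simp
      · rw [min_eq_left h]; simp
    unfold aex om
    generalize max (1 / α - 1) 0 = M at *
    generalize 1 / α * (1 - min 1 α) = w at *
    rcases (by omega : d = 1 ∨ d = 2) with rfl | rfl
    · rw [if_pos rfl]; push_cast; linarith
    · rw [if_neg (by norm_num)]; push_cast; linarith
  have hα' := hα.ne'
  have e1 : ∀ᶠ t in 𝓝[>] (0 : ℝ), τ * om d + ((d / α + t) * (τ / 2 + t) + t) < σ :=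
    ev_lt (g := fun _ => σ) (by fun_prop) (by fun_prop) (by simp only [add_zero]; linarith)
  have e2 : ∀ᶠ t in 𝓝[>] (0 : ℝ), τ + ((d / α + t) * (τ / 2 + t) + t) * (1 - (min 1 α - t)) < σ :=
    ev_lt (g := fun _ => σ) (by fun_prop) (by fun_prop) (by simp only [add_zero, sub_zero]; linarith)
  have e3 : ∀ᶠ t in 𝓝[>] (0 : ℝ), 0 < min 1 α - t :=
    ev_lt (f := fun _ => 0) (by fun_prop) (by fun_prop) (by simp [hα])
  obtain ⟨t, ⟨⟨⟨h1, h2⟩, h3⟩, ht⟩⟩ := ((e1.and e2).and e3 |>.and self_mem_nhdsWithin).exists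
  have ht : 0 < t := ht
  have m1 := min_le_left 1 α
  have m2 := min_le_right 1 α
  exact U_empty h hz hα (β := min 1 α - t) (m := (d / α + t) * (τ / 2 + t) + t) (k := τ / 2 + t) (g := d / α + t) κ h3
    (by linarith) (by linarith) hτ h1 h2 (by linarith) (by linarith) (by nlinarith)

lemma om3 (hd : 2 ≤ d) : om d = 0 := by unfold om; rw [if_neg (by omega)]

lemma aex_inv (hd : 2 ≤ d) (hα : 0 < α) : aex d α * min 1 α = 1 := by
  unfold aex; rw [om3 hd]
  rcases le_total α 1 with h | h
  · rw [min_eq_right h, max_eq_left (by rw [sub_nonneg, le_div_iff₀ hα]; linarith)]; field_simp; ring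
  · rw [min_eq_left h, max_eq_right (by rw [sub_nonpos, div_le_iff₀ hα]; linarith)]; ring

lemma U3 (h : Wk d Q Y) (hz : IsScenery d α μ z) (hα : 0 < α) (hd : 3 ≤ d) {τ σ κ : ℝ} (hτ : 0 < τ)
    (hσ : τ * aex d α < σ) (hκ : κ < σ / 2 * (d - 2) * min α (4 * α / d)) :
    ∀ᵐ ζ ∂μ, ∀ᶠ n : ℕ in atTop, ∫⁻ t in Ioc 0 ((n : ℝ) ^ τ), Q 0 ({ω | (n : ℝ) ^ σ ≤ AF Y (fun y => z y ζ) t ω} ∩ {ω | Y t ω = 0})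
      ≤ ENNReal.ofReal ((n : ℝ) ^ (-κ)) := by
  have hdp := h.dpos
  have hd3 : (3 : ℝ) ≤ d := by exact_mod_cast hd
  have hd0 : (d : ℝ) ≠ 0 := by positivity
  have hα' := hα.ne'
  have m1 := min_le_left 1 α
  have m2 := min_le_right 1 α
  have hb0 : 0 < min 1 α := by simp [hα]
  have hτb : τ < σ * min 1 α := by
    have := mul_lt_mul_of_pos_right hσ hb0
    rwa [mul_assoc, aex_inv (by omega) hα, mul_one] at this
  have hσ0 : 0 < σ := by nlinarith [one_le_aex d α]
  have e2 : ∀ᶠ t in 𝓝[>] (0 : ℝ), τ + (σ - t) * (1 - (min 1 α - t)) < σ :=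
    ev_lt (g := fun _ => σ) (by fun_prop) (by fun_prop) (by simp only [sub_zero]; linarith)
  have e3 : ∀ᶠ t in 𝓝[>] (0 : ℝ), 0 < min 1 α - t :=
    ev_lt (f := fun _ => 0) (by fun_prop) (by fun_prop) (by simp [hα])
  have hom := om3 (d := d) (by omega)
  rcases lt_or_ge (τ / 2) (σ * α / d) with hc | hc
  · have e4 : ∀ᶠ t in 𝓝[>] (0 : ℝ), (τ / 2 + t) * (d / α + t) < σ - t :=
      ev_lt (by fun_prop) (by fun_prop) (by
        simp only [sub_zero, add_zero]
        have hc2 : τ / 2 * (d / α) < σ * α / d * (d / α) := mul_lt_mul_of_pos_right hc (by positivity)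
        rwa [show σ * α / d * (d / α) = σ by field_simp] at hc2)
    obtain ⟨t, ⟨⟨⟨h1, h2⟩, h3⟩, ht⟩⟩ := ((e2.and e3).and e4 |>.and self_mem_nhdsWithin).exists
    have ht : 0 < t := ht
    exact U_empty h hz hα (β := min 1 α - t) (m := σ - t) (k := τ / 2 + t) (g := d / α + t) κ h2
      (by linarith) (by linarith) hτ (by rw [hom]; linarith) h1 (by linarith) (by linarith) h3
  · obtain ⟨κ', hκ1, hκ2⟩ := exists_between hκ
    have hp : 0 < σ / 2 * ((d : ℝ) - 2) := mul_pos (by linarith) (by linarith)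
    have b1 : κ' < σ / 2 * (d - 2) * α := lt_of_lt_of_le hκ2 (mul_le_mul_of_nonneg_left (min_le_left _ _) hp.le)
    have b2 : κ' < σ / 2 * (d - 2) * (4 * α / d) := lt_of_lt_of_le hκ2 (mul_le_mul_of_nonneg_left (min_le_right _ _) hp.le)
    have hr0 : σ / (d / α) = σ * α / d := by field_simp
    have cr : ContinuousAt (fun t : ℝ => (σ - 2 * t) / (d / α + t)) 0 := by
      refine ContinuousAt.div (by fun_prop) (by fun_prop) ?_
      rw [add_zero]; positivity
    have f1 : ∀ᶠ t in 𝓝[>] (0 : ℝ), 0 < (σ - 2 * t) / (d / α + t) :=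
      ev_lt (f := fun _ => 0) (by fun_prop) cr (by simp only [mul_zero, sub_zero, add_zero]; positivity)
    have f2 : ∀ᶠ t in 𝓝[>] (0 : ℝ), κ' < (σ - 2 * t) / (d / α + t) * (2 * d - 4) :=
      ev_lt (f := fun _ => κ') (by fun_prop) (cr.mul (by fun_prop)) (by
        simp only [mul_zero, sub_zero, add_zero]
        rw [hr0]; refine lt_of_lt_of_le b2 (le_of_eq ?_); field_simp; ring)
    have f3 : ∀ᶠ t in 𝓝[>] (0 : ℝ), κ' < (σ - t) * (α - t) + (σ - 2 * t) / (d / α + t) * (d - 4 - t) :=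
      ev_lt (f := fun _ => κ') (by fun_prop) (ContinuousAt.add (by fun_prop) (cr.mul (by fun_prop))) (by
        simp only [mul_zero, sub_zero, add_zero]
        rw [hr0]; refine lt_of_lt_of_le b2 (le_of_eq ?_); field_simp; ring)
    have f4 : ∀ᶠ t in 𝓝[>] (0 : ℝ), κ' < (σ - t) * (α - t) + (τ / 2 + t) * (d - 4 - t) :=
      ev_lt (f := fun _ => κ') (by fun_prop) (by fun_prop) (by
        simp only [sub_zero, add_zero]
        rcases Nat.lt_or_ge d 4 with h4 | h4
        · have : d = 3 := by omega
          have hd3' : (d : ℝ) = 3 := by exact_mod_cast this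
          rw [hd3'] at b1 ⊢
          have : σ * min 1 α ≤ σ * α := mul_le_mul_of_nonneg_left m2 hσ0.le
          linarith
        · have h4' : (4 : ℝ) ≤ d := by exact_mod_cast h4
          have h5 : σ * α / d * ((d : ℝ) - 4) ≤ τ / 2 * (d - 4) := mul_le_mul_of_nonneg_right hc (by linarith)
          have h6 : σ / 2 * (d - 2) * (4 * α / d) = σ * α + σ * α / d * ((d : ℝ) - 4) := by field_simp; ring
          linarith)
    have e5 : ∀ᶠ t in 𝓝[>] (0 : ℝ), 0 < α - t :=
      ev_lt (f := fun _ => 0) (by fun_prop) (by fun_prop) (by simp [hα])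
    obtain ⟨t, ⟨⟨⟨⟨h1, h2⟩, ⟨h3, h4⟩⟩, ⟨⟨h5, h6⟩, h7⟩⟩, ht⟩⟩ :=
      (((e2.and e3).and (f1.and f2)).and ((f3.and f4).and e5) |>.and self_mem_nhdsWithin).exists
    have ht : 0 < t := ht
    have hgp : 0 < d / α + t := by positivity
    refine U_abs h hz (β := min 1 α - t) (m := σ - t) (k := τ / 2 + t) (κ' := κ') h2 (by linarith) (by linarith) hτ
      (by rw [hom]; linarith) h1 (by linarith) hκ1 ?_
    exact U_near hz hα hd (β := α - t) (g := d / α + t) (r := (σ - 2 * t) / (d / α + t)) (θ := t) h7 (by linarith) (by linarith)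
      (by rw [div_mul_cancel₀ _ hgp.ne']; linarith) h3 ht h4 h5 h6
end
end LG
end Part23

section Part24
open MeasureTheory ProbabilityTheory Filter Set Topology
open scoped ENNReal
namespace LG
section
variable {d : ℕ} {Ω : Type*} [MeasurableSpace Ω] {Q : (Fin d → ℤ) → Measure Ω} {Y : ℝ → Ω → (Fin d → ℤ)}
variable {α : ℝ} {Ωz : Type*} [MeasurableSpace Ωz] {μ : Measure Ωz} {z : (Fin d → ℤ) → Ωz → ℝ}

noncomputable def Ft (Q : (Fin d → ℤ) → Measure Ω) (Y : ℝ → Ω → (Fin d → ℤ)) (v : (Fin d → ℤ) → ℝ) (n : ℕ) (t : ℝ) : ℝ≥0∞ :=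
  ∫⁻ ω, ENNReal.ofReal (q (AF Y v t ω) (n : ℤ)) * ({0} : Set (Fin d → ℤ)).indicator 1 (Y t ω) ∂(Q 0)

lemma Wk.AF_mono (h : Wk d Q Y) {v : (Fin d → ℤ) → ℝ} (hv : ∀ y, 0 ≤ v y) :
    ∀ᵐ ω ∂(Q 0), ∀ s t, s ≤ t → AF Y v s ω ≤ AF Y v t ω := by
  filter_upwards [h.range 0] with ω hω s t hst
  obtain ⟨F, hF⟩ := hω t
  exact setIntegral_mono_set (h.path_int2 v hF) (ae_of_all _ fun u => hv _) (Ioc_subset_Ioc_right hst).eventuallyLE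

lemma Wk.Y_set (h : Wk d Q Y) (t : ℝ) (w : Fin d → ℤ) : MeasurableSet {ω | Y t ω = w} :=
  (h.meas.comp (measurable_const.prodMk measurable_id)) (measurableSet_singleton w)

lemma Wk.law0 (h : Wk d Q Y) {t : ℝ} (ht : 0 ≤ t) : Q 0 {ω | Y t ω = 0} = pk d t 0 0 := by
  rw [← h.law ht, ← lintegral_indicator_one (h.Y_set t 0)]
  apply lintegral_congr
  intro ω
  by_cases hh : Y t ω = 0
  · rw [indicator_of_mem (show ω ∈ {ω | Y t ω = 0} from hh), indicator_of_mem (show Y t ω ∈ ({0} : Set (Fin d → ℤ)) from hh)]; rfl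
  · rw [indicator_of_notMem (show ω ∉ {ω | Y t ω = 0} from hh), indicator_of_notMem (show Y t ω ∉ ({0} : Set (Fin d → ℤ)) from hh)]

/-- pointwise bound to integrated bound -/
lemma Wk.Ft_le (h : Wk d Q Y) {v : (Fin d → ℤ) → ℝ} {n : ℕ} {t : ℝ} (ht : 0 ≤ t) {a : ℝ} {B1 B2 : ℝ} (hB1 : 0 ≤ B1) (hB2 : 0 ≤ B2)
    (hb : ∀ ω, q (AF Y v t ω) (n : ℤ) ≤ B1 + if a ≤ AF Y v t ω then B2 else 0) :
    Ft Q Y v n t ≤ ENNReal.ofReal B1 * pk d t 0 0 + ENNReal.ofReal B2 * Q 0 ({ω | a ≤ AF Y v t ω} ∩ {ω | Y t ω = 0}) := by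
  have hms := h.AFset1 v a 0 t
  rw [← h.law0 ht, ← lintegral_indicator_one (h.Y_set t 0), ← lintegral_indicator_one hms,
    ← lintegral_const_mul _ (measurable_one.indicator (h.Y_set t 0)), ← lintegral_const_mul _ (measurable_one.indicator hms), 
    ← lintegral_add_left ((measurable_one.indicator (h.Y_set t 0)).const_mul _)]
  apply lintegral_mono
  intro ω
  show ENNReal.ofReal (q (AF Y v t ω) (n : ℤ)) * ({0} : Set (Fin d → ℤ)).indicator 1 (Y t ω) ≤ _
  beta_reduce
  by_cases hh : Y t ω = 0
  · rw [indicator_of_mem (show ω ∈ {ω | Y t ω = 0} from hh), indicator_of_mem (show Y t ω ∈ ({0} : Set (Fin d → ℤ)) from hh)]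
    have := hb ω
    by_cases ha : a ≤ AF Y v t ω
    · rw [indicator_of_mem (show ω ∈ {ω | a ≤ AF Y v t ω} ∩ {ω | Y t ω = 0} from ⟨ha, hh⟩)]
      rw [if_pos ha] at this
      simp only [Pi.one_apply, mul_one]
      rw [← ENNReal.ofReal_add hB1 hB2]
      exact ENNReal.ofReal_le_ofReal this
    · rw [if_neg ha, add_zero] at this
      simp only [Pi.one_apply, mul_one]
      exact le_add_right (ENNReal.ofReal_le_ofReal this)
  · rw [indicator_of_notMem (show Y t ω ∉ ({0} : Set (Fin d → ℤ)) from hh)]; simp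

lemma pk_le_one (hd : 1 ≤ d) (h : Wk d Q Y) {t : ℝ} (ht : 0 ≤ t) : pk d t 0 0 ≤ 1 := by
  rw [← h.law0 ht]
  have := h.prob 0
  exact prob_le_one

lemma Wk.early (h : Wk d Q Y) {v : (Fin d → ℤ) → ℝ} (hv : ∀ y, 0 ≤ v y) {τ σ κ E : ℝ} (hσ0 : 0 < σ) (hσ : σ < 2) (hE : -(σ / 2) - κ < E)
    (hU : ∀ᶠ n : ℕ in atTop, ∫⁻ t in Ioc 0 ((n : ℝ) ^ τ), Q 0 ({ω | (n : ℝ) ^ σ ≤ AF Y v t ω} ∩ {ω | Y t ω = 0})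
      ≤ ENNReal.ofReal ((n : ℝ) ^ (-κ))) :
    ∀ᶠ n : ℕ in atTop, ∫⁻ t in Ioc 0 ((n : ℝ) ^ τ), Ft Q Y v n t ≤ ENNReal.ofReal ((n : ℝ) ^ E) := by
  filter_upwards [hU, eventually_gt_atTop 0, ev_exp (c := 1) one_pos (show 0 < 1 - σ / 2 by linarith) (2 * Real.exp 2) τ (-E),
    ev_pow hE (2 * Real.exp 2)] with n hU hn0 hx1 hx2
  have hp : (0 : ℝ) < n := by exact_mod_cast hn0
  have hp1 : (1 : ℝ) ≤ n := by exact_mod_cast hn0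
  have hM1 : (1 : ℝ) ≤ (n : ℝ) ^ σ := Real.one_le_rpow hp1 hσ0.le
  have hsq : Real.sqrt ((n : ℝ) ^ σ) = (n : ℝ) ^ (σ / 2) := by
    rw [Real.sqrt_eq_rpow, ← Real.rpow_mul hp.le]; congr 1; ring
  have pt : ∀ t ∈ Ioc 0 ((n : ℝ) ^ τ), Ft Q Y v n t ≤ ENNReal.ofReal (Real.exp 2 * Real.exp (-(1 * (n : ℝ) ^ (1 - σ / 2)))) +
      ENNReal.ofReal (Real.exp 2 * (n : ℝ) ^ (-(σ / 2))) * Q 0 ({ω | (n : ℝ) ^ σ ≤ AF Y v t ω} ∩ {ω | Y t ω = 0}) := by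
    intro t ht
    refine (h.Ft_le ht.1.le (a := (n : ℝ) ^ σ) (B1 := Real.exp 2 * Real.exp (-(1 * (n : ℝ) ^ (1 - σ / 2))))
      (B2 := Real.exp 2 * (n : ℝ) ^ (-(σ / 2))) (by positivity) (by positivity) ?_).trans ?_
    · intro ω
      have hA := AF_nonneg (Y := Y) hv t ω
      refine (q_le hA _).trans ?_
      have hs1 : 1 ≤ Real.sqrt (max (AF Y v t ω) 1) := by
        rw [Real.one_le_sqrt]; exact le_max_right _ _
      have hs0 : 0 < Real.sqrt (max (AF Y v t ω) 1) := by linarith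
      by_cases ha : (n : ℝ) ^ σ ≤ AF Y v t ω
      · rw [if_pos ha]
        have h1 : (n : ℝ) ^ (σ / 2) ≤ Real.sqrt (max (AF Y v t ω) 1) := by
          rw [← hsq]; exact Real.sqrt_le_sqrt (ha.trans (le_max_left _ _))
        have h2 : 1 / Real.sqrt (max (AF Y v t ω) 1) ≤ (n : ℝ) ^ (-(σ / 2)) := by
          rw [Real.rpow_neg hp.le, one_div]; exact inv_anti₀ (by positivity) h1
        have h3 : Real.exp (-(|((n : ℤ) : ℝ)| / Real.sqrt (max (AF Y v t ω) 1))) ≤ 1 := by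
          rw [Real.exp_le_one_iff]; have : 0 ≤ |((n : ℤ) : ℝ)| / Real.sqrt (max (AF Y v t ω) 1) := by positivity
          linarith
        refine le_trans (mul_le_of_le_one_right (by positivity) h3) ?_
        have := mul_le_mul_of_nonneg_left h2 (Real.exp_pos 2).le
        have : 0 ≤ Real.exp 2 * Real.exp (-(1 * (n : ℝ) ^ (1 - σ / 2))) := by positivity
        linarith
      · rw [if_neg ha, add_zero]
        push Not at ha
        have h1 : Real.sqrt (max (AF Y v t ω) 1) ≤ (n : ℝ) ^ (σ / 2) := by
          rw [← hsq]; exact Real.sqrt_le_sqrt (max_le ha.le hM1)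
        have h2 : 1 / Real.sqrt (max (AF Y v t ω) 1) ≤ 1 := by
          rw [div_le_one hs0]; exact hs1
        have h3 : 1 * (n : ℝ) ^ (1 - σ / 2) ≤ |((n : ℤ) : ℝ)| / Real.sqrt (max (AF Y v t ω) 1) := by
          rw [le_div_iff₀ hs0]
          have e : |((n : ℤ) : ℝ)| = (n : ℝ) ^ (1 - σ / 2) * (n : ℝ) ^ (σ / 2) := by
            rw [← Real.rpow_add hp]; simp
          rw [e, one_mul]; gcongr
        have h4 := Real.exp_le_exp.2 (neg_le_neg h3)
        exact mul_le_mul (mul_le_of_le_one_right (Real.exp_pos _).le h2) h4 (Real.exp_pos _).le (Real.exp_pos _).le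
    · gcongr
      exact mul_le_of_le_one_right' (pk_le_one h.dpos h ht.1.le)
  refine (setLIntegral_mono' measurableSet_Ioc pt).trans ?_
  rw [lintegral_add_left measurable_const, lintegral_const_mul _ (h.AFset_fun v _ 0 0), setLIntegral_const, Real.volume_Ioc, sub_zero,
    ← ENNReal.ofReal_mul (by positivity)]
  refine (add_le_add le_rfl (mul_le_mul_right hU _)).trans ?_
  rw [← ENNReal.ofReal_mul (by positivity), ← ENNReal.ofReal_add (by positivity) (by positivity)]
  apply ENNReal.ofReal_le_ofReal
  rw [neg_neg] at hx1
  have e : (n : ℝ) ^ (-(σ / 2)) * (n : ℝ) ^ (-κ) = (n : ℝ) ^ (-(σ / 2) - κ) := by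
    rw [← Real.rpow_add hp]; rfl
  rw [mul_assoc (Real.exp 2) ((n : ℝ) ^ (-(σ / 2))), e]
  linarith

lemma Wk.Ft_le2 (h : Wk d Q Y) {v : (Fin d → ℤ) → ℝ} {n : ℕ} {t : ℝ} (ht : 0 ≤ t) {a : ℝ} {B1 B2 : ℝ} (hB1 : 0 ≤ B1) (hB2 : 0 ≤ B2)
    (hb : ∀ ω, q (AF Y v t ω) (n : ℤ) ≤ B1 + if AF Y v t ω ≤ a then B2 else 0) :
    Ft Q Y v n t ≤ ENNReal.ofReal B1 * pk d t 0 0 + ENNReal.ofReal B2 * Q 0 {ω | AF Y v t ω ≤ a} := by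
  have hms : MeasurableSet {ω | AF Y v t ω ≤ a} := measurableSet_le (h.AF_meas v t) measurable_const
  rw [← h.law0 ht, ← lintegral_indicator_one (h.Y_set t 0), ← lintegral_indicator_one hms,
    ← lintegral_const_mul _ (measurable_one.indicator (h.Y_set t 0)), ← lintegral_const_mul _ (measurable_one.indicator hms), 
    ← lintegral_add_left ((measurable_one.indicator (h.Y_set t 0)).const_mul _)]
  apply lintegral_mono
  intro ω
  show ENNReal.ofReal (q (AF Y v t ω) (n : ℤ)) * ({0} : Set (Fin d → ℤ)).indicator 1 (Y t ω) ≤ _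
  beta_reduce
  by_cases hh : Y t ω = 0
  · rw [indicator_of_mem (show ω ∈ {ω | Y t ω = 0} from hh), indicator_of_mem (show Y t ω ∈ ({0} : Set (Fin d → ℤ)) from hh)]
    have := hb ω
    by_cases ha : AF Y v t ω ≤ a
    · rw [indicator_of_mem (show ω ∈ {ω | AF Y v t ω ≤ a} from ha)]
      rw [if_pos ha] at this
      simp only [Pi.one_apply, mul_one]
      rw [← ENNReal.ofReal_add hB1 hB2]
      exact ENNReal.ofReal_le_ofReal this
    · rw [if_neg ha, add_zero] at this
      simp only [Pi.one_apply, mul_one]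
      exact le_add_right (ENNReal.ofReal_le_ofReal this)
  · rw [indicator_of_notMem (show Y t ω ∉ ({0} : Set (Fin d → ℤ)) from hh)]; simp

lemma lint_tail {s T : ℝ} (hs : 1 < s) (hT : 0 < T) :
    ∫⁻ t in Ioi T, ENNReal.ofReal (t ^ (-s)) = ENNReal.ofReal (T ^ (1 - s) / (s - 1)) := by
  rw [← ofReal_integral_eq_lintegral_ofReal (integrableOn_Ioi_rpow_of_lt (by linarith) hT), integral_Ioi_rpow_of_lt (by linarith) hT]
  · congr 1
    rw [show -s + 1 = -(s - 1) by ring, show 1 - s = -(s - 1) by ring, neg_div_neg_eq]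
  · filter_upwards [ae_restrict_mem measurableSet_Ioi] with t ht
    exact Real.rpow_nonneg (hT.le.trans (le_of_lt ht)) _

/-- the additive functional at real times -/
lemma Wk.LTreal (h : Wk d Q Y) {v : (Fin d → ℤ) → ℝ} (hv : ∀ y, 0 ≤ v y) {b K : ℝ} (hb : 0 ≤ b) (hK : 0 ≤ K)
    (hLT : ∀ᶠ N : ℕ in atTop, Q 0 {ω | AF Y v N ω ≤ (N : ℝ) ^ b} ≤ ENNReal.ofReal ((N : ℝ) ^ (-K))) :
    ∀ᶠ t : ℝ in atTop, Q 0 {ω | AF Y v t ω ≤ (t / 2) ^ b} ≤ ENNReal.ofReal ((t / 2) ^ (-K)) := by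
  filter_upwards [tendsto_nat_floor_atTop.eventually hLT, eventually_ge_atTop 2] with t ht h2
  have h3 : t / 2 ≤ (⌊t⌋₊ : ℝ) := by have := Nat.lt_floor_add_one t; linarith
  have h4 : (⌊t⌋₊ : ℝ) ≤ t := Nat.floor_le (by linarith)
  refine le_trans (measure_mono_ae ?_) (ht.trans (ENNReal.ofReal_le_ofReal (Real.rpow_le_rpow_of_nonpos (by linarith) h3 (by linarith))))
  filter_upwards [h.AF_mono hv] with ω hω h5
  have h5 : AF Y v t ω ≤ (t / 2) ^ b := h5
  show AF Y v (⌊t⌋₊ : ℝ) ω ≤ (⌊t⌋₊ : ℝ) ^ b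
  exact (hω _ _ h4).trans (h5.trans (Real.rpow_le_rpow (by linarith) h3 hb))

lemma Wk.late (h : Wk d Q Y) {v : (Fin d → ℤ) → ℝ} (hv : ∀ y, 0 ≤ v y) {τ b s E : ℝ} (hτ : 0 < τ) (hb : 0 ≤ b)
    (hs : s = d / 2 + b / 2) (hs1 : 1 < s) (hE : τ * (1 - s) < E)
    (hLT : ∀ᶠ N : ℕ in atTop, Q 0 {ω | AF Y v N ω ≤ (N : ℝ) ^ b} ≤ ENNReal.ofReal ((N : ℝ) ^ (-s))) :
    ∀ᶠ n : ℕ in atTop, ∫⁻ t in Ioi ((n : ℝ) ^ τ), Ft Q Y v n t ≤ ENNReal.ofReal ((n : ℝ) ^ E) := by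
  have hL := h.LTreal hv hb (by linarith) hLT
  obtain ⟨t0, ht0⟩ := eventually_atTop.1 hL
  have htt : Tendsto (fun n : ℕ => (n : ℝ) ^ τ) atTop atTop := (tendsto_rpow_atTop hτ).comp tendsto_natCast_atTop_atTop
  set C := Real.exp 2 * Real.exp 2 ^ d + Real.exp 2 with hC
  have hCp : 0 < C := by positivity
  filter_upwards [htt.eventually_ge_atTop t0, htt.eventually_ge_atTop 2, ev_pow hE (C * 2 ^ s / (s - 1)), eventually_gt_atTop 0] with n h1 h2 hx hn0
  have hp : (0 : ℝ) < n := by exact_mod_cast hn0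
  have hT0 : 0 < (n : ℝ) ^ τ := by positivity
  have pt : ∀ t ∈ Ioi ((n : ℝ) ^ τ), Ft Q Y v n t ≤ ENNReal.ofReal (C * 2 ^ s) * ENNReal.ofReal (t ^ (-s)) := by
    intro t ht
    have ht' : (n : ℝ) ^ τ < t := ht
    have htp : 0 < t / 2 := by linarith
    have hh1 : 1 ≤ t / 2 := by linarith
    have hq := ht0 t (by linarith)
    refine (h.Ft_le2 (by linarith) (a := (t / 2) ^ b) (B1 := Real.exp 2 * (t / 2) ^ (-(b / 2))) (B2 := Real.exp 2) (by positivity) (by positivity) ?_).trans ?_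
    · intro ω
      refine (q_le (AF_nonneg (Y := Y) hv t ω) _).trans ?_
      have hs1 : 1 ≤ Real.sqrt (max (AF Y v t ω) 1) := by
        rw [Real.one_le_sqrt]; exact le_max_right _ _
      have hs0 : 0 < Real.sqrt (max (AF Y v t ω) 1) := by linarith
      have h3 : Real.exp (-(|((n : ℤ) : ℝ)| / Real.sqrt (max (AF Y v t ω) 1))) ≤ 1 := by
        rw [Real.exp_le_one_iff]; have : 0 ≤ |((n : ℤ) : ℝ)| / Real.sqrt (max (AF Y v t ω) 1) := by positivity
        linarith
      refine le_trans (mul_le_of_le_one_right (by positivity) h3) ?_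
      by_cases ha : AF Y v t ω ≤ (t / 2) ^ b
      · rw [if_pos ha]
        have h2 : 1 / Real.sqrt (max (AF Y v t ω) 1) ≤ 1 := by
          rw [div_le_one hs0]; exact hs1
        have := mul_le_mul_of_nonneg_left h2 (Real.exp_pos 2).le
        have : 0 ≤ Real.exp 2 * (t / 2) ^ (-(b / 2)) := by positivity
        linarith
      · rw [if_neg ha, add_zero]
        push Not at ha
        have h1 : (t / 2) ^ (b / 2) ≤ Real.sqrt (max (AF Y v t ω) 1) := by
          have hsq : Real.sqrt ((t / 2) ^ b) = (t / 2) ^ (b / 2) := by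
            rw [Real.sqrt_eq_rpow, ← Real.rpow_mul htp.le]; congr 1; ring
          rw [← hsq]; exact Real.sqrt_le_sqrt (ha.le.trans (le_max_left _ _))
        have h2 : 1 / Real.sqrt (max (AF Y v t ω) 1) ≤ (t / 2) ^ (-(b / 2)) := by
          rw [Real.rpow_neg htp.le, one_div]; exact inv_anti₀ (by positivity) h1
        exact mul_le_mul_of_nonneg_left h2 (Real.exp_pos 2).le
    · have hpk : pk d t 0 0 ≤ ENNReal.ofReal (Real.exp 2 ^ d * (t / 2) ^ (-((d : ℝ) / 2))) := by
        unfold pk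
        apply ENNReal.ofReal_le_ofReal
        refine (heat_diag d h.dpos (by linarith) 0 0).trans ?_
        rw [inv_sqrt_pow (by positivity)]
        apply mul_le_mul_of_nonneg_left _ (by positivity)
        apply Real.rpow_le_rpow_of_nonpos htp _ (by have : (0 : ℝ) ≤ d := by positivity
                                                    linarith)
        exact le_trans (by linarith) (le_max_left _ _)
      refine (add_le_add (mul_le_mul_right hpk _) (mul_le_mul_right hq _)).trans ?_
      rw [← ENNReal.ofReal_mul (by positivity), ← ENNReal.ofReal_mul (by positivity), ← ENNReal.ofReal_mul (by positivity), 
        ← ENNReal.ofReal_add (by positivity) (by positivity)]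
      apply ENNReal.ofReal_le_ofReal
      have e1 : (t / 2) ^ (-(b / 2)) * (t / 2) ^ (-((d : ℝ) / 2)) = (t / 2) ^ (-s) := by
        rw [← Real.rpow_add htp, hs]; congr 1; ring
      have e2 : (t / 2) ^ (-s) = 2 ^ s * t ^ (-s) := by
        rw [Real.div_rpow (by linarith) (by norm_num), Real.rpow_neg (x := 2) (by norm_num), div_inv_eq_mul, mul_comm]
      calc _ = Real.exp 2 * Real.exp 2 ^ d * ((t / 2) ^ (-(b / 2)) * (t / 2) ^ (-((d : ℝ) / 2))) + Real.exp 2 * (t / 2) ^ (-s) := by ring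
        _ = C * (t / 2) ^ (-s) := by rw [e1, hC]; ring
        _ ≤ _ := by rw [e2]; apply le_of_eq; ring
  refine (setLIntegral_mono' measurableSet_Ioi pt).trans ?_
  rw [lintegral_const_mul _ (by fun_prop), lint_tail hs1 hT0, ← ENNReal.ofReal_mul (by positivity)]
  apply ENNReal.ofReal_le_ofReal
  refine le_trans (le_of_eq ?_) hx
  rw [← Real.rpow_mul hp.le]; ring
end
end LG
end Part24

section Part25
open MeasureTheory ProbabilityTheory Filter Set Topology
open scoped ENNReal
namespace LG
section
variable {d : ℕ} {Ω : Type*} [MeasurableSpace Ω] {Q : (Fin d → ℤ) → Measure Ω} {Y : ℝ → Ω → (Fin d → ℤ)}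
variable {α : ℝ} {Ωz : Type*} [MeasurableSpace Ωz] {μ : Measure Ωz} {z : (Fin d → ℤ) → Ωz → ℝ}

lemma Wk.lower (h : Wk d Q Y) : ∃ C : ℝ, 0 < C ∧ ∀ (v : (Fin d → ℤ) → ℝ) (τ σ κ1 κ2 E : ℝ), κ1 < κ2 → E < -(σ / 2) - κ1 →
    (∀ᶠ n : ℕ in atTop, ENNReal.ofReal ((n : ℝ) ^ (-κ1)) ≤ 
      ∫⁻ t in Ioc 0 ((n : ℝ) ^ τ), Q 0 ({ω | C * (n : ℝ) ^ 2 ≤ AF Y v t ω} ∩ {ω | Y t ω = 0})) →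
    (∀ᶠ n : ℕ in atTop, ∫⁻ t in Ioc 0 ((n : ℝ) ^ τ), Q 0 ({ω | (n : ℝ) ^ σ ≤ AF Y v t ω} ∩ {ω | Y t ω = 0})
      ≤ ENNReal.ofReal ((n : ℝ) ^ (-κ2))) →
    ∀ᶠ n : ℕ in atTop, ENNReal.ofReal ((n : ℝ) ^ E) ≤ ∫⁻ t in Ioi 0, Ft Q Y v n t := by
  obtain ⟨c, hc, hq⟩ := q_ge
  refine ⟨max 1 (1 / c), by positivity, fun v τ σ κ1 κ2 E hκ hE hV hU => ?_⟩
  set C := max 1 (1 / c) with hC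
  have hC1 : 1 ≤ C := le_max_left _ _
  have hC2 : 1 ≤ c * C := by
    have := mul_le_mul_of_nonneg_left (le_max_right 1 (1 / c)) hc.le
    rwa [mul_one_div_cancel hc.ne'] at this
  filter_upwards [hV, hU, eventually_gt_atTop 0, ev_pow (show -κ2 < -κ1 by linarith) 2, ev_pow hE (2 / c)] with n hV hU hn0 hx1 hx2
  have hp : (0 : ℝ) < n := by exact_mod_cast hn0
  have hp1 : (1 : ℝ) ≤ n := by exact_mod_cast hn0
  have pt : ∀ t, Q 0 ({ω | C * (n : ℝ) ^ 2 ≤ AF Y v t ω} ∩ {ω | Y t ω = 0}) ≤ 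
      Q 0 ({ω | (n : ℝ) ^ σ ≤ AF Y v t ω} ∩ {ω | Y t ω = 0}) + ENNReal.ofReal ((n : ℝ) ^ (σ / 2) / c) * Ft Q Y v n t := by
    intro t
    set s1 := {ω | C * (n : ℝ) ^ 2 ≤ AF Y v t ω} ∩ {ω | Y t ω = 0} with hs1
    set s2 := {ω | (n : ℝ) ^ σ ≤ AF Y v t ω} ∩ {ω | Y t ω = 0} with hs2
    have hm : MeasurableSet (s1 \ s2) := (h.AFset1 v _ 0 t).diff (h.AFset1 v _ 0 t)
    have hu : Q 0 s1 ≤ Q 0 s2 + Q 0 (s1 \ s2) := by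
      refine le_trans (measure_mono ?_) (measure_union_le _ _)
      rw [union_diff_self]; exact subset_union_right
    refine hu.trans (add_le_add le_rfl ?_)
    unfold Ft
    rw [← lintegral_const_mul' _ _ ENNReal.ofReal_ne_top, ← lintegral_indicator_one hm]
    apply lintegral_mono
    intro ω
    beta_reduce
    by_cases hw : ω ∈ s1 \ s2
    · rw [indicator_of_mem hw]
      obtain ⟨⟨h1, h2⟩, h3⟩ := hw
      have h1 : C * (n : ℝ) ^ 2 ≤ AF Y v t ω := h1
      have h2 : Y t ω = 0 := h2
      have h4 : AF Y v t ω < (n : ℝ) ^ σ := by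
        by_contra h5
        exact h3 ⟨not_lt.1 h5, h2⟩
      rw [indicator_of_mem (show Y t ω ∈ ({0} : Set (Fin d → ℤ)) from h2), Pi.one_apply, Pi.one_apply, mul_one,
        ← ENNReal.ofReal_mul (by positivity), ← ENNReal.ofReal_one]
      apply ENNReal.ofReal_le_ofReal
      have hn2 : (1 : ℝ) ≤ (n : ℝ) ^ 2 := one_le_pow₀ hp1
      have hA1 : 1 ≤ AF Y v t ω := by nlinarith
      have hh := hq _ hA1 (n : ℤ) (by
        push_cast
        have := mul_le_mul_of_nonneg_left h1 hc.le
        nlinarith)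
      have hsq : Real.sqrt (AF Y v t ω) ≤ (n : ℝ) ^ (σ / 2) := by
        have : Real.sqrt ((n : ℝ) ^ σ) = (n : ℝ) ^ (σ / 2) := by
          rw [Real.sqrt_eq_rpow, ← Real.rpow_mul hp.le]; congr 1; ring
        rw [← this]; exact Real.sqrt_le_sqrt h4.le
      have hsp : 0 < Real.sqrt (AF Y v t ω) := Real.sqrt_pos.2 (by linarith)
      calc (1 : ℝ) = Real.sqrt (AF Y v t ω) / c * (c / Real.sqrt (AF Y v t ω)) := by field_simp
        _ ≤ (n : ℝ) ^ (σ / 2) / c * q (AF Y v t ω) (n : ℤ) := by gcongr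
    · rw [indicator_of_notMem hw]; exact zero_le
  have hI : ENNReal.ofReal ((n : ℝ) ^ (-κ1)) ≤ ENNReal.ofReal ((n : ℝ) ^ (-κ2)) + 
      ENNReal.ofReal ((n : ℝ) ^ (σ / 2) / c) * ∫⁻ t in Ioi 0, Ft Q Y v n t := by
    refine hV.trans ((lintegral_mono pt).trans ?_)
    rw [lintegral_add_left (h.AFset_fun v _ 0 0), lintegral_const_mul' _ _ ENNReal.ofReal_ne_top]
    exact add_le_add hU (mul_le_mul_right (lintegral_mono_set Ioc_subset_Ioi_self) _)
  have e1 : ENNReal.ofReal ((n : ℝ) ^ (-κ1)) = ENNReal.ofReal ((n : ℝ) ^ (-κ1) / 2) + ENNReal.ofReal ((n : ℝ) ^ (-κ1) / 2) := by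
    rw [← ENNReal.ofReal_add (by positivity) (by positivity)]; congr 1; ring
  have hI2 : ENNReal.ofReal ((n : ℝ) ^ (-κ1) / 2) ≤ ENNReal.ofReal ((n : ℝ) ^ (σ / 2) / c) * ∫⁻ t in Ioi 0, Ft Q Y v n t := by
    rw [e1] at hI
    have h2 : ENNReal.ofReal ((n : ℝ) ^ (-κ2)) ≤ ENNReal.ofReal ((n : ℝ) ^ (-κ1) / 2) := ENNReal.ofReal_le_ofReal (by linarith)
    exact (ENNReal.add_le_add_iff_left ENNReal.ofReal_ne_top).1 (hI.trans (add_le_add h2 le_rfl))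
  have hI3 := mul_le_mul_right hI2 (ENNReal.ofReal (c * (n : ℝ) ^ (-(σ / 2))))
  rw [← mul_assoc, ← ENNReal.ofReal_mul (by positivity), ← ENNReal.ofReal_mul (by positivity)] at hI3
  have e2 : c * (n : ℝ) ^ (-(σ / 2)) * ((n : ℝ) ^ (σ / 2) / c) = 1 := by
    rw [Real.rpow_neg hp.le]; field_simp
  rw [e2, ENNReal.ofReal_one, one_mul] at hI3
  refine le_trans (ENNReal.ofReal_le_ofReal ?_) hI3
  have e3 : (n : ℝ) ^ (-(σ / 2) - κ1) = (n : ℝ) ^ (-(σ / 2)) * (n : ℝ) ^ (-κ1) := by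
    rw [← Real.rpow_add hp]; rfl
  rw [e3] at hx2
  have := mul_le_mul_of_nonneg_left hx2 (show 0 ≤ c / 2 by positivity)
  calc (n : ℝ) ^ E = c / 2 * (2 / c * (n : ℝ) ^ E) := by field_simp
    _ ≤ _ := this
    _ = _ := by ring

lemma Wk.V1 (h : Wk d Q Y) {v : (Fin d → ℤ) → ℝ} (hv : ∀ y, 0 ≤ v y) {C τ b κ : ℝ} (hτ : 0 < τ) (hb : 0 ≤ b)
    (hbτ : 2 < τ * b) (hκ : -κ < τ * (1 - d / 2))
    (hLT : ∀ᶠ N : ℕ in atTop, Q 0 {ω | AF Y v N ω ≤ (N : ℝ) ^ b} ≤ ENNReal.ofReal ((N : ℝ) ^ (-(d / 2 + 1 : ℝ)))) :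
    ∀ᶠ n : ℕ in atTop, ENNReal.ofReal ((n : ℝ) ^ (-κ)) ≤ 
      ∫⁻ t in Ioc 0 ((n : ℝ) ^ τ), Q 0 ({ω | C * (n : ℝ) ^ 2 ≤ AF Y v t ω} ∩ {ω | Y t ω = 0}) := by
  have hL := h.LTreal hv hb (by positivity) hLT
  obtain ⟨t0, ht0⟩ := eventually_atTop.1 hL
  obtain ⟨c, hc, -, hge⟩ := heat_ge d h.dpos
  have htt : Tendsto (fun n : ℕ => (n : ℝ) ^ τ) atTop atTop := (tendsto_rpow_atTop hτ).comp tendsto_natCast_atTop_atTop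
  filter_upwards [htt.eventually_ge_atTop (2 * t0), htt.eventually_ge_atTop 4, eventually_gt_atTop 0, ev_pow hbτ (C * 4 ^ b), 
    ev_pow hκ (4 / c), ev_pow (show τ * (-(d / 2 + 1)) < τ * (-(d / 2 : ℝ)) by nlinarith) (2 / c * 4 ^ (d / 2 + 1 : ℝ))] with n h1 h2 hn0 hx1 hx2 hx3
  have hp : (0 : ℝ) < n := by exact_mod_cast hn0
  set T := (n : ℝ) ^ τ with hT
  have hT0 : 0 < T := by positivity
  have hdn : (0 : ℝ) ≤ d := by positivity
  have pt : ∀ t ∈ Ioc (T / 2) T, ENNReal.ofReal (c / 2 * T ^ (-(d / 2 : ℝ))) ≤ Q 0 ({ω | C * (n : ℝ) ^ 2 ≤ AF Y v t ω} ∩ {ω | Y t ω = 0}) := by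
    intro t ht
    have ht1 := ht.1
    have hq := ht0 t (by linarith)
    have ht4 : T / 4 ≤ t / 2 := by linarith
    have htp : 0 < t := by linarith
    have b1 : C * (n : ℝ) ^ 2 ≤ (t / 2) ^ b := by
      refine le_trans ?_ (Real.rpow_le_rpow (by positivity) ht4 hb)
      rw [Real.div_rpow hT0.le (by norm_num), le_div_iff₀ (by positivity), hT, ← Real.rpow_mul hp.le]
      refine le_trans (le_of_eq ?_) hx1
      rw [Real.rpow_two]; ring
    have b2 : (t / 2) ^ (-(d / 2 + 1 : ℝ)) ≤ c / 2 * T ^ (-(d / 2 : ℝ)) := by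
      refine le_trans (Real.rpow_le_rpow_of_nonpos (by positivity) ht4 (by linarith)) ?_
      rw [Real.div_rpow hT0.le (by norm_num), Real.rpow_neg (x := 4) (by norm_num), div_inv_eq_mul, hT, ← Real.rpow_mul hp.le, 
        ← Real.rpow_mul hp.le]
      have := mul_le_mul_of_nonneg_left hx3 (show 0 ≤ c / 2 by positivity)
      refine le_trans (le_of_eq ?_) this
      field_simp
    have b3 : ENNReal.ofReal (c * T ^ (-(d / 2 : ℝ))) ≤ pk d t 0 0 := by
      unfold pk
      apply ENNReal.ofReal_le_ofReal
      refine le_trans ?_ (hge t (by linarith) 0 0 (by simp; positivity))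
      rw [inv_sqrt_pow htp]
      apply mul_le_mul_of_nonneg_left _ hc.le
      exact Real.rpow_le_rpow_of_nonpos htp ht.2 (by linarith)
    have b4 : Q 0 {ω | Y t ω = 0} ≤ Q 0 ({ω | C * (n : ℝ) ^ 2 ≤ AF Y v t ω} ∩ {ω | Y t ω = 0}) + Q 0 {ω | AF Y v t ω ≤ (t / 2) ^ b} := by
      refine le_trans (measure_mono ?_) (measure_union_le _ _)
      intro ω hω
      rcases le_total (AF Y v t ω) ((t / 2) ^ b) with h5 | h5
      · exact Or.inr h5
      · exact Or.inl ⟨b1.trans h5, hω⟩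
    rw [h.law0 htp.le] at b4
    have b5 := (b3.trans b4).trans (add_le_add le_rfl (hq.trans (ENNReal.ofReal_le_ofReal b2)))
    have e1 : c * T ^ (-(d / 2 : ℝ)) = c / 2 * T ^ (-(d / 2 : ℝ)) + c / 2 * T ^ (-(d / 2 : ℝ)) := by ring
    rw [e1, ENNReal.ofReal_add (by positivity) (by positivity)] at b5
    exact (ENNReal.add_le_add_iff_right ENNReal.ofReal_ne_top).1 b5
  refine le_trans ?_ (lintegral_mono_set (Ioc_subset_Ioc_left (show 0 ≤ T / 2 by positivity)))
  refine le_trans ?_ (setLIntegral_mono' measurableSet_Ioc pt)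
  rw [setLIntegral_const, Real.volume_Ioc, ← ENNReal.ofReal_mul (by positivity)]
  apply ENNReal.ofReal_le_ofReal
  have := mul_le_mul_of_nonneg_left hx2 (show 0 ≤ c / 4 by positivity)
  rw [Real.rpow_mul hp.le, ← hT, sub_eq_add_neg, Real.rpow_add hT0, Real.rpow_one] at this
  calc (n : ℝ) ^ (-κ) = c / 4 * (4 / c * (n : ℝ) ^ (-κ)) := by field_simp
    _ ≤ _ := this
    _ = _ := by ring

lemma Wk.V2 (h : Wk d Q Y) (hz : IsScenery d α μ z) (hα : 0 < α) (hd : 3 ≤ d) {C τ ρ κ : ℝ} (hC : 0 < C) 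
    (hρ : 2 * α / d < ρ) (hτ : 2 * ρ < τ) (hκ : ρ * (2 * d - 4) < κ) :
    ∀ᵐ ζ ∂μ, ∀ᶠ n : ℕ in atTop, ENNReal.ofReal ((n : ℝ) ^ (-κ)) ≤ 
      ∫⁻ t in Ioc 0 ((n : ℝ) ^ τ), Q 0 ({ω | C * (n : ℝ) ^ 2 ≤ AF Y (fun y => z y ζ) t ω} ∩ {ω | Y t ω = 0}) := by
  obtain ⟨c, hc, lam, hlam, hlow⟩ := h.low_hit hd
  filter_upwards [high_pt hz h.dpos hα (sub_pos.2 hρ) (show 0 < C / lam by positivity)] with ζ hζ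
  filter_upwards [hζ, eventually_gt_atTop 0, ev_pow hτ (1 / c), ev_pow (show -κ < ρ * (4 - 2 * d) by linarith) (1 / c)] with n hy hn0 hx1 hx2
  have hp : (0 : ℝ) < n := by exact_mod_cast hn0
  obtain ⟨y, hy1, hy2⟩ := hy
  rw [add_sub_cancel] at hy1
  have hj := jb_pos y
  have hd3 : (3 : ℝ) ≤ d := by exact_mod_cast hd
  have l := hlow y ((n : ℝ) ^ τ) (by
    have := mul_le_mul_of_nonneg_left hx1 hc.le
    rw [← mul_assoc, mul_one_div_cancel hc.ne', one_mul] at this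
    refine le_trans ?_ this
    rw [mul_comm 2 ρ, Real.rpow_mul hp.le, Real.rpow_two]
    gcongr)
  refine le_trans (ENNReal.ofReal_le_ofReal ?_) (l.trans ?_)
  · have := mul_le_mul_of_nonneg_left hx2 hc.le
    rw [← mul_assoc, mul_one_div_cancel hc.ne', one_mul] at this
    refine this.trans ?_
    apply mul_le_mul_of_nonneg_left _ hc.le
    rw [Real.rpow_mul hp.le]
    exact Real.rpow_le_rpow_of_nonpos hj hy1 (by linarith)
  · apply lintegral_mono
    intro t
    apply measure_mono_ae
    filter_upwards [h.range 0] with ω hω hm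
    obtain ⟨F, hF⟩ := hω t
    obtain ⟨hm1, hm2⟩ := hm
    refine ⟨?_, hm2⟩
    have hm1 : lam ≤ AF Y (({y} : Set (Fin d → ℤ)).indicator 1) t ω := hm1
    show C * (n : ℝ) ^ 2 ≤ AF Y (fun y => z y ζ) t ω
    have h1 : z y ζ * AF Y (({y} : Set (Fin d → ℤ)).indicator 1) t ω ≤ AF Y (fun y => z y ζ) t ω := by
      unfold AF
      rw [← integral_const_mul]
      apply setIntegral_mono
      · exact (h.path_int2 _ hF).const_mul _
      · exact h.path_int2 (fun y => z y ζ) hF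
      · intro u
        beta_reduce
        by_cases hu : Y u ω = y
        · rw [indicator_of_mem (show Y u ω ∈ ({y} : Set (Fin d → ℤ)) from hu), hu]; simp
        · rw [indicator_of_notMem (show Y u ω ∉ ({y} : Set (Fin d → ℤ)) from hu), mul_zero]; exact hz.nonneg _ _
    refine le_trans ?_ h1
    calc C * (n : ℝ) ^ 2 = C / lam * (n : ℝ) ^ 2 * lam := by field_simp
      _ ≤ _ := by gcongr; exact hz.nonneg _ _
end
end LG
end Part25

section Part26
open MeasureTheory ProbabilityTheory Filter Set Topology
open scoped ENNReal
namespace LG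
section
variable {d : ℕ} {Ω : Type*} [MeasurableSpace Ω] {Q : (Fin d → ℤ) → Measure Ω} {Y : ℝ → Ω → (Fin d → ℤ)}
variable {α : ℝ} {Ωz : Type*} [MeasurableSpace Ωz] {μ : Measure Ωz} {z : (Fin d → ℤ) → Ωz → ℝ}

lemma Wk.upper (h : Wk d Q Y) (hz : IsScenery d α μ z) (hα : 0 < α) (h1 : d = 1 → 1 < aex d α) {E : ℝ}
    (hE1 : -1 - ((d : ℝ) - 2) / aex d α < E) (hE2 : 3 ≤ d → -1 - ((d : ℝ) - 2) * min α (4 * α / d) < E) :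
    ∀ᵐ ζ ∂μ, ∀ᶠ n : ℕ in atTop, ∫⁻ t in Ioi 0, Ft Q Y (fun y => z y ζ) n t ≤ ENNReal.ofReal ((n : ℝ) ^ E) := by
  obtain ⟨E', hE1', hE2', hEE⟩ : ∃ E', -1 - ((d : ℝ) - 2) / aex d α < E' ∧ (3 ≤ d → -1 - ((d : ℝ) - 2) * min α (4 * α / d) < E') ∧ E' < E := by
    by_cases hd : 3 ≤ d
    · obtain ⟨E', hh, hE'⟩ := exists_between (max_lt hE1 (hE2 hd))
      exact ⟨E', (le_max_left _ _).trans_lt hh, fun _ => (le_max_right _ _).trans_lt hh, hE'⟩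
    · obtain ⟨E', hh, hE'⟩ := exists_between hE1
      exact ⟨E', hh, fun h => absurd h hd, hE'⟩
  have ha1 := one_le_aex d α
  have hdp := h.dpos
  set a := aex d α with ha
  have ha0 : a ≠ 0 := by linarith
  have f1 : ∀ᶠ t in 𝓝[>] (0 : ℝ), t < 1 / 2 :=
    ev_lt (g := fun _ => 1 / 2) (by fun_prop) (by fun_prop) (by norm_num)
  have f2 : ∀ᶠ t in 𝓝[>] (0 : ℝ), 1 < (d : ℝ) / 2 + (a - t) / 2 :=
    ev_lt (f := fun _ => 1) (by fun_prop) (by fun_prop) (by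
      rw [sub_zero]
      rcases Nat.lt_or_ge d 2 with h2 | h2
      · have : d = 1 := by omega
        have h3 := h1 this
        rw [this]; push_cast; linarith
      · have : (2 : ℝ) ≤ d := by exact_mod_cast h2
        linarith)
  have f3 : ∀ᶠ t in 𝓝[>] (0 : ℝ), (2 - 2 * t) / a * (1 - ((d : ℝ) / 2 + (a - t) / 2)) < E' :=
    ev_lt (g := fun _ => E') (by fun_prop) (by fun_prop) (by
      refine lt_of_le_of_lt (le_of_eq ?_) hE1'
      field_simp; ring)
  have f4 : ∀ᶠ t in 𝓝[>] (0 : ℝ), 3 ≤ d → -((2 - t) / 2) - ((2 - t) / 2 * (d - 2) * min α (4 * α / d) - t) < E' := by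
    by_cases hd : 3 ≤ d
    · filter_upwards [ev_lt (f := fun t => -((2 - t) / 2) - ((2 - t) / 2 * ((d : ℝ) - 2) * min α (4 * α / d) - t)) (g := fun _ => E') 
        (by fun_prop) (by fun_prop) (by
          refine lt_of_le_of_lt (le_of_eq ?_) (hE2' hd)
          ring)] with t ht _
      exact ht
    · exact Eventually.of_forall fun t h => absurd h hd
  obtain ⟨t, ⟨⟨⟨g1, g2⟩, g3⟩, g4⟩, ht⟩ := (((f1.and f2).and f3).and f4 |>.and self_mem_nhdsWithin).exists
  have ht : 0 < t := ht
  have hτ : 0 < (2 - 2 * t) / a := div_pos (by linarith) (by linarith)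
  have hτa : (2 - 2 * t) / a * a < 2 - t := by rw [div_mul_cancel₀ _ ha0]; linarith
  obtain ⟨κ, hκ, hU⟩ : ∃ κ, -((2 - t) / 2) - κ < E' ∧ ∀ᵐ ζ ∂μ, ∀ᶠ n : ℕ in atTop, ∫⁻ s in Ioc 0 ((n : ℝ) ^ ((2 - 2 * t) / a)), 
      Q 0 ({ω | (n : ℝ) ^ (2 - t) ≤ AF Y (fun y => z y ζ) s ω} ∩ {ω | Y s ω = 0}) ≤ ENNReal.ofReal ((n : ℝ) ^ (-κ)) := by
    by_cases hd : 3 ≤ d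
    · exact ⟨_, g4 hd, U3 h hz hα hd hτ hτa (by linarith)⟩
    · exact ⟨-E', by linarith, U12 h hz hα (by omega) (-E') hτ hτa⟩
  filter_upwards [hU, h.LTas hz hα ht ((d : ℝ) / 2 + (a - t) / 2)] with ζ hU hL
  filter_upwards [h.early (fun y => hz.nonneg y ζ) (by linarith) (by linarith) hκ hU, 
    h.late (fun y => hz.nonneg y ζ) hτ (by linarith) rfl g2 g3 hL, ev_pow hEE 2] with n hA hB hx
  rw [← Ioc_union_Ioi_eq_Ioi (show (0 : ℝ) ≤ (n : ℝ) ^ ((2 - 2 * t) / a) by positivity)]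
  refine (lintegral_union_le _ _ _).trans ((add_le_add hA hB).trans ?_)
  rw [← ENNReal.ofReal_add (by positivity) (by positivity)]
  exact ENNReal.ofReal_le_ofReal (by linarith)

lemma Wk.lower1 (h : Wk d Q Y) (hz : IsScenery d α μ z) (hα : 0 < α) (hm : 3 ≤ d → 1 / aex d α ≤ min α (4 * α / d)) {E : ℝ}
    (hE : E < -1 - ((d : ℝ) - 2) / aex d α) :
    ∀ᵐ ζ ∂μ, ∀ᶠ n : ℕ in atTop, ENNReal.ofReal ((n : ℝ) ^ E) ≤ ∫⁻ t in Ioi 0, Ft Q Y (fun y => z y ζ) n t := by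
  obtain ⟨C, hC, hlow⟩ := h.lower
  have ha1 := one_le_aex d α
  have hdp := h.dpos
  set a := aex d α with ha
  have ha0 : a ≠ 0 := by linarith
  have hap : 0 < a := by linarith
  have f1 : ∀ᶠ t in 𝓝[>] (0 : ℝ), t < 1 / 2 :=
    ev_lt (g := fun _ => 1 / 2) (by fun_prop) (by fun_prop) (by norm_num)
  have f2 : ∀ᶠ t in 𝓝[>] (0 : ℝ), E < -((2 + 2 * t) / 2) - (-((2 + t) / a * (1 - (d : ℝ) / 2)) + t / (4 * a)) :=
    ev_lt (f := fun _ => E) (by fun_prop) (by fun_prop) (by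
      refine lt_of_lt_of_le hE (le_of_eq ?_)
      field_simp; ring)
  obtain ⟨t, ⟨g1, g2⟩, ht⟩ := (f1.and f2 |>.and self_mem_nhdsWithin).exists
  have ht : 0 < t := ht
  have hτ : 0 < (2 + t) / a := by positivity
  have hτa : (2 + t) / a * a < 2 + 2 * t := by rw [div_mul_cancel₀ _ ha0]; linarith
  obtain ⟨κ, hκ, hU⟩ : ∃ κ, -((2 + t) / a * (1 - (d : ℝ) / 2)) + t / (4 * a) < κ ∧ ∀ᵐ ζ ∂μ, ∀ᶠ n : ℕ in atTop, ∫⁻ s in Ioc 0 ((n : ℝ) ^ ((2 + t) / a)), 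
      Q 0 ({ω | (n : ℝ) ^ (2 + 2 * t) ≤ AF Y (fun y => z y ζ) s ω} ∩ {ω | Y s ω = 0}) ≤ ENNReal.ofReal ((n : ℝ) ^ (-κ)) := by
    by_cases hd : 3 ≤ d
    · have hd3 : (3 : ℝ) ≤ d := by exact_mod_cast hd
      obtain ⟨κ, hk1, hk2⟩ := exists_between (show -((2 + t) / a * (1 - (d : ℝ) / 2)) + t / (4 * a) < (2 + 2 * t) / 2 * (d - 2) * (1 / a) by
        rw [← sub_pos, show (2 + 2 * t) / 2 * ((d : ℝ) - 2) * (1 / a) - (-((2 + t) / a * (1 - (d : ℝ) / 2)) + t / (4 * a)) = 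
          t / a * (((d : ℝ) - 2) / 2 - 1 / 4) by field_simp; ring]
        exact mul_pos (by positivity) (by linarith))
      refine ⟨κ, hk1, U3 h hz hα hd hτ hτa (hk2.trans_le (mul_le_mul_of_nonneg_left (hm hd) ?_))⟩
      exact mul_nonneg (by linarith) (by linarith)
    · exact ⟨_, lt_add_one _, U12 h hz hα (by omega) _ hτ hτa⟩
  have hta : 0 < a * t / 4 := by positivity
  filter_upwards [hU, h.LTas hz hα hta ((d : ℝ) / 2 + 1)] with ζ hU hL
  refine hlow _ _ _ _ _ _ hκ g2 ?_ hU
  refine h.V1 (fun y => hz.nonneg y ζ) hτ ?_ ?_ ?_ hL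
  · nlinarith
  · rw [← ha, show (2 + t) / a * (a - a * t / 4) = 2 + t / 2 - t ^ 2 / 4 by field_simp; ring]
    nlinarith
  · have : 0 < t / (4 * a) := by positivity
    linarith

lemma Wk.lower2 (h : Wk d Q Y) (hz : IsScenery d α μ z) (hα : 0 < α) (hd : 3 ≤ d) (hm : 4 * α / d < min 1 α) {E : ℝ}
    (hE : E < -1 - ((d : ℝ) - 2) * (4 * α / d)) :
    ∀ᵐ ζ ∂μ, ∀ᶠ n : ℕ in atTop, ENNReal.ofReal ((n : ℝ) ^ E) ≤ ∫⁻ t in Ioi 0, Ft Q Y (fun y => z y ζ) n t := by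
  obtain ⟨C, hC, hlow⟩ := h.lower
  have hdp := h.dpos
  have hd3 : (3 : ℝ) ≤ d := by exact_mod_cast hd
  have hd0 : (d : ℝ) ≠ 0 := by positivity
  have hinv := aex_inv (d := d) (by omega) hα
  have hb0 : 0 < min 1 α := by simp [hα]
  have hmin : min α (4 * α / d) = 4 * α / d := min_eq_right (hm.le.trans (min_le_right _ _))
  have f1 : ∀ᶠ t in 𝓝[>] (0 : ℝ), 2 * (2 * α / d + α / (4 * d) * t) < 2 * min 1 α :=
    ev_lt (g := fun _ => 2 * min 1 α) (by fun_prop) (by fun_prop) (by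
      have : 2 * (2 * α / d + α / (4 * d) * 0) = 4 * α / d := by ring
      rw [this]; linarith)
  have f2 : ∀ᶠ t in 𝓝[>] (0 : ℝ), E < -((2 + t) / 2) - ((2 * α / d + α / (4 * d) * t) * (2 * d - 4) + α / (4 * d) * t) :=
    ev_lt (f := fun _ => E) (by fun_prop) (by fun_prop) (by
      refine lt_of_lt_of_le hE (le_of_eq ?_)
      field_simp; ring)
  obtain ⟨t, ⟨g1, g2⟩, ht⟩ := (f1.and f2 |>.and self_mem_nhdsWithin).exists
  have ht : 0 < t := ht
  have hpos : 0 < α / (4 * d) * t := by positivity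
  obtain ⟨κ, hk1, hk2⟩ := exists_between (show (2 * α / d + α / (4 * d) * t) * (2 * d - 4) + α / (4 * d) * t < (2 + t) / 2 * (d - 2) * min α (4 * α / d) by
    rw [hmin, ← sub_pos, show (2 + t) / 2 * ((d : ℝ) - 2) * (4 * α / d) - ((2 * α / d + α / (4 * d) * t) * (2 * d - 4) + α / (4 * d) * t) = 
          α / (4 * d) * t * (3 * (2 * d - 4) - 1) by field_simp; ring]
    exact mul_pos (by positivity) (by linarith))
  filter_upwards [U3 h hz hα hd (τ := 2 * min 1 α) (σ := 2 + t) (by positivity) (by nlinarith) hk2, 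
    h.V2 hz hα hd hC (ρ := 2 * α / d + α / (4 * d) * t) (by linarith) g1 (lt_add_of_pos_right _ hpos)] with ζ hU hV
  exact hlow _ _ _ _ _ _ hk1 g2 hV hU

lemma log_lim {I : ℕ → ℝ≥0∞} {e : ℝ} (hu : ∀ k : ℕ, ∀ᶠ n : ℕ in atTop, I n ≤ ENNReal.ofReal ((n : ℝ) ^ (e + 1 / ((k : ℝ) + 1))))
    (hl : ∀ k : ℕ, ∀ᶠ n : ℕ in atTop, ENNReal.ofReal ((n : ℝ) ^ (e - 1 / ((k : ℝ) + 1))) ≤ I n) :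
    Tendsto (fun n : ℕ => Real.log (I n).toReal / Real.log n) atTop (nhds e) := by
  rw [Metric.tendsto_atTop']
  intro ε hε
  obtain ⟨k, hk⟩ := exists_nat_one_div_lt hε
  obtain ⟨N, hN⟩ := eventually_atTop.1 ((hu k).and ((hl k).and (eventually_ge_atTop 2)))
  refine ⟨N, fun n hn => ?_⟩
  obtain ⟨h1, h2, h3⟩ := hN n hn.le
  have hp : (1 : ℝ) < n := by exact_mod_cast (by omega : 1 < n)
  have hp0 : (0 : ℝ) < n := by linarith
  have hlog := Real.log_pos hp
  have h1' := ENNReal.toReal_le_of_le_ofReal (by positivity) h1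
  have h2' := (ENNReal.ofReal_le_iff_le_toReal (ne_top_of_le_ne_top ENNReal.ofReal_ne_top h1)).1 h2
  have hIp : 0 < (I n).toReal := lt_of_lt_of_le (by positivity) h2'
  have l1 := Real.log_le_log hIp h1'
  have l2 := Real.log_le_log (by positivity) h2'
  rw [Real.log_rpow hp0] at l1 l2
  rw [Real.dist_eq, abs_lt]
  have m1 := (div_le_iff₀ hlog).2 l1
  have m2 := (le_div_iff₀ hlog).2 l2
  constructor <;> linarith
end

section
variable {d : ℕ} {Ωw : Type*} [MeasurableSpace Ωw]

lemma main (hd : 1 ≤ d) {α : ℝ} (hα : 0 < α) (hα₂ : d = 1 → α < 1)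
    {Ωz : Type*} [MeasurableSpace Ωz]
    {μ : Measure Ωz} {z : (Fin d → ℤ) → Ωz → ℝ} (hz : IsScenery d α μ z)
    {P : (Fin (d + 1) → ℤ) → Measure Ωw} {S : ℝ → Ωw → (Fin (d + 1) → ℤ)}
    (hS : IsCTSRW (d + 1) P S) {e : ℝ} (he1 : d = 1 → e = -((1 - α) / (1 + α)))
    (he2 : 2 ≤ d → e = -1 - min 1 (min α (4 * α / d)) * (d - 2)) :
    ∀ᵐ ζ ∂ μ, Tendsto (fun n : ℕ => Real.log (layeredGreen d z S P ζ ((n : ℤ), 0)) / Real.log n) atTop (nhds e) := by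
  have hW := tail_Wk hd hS
  have h0 : (Fin.cons 0 0 : Fin (d + 1) → ℤ) = 0 := by
    funext i; refine Fin.cases rfl (fun _ => rfl) i
  have hG : ∀ ζ (n : ℕ), layeredGreen d z S P ζ ((n : ℤ), 0) = 
      (∫⁻ t in Ioi 0, Ft (fun x => P (Fin.cons 0 x)) (fun u ω (i : Fin d) => S u ω i.succ) (fun y => z y ζ) n t).toReal := by
    intro ζ n
    unfold layeredGreen
    congr 1
    refine setLIntegral_congr_fun measurableSet_Ioi ?_
    intro t ht
    have := green_formula hd hS (v := fun y => z y ζ) (fun y => hz.nonneg y ζ) (t := t) (le_of_lt ht) (n : ℤ)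
    unfold Ft
    simp only [h0]
    rw [← this]
    congr 1
    ext ω
    show (_, _) = (_, _) ↔ _
    rw [Prod.mk.injEq]
    rfl
  simp only [hG]
  have ha1 := one_le_aex d α
  have ha0 : aex d α ≠ 0 := by linarith
  have h1 : d = 1 → 1 < aex d α := by
    intro h; unfold aex om
    rw [if_pos h]
    have h1 : 1 < 1 / α := by rw [lt_div_iff₀ hα]; linarith [hα₂ h]
    have := le_max_left (1 / α - 1) 0
    linarith
  have hed : d = 1 → e = -1 - ((d : ℝ) - 2) / aex d α := by
    intro h
    have h1 : 1 < 1 / α := by rw [lt_div_iff₀ hα]; linarith [hα₂ h]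
    rw [he1 h]; unfold aex om
    rw [if_pos h, max_eq_left (by linarith), h]
    have h2 : 0 < 1 + α := by linarith
    have : (1 : ℝ) + (1 - 1 / 2) * (1 / α - 1) = (1 + α) / (2 * α) := by field_simp; ring
    rw [this]
    push_cast
    field_simp
    ring
  have hinv : 2 ≤ d → 1 / aex d α = min 1 α := by
    intro h
    rw [div_eq_iff ha0, mul_comm]; exact (aex_inv h hα).symm
  have hed2 : d = 2 → e = -1 - ((d : ℝ) - 2) / aex d α := by
    intro h
    rw [he2 (by omega), h]; norm_num
  have U : ∀ k : ℕ, ∀ᵐ ζ ∂μ, ∀ᶠ n : ℕ in atTop, 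
      ∫⁻ t in Ioi 0, Ft (fun x => P (Fin.cons 0 x)) (fun u ω (i : Fin d) => S u ω i.succ) (fun y => z y ζ) n t ≤
      ENNReal.ofReal ((n : ℝ) ^ (e + 1 / ((k : ℝ) + 1))) := by
    intro k
    have hk : 0 < 1 / ((k : ℝ) + 1) := by positivity
    refine hW.upper hz hα h1 ?_ ?_
    · rcases Nat.lt_or_ge d 3 with h3 | h3
      · rcases (by omega : d = 1 ∨ d = 2) with h | h
        · rw [← hed h]; linarith
        · rw [← hed2 h]; linarith
      · have hd3 : (3 : ℝ) ≤ d := by exact_mod_cast h3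
        rw [he2 (by omega), div_eq_mul_one_div, hinv (by omega)]
        have : min 1 (min α (4 * α / d)) ≤ min 1 α := min_le_min le_rfl (min_le_left _ _)
        nlinarith
    · intro h3
      have hd3 : (3 : ℝ) ≤ d := by exact_mod_cast h3
      rw [he2 (by omega)]
      have : min 1 (min α (4 * α / d)) ≤ min α (4 * α / d) := min_le_right _ _
      nlinarith
  have L : ∀ k : ℕ, ∀ᵐ ζ ∂μ, ∀ᶠ n : ℕ in atTop, 
      ENNReal.ofReal ((n : ℝ) ^ (e - 1 / ((k : ℝ) + 1))) ≤
      ∫⁻ t in Ioi 0, Ft (fun x => P (Fin.cons 0 x)) (fun u ω (i : Fin d) => S u ω i.succ) (fun y => z y ζ) n t := by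
    intro k
    have hk : 0 < 1 / ((k : ℝ) + 1) := by positivity
    rcases Nat.lt_or_ge d 3 with h3 | h3
    · refine hW.lower1 hz hα (fun h => by omega) ?_
      rcases (by omega : d = 1 ∨ d = 2) with h | h
      · rw [← hed h]; linarith
      · rw [← hed2 h]; linarith
    · rcases lt_or_ge (4 * α / d) (min 1 α) with hc | hc
      · refine hW.lower2 hz hα h3 hc ?_
        have e1 : min 1 (min α (4 * α / d)) = 4 * α / d := by
          rw [← min_assoc]; exact min_eq_right hc.le
        rw [he2 (by omega), e1]; linarith
      · refine hW.lower1 hz hα (fun h => ?_) ?_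
        · rw [hinv (by omega)]; exact le_min (min_le_right _ _) hc
        · have e1 : min 1 (min α (4 * α / d)) = min 1 α := by
            rw [← min_assoc]; exact min_eq_left hc
          rw [he2 (by omega), e1, div_eq_mul_one_div ((d : ℝ) - 2), hinv (by omega)]; linarith
  filter_upwards [ae_all_iff.2 U, ae_all_iff.2 L] with ζ hU hL
  exact log_lim hU hL
end
end LG
end Part26

/-- Theorem (Green function, non-standard regime `α ≤ max(d/2,1)`): ℙ-a.s.
`g^ω(0, n e₁) = n^{-(1-α)/(1+α)+o(1)}` for `d = 1` (with `α < 1`) and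
`g^ω(0, n e₁) = n^{-1-min(1,α,4α/d)(d-2)+o(1)}` for `d ≥ 2`. -/
theorem stmt11 (d : ℕ) (hd : 1 ≤ d) (α : ℝ) (hα : 0 < α)
    (hα₁ : α ≤ max ((d : ℝ) / 2) 1) (hα₂ : d = 1 → α < 1)
    {Ωz Ωw : Type*} [MeasurableSpace Ωz] [MeasurableSpace Ωw]
    (μ : Measure Ωz) (z : (Fin d → ℤ) → Ωz → ℝ) (hz : IsScenery d α μ z)
    (P : (Fin (d + 1) → ℤ) → Measure Ωw) (S : ℝ → Ωw → (Fin (d + 1) → ℤ))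
    (hS : IsCTSRW (d + 1) P S) :
    ∀ᵐ ζ ∂ μ,
      (d = 1 →
        Tendsto (fun n : ℕ =>
            Real.log (layeredGreen d z S P ζ ((n : ℤ), 0)) / Real.log n)
          atTop (nhds (-((1 - α) / (1 + α))))) ∧
      (2 ≤ d →
        Tendsto (fun n : ℕ =>
            Real.log (layeredGreen d z S P ζ ((n : ℤ), 0)) / Real.log n)
          atTop (nhds (-1 - min 1 (min α (4 * α / d)) * (d - 2)))) := by
  by_cases hd1 : d = 1
  · filter_upwards [LG.main hd hα hα₂ hz hS (e := -((1 - α) / (1 + α))) (fun _ => rfl) (fun h => by omega)] with ζ hζ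
    exact ⟨fun _ => hζ, fun h => by omega⟩
  · filter_upwards [LG.main hd hα hα₂ hz hS (e := -1 - min 1 (min α (4 * α / d)) * (d - 2)) (fun h => absurd h hd1) (fun _ => rfl)] with ζ hζ
    exact ⟨fun h => absurd h hd1, fun _ => hζ⟩
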